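/- There exists a universal constant C > 0 such that for every integer n ≥ 2 and every isotropic log-concave probability measure μ on ℝⁿ, the Poincaré constant satisfies C_P(μ) ≤ C log n. (By the Cheeger and Buser–Ledoux inequalities this is equivalent to the bound ψ_n ≤ C √(log n) on the KLS isoperimetric constant.) -/

import Mathlib

open MeasureTheory Real
open scoped ENNReal RealInnerProductSpace

noncomputable section

abbrev Euc (n : ℕ) := EuclideanSpace ℝ (Fin n)

/-- A nonnegative function `g` is log-concave: `g(ax+by) ≥ g(x)^a g(y)^b`. -/
def IsLogConcaveFun {n : ℕ} (g : Euc n → ℝ) : Prop :=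
  (∀ x, 0 ≤ g x) ∧
  ∀ x y : Euc n, ∀ a b : ℝ, 0 ≤ a → 0 ≤ b → a + b = 1 →
    g x ^ a * g y ^ b ≤ g (a • x + b • y)

def IsLogConcaveMeasure {n : ℕ} (μ : Measure (Euc n)) : Prop :=
  ∃ ρ : Euc n → ℝ, Measurable ρ ∧ IsLogConcaveFun ρ ∧
    μ = volume.withDensity (fun x => ENNReal.ofReal (ρ x))

def poincareSet {n : ℕ} (μ : Measure (Euc n)) : Set ℝ :=
  {C : ℝ | 0 ≤ C ∧ ∀ f : Euc n → ℝ, LocallyLipschitz f →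
    Integrable (fun x => ‖gradient f x‖ ^ 2) μ →
    ∫ x, f x ^ 2 ∂μ - (∫ x, f x ∂μ) ^ 2 ≤ C * ∫ x, ‖gradient f x‖ ^ 2 ∂μ}

def poincareConst {n : ℕ} (μ : Measure (Euc n)) : ℝ := sInf (poincareSet μ)

def covMatrix {n : ℕ} (μ : Measure (Euc n)) : Matrix (Fin n) (Fin n) ℝ :=
  Matrix.of fun i j => ∫ x, x i * x j ∂μ - (∫ x, x i ∂μ) * (∫ x, x j ∂μ)

def opNorm {n : ℕ} (M : Matrix (Fin n) (Fin n) ℝ) : ℝ :=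
  ‖Matrix.toEuclideanCLM (𝕜 := ℝ) M‖

def IsIsotropic {n : ℕ} (μ : Measure (Euc n)) : Prop :=
  (∫ x, x ∂μ) = 0 ∧ ∀ i j, ∫ x, x i * x j ∂μ = if i = j then 1 else 0

def UniformlyLogConcave {n : ℕ} (t : ℝ) (μ : Measure (Euc n)) : Prop :=
  ∃ g : Euc n → ℝ, Measurable g ∧ IsLogConcaveFun g ∧
    μ = volume.withDensity (fun x => ENNReal.ofReal (Real.exp (-t * ‖x‖ ^ 2 / 2) * g x))

def IsRegularPotential {n : ℕ} (ψ : Euc n → ℝ) : Prop :=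
  ContDiff ℝ (⊤ : ℕ∞) ψ ∧
  (∃ ε : ℝ, 0 < ε ∧ ∀ x v : Euc n,
    ε * ‖v‖ ^ 2 ≤ iteratedFDeriv ℝ 2 ψ x ![v, v] ∧
    iteratedFDeriv ℝ 2 ψ x ![v, v] ≤ ε⁻¹ * ‖v‖ ^ 2) ∧
  (∀ m : ℕ, ∃ C : ℝ, ∃ k : ℕ, ∀ x, ‖iteratedFDeriv ℝ m ψ x‖ ≤ C * (1 + ‖x‖) ^ k)

def IsRegularMeasure {n : ℕ} (μ : Measure (Euc n)) (ψ : Euc n → ℝ) : Prop :=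
  IsRegularPotential ψ ∧ μ = volume.withDensity (fun x => ENNReal.ofReal (Real.exp (-ψ x)))

def IsTempered {n : ℕ} (ρ : Euc n → ℝ) (f : Euc n → ℝ) : Prop :=
  ContDiff ℝ (⊤ : ℕ∞) f ∧ ∀ m : ℕ, ∃ C : ℝ, 0 < C ∧ ∃ a : ℝ, 0 < a ∧ ∀ x,
    ‖iteratedFDeriv ℝ m f x‖ ≤ C / Real.sqrt (ρ x) * Real.exp (-a * ‖x‖)

def lap {n : ℕ} (f : Euc n → ℝ) (x : Euc n) : ℝ :=
  ∑ i, iteratedFDeriv ℝ 2 f x ![EuclideanSpace.single i (1:ℝ), EuclideanSpace.single i (1:ℝ)]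

def Lop {n : ℕ} (ψ u : Euc n → ℝ) (x : Euc n) : ℝ :=
  lap u x - ⟪gradient ψ x, gradient u x⟫

def gaussDensity (n : ℕ) (s : ℝ) (x : Euc n) : ℝ :=
  (2 * π * s) ^ (-(n : ℝ) / 2) * Real.exp (-‖x‖ ^ 2 / (2 * s))

def gaussMeasure (n : ℕ) (s : ℝ) : Measure (Euc n) :=
  volume.withDensity fun x => ENNReal.ofReal (gaussDensity n s x)

def tiltZ {n : ℕ} (ρ : Euc n → ℝ) (t : ℝ) (θ : Euc n) : ℝ :=
  ∫ x, Real.exp (⟪θ, x⟫ - t * ‖x‖ ^ 2 / 2) * ρ x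

def tiltDensity {n : ℕ} (ρ : Euc n → ℝ) (t : ℝ) (θ : Euc n) (x : Euc n) : ℝ :=
  Real.exp (⟪θ, x⟫ - t * ‖x‖ ^ 2 / 2) * ρ x / tiltZ ρ t θ

def tiltMeasure {n : ℕ} (ρ : Euc n → ℝ) (t : ℝ) (θ : Euc n) : Measure (Euc n) :=
  volume.withDensity fun x => ENNReal.ofReal (tiltDensity ρ t θ x)

def varD {n : ℕ} (p : Euc n → ℝ) (f : Euc n → ℝ) : ℝ :=
  (∫ x, f x ^ 2 * p x) - (∫ x, f x * p x) ^ 2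

end

section
open MeasureTheory Real Set
open scoped ENNReal RealInnerProductSpace Pointwise

namespace KLS

/-- one-dimensional Brunn-Minkowski for compact sets -/
theorem bm_compact {A B : Set ℝ} (hA : IsCompact A) (hB : IsCompact B) (hAn : A.Nonempty)
    (hBn : B.Nonempty) : volume A + volume B ≤ volume (A + B) := by
  obtain ⟨p, hpA, hp⟩ := hA.exists_isGreatest hAn
  obtain ⟨q, hqB, hq⟩ := hB.exists_isLeast hBn
  have h1 : (fun x => x + q) '' A ∪ (fun x => p + x) '' B ⊆ A + B := by
    rintro _ (⟨x, hx, rfl⟩ | ⟨x, hx, rfl⟩)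
    · exact Set.add_mem_add hx hqB
    · exact Set.add_mem_add hpA hx
  have hA' : volume ((fun x => x + q) '' A) = volume A := by
    rw [Set.image_add_right, measure_preimage_add_right]
  have hB' : volume ((fun x => p + x) '' B) = volume B := by
    rw [Set.image_add_left, measure_preimage_add]
  have hd : AEDisjoint volume ((fun x => x + q) '' A) ((fun x => p + x) '' B) := by
    refine measure_mono_null (t := {p + q}) ?_ (by simp)
    rintro z ⟨⟨x, hx, rfl⟩, ⟨y, hy, hxy⟩⟩
    have := hp hx; have := hq hy
    simp only [mem_singleton_iff] at *
    linarith
  calc volume A + volume B = volume ((fun x => x + q) '' A ∪ (fun x => p + x) '' B) := by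
        rw [measure_union₀ _ hd, hA', hB']
        exact (hB.image (by fun_prop)).measurableSet.nullMeasurableSet
    _ ≤ _ := measure_mono h1

theorem bm_one {A B : Set ℝ} (hA : MeasurableSet A) (hB : MeasurableSet B) (hAn : A.Nonempty)
    (hBn : B.Nonempty) : volume A + volume B ≤ volume (A + B) := by
  rw [hA.measure_eq_iSup_isCompact, hB.measure_eq_iSup_isCompact]
  obtain ⟨x0, hx0⟩ := hAn
  obtain ⟨y0, hy0⟩ := hBn
  simp only [iSup_and']
  refine ENNReal.biSup_add_biSup_le (s := {K | K ⊆ A ∧ IsCompact K}) (t := {K | K ⊆ B ∧ IsCompact K}) ⟨∅, by simp⟩ ⟨∅, by simp⟩ ?_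
  rintro K ⟨hK, hKc⟩ L ⟨hL, hLc⟩
  have h1 : volume K + volume L ≤ volume (K ∪ {x0}) + volume (L ∪ {y0}) :=
    add_le_add (measure_mono subset_union_left) (measure_mono subset_union_left)
  refine h1.trans ((bm_compact (hKc.union isCompact_singleton) (hLc.union isCompact_singleton)
    ⟨x0, by simp⟩ ⟨y0, by simp⟩).trans (measure_mono ?_))
  exact Set.add_subset_add (union_subset hK (by simpa using hx0))
    (union_subset hL (by simpa using hy0))

theorem vol_smul_one {a : ℝ} (ha : 0 < a) (A : Set ℝ) :
    volume (a • A) = ENNReal.ofReal a * volume A := by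
  rw [Measure.addHaar_smul]
  simp [abs_of_pos ha]

theorem pl_one_norm {a b : ℝ} (ha : 0 < a) (hb : 0 < b) (hab : a + b = 1) {f g h : ℝ → ℝ}
    (hf : Measurable f) (hg : Measurable g) (hh : Measurable h)
    (f0 : ∀ x, 0 ≤ f x) (g0 : ∀ x, 0 ≤ g x) (h0 : ∀ x, 0 ≤ h x)
    (f1 : ∀ x, f x ≤ 1) (g1 : ∀ x, g x ≤ 1)
    (fs : ∀ s < 1, ∃ x, s < f x) (gs : ∀ s < 1, ∃ x, s < g x)
    (H : ∀ x y, f x ^ a * g y ^ b ≤ h (a * x + b * y)) :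
    ENNReal.ofReal a * (∫⁻ x, ENNReal.ofReal (f x)) +
      ENNReal.ofReal b * (∫⁻ x, ENNReal.ofReal (g x)) ≤ ∫⁻ x, ENNReal.ofReal (h x) := by
  have red : ∀ {f : ℝ → ℝ}, Measurable f → (∀ x, 0 ≤ f x) → (∀ x, f x ≤ 1) →
      ∫⁻ x, ENNReal.ofReal (f x) = ∫⁻ t in Ioo (0:ℝ) 1, volume {x | t < f x} := by
    intro f hf f0 f1
    rw [lintegral_eq_lintegral_meas_lt _ (Filter.Eventually.of_forall f0) hf.aemeasurable]
    rw [← Ioo_union_Ici_eq_Ioi (zero_lt_one' ℝ), lintegral_union measurableSet_Ici]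
    · rw [setLIntegral_congr_fun (g := fun _ => 0) measurableSet_Ici]
      · simp
      · intro t ht
        have : {x | t < f x} = ∅ := by
          ext x; simp only [mem_ofPred_eq, mem_empty_iff_false, iff_false, not_lt]
          exact (f1 x).trans ht
        simp [this]
    · rw [Set.disjoint_left]; rintro x ⟨_, h1⟩ h2; exact absurd h1 (not_lt.mpr h2)
  have mm : ∀ {f : ℝ → ℝ}, Measurable fun t => volume {x | t < f x} := by
    intro f
    exact Antitone.measurable (fun s t hst => measure_mono fun x hx => lt_of_le_of_lt hst hx)
  rw [red hf f0 f1, red hg g0 g1, ← lintegral_const_mul _ mm, ← lintegral_const_mul _ mm,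
    ← lintegral_add_left (mm.const_mul _),
    lintegral_eq_lintegral_meas_lt _ (Filter.Eventually.of_forall h0) hh.aemeasurable]
  refine le_trans (setLIntegral_mono mm ?_) (lintegral_mono_set Ioo_subset_Ioi_self)
  intro t ht
  rw [← vol_smul_one ha, ← vol_smul_one hb]
  obtain ⟨x0, hx0⟩ := fs t ht.2
  obtain ⟨y0, hy0⟩ := gs t ht.2
  have m1 : MeasurableSet {x | t < f x} := measurableSet_lt measurable_const hf
  have m2 : MeasurableSet {x | t < g x} := measurableSet_lt measurable_const hg
  refine (bm_one (m1.const_smul₀ a) (m2.const_smul₀ b) ⟨a • x0, ⟨x0, hx0, rfl⟩⟩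
    ⟨b • y0, ⟨y0, hy0, rfl⟩⟩).trans (measure_mono ?_)
  rintro _ ⟨_, ⟨x, hx, rfl⟩, _, ⟨y, hy, rfl⟩, rfl⟩
  simp only [mem_ofPred_eq, smul_eq_mul] at *
  refine lt_of_lt_of_le ?_ (H x y)
  calc t = t ^ a * t ^ b := by rw [← rpow_add ht.1, hab, rpow_one]
    _ < _ := by
      apply mul_lt_mul (rpow_lt_rpow ht.1.le hx ha) (rpow_le_rpow ht.1.le hy.le hb.le)
        (rpow_pos_of_pos ht.1 _) (rpow_nonneg (f0 x) _)

theorem ennreal_amgm {a b : ℝ} (ha : 0 < a) (hb : 0 < b) (hab : a + b = 1) (x y : ℝ≥0∞) :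
    x ^ a * y ^ b ≤ ENNReal.ofReal a * x + ENNReal.ofReal b * y := by
  by_cases hx : x = ∞
  · rw [hx, ENNReal.mul_top (by simpa using ha)]; simp
  by_cases hy : y = ∞
  · rw [hy, ENNReal.mul_top (by simpa using hb)]; simp
  lift x to NNReal using hx
  lift y to NNReal using hy
  have := NNReal.geom_mean_le_arith_mean2_weighted a.toNNReal b.toNNReal x y (by
    rw [← Real.toNNReal_add ha.le hb.le, hab]; simp)
  rw [Real.coe_toNNReal _ ha.le, Real.coe_toNNReal _ hb.le] at this
  rw [← ENNReal.coe_rpow_of_nonneg _ ha.le, ← ENNReal.coe_rpow_of_nonneg _ hb.le]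
  unfold ENNReal.ofReal
  exact_mod_cast this

theorem pl_one_bdd {a b : ℝ} (ha : 0 < a) (hb : 0 < b) (hab : a + b = 1) {f g h : ℝ → ℝ≥0∞}
    (hf : Measurable f) (hg : Measurable g) (hh : Measurable h) {N : ℝ≥0∞} (hN : N ≠ ∞)
    (fN : ∀ x, f x ≤ N) (gN : ∀ x, g x ≤ N)
    (H : ∀ x y, f x ^ a * g y ^ b ≤ h (a * x + b * y)) :
    (∫⁻ x, f x) ^ a * (∫⁻ x, g x) ^ b ≤ ∫⁻ x, h x := by
  set F := ⨆ x, f x with hF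
  set G := ⨆ x, g x with hG
  have hfF : ∀ x, f x ≤ F := fun x => le_iSup f x
  have hgG : ∀ x, g x ≤ G := fun x => le_iSup g x
  have hFt : F ≠ ∞ := ne_top_of_le_ne_top hN (iSup_le fN)
  have hGt : G ≠ ∞ := ne_top_of_le_ne_top hN (iSup_le gN)
  by_cases hF0 : F = 0
  · have : ∀ x, f x = 0 := fun x => le_antisymm (hF0 ▸ hfF x) bot_le
    simp [this, ENNReal.zero_rpow_of_pos ha]
  by_cases hG0 : G = 0
  · have : ∀ x, g x = 0 := fun x => le_antisymm (hG0 ▸ hgG x) bot_le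
    simp [this, ENNReal.zero_rpow_of_pos hb]
  set Q := F ^ a * G ^ b with hQ
  have hQ0 : Q ≠ 0 := by
    simp only [hQ, ne_eq, mul_eq_zero, ENNReal.rpow_eq_zero_iff, hF0, hG0, hFt, hGt]; simp
  have hQt : Q ≠ ∞ := ENNReal.mul_ne_top (ENNReal.rpow_ne_top_of_nonneg ha.le hFt)
    (ENNReal.rpow_ne_top_of_nonneg hb.le hGt)
  have tr : ∀ {u : ℝ → ℝ≥0∞} {U : ℝ≥0∞}, U ≠ 0 → U ≠ ∞ → (∀ x, u x ≤ U) →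
      ∀ x, ENNReal.ofReal ((u x / U).toReal) = u x / U := by
    intro u U h0 ht hu x
    exact ENNReal.ofReal_toReal (ENNReal.div_ne_top (ne_top_of_le_ne_top ht (hu x)) h0)
  have le1 : ∀ {u : ℝ → ℝ≥0∞} {U : ℝ≥0∞}, U ≠ 0 → U ≠ ∞ → (∀ x, u x ≤ U) →
      ∀ x, (u x / U).toReal ≤ 1 := by
    intro u U h0 ht hu x
    refine ENNReal.toReal_le_of_le_ofReal zero_le_one ?_
    simpa using ENNReal.div_le_of_le_mul (by simpa using hu x)
  have ss : ∀ {u : ℝ → ℝ≥0∞} {U : ℝ≥0∞}, U ≠ 0 → U ≠ ∞ → U = (⨆ x, u x) →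
      ∀ s < 1, ∃ x, s < (u x / U).toReal := by
    intro u U h0 ht hu s hs
    have hlt : ENNReal.ofReal s * U < U := by
      conv_rhs => rw [← one_mul U]
      exact ENNReal.mul_lt_mul_left h0 ht (by simpa using hs)
    conv_rhs at hlt => rw [hu]
    obtain ⟨x, hx⟩ := lt_iSup_iff.1 hlt
    refine ⟨x, ?_⟩
    have hux : u x ≤ U := hu ▸ le_iSup u x
    by_cases hs0 : s < 0
    · exact hs0.trans_le ENNReal.toReal_nonneg
    refine (ENNReal.ofReal_lt_iff_lt_toReal (not_lt.1 hs0)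
      (ENNReal.div_ne_top (ne_top_of_le_ne_top ht hux) h0)).1 ?_
    rw [ENNReal.lt_div_iff_mul_lt (Or.inl h0) (Or.inl ht)]
    exact hx
  set h' : ℝ → ℝ≥0∞ := fun x => min (h x) Q with hh'
  have key := pl_one_norm ha hb hab (f := fun x => (f x / F).toReal) (g := fun x => (g x / G).toReal)
    (h := fun x => (h' x / Q).toReal) (by fun_prop) (by fun_prop) (by fun_prop)
    (fun _ => ENNReal.toReal_nonneg) (fun _ => ENNReal.toReal_nonneg)
    (fun _ => ENNReal.toReal_nonneg) (le1 hF0 hFt hfF) (le1 hG0 hGt hgG)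
    (ss hF0 hFt rfl) (ss hG0 hGt rfl) (by
      intro x y
      rw [ENNReal.toReal_rpow, ENNReal.toReal_rpow, ← ENNReal.toReal_mul]
      refine ENNReal.toReal_mono (ENNReal.div_ne_top (ne_top_of_le_ne_top hQt (min_le_right _ _)) hQ0) ?_
      rw [ENNReal.div_rpow_of_nonneg _ _ ha.le, ENNReal.div_rpow_of_nonneg _ _ hb.le]
      rw [ENNReal.le_div_iff_mul_le (Or.inl hQ0) (Or.inl hQt)]
      have : f x ^ a / F ^ a * (g y ^ b / G ^ b) * Q = f x ^ a * g y ^ b := by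
        rw [hQ]
        have e1 : f x ^ a / F ^ a * F ^ a = f x ^ a := ENNReal.div_mul_cancel
          (by simp [hF0, hFt]) (by simp [hF0, hFt, ha.le])
        have e2 : g y ^ b / G ^ b * G ^ b = g y ^ b := ENNReal.div_mul_cancel
          (by simp [hG0, hGt]) (by simp [hG0, hGt, hb.le])
        calc _ = (f x ^ a / F ^ a * F ^ a) * (g y ^ b / G ^ b * G ^ b) := by ring
          _ = _ := by rw [e1, e2]
      rw [this]
      refine le_min (H x y) ?_
      exact mul_le_mul' (ENNReal.rpow_le_rpow (hfF x) ha.le) (ENNReal.rpow_le_rpow (hgG y) hb.le))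
  simp only [tr hF0 hFt hfF, tr hG0 hGt hgG, tr hQ0 hQt (fun x => min_le_right (h x) Q), hh'] at key
  have key2 := (ennreal_amgm ha hb hab _ _).trans key
  simp only [div_eq_mul_inv] at key2
  rw [lintegral_mul_const _ hf, lintegral_mul_const _ hg, lintegral_mul_const _ (by fun_prop),
    ENNReal.mul_rpow_of_nonneg _ _ ha.le, ENNReal.mul_rpow_of_nonneg _ _ hb.le] at key2
  have key3 := mul_le_mul_left key2 Q
  have e1 : (F⁻¹) ^ a * F ^ a = 1 := by
    rw [← ENNReal.mul_rpow_of_nonneg _ _ ha.le, ENNReal.inv_mul_cancel hF0 hFt]; simp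
  have e2 : (G⁻¹) ^ b * G ^ b = 1 := by
    rw [← ENNReal.mul_rpow_of_nonneg _ _ hb.le, ENNReal.inv_mul_cancel hG0 hGt]; simp
  calc (∫⁻ x, f x) ^ a * (∫⁻ x, g x) ^ b
      = (∫⁻ x, f x) ^ a * ((F⁻¹) ^ a * F ^ a) * ((∫⁻ x, g x) ^ b * ((G⁻¹) ^ b * G ^ b)) := by
        rw [e1, e2]; simp
    _ = _ := by rw [hQ]; ring
    _ ≤ (∫⁻ x, min (h x) Q) * Q⁻¹ * Q := key3
    _ = ∫⁻ x, min (h x) Q := by rw [mul_assoc, ENNReal.inv_mul_cancel hQ0 hQt, mul_one]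
    _ ≤ _ := lintegral_mono fun x => min_le_left _ _

/-- the Prékopa–Leindler property of a space -/
def PLProp (E : Type) [AddCommGroup E] [Module ℝ E] [MeasureSpace E] : Prop :=
  ∀ (a b : ℝ), 0 < a → 0 < b → a + b = 1 → ∀ f g h : E → ℝ≥0∞, Measurable f → Measurable g →
    Measurable h → (∀ x y, f x ^ a * g y ^ b ≤ h (a • x + b • y)) →
    (∫⁻ x, f x) ^ a * (∫⁻ x, g x) ^ b ≤ ∫⁻ x, h x

theorem pl_one : PLProp ℝ := by
  intro a b ha hb hab f g h hf hg hh H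
  have lim : ∀ {u : ℝ → ℝ≥0∞}, Measurable u →
      ∫⁻ x, u x = ⨆ N : ℕ, ∫⁻ x, min (u x) N := by
    intro u hu
    rw [← lintegral_iSup (fun N => by fun_prop)]
    · refine lintegral_congr fun x => ?_
      rw [← inf_iSup_eq, ENNReal.iSup_natCast]
      simp
    · intro N M hNM x
      exact min_le_min_left _ (by exact_mod_cast hNM)
  have tt : ∀ {u : ℝ → ℝ≥0∞}, Measurable u → Filter.Tendsto (fun N : ℕ => ∫⁻ x, min (u x) N)
      Filter.atTop (nhds (∫⁻ x, u x)) := by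
    intro u hu
    rw [lim hu]
    apply tendsto_atTop_iSup
    intro N M hNM
    exact lintegral_mono fun x => min_le_min_left _ (by exact_mod_cast hNM)
  have step : ∀ N : ℕ, (∫⁻ x, min (f x) N) ^ a * (∫⁻ x, min (g x) N) ^ b ≤ ∫⁻ x, h x := by
    intro N
    refine pl_one_bdd ha hb hab (by fun_prop) (by fun_prop) hh (N := N) (by simp)
      (fun x => min_le_right _ _) (fun x => min_le_right _ _) ?_
    intro x y
    exact (mul_le_mul' (ENNReal.rpow_le_rpow (min_le_left _ _) ha.le)
      (ENNReal.rpow_le_rpow (min_le_left _ _) hb.le)).trans (H x y)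
  by_cases hf0 : ∫⁻ x, f x = 0
  · simp [hf0, ENNReal.zero_rpow_of_pos ha]
  by_cases hg0 : ∫⁻ x, g x = 0
  · simp [hg0, ENNReal.zero_rpow_of_pos hb]
  refine le_of_tendsto (ENNReal.Tendsto.mul ((tt hf).ennrpow_const a) (Or.inl ?_)
    ((tt hg).ennrpow_const b) (Or.inl ?_)) (Filter.Eventually.of_forall step)
  · simp [hf0, ha.le, ha.not_gt]
  · simp [hg0, hb.le, hb.not_gt]

theorem PLProp.prod {E F : Type} [AddCommGroup E] [Module ℝ E] [MeasureSpace E]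
    [AddCommGroup F] [Module ℝ F] [MeasureSpace F] [SFinite (volume : Measure E)]
    [SFinite (volume : Measure F)]
    (hE : PLProp E) (hF : PLProp F) : PLProp (E × F) := by
  intro a b ha hb hab f g h hf hg hh H
  have e : ∀ {u : E × F → ℝ≥0∞}, Measurable u → ∫⁻ p, u p = ∫⁻ y, ∫⁻ x, u (x, y) := by
    intro u hu
    exact lintegral_prod_symm' u hu
  rw [e hf, e hg, e hh]
  refine hF a b ha hb hab _ _ _ hf.lintegral_prod_left' hg.lintegral_prod_left'
    hh.lintegral_prod_left' ?_
  intro y y'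
  exact hE a b ha hb hab _ _ _ (by fun_prop) (by fun_prop) (by fun_prop)
    fun x x' => H (x, y) (x', y')

theorem PLProp.transfer {E F : Type} [AddCommGroup E] [Module ℝ E] [MeasureSpace E]
    [AddCommGroup F] [Module ℝ F] [MeasureSpace F] (hE : PLProp E) (φ : E → F)
    (hφ : MeasurePreserving φ) (hadd : ∀ (a b : ℝ) x y, φ (a • x + b • y) = a • φ x + b • φ y) :
    PLProp F := by
  intro a b ha hb hab f g h hf hg hh H
  rw [← hφ.lintegral_comp hf, ← hφ.lintegral_comp hg, ← hφ.lintegral_comp hh]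
  refine hE a b ha hb hab _ _ _ (hf.comp hφ.measurable) (hg.comp hφ.measurable)
    (hh.comp hφ.measurable) ?_
  intro x y
  rw [hadd]
  exact H _ _

theorem pl_pi : ∀ n : ℕ, PLProp (Fin n → ℝ)
  | 0 => by
    intro a b ha hb hab f g h hf hg hh H
    have : (volume : Measure (Fin 0 → ℝ)) = Measure.dirac default := by
      rw [volume_pi]; exact Measure.pi_of_empty _ _
    rw [this, lintegral_dirac' _ hf, lintegral_dirac' _ hg, lintegral_dirac' _ hh]
    convert H default default
  | n + 1 => by
    refine ((pl_one.prod (pl_pi n)).transfer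
      (MeasurableEquiv.piFinSuccAbove (fun _ : Fin (n+1) => ℝ) 0).symm
      (volume_preserving_piFinSuccAbove (fun _ : Fin (n + 1) => ℝ) 0).symm ?_)
    rintro a b ⟨x, x'⟩ ⟨y, y'⟩
    ext i
    refine Fin.cases ?_ (fun j => ?_) i
    · simp [MeasurableEquiv.piFinSuccAbove]
    · simp [MeasurableEquiv.piFinSuccAbove]

theorem prekopa_leindler (n : ℕ) : PLProp (Euc n) :=
  (pl_pi n).transfer (WithLp.toLp 2) (PiLp.volume_preserving_toLp (Fin n)) (by
    intro a b x y; rfl)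

end KLS

end

section
open MeasureTheory Real Set
open scoped ENNReal RealInnerProductSpace

namespace KLS

noncomputable section

variable {n : ℕ}

/-- standard basis vector -/
def ee (i : Fin n) : Euc n := EuclideanSpace.single i (1:ℝ)

/-- partial derivative -/
def pd (i : Fin n) (f : Euc n → ℝ) (x : Euc n) : ℝ := fderiv ℝ f x (ee i)

/-- squared norm of the gradient -/
def gsq (f : Euc n → ℝ) (x : Euc n) : ℝ := ∑ i, (pd i f x) ^ 2

theorem inner_ee (x : Euc n) (i : Fin n) : ⟪x, ee i⟫ = x i := by
  simp [ee, EuclideanSpace.inner_single_right]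

theorem inner_sum (x y : Euc n) : ⟪x, y⟫ = ∑ i, x i * y i := by
  simp [PiLp.inner_apply, mul_comm]

theorem ee_apply (i j : Fin n) : (ee i : Euc n) j = if j = i then 1 else 0 := by
  simp [ee, EuclideanSpace.single_apply]

theorem norm_ee (i : Fin n) : ‖(ee i : Euc n)‖ = 1 := by simp [ee]

theorem sum_ee (x : Euc n) : ∑ i, x i • ee i = x := by
  ext j
  simp [ee_apply, Finset.sum_apply]

theorem gradient_apply (f : Euc n → ℝ) (x : Euc n) (i : Fin n) : gradient f x i = pd i f x := by
  rw [← inner_ee, gradient, pd, InnerProductSpace.toDual_symm_apply]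

theorem gsq_eq (f : Euc n → ℝ) (x : Euc n) : gsq f x = ‖gradient f x‖ ^ 2 := by
  rw [EuclideanSpace.norm_sq_eq, gsq]
  simp [gradient_apply]

theorem fderiv_apply_eq (f : Euc n → ℝ) (x v : Euc n) :
    fderiv ℝ f x v = ∑ i, v i * pd i f x := by
  conv_lhs => rw [← sum_ee v]
  simp [pd]

theorem fderiv_eq_inner (f : Euc n → ℝ) (x v : Euc n) :
    fderiv ℝ f x v = ⟪gradient f x, v⟫ := by
  rw [gradient, InnerProductSpace.toDual_symm_apply]

theorem gsq_nonneg (f : Euc n → ℝ) (x : Euc n) : 0 ≤ gsq f x :=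
  Finset.sum_nonneg fun _ _ => sq_nonneg _

theorem norm_sq_sum (x : Euc n) : ‖x‖ ^ 2 = ∑ i, x i ^ 2 := by
  rw [EuclideanSpace.norm_sq_eq]; simp

/-- bounded functions with bounded continuous partial derivatives up to order `k` -/
def Cb : ℕ → (Euc n → ℝ) → Prop
  | 0, f => Continuous f ∧ ∃ K, ∀ x, |f x| ≤ K
  | k + 1, f => (Continuous f ∧ ∃ K, ∀ x, |f x| ≤ K) ∧ Differentiable ℝ f ∧ ∀ i, Cb k (pd i f)

theorem Cb.zero {k : ℕ} {f : Euc n → ℝ} (h : Cb k f) : Continuous f ∧ ∃ K, ∀ x, |f x| ≤ K := by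
  cases k with
  | zero => exact h
  | succ k => exact h.1

theorem Cb.continuous {k : ℕ} {f : Euc n → ℝ} (h : Cb k f) : Continuous f := h.zero.1

theorem Cb.measurable {k : ℕ} {f : Euc n → ℝ} (h : Cb k f) : Measurable f := h.zero.1.measurable

theorem Cb.bdd {k : ℕ} {f : Euc n → ℝ} (h : Cb k f) : ∃ K, 0 ≤ K ∧ ∀ x, |f x| ≤ K := by
  obtain ⟨K, hK⟩ := h.zero.2
  exact ⟨K, (abs_nonneg _).trans (hK 0), hK⟩

theorem Cb.diff {k : ℕ} {f : Euc n → ℝ} (h : Cb (k+1) f) : Differentiable ℝ f := h.2.1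

theorem Cb.pd {k : ℕ} {f : Euc n → ℝ} (h : Cb (k+1) f) (i : Fin n) : Cb k (pd i f) := h.2.2 i

theorem Cb.of_succ : ∀ {k : ℕ} {f : Euc n → ℝ}, Cb (k+1) f → Cb k f
  | 0, _, h => h.1
  | _ + 1, _, h => ⟨h.1, h.2.1, fun i => (h.2.2 i).of_succ⟩

theorem Cb.mono {k l : ℕ} (hkl : k ≤ l) {f : Euc n → ℝ} (h : Cb l f) : Cb k f := by
  induction hkl with
  | refl => exact h
  | step _ ih => exact ih h.of_succ

theorem Cb.const (c : ℝ) : ∀ k : ℕ, Cb k (fun _ : Euc n => c)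
  | 0 => ⟨continuous_const, |c|, fun _ => le_rfl⟩
  | k + 1 => ⟨⟨continuous_const, |c|, fun _ => le_rfl⟩, differentiable_const c, fun i => by
      have : KLS.pd i (fun _ : Euc n => c) = fun _ => 0 := by ext x; simp [KLS.pd]
      rw [this]; exact Cb.const 0 k⟩

theorem pd_add {f g : Euc n → ℝ} (hf : Differentiable ℝ f) (hg : Differentiable ℝ g) (i : Fin n) :
    pd i (fun x => f x + g x) = fun x => pd i f x + pd i g x := by
  ext x; simp only [pd]
  rw [fderiv_fun_add (hf x) (hg x)]; simp

theorem pd_mul {f g : Euc n → ℝ} (hf : Differentiable ℝ f) (hg : Differentiable ℝ g) (i : Fin n) :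
    pd i (fun x => f x * g x) = fun x => f x * pd i g x + pd i f x * g x := by
  ext x; simp only [pd]
  rw [fderiv_fun_mul (hf x) (hg x)]; simp [mul_comm]

theorem Cb.add : ∀ {k : ℕ} {f g : Euc n → ℝ}, Cb k f → Cb k g → Cb k (fun x => f x + g x) := by
  have z : ∀ {f g : Euc n → ℝ}, Cb 0 f → Cb 0 g → Cb 0 (fun x => f x + g x) := by
    rintro f g ⟨hf, K, hK⟩ ⟨hg, L, hL⟩
    exact ⟨hf.add hg, K + L, fun x => (abs_add_le _ _).trans (add_le_add (hK x) (hL x))⟩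
  intro k
  induction k with
  | zero => exact z
  | succ k ih =>
    intro f g hf hg
    refine ⟨z hf.zero hg.zero, hf.diff.add hg.diff, fun i => ?_⟩
    rw [pd_add hf.diff hg.diff]
    exact ih (hf.pd i) (hg.pd i)

theorem Cb.mul : ∀ {k : ℕ} {f g : Euc n → ℝ}, Cb k f → Cb k g → Cb k (fun x => f x * g x) := by
  have z : ∀ {f g : Euc n → ℝ}, Cb 0 f → Cb 0 g → Cb 0 (fun x => f x * g x) := by
    rintro f g ⟨hf, K, hK⟩ ⟨hg, L, hL⟩
    refine ⟨hf.mul hg, K * L, fun x => ?_⟩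
    rw [abs_mul]
    exact mul_le_mul (hK x) (hL x) (abs_nonneg _) ((abs_nonneg _).trans (hK x))
  intro k
  induction k with
  | zero => exact z
  | succ k ih =>
    intro f g hf hg
    refine ⟨z hf.zero hg.zero, hf.diff.mul hg.diff, fun i => ?_⟩
    rw [pd_mul hf.diff hg.diff]
    exact (ih hf.of_succ (hg.pd i)).add (ih (hf.pd i) hg.of_succ)

theorem Cb.const_mul {k : ℕ} {f : Euc n → ℝ} (c : ℝ) (h : Cb k f) : Cb k (fun x => c * f x) :=
  (Cb.const c k).mul h

theorem Cb.neg {k : ℕ} {f : Euc n → ℝ} (h : Cb k f) : Cb k (fun x => - f x) := by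
  simpa using h.const_mul (-1)

theorem Cb.sub {k : ℕ} {f g : Euc n → ℝ} (hf : Cb k f) (hg : Cb k g) :
    Cb k (fun x => f x - g x) := by
  simpa [sub_eq_add_neg] using hf.add hg.neg

theorem Cb.sum {k : ℕ} {ι : Type*} (s : Finset ι) {f : ι → Euc n → ℝ} (h : ∀ i ∈ s, Cb k (f i)) :
    Cb k (fun x => ∑ i ∈ s, f i x) := by
  classical
  induction s using Finset.induction_on with
  | empty => simpa using Cb.const 0 k
  | insert a s ha ih =>
    simp only [Finset.sum_insert ha]
    exact (h a (by simp)).add (ih fun i hi => h i (by simp [hi]))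

theorem Cb.pow {k : ℕ} {f : Euc n → ℝ} (h : Cb k f) (m : ℕ) : Cb k (fun x => f x ^ m) := by
  induction m with
  | zero => simpa using Cb.const 1 k
  | succ m ih => simpa [pow_succ] using ih.mul h

theorem Cb.inv {k : ℕ} {f : Euc n → ℝ} (h : Cb k f) {c : ℝ} (hc : 0 < c) (hf : ∀ x, c ≤ f x) :
    Cb k (fun x => (f x)⁻¹) := by
  have z : ∀ {f : Euc n → ℝ}, Cb 0 f → (∀ x, c ≤ f x) → Cb 0 (fun x => (f x)⁻¹) := by
    rintro f ⟨h, -⟩ hf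
    refine ⟨h.inv₀ fun x => (hc.trans_le (hf x)).ne', c⁻¹, fun x => ?_⟩
    rw [abs_of_pos (inv_pos.2 (hc.trans_le (hf x)))]
    exact inv_anti₀ hc (hf x)
  induction k with
  | zero => exact z h hf
  | succ k ih =>
    refine ⟨z h.zero hf, fun x => (h.diff x).inv (hc.trans_le (hf x)).ne', fun i => ?_⟩
    have : KLS.pd i (fun x => (f x)⁻¹) = fun x => - (KLS.pd i f x * ((f x)⁻¹) ^ 2) := by
      ext x; simp only [KLS.pd]
      have h1 := (hasDerivAt_inv (hc.trans_le (hf x)).ne').comp_hasFDerivAt x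
        (h.diff x).hasFDerivAt
      rw [show (fun x => (f x)⁻¹) = Inv.inv ∘ f from rfl, h1.fderiv]
      simp; ring
    rw [this]
    exact ((h.pd i).mul ((ih h.of_succ).pow 2)).neg

theorem pd_log {f : Euc n → ℝ} (h : Differentiable ℝ f) (hf : ∀ x, 0 < f x) (i : Fin n) :
    pd i (fun x => log (f x)) = fun x => pd i f x * (f x)⁻¹ := by
  ext x; simp only [KLS.pd]
  rw [((h x).hasFDerivAt.log (hf x).ne').fderiv]
  simp; ring

theorem Cb.log {k : ℕ} {f : Euc n → ℝ} (h : Cb k f) {c : ℝ} (hc : 0 < c) (hf : ∀ x, c ≤ f x) :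
    Cb k (fun x => log (f x)) := by
  have z : ∀ {f : Euc n → ℝ}, Cb 0 f → (∀ x, c ≤ f x) → Cb 0 (fun x => Real.log (f x)) := by
    rintro f ⟨h, K, hK⟩ hf
    refine ⟨h.log fun x => (hc.trans_le (hf x)).ne', max |Real.log c| |Real.log K|, fun x => ?_⟩
    refine abs_le_max_abs_abs (log_le_log hc (hf x)) ?_
    exact log_le_log (hc.trans_le (hf x)) ((le_abs_self _).trans (hK x))
  cases k with
  | zero => exact z h hf
  | succ k =>
    refine ⟨z h.zero hf, fun x => (h.diff x).log (hc.trans_le (hf x)).ne', fun i => ?_⟩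
    rw [pd_log h.diff (fun x => hc.trans_le (hf x))]
    exact (h.pd i).mul (h.of_succ.inv hc hf)

theorem Cb.lip {f : Euc n → ℝ} (h : Cb 1 f) : ∃ L, 0 ≤ L ∧ ∀ x y, |f x - f y| ≤ L * ‖x - y‖ := by
  choose K hK0 hK using fun i => (h.pd i).bdd
  refine ⟨∑ i, K i, Finset.sum_nonneg fun i _ => hK0 i, fun x y => ?_⟩
  have := Convex.norm_image_sub_le_of_norm_fderiv_le (𝕜 := ℝ) (f := f) (s := univ)
    (C := ∑ i, K i) (fun x _ => h.diff x) (fun x _ => ?_) convex_univ (mem_univ y) (mem_univ x)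
  · simpa using this
  · refine ContinuousLinearMap.opNorm_le_bound _ (Finset.sum_nonneg fun i _ => hK0 i) fun v => ?_
    rw [fderiv_apply_eq, Finset.sum_mul]
    refine (norm_sum_le _ _).trans (Finset.sum_le_sum fun i _ => ?_)
    rw [norm_mul, mul_comm]
    exact mul_le_mul (hK i x) (PiLp.norm_apply_le v i) (norm_nonneg _) (hK0 i)

theorem Cb.quad {f : Euc n → ℝ} (h : Cb 2 f) : ∃ L, 0 ≤ L ∧ ∀ x z,
    f x + ⟪gradient f x, z - x⟫ - L / 2 * ‖z - x‖ ^ 2 ≤ f z := by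
  choose K hK0 hK using fun i => (h.pd i).lip
  refine ⟨2 * ∑ i, K i, mul_nonneg zero_le_two (Finset.sum_nonneg fun i _ => hK0 i), fun x z => ?_⟩
  obtain ⟨c, hc, hcz⟩ := domain_mvt (f := f) (s := univ) (f' := fun x => fderiv ℝ f x)
    (fun x _ => (h.diff x).hasFDerivAt.hasFDerivWithinAt) convex_univ (mem_univ x) (mem_univ z)
  have hcx : ‖c - x‖ ≤ ‖z - x‖ := by
    have := (segment_subset_closedBall_left x z) hc
    rw [Metric.mem_closedBall, dist_eq_norm, dist_eq_norm] at this
    rwa [norm_sub_rev x z] at this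
  have e1 : ⟪gradient f x, z - x⟫ - (f z - f x) ≤ (∑ i, K i) * ‖z - x‖ ^ 2 := by
    rw [hcz, ← fderiv_eq_inner, fderiv_apply_eq, fderiv_apply_eq, ← Finset.sum_sub_distrib,
      Finset.sum_mul]
    refine Finset.sum_le_sum fun i _ => ?_
    rw [← mul_sub]
    refine (le_abs_self _).trans ?_
    rw [abs_mul]
    calc |(z - x) i| * |KLS.pd i f x - KLS.pd i f c| ≤ ‖z - x‖ * (K i * ‖z - x‖) := by
          refine mul_le_mul (PiLp.norm_apply_le (z - x) i) ((hK i x c).trans ?_) (abs_nonneg _)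
            (norm_nonneg _)
          rw [norm_sub_rev]
          exact mul_le_mul_of_nonneg_left hcx (hK0 i)
      _ = _ := by ring
  linarith

/-- smooth with all derivatives bounded -/
def SB (f : Euc n → ℝ) : Prop := ∀ k, Cb k f

theorem pd_contDiff {f : Euc n → ℝ} (hf : ContDiff ℝ ((⊤ : ℕ∞) : WithTop ℕ∞) f) (i : Fin n) :
    ContDiff ℝ ((⊤ : ℕ∞) : WithTop ℕ∞) (pd i f) := by
  have h1 : ContDiff ℝ ((⊤ : ℕ∞) : WithTop ℕ∞) (fderiv ℝ f) := hf.fderiv_right (by simp)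
  unfold pd
  exact h1.clm_apply contDiff_const

theorem SB.of_compact {f : Euc n → ℝ} (hf : ContDiff ℝ ((⊤ : ℕ∞) : WithTop ℕ∞) f)
    (hc : HasCompactSupport f) : SB f := by
  intro k
  have z : ∀ {f : Euc n → ℝ}, ContDiff ℝ ((⊤ : ℕ∞) : WithTop ℕ∞) f → HasCompactSupport f → Cb 0 f := by
    intro f hf hc
    obtain ⟨K, hK⟩ := hc.exists_bound_of_continuous hf.continuous
    exact ⟨hf.continuous, K, hK⟩
  induction k generalizing f with
  | zero => exact z hf hc
  | succ k ih =>
    refine ⟨z hf hc, hf.differentiable (by simp), fun i => ih (pd_contDiff hf i) ?_⟩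
    exact (hc.fderiv (𝕜 := ℝ)).comp_left (g := fun l : Euc n →L[ℝ] ℝ => l (ee i)) rfl

theorem Cb.integrable {k : ℕ} {f : Euc n → ℝ} (h : Cb k f) (ν : Measure (Euc n))
    [IsFiniteMeasure ν] : Integrable f ν := by
  obtain ⟨K, hK⟩ := h.zero.2
  exact Integrable.of_bound h.continuous.aestronglyMeasurable K (Filter.Eventually.of_forall hK)

theorem Cb.gsq {k : ℕ} {f : Euc n → ℝ} (h : Cb (k+1) f) : Cb k (gsq f) :=
  Cb.sum _ fun i _ => (h.pd i).pow 2

end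

end KLS

end

section
open MeasureTheory Real Set
open scoped ENNReal RealInnerProductSpace

namespace KLS

noncomputable section

variable {n : ℕ} {t : ℝ} {ν : Measure (Euc n)}

theorem norm_combo (a b : ℝ) (hab : a + b = 1) (x y : Euc n) :
    ‖a • x + b • y‖ ^ 2 = a * ‖x‖ ^ 2 + b * ‖y‖ ^ 2 - a * b * ‖x - y‖ ^ 2 := by
  rw [norm_add_sq_real, norm_sub_sq_real, norm_smul, norm_smul, mul_pow, mul_pow, inner_smul_left,
    inner_smul_right]
  simp only [norm_eq_abs, sq_abs, conj_trivial]
  have : b = 1 - a := by linarith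
  subst this
  ring

/-- Prékopa–Leindler relative to a uniformly log-concave measure -/
theorem ul_pl (hν : UniformlyLogConcave t ν) {a b : ℝ} (ha : 0 < a) (hb : 0 < b) (hab : a + b = 1)
    {F G H : Euc n → ℝ≥0∞} (hF : Measurable F) (hG : Measurable G) (hH : Measurable H)
    (h : ∀ x y, F x ^ a * G y ^ b * ENNReal.ofReal (exp (-t * a * b / 2 * ‖x - y‖ ^ 2)) ≤
      H (a • x + b • y)) :
    (∫⁻ x, F x ∂ν) ^ a * (∫⁻ x, G x ∂ν) ^ b ≤ ∫⁻ x, H x ∂ν := by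
  obtain ⟨g, hg, ⟨g0, hlc⟩, rfl⟩ := hν
  set D : Euc n → ℝ≥0∞ := fun x => ENNReal.ofReal (Real.exp (-t * ‖x‖ ^ 2 / 2) * g x) with hD
  have hDm : Measurable D := by fun_prop
  rw [lintegral_withDensity_eq_lintegral_mul _ hDm hF, lintegral_withDensity_eq_lintegral_mul _ hDm hG,
    lintegral_withDensity_eq_lintegral_mul _ hDm hH]
  refine prekopa_leindler n a b ha hb hab _ _ _ (hDm.mul hF) (hDm.mul hG) (hDm.mul hH) fun x y => ?_
  simp only [Pi.mul_apply]
  rw [ENNReal.mul_rpow_of_nonneg _ _ ha.le, ENNReal.mul_rpow_of_nonneg _ _ hb.le]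
  have key : D x ^ a * D y ^ b ≤ ENNReal.ofReal (exp (-t * a * b / 2 * ‖x - y‖ ^ 2)) *
      D (a • x + b • y) := by
    simp only [hD]
    have p : ∀ x, 0 ≤ Real.exp (-t * ‖x‖ ^ 2 / 2) * g x := fun x => mul_nonneg (exp_nonneg _) (g0 x)
    rw [ENNReal.ofReal_rpow_of_nonneg (p x) ha.le, ENNReal.ofReal_rpow_of_nonneg (p y) hb.le,
      ← ENNReal.ofReal_mul (rpow_nonneg (p x) _), ← ENNReal.ofReal_mul (exp_nonneg _)]
    refine ENNReal.ofReal_le_ofReal ?_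
    rw [mul_rpow (exp_nonneg _) (g0 x), mul_rpow (exp_nonneg _) (g0 y), ← exp_mul, ← exp_mul]
    calc _ = exp (-t * ‖x‖ ^ 2 / 2 * a + -t * ‖y‖ ^ 2 / 2 * b) * (g x ^ a * g y ^ b) := by
          rw [exp_add]; ring
      _ ≤ exp (-t * ‖x‖ ^ 2 / 2 * a + -t * ‖y‖ ^ 2 / 2 * b) * g (a • x + b • y) :=
          mul_le_mul_of_nonneg_left (hlc x y a b ha.le hb.le hab) (exp_nonneg _)
      _ = _ := by
          rw [← mul_assoc, ← exp_add, norm_combo a b hab]; congr 2; ring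
  calc D x ^ a * F x ^ a * (D y ^ b * G y ^ b) = (D x ^ a * D y ^ b) * (F x ^ a * G y ^ b) := by ring
    _ ≤ ENNReal.ofReal (exp (-t * a * b / 2 * ‖x - y‖ ^ 2)) *
      D (a • x + b • y) * (F x ^ a * G y ^ b) := mul_le_mul' key le_rfl
    _ = D (a • x + b • y) * (F x ^ a * G y ^ b *
      ENNReal.ofReal (exp (-t * a * b / 2 * ‖x - y‖ ^ 2))) := by ring
    _ ≤ _ := mul_le_mul' le_rfl (h x y)

theorem isub {f g : Euc n → ℝ} (hf : Integrable f ν) (hg : Integrable g ν) :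
    Integrable (fun x => f x - g x) ν := hf.sub hg

theorem iadd {f g : Euc n → ℝ} (hf : Integrable f ν) (hg : Integrable g ν) :
    Integrable (fun x => f x + g x) ν := hf.add hg

/-- bounded measurable -/
theorem integrable_bm [IsFiniteMeasure ν] {f : Euc n → ℝ} (hf : Measurable f) {K : ℝ}
    (hK : ∀ x, |f x| ≤ K) : Integrable f ν :=
  Integrable.of_bound hf.aestronglyMeasurable K (Filter.Eventually.of_forall hK)

theorem ul_pl_exp [IsProbabilityMeasure ν] (hν : UniformlyLogConcave t ν) {a b : ℝ} (ha : 0 < a)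
    (hb : 0 < b) (hab : a + b = 1) {u w : Euc n → ℝ} (hu : Measurable u) (hw : Measurable w)
    {K : ℝ} (hK : ∀ x, |u x| ≤ K) (hK' : ∀ x, |w x| ≤ K)
    (h : ∀ x y, a * u x - t * a * b / 2 * ‖x - y‖ ^ 2 ≤ w (a • x + b • y)) :
    (∫ x, exp (u x) ∂ν) ^ a ≤ ∫ x, exp (w x) ∂ν := by
  have ii : ∀ {u : Euc n → ℝ}, Measurable u → (∀ x, |u x| ≤ K) → Integrable (fun x => exp (u x)) ν := by
    intro u hu hK
    refine integrable_bm (by fun_prop) (K := exp K) fun x => ?_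
    rw [abs_of_pos (exp_pos _)]
    exact exp_le_exp.2 ((le_abs_self _).trans (hK x))
  have := ul_pl hν ha hb hab (F := fun x => ENNReal.ofReal (exp (u x))) (G := fun _ => 1)
    (H := fun x => ENNReal.ofReal (exp (w x))) (by fun_prop) (by fun_prop) (by fun_prop) (by
      intro x y
      simp only [ENNReal.one_rpow, mul_one]
      rw [ENNReal.ofReal_rpow_of_pos (exp_pos _), ← exp_mul, ← ENNReal.ofReal_mul (exp_nonneg _),
        ← exp_add]
      refine ENNReal.ofReal_le_ofReal (exp_le_exp.2 ?_)
      have := h x y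
      linarith)
  simp only [lintegral_const, measure_univ, mul_one, ENNReal.one_rpow] at this
  rw [← ofReal_integral_eq_lintegral_ofReal (ii hu hK) (Filter.Eventually.of_forall fun x => exp_nonneg _),
    ← ofReal_integral_eq_lintegral_ofReal (ii hw hK') (Filter.Eventually.of_forall fun x => exp_nonneg _),
    ENNReal.ofReal_rpow_of_nonneg (integral_nonneg fun x => exp_nonneg _) ha.le] at this
  exact (ENNReal.ofReal_le_ofReal_iff (integral_nonneg fun x => exp_nonneg _)).1 this

/-- the basic infimum-convolution inequality -/
theorem ul_infconv [IsProbabilityMeasure ν] (hν : UniformlyLogConcave t ν) {δ : ℝ} (hδ : 0 < δ)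
    (hδ1 : δ < 1) {g : Euc n → ℝ} (hg : Cb 2 g) {L : ℝ}
    (hL : ∀ x z, g x + ⟪gradient g x, z - x⟫ - L / 2 * ‖z - x‖ ^ 2 ≤ g z)
    (hκ : 0 < t * (1 - δ) / δ - L) :
    (∫ x, exp ((g x - gsq g x / (2 * (t * (1 - δ) / δ - L))) / (1 - δ)) ∂ν) ^ (1 - δ) ≤
      ∫ x, exp (g x) ∂ν := by
  set c := t * (1 - δ) / δ - L with hc
  have h1δ : 0 < 1 - δ := by linarith
  have hm : Cb 0 (fun x => (g x - gsq g x / (2 * c)) / (1 - δ)) := by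
    have := ((hg.mono (k := 0) (by norm_num)).sub (((hg.mono (k := 1) (by norm_num)).gsq).const_mul (2 * c)⁻¹)).const_mul (1 - δ)⁻¹
    convert this using 2
    ring
  obtain ⟨K1, h1, hK1⟩ := hm.bdd
  obtain ⟨K2, h2, hK2⟩ := hg.bdd
  refine ul_pl_exp hν h1δ hδ (by ring) hm.measurable hg.measurable
    (K := K1 + K2) (fun x => (hK1 x).trans (by linarith)) (fun x => (hK2 x).trans (by linarith)) ?_
  intro x y
  refine le_trans ?_ (hL x _)
  have e : (1 - δ) • x + δ • y - x = δ • (y - x) := by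
    rw [smul_sub, sub_smul, one_smul]; abel
  rw [e, norm_smul, inner_smul_right, mul_div_cancel₀ _ h1δ.ne', gsq_eq]
  have e2 : |⟪gradient g x, y - x⟫| ≤ ‖gradient g x‖ * ‖y - x‖ := abs_real_inner_le_norm _ _
  have e3 := (abs_le.1 e2).1
  set p := ‖gradient g x‖
  rw [norm_sub_rev x y]
  set q := ‖y - x‖
  rw [mul_pow, norm_eq_abs, sq_abs]
  have e4 : t * (1 - δ) * δ = (c + L) * δ ^ 2 := by
    rw [hc]; field_simp; ring
  rw [e4]
  have e5 : 0 ≤ p ^ 2 / (2 * c) - δ * (p * q) + c * δ ^ 2 / 2 * q ^ 2 := by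
    have : p ^ 2 / (2 * c) - δ * (p * q) + c * δ ^ 2 / 2 * q ^ 2 = (p - c * δ * q) ^ 2 / (2 * c) := by
      field_simp; ring
    rw [this]; positivity
  nlinarith [mul_le_mul_of_nonneg_left e3 hδ.le]

/-- log-Sobolev inequality for `e^g` -/
theorem ul_lsi [IsProbabilityMeasure ν] (ht : 0 < t) (hν : UniformlyLogConcave t ν)
    {g : Euc n → ℝ} (hg : Cb 2 g) :
    ∫ x, g x * exp (g x) ∂ν - (∫ x, exp (g x) ∂ν) * log (∫ x, exp (g x) ∂ν) ≤
      1 / (2 * t) * ∫ x, gsq g x * exp (g x) ∂ν := by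
  obtain ⟨L, hL0, hL⟩ := hg.quad
  set I := ∫ x, exp (g x) ∂ν with hI
  obtain ⟨K, hK0, hK⟩ := hg.bdd
  have he : Measurable fun x => exp (g x) := hg.measurable.exp
  have heK : ∀ x, |exp (g x)| ≤ exp K := fun x => by
    rw [abs_of_pos (exp_pos _)]; exact exp_le_exp.2 ((le_abs_self _).trans (hK x))
  have ie : Integrable (fun x => exp (g x)) ν := integrable_bm he heK
  have ige : Integrable (fun x => g x * exp (g x)) ν :=
    ie.bdd_mul hg.measurable.aestronglyMeasurable (Filter.Eventually.of_forall hK)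
  have hgs := (hg.mono (k := 1) (by norm_num)).gsq
  obtain ⟨K', hK0', hK'⟩ := hgs.bdd
  have iqe : Integrable (fun x => gsq g x * exp (g x)) ν :=
    ie.bdd_mul hgs.measurable.aestronglyMeasurable (Filter.Eventually.of_forall hK')
  have hIpos : 0 < I := integral_exp_pos ie
  set A := ∫ x, g x * exp (g x) ∂ν
  set Bq := ∫ x, gsq g x * exp (g x) ∂ν
  -- the inequality for small s
  have step : ∀ s : ℝ, 0 < s → L * s < t → 
      A - 1 / (2 * (t - L * s)) * (1 + s) * Bq ≤ I * ((exp (s * log I) - 1) / s) := by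
    intro s hs hsL
    set δ := s / (1 + s) with hδ
    have hδ0 : 0 < δ := by positivity
    have hδ1 : 1 - δ = 1 / (1 + s) := by rw [hδ]; field_simp; ring
    have h1 : t * (1 - δ) / δ = t / s := by rw [hδ1, hδ]; field_simp
    have hc : 0 < t / s - L := by rw [sub_pos, lt_div_iff₀ hs]; exact hsL
    have key := ul_infconv hν hδ0 (by rw [← sub_pos, hδ1]; positivity) hg hL (by rw [h1]; exact hc)
    rw [h1, hδ1] at key
    have key2 : ∫ x, exp ((g x - gsq g x / (2 * (t / s - L))) / (1 / (1 + s))) ∂ν ≤ I ^ (1 + s) := by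
      have := rpow_le_rpow (by positivity) key (show 0 ≤ 1 + s by positivity)
      rwa [← rpow_mul (integral_nonneg fun x => exp_nonneg _), one_div_mul_cancel (by positivity),
        rpow_one] at this
    have low : I + s * (A - 1 / (2 * (t - L * s)) * (1 + s) * Bq) ≤
        ∫ x, exp ((g x - gsq g x / (2 * (t / s - L))) / (1 / (1 + s))) ∂ν := by
      have e : I + s * (A - 1 / (2 * (t - L * s)) * (1 + s) * Bq) =
          ∫ x, (exp (g x) + s * (g x * exp (g x) - 1 / (2 * (t - L * s)) * (1 + s) * (gsq g x * exp (g x)))) ∂ν := by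
        rw [integral_add ie ((isub ige (iqe.const_mul _)).const_mul _), integral_const_mul,
          integral_sub ige (iqe.const_mul _), integral_const_mul]
      rw [e]
      refine integral_mono (ie.add ((isub ige (iqe.const_mul _)).const_mul _)) ?_ ?_
      · have hm : Cb 0 (fun x => (g x - gsq g x / (2 * (t / s - L))) / (1 / (1 + s))) := by
          have := ((hg.mono (k := 0) (by norm_num)).sub (hgs.const_mul (2 * (t / s - L))⁻¹)).const_mul (1 + s)
          convert this using 2
          rw [div_div_eq_mul_div]; ring
        obtain ⟨K3, h3, hK3⟩ := hm.bdd
        refine integrable_bm hm.measurable.exp (K := exp K3) fun x => ?_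
        rw [abs_of_pos (exp_pos _)]; exact exp_le_exp.2 ((le_abs_self _).trans (hK3 x))
      · intro x
        have hts : 0 < t - L * s := by linarith
        have : (g x - gsq g x / (2 * (t / s - L))) / (1 / (1 + s)) =
            g x + s * (g x - 1 / (2 * (t - L * s)) * (1 + s) * gsq g x) := by
          have : t / s - L = (t - L * s) / s := by field_simp
          rw [this]; field_simp; ring
        simp only
        rw [this, exp_add]
        have := add_one_le_exp (s * (g x - 1 / (2 * (t - L * s)) * (1 + s) * gsq g x))
        nlinarith [mul_le_mul_of_nonneg_left this (exp_nonneg (g x))]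
    have : I ^ (1 + s) = I * exp (s * log I) := by
      rw [rpow_add hIpos, rpow_one, rpow_def_of_pos hIpos, mul_comm (log I)]
    rw [this] at key2
    have h3 := low.trans key2
    rw [← mul_div_assoc, le_div_iff₀ hs]
    nlinarith
  have lim1 : Filter.Tendsto (fun s : ℝ => A - 1 / (2 * (t - L * s)) * (1 + s) * Bq)
      (nhdsWithin 0 (Ioi 0)) (nhds (A - 1 / (2 * (t - L * 0)) * (1 + 0) * Bq)) := by
    refine (ContinuousAt.tendsto ?_).mono_left nhdsWithin_le_nhds
    have : 2 * (t - L * 0) ≠ 0 := by simp [ht.ne']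
    fun_prop (disch := exact this)
  have lim2 : Filter.Tendsto (fun s : ℝ => I * ((exp (s * log I) - 1) / s))
      (nhdsWithin 0 (Ioi 0)) (nhds (I * log I)) := by
    have : HasDerivAt (fun s : ℝ => exp (s * log I)) (log I) 0 := by
      have := ((hasDerivAt_id (0:ℝ)).mul_const (log I)).exp
      simpa using this
    have := (this.tendsto_slope_zero_right).const_mul I
    simpa [div_eq_inv_mul] using this
  have fin : A - 1 / (2 * (t - L * 0)) * (1 + 0) * Bq ≤ I * log I := by
    refine le_of_tendsto_of_tendsto lim1 lim2 ?_
    have : ∀ᶠ s : ℝ in nhdsWithin 0 (Ioi 0), L * s < t := by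
      refine Filter.Eventually.filter_mono nhdsWithin_le_nhds ?_
      have : ContinuousAt (fun s : ℝ => L * s) 0 := by fun_prop
      exact this.eventually_lt_const (by simpa using ht)
    filter_upwards [this, self_mem_nhdsWithin] with s h1 h2
    exact step s h2 h1
  simp only [mul_zero, sub_zero, add_zero, mul_one] at fin
  linarith

/-- log-Sobolev and the Gibbs variational principle combined -/
theorem ul_gibbs [IsProbabilityMeasure ν] (ht : 0 < t) (hν : UniformlyLogConcave t ν)
    {h : Euc n → ℝ} (hh : Cb 2 h) {ψ : Euc n → ℝ} (hψ : Integrable ψ ν)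
    (hψe : Integrable (fun x => exp (ψ x)) ν) {K : ℝ} (hK : ∫ x, exp (ψ x) ∂ν ≤ K) :
    ∫ x, ψ x * h x ^ 2 ∂ν ≤ 2 / t * ∫ x, gsq h x ∂ν + log K * ∫ x, h x ^ 2 ∂ν := by
  have hKpos : 0 < K := (integral_exp_pos hψe).trans_le hK
  obtain ⟨M, hM0, hM⟩ := (hh.pow 2).bdd
  have ih2 : Integrable (fun x => h x ^ 2) ν := (hh.pow 2).integrable ν
  have iψh : Integrable (fun x => ψ x * h x ^ 2) ν :=
    hψ.mul_bdd (c := M) (hh.pow 2).measurable.aestronglyMeasurable (Filter.Eventually.of_forall hM)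
  have igs : Integrable (gsq h) ν := ((hh.mono (k := 1) (by norm_num)).gsq).integrable ν
  have step : ∀ ε : ℝ, 0 < ε → ∫ x, ψ x * h x ^ 2 ∂ν + ε * ∫ x, ψ x ∂ν ≤
      2 / t * ∫ x, gsq h x ∂ν + log K * (∫ x, h x ^ 2 ∂ν + ε) := by
    intro ε hε
    have hy : Cb 2 (fun x => h x ^ 2 + ε) := (hh.pow 2).add (Cb.const ε 2)
    have hypos : ∀ x, ε ≤ h x ^ 2 + ε := fun x => by nlinarith [sq_nonneg (h x)]
    have hyp : ∀ x, 0 < h x ^ 2 + ε := fun x => hε.trans_le (hypos x)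
    have hg := hy.log hε hypos
    have lsi := ul_lsi ht hν hg
    simp only [exp_log (hyp _)] at lsi
    set I := ∫ x, (h x ^ 2 + ε) ∂ν with hI
    have hIe : I = ∫ x, h x ^ 2 ∂ν + ε := by
      rw [hI, integral_add ih2 (integrable_const _)]; simp
    have hIpos : 0 < I := by
      rw [hIe]; have : 0 ≤ ∫ x, h x ^ 2 ∂ν := integral_nonneg fun x => sq_nonneg _
      linarith
    have gr : ∫ x, gsq (fun x => log (h x ^ 2 + ε)) x * (h x ^ 2 + ε) ∂ν ≤ 4 * ∫ x, gsq h x ∂ν := by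
      rw [← integral_const_mul]
      refine integral_mono ?_ (igs.const_mul 4) ?_
      · exact ((((hg.mono (k := 1) (by norm_num)).gsq)).mul (hy.mono (k := 0) (by norm_num))).integrable ν
      · intro x
        simp only [gsq, Finset.mul_sum, Finset.sum_mul]
        refine Finset.sum_le_sum fun i _ => ?_
        rw [pd_log hy.diff hyp]
        have : pd i (fun x => h x ^ 2 + ε) x = 2 * h x * pd i h x := by
          have e1 : (fun x => h x ^ 2 + ε) = fun x => h x * h x + (fun _ => ε) x := by ext x; ring
          rw [e1, pd_add (f := fun x => h x * h x) (hh.diff.mul hh.diff) (differentiable_const _),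
            pd_mul hh.diff hh.diff]
          simp [pd]; ring
        simp only
        rw [this]
        have : (2 * h x * pd i h x * (h x ^ 2 + ε)⁻¹) ^ 2 * (h x ^ 2 + ε) =
          4 * pd i h x ^ 2 * (h x ^ 2 / (h x ^ 2 + ε)) := by
          have := (hyp x).ne'
          field_simp
          ring
        rw [this]
        refine mul_le_of_le_one_right (by positivity) ?_
        rw [div_le_one (hyp x)]; linarith
    -- Gibbs
    have ilog : Integrable (fun x => log (h x ^ 2 + ε) * (h x ^ 2 + ε)) ν :=
      (hg.mul hy).integrable ν
    have gibbs : ∫ x, ψ x * (h x ^ 2 + ε) ∂ν - I * log K + I * log I ≤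
        ∫ x, log (h x ^ 2 + ε) * (h x ^ 2 + ε) ∂ν := by
      have iy : Integrable (fun x => h x ^ 2 + ε) ν := hy.integrable ν
      have iψy : Integrable (fun x => ψ x * (h x ^ 2 + ε)) ν := by
        simpa only [mul_add] using iadd iψh (hψ.mul_const ε)
      have e1 : ∫ x, (ψ x * (h x ^ 2 + ε) + (log I - log K) * (h x ^ 2 + ε)) ∂ν ≤
          ∫ x, (log (h x ^ 2 + ε) * (h x ^ 2 + ε) + (I / K * exp (ψ x) - (h x ^ 2 + ε))) ∂ν := by
        refine integral_mono (iψy.add (iy.const_mul _)) (ilog.add (isub (hψe.const_mul _) iy)) ?_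
        intro x
        simp only
        set y := h x ^ 2 + ε
        have hy0 : 0 < y := hyp x
        have := add_one_le_exp (ψ x + log I - log K - log y)
        rw [exp_sub, exp_sub, exp_add, exp_log hIpos, exp_log hKpos, exp_log hy0] at this
        have h2 := mul_le_mul_of_nonneg_right this hy0.le
        rw [div_mul_cancel₀ _ hy0.ne'] at h2
        have : exp (ψ x) * I / K = I / K * exp (ψ x) := by ring
        nlinarith
      rw [integral_add iψy (iy.const_mul _), integral_add ilog (isub (hψe.const_mul _) iy),
        integral_sub (hψe.const_mul _) iy, integral_const_mul, integral_const_mul, ← hI] at e1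
      have e2 : I / K * ∫ x, exp (ψ x) ∂ν ≤ I := by
        calc I / K * ∫ x, exp (ψ x) ∂ν ≤ I / K * K := mul_le_mul_of_nonneg_left hK (by positivity)
          _ = I := by field_simp
      linarith
    have e3 : ∫ x, ψ x * (h x ^ 2 + ε) ∂ν = ∫ x, ψ x * h x ^ 2 ∂ν + ε * ∫ x, ψ x ∂ν := by
      simp only [mul_add]
      rw [integral_add iψh (hψ.mul_const ε), integral_mul_const]; ring
    rw [e3] at gibbs
    have e4 : 1 / (2 * t) * ∫ x, gsq (fun x => log (h x ^ 2 + ε)) x * (h x ^ 2 + ε) ∂ν ≤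
        2 / t * ∫ x, gsq h x ∂ν := by
      calc _ ≤ 1 / (2 * t) * (4 * ∫ x, gsq h x ∂ν) := mul_le_mul_of_nonneg_left gr (by positivity)
        _ = _ := by field_simp; ring
    rw [← hIe]
    linarith
  have l1 : Filter.Tendsto (fun ε : ℝ => ∫ x, ψ x * h x ^ 2 ∂ν + ε * ∫ x, ψ x ∂ν)
      (nhdsWithin 0 (Ioi 0)) (nhds (∫ x, ψ x * h x ^ 2 ∂ν + 0 * ∫ x, ψ x ∂ν)) :=
    (Continuous.tendsto (by fun_prop) 0).mono_left nhdsWithin_le_nhds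
  have l2 : Filter.Tendsto (fun ε : ℝ => 2 / t * ∫ x, gsq h x ∂ν + log K * (∫ x, h x ^ 2 ∂ν + ε))
      (nhdsWithin 0 (Ioi 0)) (nhds (2 / t * ∫ x, gsq h x ∂ν + log K * (∫ x, h x ^ 2 ∂ν + 0))) :=
    (Continuous.tendsto (by fun_prop) 0).mono_left nhdsWithin_le_nhds
  have := le_of_tendsto_of_tendsto l1 l2 (by
    filter_upwards [self_mem_nhdsWithin] with ε hε using step ε hε)
  simpa using this

/-- variance -/
def vr (ν : Measure (Euc n)) (f : Euc n → ℝ) : ℝ := ∫ x, f x ^ 2 ∂ν - (∫ x, f x ∂ν) ^ 2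

/-- Poincaré inequality on smooth bounded functions -/
def Poin (ν : Measure (Euc n)) (C : ℝ) : Prop :=
  ∀ f, SB f → vr ν f ≤ C * ∫ x, gsq f x ∂ν

theorem pd_sub_const {f : Euc n → ℝ} (c : ℝ) (i : Fin n) :
    pd i (fun x => f x - c) = pd i f := by
  ext x; simp only [pd]; rw [fderiv_sub_const]

theorem gsq_sub_const {f : Euc n → ℝ} (c : ℝ) : gsq (fun x => f x - c) = gsq f := by
  ext x; simp only [gsq, pd_sub_const]

theorem pd_const_mul {f : Euc n → ℝ} (hf : Differentiable ℝ f) (c : ℝ) (i : Fin n) :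
    pd i (fun x => c * f x) = fun x => c * pd i f x := by
  ext x; simp only [pd]; rw [fderiv_const_mul (hf x)]; simp

theorem gsq_const_mul {f : Euc n → ℝ} (hf : Differentiable ℝ f) (c : ℝ) :
    gsq (fun x => c * f x) = fun x => c ^ 2 * gsq f x := by
  ext x; simp only [gsq, pd_const_mul hf, Finset.mul_sum, mul_pow]

theorem vr_eq [IsProbabilityMeasure ν] {f : Euc n → ℝ} (hf : Integrable f ν)
    (hf2 : Integrable (fun x => f x ^ 2) ν) (c : ℝ) :
    vr ν f = ∫ x, (f x - c) ^ 2 ∂ν - (∫ x, f x ∂ν - c) ^ 2 := by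
  have : ∀ x, (f x - c) ^ 2 = f x ^ 2 - (2 * c) * f x + c ^ 2 := fun x => by ring
  simp only [this, vr]
  rw [integral_add (isub hf2 (hf.const_mul _)) (integrable_const _), integral_sub hf2 (hf.const_mul _),
    integral_const_mul]
  simp; ring

theorem exp_lower {u : ℝ} (hu : |u| ≤ 1) : 1 + u + u ^ 2 / 2 - |u| ^ 3 ≤ exp u := by
  have := Real.exp_bound hu (n := 3) (by norm_num)
  simp only [Finset.sum_range_succ, Finset.sum_range_zero] at this
  norm_num [Nat.factorial] at this
  have h := (abs_le.1 this).1
  nlinarith [pow_nonneg (abs_nonneg u) 3]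

theorem exp_upper {u : ℝ} (hu : |u| ≤ 1) : exp u ≤ 1 + u + u ^ 2 / 2 + |u| ^ 3 := by
  have := Real.exp_bound hu (n := 3) (by norm_num)
  simp only [Finset.sum_range_succ, Finset.sum_range_zero] at this
  norm_num [Nat.factorial] at this
  have h := (abs_le.1 this).2
  nlinarith [pow_nonneg (abs_nonneg u) 3]

theorem ul_poin_centered [IsProbabilityMeasure ν] (ht : 0 < t) (hν : UniformlyLogConcave t ν)
    {φ : Euc n → ℝ} (hφ : Cb 2 φ) (h0 : ∫ x, φ x ∂ν = 0) :
    ∫ x, φ x ^ 2 ∂ν ≤ 1 / t * ∫ x, gsq φ x ∂ν := by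
  obtain ⟨L, hL0, hL⟩ := hφ.quad
  obtain ⟨K, hK0, hK⟩ := hφ.bdd
  have hgs := (hφ.mono (k := 1) (by norm_num)).gsq
  obtain ⟨K', hK0', hK'⟩ := hgs.bdd
  set v := ∫ x, φ x ^ 2 ∂ν
  set Q := ∫ x, gsq φ x ∂ν
  have iφ := hφ.integrable ν
  have iφ2 := (hφ.pow 2).integrable ν
  have iq := hgs.integrable ν
  set K1 := 2 * K + 2 * K' / t with hK1
  have hK1' : 0 ≤ K1 := by positivity
  set K2 := 4 * K * K' / t + K1 ^ 3 with hK2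
  have step : ∀ ε : ℝ, 0 < ε → ε < 1 → ε * L < t / 2 → ε * K1 < 1 →
      v - Q / (t - ε * L) ≤ ε * K2 + 2 * ε * K ^ 3 + ε ^ 2 * (v / 2 + ε * K ^ 3) ^ 2 := by
    intro ε hε hε1 hεL hεK
    set c := t - ε * L with hc
    have hct : t / 2 < c := by linarith
    have hc0 : 0 < c := by linarith
    have hφε : Cb 2 (fun x => ε * φ x) := hφ.const_mul ε
    have gεx : ∀ x, gradient (fun x => ε * φ x) x = ε • gradient φ x := by
      intro x; ext i; rw [gradient_apply, pd_const_mul hφ.diff]; simp [gradient_apply]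
    have key := ul_infconv hν (δ := 1/2) (by norm_num) (by norm_num) hφε (L := ε * L) (by
      intro x z
      rw [gεx, inner_smul_left]
      have := mul_le_mul_of_nonneg_left (hL x z) hε.le
      simp only [conj_trivial]
      linarith) (by norm_num; linarith)
    have e1 : t * (1 - 1 / 2) / (1 / 2) - ε * L = c := by rw [hc]; ring
    rw [e1, gsq_const_mul hφ.diff] at key
    have e2 : ∀ x, (ε * φ x - ε ^ 2 * gsq φ x / (2 * c)) / (1 - 1 / 2) =
        2 * ε * φ x - ε ^ 2 * (gsq φ x / c) := by intro x; field_simp; ring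
    simp only [e2] at key
    have key2 : ∫ x, exp (2 * ε * φ x - ε ^ 2 * (gsq φ x / c)) ∂ν ≤ (∫ x, exp (ε * φ x) ∂ν) ^ 2 := by
      have := pow_le_pow_left₀ (by positivity) key 2
      rw [← rpow_natCast, ← rpow_mul (integral_nonneg fun x => exp_nonneg _)] at this
      norm_num at this
      exact this
    have hq : ∀ x, 0 ≤ gsq φ x / c ∧ gsq φ x / c ≤ 2 * K' / t := by
      intro x
      refine ⟨div_nonneg (gsq_nonneg _ _) hc0.le, ?_⟩
      calc gsq φ x / c ≤ K' / (t / 2) := div_le_div₀ hK0' ((le_abs_self _).trans (hK' x)) (by linarith) hct.le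
        _ = _ := by field_simp
    have low : 1 - ε ^ 2 * (Q / c) + 2 * ε ^ 2 * v - ε ^ 3 * K2 ≤
        ∫ x, exp (2 * ε * φ x - ε ^ 2 * (gsq φ x / c)) ∂ν := by
      have e : 1 - ε ^ 2 * (Q / c) + 2 * ε ^ 2 * v - ε ^ 3 * K2 =
          ∫ x, ((2 * ε * φ x + 2 * ε ^ 2 * φ x ^ 2) - ε ^ 2 / c * gsq φ x + (1 - ε ^ 3 * K2)) ∂ν := by
        rw [integral_add (isub (iadd (iφ.const_mul _) (iφ2.const_mul _)) (iq.const_mul _))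
          (integrable_const _), integral_sub (iadd (iφ.const_mul _) (iφ2.const_mul _)) (iq.const_mul _),
          integral_add (iφ.const_mul _) (iφ2.const_mul _), integral_const_mul, integral_const_mul,
          integral_const_mul, h0]
        simp; ring
      rw [e]
      refine integral_mono (iadd (isub (iadd (iφ.const_mul _) (iφ2.const_mul _)) (iq.const_mul _))
          (integrable_const _)) ?_ ?_
      · have hm : Cb 0 (fun x => 2 * ε * φ x - ε ^ 2 * (gsq φ x / c)) := by
          have := (hφ.const_mul (2 * ε)).of_succ.of_succ.sub (hgs.const_mul (ε ^ 2 / c))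
          convert this using 2
          ring
        obtain ⟨K3, h3, hK3⟩ := hm.bdd
        refine integrable_bm hm.measurable.exp (K := exp K3) fun x => ?_
        rw [abs_of_pos (exp_pos _)]; exact exp_le_exp.2 ((le_abs_self _).trans (hK3 x))
      · intro x
        simp only
        set q := gsq φ x / c with hqd
        obtain ⟨hq0, hq1⟩ := hq x
        rw [← hqd] at hq0 hq1
        have e4 : ε ^ 2 / c * gsq φ x = ε ^ 2 * q := by rw [hqd]; ring
        rw [e4]
        have hφx := hK x
        have hu : |2 * ε * φ x - ε ^ 2 * q| ≤ ε * K1 := by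
          rw [hK1]
          have a1 : |2 * ε * φ x| ≤ 2 * ε * K := by
            rw [abs_mul, abs_of_pos (by positivity : 0 < 2 * ε)]
            exact mul_le_mul_of_nonneg_left hφx (by positivity)
          have a2 : |ε ^ 2 * q| ≤ ε * (2 * K' / t) := by
            rw [abs_of_nonneg (by positivity)]
            calc ε ^ 2 * q ≤ ε * q := mul_le_mul_of_nonneg_right (by nlinarith) hq0
              _ ≤ _ := mul_le_mul_of_nonneg_left hq1 hε.le
          refine (abs_sub _ _).trans ?_
          linarith
        have e5 := exp_lower (hu.trans hεK.le)
        have e6 : |2 * ε * φ x - ε ^ 2 * q| ^ 3 ≤ ε ^ 3 * K1 ^ 3 := by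
          rw [← mul_pow]; exact pow_le_pow_left₀ (abs_nonneg _) hu 3
        have e7 : φ x * q ≤ K * (2 * K' / t) := by
          calc φ x * q ≤ K * q := mul_le_mul_of_nonneg_right ((le_abs_self _).trans hφx) hq0
            _ ≤ _ := mul_le_mul_of_nonneg_left hq1 hK0
        have e8 : ε ^ 3 * (φ x * q) ≤ ε ^ 3 * (K * (2 * K' / t)) :=
          mul_le_mul_of_nonneg_left e7 (by positivity)
        have e9 : ε ^ 3 * K2 = 2 * (ε ^ 3 * (K * (2 * K' / t))) + ε ^ 3 * K1 ^ 3 := by rw [hK2]; ring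
        nlinarith [sq_nonneg (ε ^ 2 * q)]
    have up : ∫ x, exp (ε * φ x) ∂ν ≤ 1 + ε ^ 2 * v / 2 + ε ^ 3 * K ^ 3 := by
      have e : 1 + ε ^ 2 * v / 2 + ε ^ 3 * K ^ 3 =
          ∫ x, ((ε * φ x + ε ^ 2 / 2 * φ x ^ 2) + (1 + ε ^ 3 * K ^ 3)) ∂ν := by
        rw [integral_add (iadd (iφ.const_mul _) (iφ2.const_mul _)) (integrable_const _),
          integral_add (iφ.const_mul _) (iφ2.const_mul _), integral_const_mul, integral_const_mul, h0]
        simp; ring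
      rw [e]
      refine integral_mono ?_ (iadd (iadd (iφ.const_mul _) (iφ2.const_mul _)) (integrable_const _)) ?_
      · obtain ⟨K3, h3, hK3⟩ := hφε.bdd
        refine integrable_bm hφε.measurable.exp (K := exp K3) fun x => ?_
        rw [abs_of_pos (exp_pos _)]; exact exp_le_exp.2 ((le_abs_self _).trans (hK3 x))
      · intro x
        simp only
        have hu : |ε * φ x| ≤ ε * K := by
          rw [abs_mul, abs_of_pos hε]; exact mul_le_mul_of_nonneg_left (hK x) hε.le
        have hu1 : ε * K ≤ 1 := by
          have : K ≤ K1 := by rw [hK1]; have : 0 ≤ 2 * K' / t := by positivity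
                              linarith
          nlinarith
        have e5 := exp_upper (hu.trans hu1)
        have e6 : |ε * φ x| ^ 3 ≤ ε ^ 3 * K ^ 3 := by
          rw [← mul_pow]; exact pow_le_pow_left₀ (abs_nonneg _) hu 3
        nlinarith
    have fin := (low.trans key2).trans (pow_le_pow_left₀ (integral_nonneg fun x => exp_nonneg _) up 2)
    have hε2 : 0 < ε ^ 2 := by positivity
    have : ε ^ 2 * (v - Q / c) ≤ ε ^ 2 * (ε * K2 + 2 * ε * K ^ 3 + ε ^ 2 * (v / 2 + ε * K ^ 3) ^ 2) := by
      nlinarith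
    exact le_of_mul_le_mul_left this hε2
  have l1 : Filter.Tendsto (fun ε : ℝ => v - Q / (t - ε * L))
      (nhdsWithin 0 (Ioi 0)) (nhds (v - Q / (t - 0 * L))) := by
    refine (ContinuousAt.tendsto ?_).mono_left nhdsWithin_le_nhds
    have : t - 0 * L ≠ 0 := by simp [ht.ne']
    fun_prop (disch := exact this)
  have l2 : Filter.Tendsto (fun ε : ℝ => ε * K2 + 2 * ε * K ^ 3 + ε ^ 2 * (v / 2 + ε * K ^ 3) ^ 2)
      (nhdsWithin 0 (Ioi 0)) (nhds (0 * K2 + 2 * 0 * K ^ 3 + 0 ^ 2 * (v / 2 + 0 * K ^ 3) ^ 2)) :=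
    (Continuous.tendsto (by fun_prop) 0).mono_left nhdsWithin_le_nhds
  have := le_of_tendsto_of_tendsto l1 l2 (by
    have c1 : ∀ᶠ ε : ℝ in nhdsWithin 0 (Ioi 0), ε < 1 :=
      Filter.Eventually.filter_mono nhdsWithin_le_nhds (gt_mem_nhds one_pos)
    have c2 : ∀ᶠ ε : ℝ in nhdsWithin 0 (Ioi 0), ε * L < t / 2 := by
      refine Filter.Eventually.filter_mono nhdsWithin_le_nhds ?_
      have : ContinuousAt (fun s : ℝ => s * L) 0 := by fun_prop
      exact this.eventually_lt_const (by simpa using ht)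
    have c3 : ∀ᶠ ε : ℝ in nhdsWithin 0 (Ioi 0), ε * K1 < 1 := by
      refine Filter.Eventually.filter_mono nhdsWithin_le_nhds ?_
      have : ContinuousAt (fun s : ℝ => s * K1) 0 := by fun_prop
      exact this.eventually_lt_const (by simp)
    filter_upwards [self_mem_nhdsWithin, c1, c2, c3] with ε h1 h2 h3 h4 using step ε h1 h2 h3 h4)
  norm_num at this
  rw [div_eq_inv_mul] at this
  rw [one_div]; exact this

theorem ul_poin [IsProbabilityMeasure ν] (ht : 0 < t) (hν : UniformlyLogConcave t ν)
    {f : Euc n → ℝ} (hf : Cb 2 f) : vr ν f ≤ 1 / t * ∫ x, gsq f x ∂ν := by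
  rw [vr_eq (hf.integrable ν) ((hf.pow 2).integrable ν) (∫ x, f x ∂ν), ← gsq_sub_const (∫ x, f x ∂ν)]
  simp only [sub_self]
  have := ul_poin_centered ht hν (hf.sub (Cb.const (∫ x, f x ∂ν) 2)) (by
    rw [integral_sub (hf.integrable ν) (integrable_const _)]; simp)
  simpa using this

theorem ul_Poin [IsProbabilityMeasure ν] (ht : 0 < t) (hν : UniformlyLogConcave t ν) :
    Poin ν (1 / t) := fun _ hf => ul_poin ht hν (hf 2)

end

end KLS

end

section
open MeasureTheory Real Set
open scoped ENNReal RealInnerProductSpace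

namespace KLS

noncomputable section

variable {n : ℕ} {t : ℝ} {ν : Measure (Euc n)}

/-- essentially bounded support -/
def BS (ν : Measure (Euc n)) : Prop := ∃ R, ∀ᵐ x ∂ν, ‖x‖ ≤ R

theorem BS.pos (h : BS ν) : ∃ R, 0 < R ∧ ∀ᵐ x ∂ν, ‖x‖ ≤ R := by
  obtain ⟨R, hR⟩ := h
  refine ⟨max R 1, by positivity, ?_⟩
  filter_upwards [hR] with x hx using hx.trans (le_max_left _ _)

theorem BS.bdd (h : BS ν) {F : Type*} [NormedAddCommGroup F] {f : Euc n → F} (hf : Continuous f) :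
    ∃ K, 0 ≤ K ∧ ∀ᵐ x ∂ν, ‖f x‖ ≤ K := by
  obtain ⟨R, hR⟩ := h
  obtain ⟨K, hK⟩ := (isCompact_closedBall (0 : Euc n) R).exists_bound_of_continuousOn hf.continuousOn
  refine ⟨max K 0, le_max_right _ _, ?_⟩
  filter_upwards [hR] with x hx
  exact (hK x (by simpa using hx)).trans (le_max_left _ _)

theorem BS.integrable [IsFiniteMeasure ν] (h : BS ν) {F : Type*} [NormedAddCommGroup F]
    {f : Euc n → F} (hf : Continuous f) : Integrable f ν := by
  obtain ⟨K, _, hK⟩ := h.bdd hf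
  exact Integrable.of_bound (hf.aestronglyMeasurable) K hK

theorem cutoff (R : ℝ) : ∃ χ : Euc n → ℝ, ContDiff ℝ ((⊤ : ℕ∞) : WithTop ℕ∞) χ ∧
    HasCompactSupport χ ∧ ∀ x, ‖x‖ ≤ R → χ =ᶠ[nhds x] fun _ => 1 := by
  let c : ContDiffBump (0 : Euc n) := ⟨|R| + 1, |R| + 2, by positivity, by linarith⟩
  refine ⟨c, c.contDiff, c.hasCompactSupport, fun x hx => ?_⟩
  refine c.eventuallyEq_one_of_mem_ball ?_
  rw [Metric.mem_ball, dist_zero_right]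
  show ‖x‖ < |R| + 1
  linarith [le_abs_self R]

theorem Poin.smooth {C : ℝ} (h : Poin ν C) (hb : BS ν) {f : Euc n → ℝ}
    (hf : ContDiff ℝ ((⊤ : ℕ∞) : WithTop ℕ∞) f) : vr ν f ≤ C * ∫ x, gsq f x ∂ν := by
  obtain ⟨R, hR⟩ := hb
  obtain ⟨χ, h1, h2, h3⟩ := cutoff (n := n) R
  have := h (fun x => χ x * f x) (SB.of_compact (h1.mul hf) h2.mul_right)
  have e : ∀ᵐ x ∂ν, (fun x => χ x * f x) =ᶠ[nhds x] f := by
    filter_upwards [hR] with x hx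
    filter_upwards [h3 x hx] with y hy
    simp [hy]
  have e1 : ∫ x, (χ x * f x) ^ 2 ∂ν = ∫ x, f x ^ 2 ∂ν := by
    refine integral_congr_ae ?_
    filter_upwards [e] with x hx
    have := hx.self_of_nhds
    simp only at this
    simp only [this]
  have e2 : ∫ x, (χ x * f x) ∂ν = ∫ x, f x ∂ν := by
    refine integral_congr_ae ?_
    filter_upwards [e] with x hx using hx.self_of_nhds
  have e3 : ∫ x, gsq (fun x => χ x * f x) x ∂ν = ∫ x, gsq f x ∂ν := by
    refine integral_congr_ae ?_
    filter_upwards [e] with x hx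
    simp only [gsq, pd, hx.fderiv_eq]
  rw [e3] at this
  unfold vr at this ⊢
  rwa [e1, e2] at this

theorem borell_tail [IsProbabilityMeasure ν] (ht : 0 ≤ t) (hν : UniformlyLogConcave t ν)
    (e : Euc n) (c : ℝ) {σ : ℝ} (hσ : 0 < σ) (hi : Integrable (fun x => (⟪x, e⟫ - c) ^ 2) ν)
    (h2 : ∫ x, (⟪x, e⟫ - c) ^ 2 ∂ν ≤ σ ^ 2) (k : ℕ) :
    ν {x | 4 * k * σ < |⟪x, e⟫ - c|} ≤ ENNReal.ofReal ((1 / 3) ^ k) := by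
  set φ : Euc n → ℝ := fun x => ⟪x, e⟫ - c with hφ
  have hφm : Measurable φ := by fun_prop
  set A : Set (Euc n) := {x | |φ x| ≤ 2 * σ} with hA
  have hAm : MeasurableSet A := measurableSet_le hφm.abs measurable_const
  have hAc : ν Aᶜ ≤ ENNReal.ofReal (1 / 4) := by
    have := mul_meas_ge_le_integral_of_nonneg (Filter.Eventually.of_forall fun x => sq_nonneg (φ x)) hi
      (4 * σ ^ 2)
    have h3 : ν.real Aᶜ ≤ ν.real {x | 4 * σ ^ 2 ≤ φ x ^ 2} := by
      refine measureReal_mono ?_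
      intro x hx
      simp only [hA, mem_compl_iff, mem_ofPred_eq, not_le] at hx ⊢
      rw [← sq_abs (φ x)]
      have := pow_le_pow_left₀ (by positivity) hx.le 2
      linarith [mul_pow 2 σ 2]
    rw [← ofReal_measureReal]
    refine ENNReal.ofReal_le_ofReal ?_
    have : (4 * σ ^ 2) * ν.real Aᶜ ≤ σ ^ 2 :=
      (mul_le_mul_of_nonneg_left h3 (by positivity)).trans (this.trans h2)
    have hs : 0 < σ ^ 2 := by positivity
    nlinarith
  have hA34 : ENNReal.ofReal (3 / 4) ≤ ν A := by
    rw [← ofReal_measureReal] at hAc ⊢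
    rw [ENNReal.ofReal_le_ofReal_iff (by norm_num)] at hAc
    refine ENNReal.ofReal_le_ofReal ?_
    have := measureReal_add_measureReal_compl (μ := ν) hAm
    simp at this
    linarith
  rcases Nat.eq_zero_or_pos k with hk | hk
  · subst hk; simpa using prob_le_one
  set B : Set (Euc n) := {x | 2 * (2 * k - 1) * σ < |φ x|} with hB
  have hBm : MeasurableSet B := measurableSet_lt measurable_const hφm.abs
  have hsub : ν {x | 4 * k * σ < |φ x|} ≤ ν B := by
    refine measure_mono fun x hx => ?_
    simp only [hB, mem_ofPred_eq] at hx ⊢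
    nlinarith
  refine hsub.trans ?_
  rcases Nat.lt_or_ge 1 k with hk1 | hk1
  swap
  · have : k = 1 := by omega
    subst this
    have hBA : B = Aᶜ := by
      ext x; simp only [hB, hA, mem_ofPred_eq, mem_compl_iff, not_le]; norm_num
    rw [hBA]
    exact hAc.trans (ENNReal.ofReal_le_ofReal (by norm_num))
  have hk0 : (0:ℝ) < k := by exact_mod_cast hk
  have hk1' : (1:ℝ) < k := by exact_mod_cast hk1
  have hb : 0 < 1 - 1 / (k:ℝ) := by rw [sub_pos, div_lt_one hk0]; exact hk1'
  have pl := ul_pl hν (a := 1 / k) (b := 1 - 1 / k) (by positivity) hb (by ring)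
    (F := B.indicator 1) (G := A.indicator 1) (H := Aᶜ.indicator 1)
    (measurable_one.indicator hBm) (measurable_one.indicator hAm) (measurable_one.indicator hAm.compl) (by
      intro x y
      by_cases hx : x ∈ B
      swap
      · rw [indicator_of_notMem hx, ENNReal.zero_rpow_of_pos (by positivity)]; simp
      by_cases hy : y ∈ A
      swap
      · rw [indicator_of_notMem hy, ENNReal.zero_rpow_of_pos hb]; simp
      have hz : (1 / (k:ℝ)) • x + (1 - 1 / (k:ℝ)) • y ∈ Aᶜ := by
        simp only [hA, hB, mem_compl_iff, mem_ofPred_eq, not_le] at hx hy ⊢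
        have e1 : φ ((1 / (k:ℝ)) • x + (1 - 1 / (k:ℝ)) • y) = (1 / (k:ℝ)) * φ x + (1 - 1 / (k:ℝ)) * φ y := by
          simp only [hφ, inner_add_left, inner_smul_left, conj_trivial]; ring
        rw [e1]
        have e2 : |1 / (k:ℝ) * φ x| - |(1 - 1 / (k:ℝ)) * φ y| ≤
            |(1 / (k:ℝ)) * φ x + (1 - 1 / (k:ℝ)) * φ y| := by
          have := abs_sub_abs_le_abs_sub (1 / (k:ℝ) * φ x) (-((1 - 1 / (k:ℝ)) * φ y))
          rwa [abs_neg, sub_neg_eq_add] at this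
        refine lt_of_lt_of_le ?_ e2
        rw [abs_mul, abs_mul, abs_of_pos hb, abs_of_pos (by positivity : 0 < 1 / (k:ℝ))]
        have e3 : 1 / (k:ℝ) * (2 * (2 * k - 1) * σ) < 1 / (k:ℝ) * |φ x| :=
          mul_lt_mul_of_pos_left hx (by positivity)
        have e4 : (1 - 1 / (k:ℝ)) * |φ y| ≤ (1 - 1 / (k:ℝ)) * (2 * σ) :=
          mul_le_mul_of_nonneg_left hy hb.le
        have e5 : 1 / (k:ℝ) * (2 * (2 * k - 1) * σ) - (1 - 1 / (k:ℝ)) * (2 * σ) = 2 * σ := by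
          field_simp; ring
        linarith
      rw [indicator_of_mem hx, indicator_of_mem hy, indicator_of_mem hz]
      simp only [Pi.one_apply, ENNReal.one_rpow, one_mul]
      rw [ENNReal.ofReal_le_one]
      refine exp_le_one_iff.2 ?_
      have : 0 ≤ t * (1 / k) * (1 - 1 / k) / 2 * ‖x - y‖ ^ 2 := by positivity
      linarith)
  rw [lintegral_indicator_one hBm, lintegral_indicator_one hAm, lintegral_indicator_one hAm.compl] at pl
  have pl2 : (ν B) ^ (1 / (k:ℝ)) * ENNReal.ofReal (3 / 4) ^ (1 - 1 / (k:ℝ)) ≤ ENNReal.ofReal (1 / 4) :=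
    (mul_le_mul' le_rfl (ENNReal.rpow_le_rpow hA34 hb.le)).trans (pl.trans hAc)
  have pl3 := ENNReal.rpow_le_rpow pl2 hk0.le
  rw [ENNReal.mul_rpow_of_nonneg _ _ hk0.le, ← ENNReal.rpow_mul, ← ENNReal.rpow_mul,
    one_div_mul_cancel hk0.ne', ENNReal.rpow_one, ← ofReal_measureReal,
    ENNReal.ofReal_rpow_of_pos (by norm_num), ENNReal.ofReal_rpow_of_pos (by norm_num),
    ← ENNReal.ofReal_mul measureReal_nonneg, ENNReal.ofReal_le_ofReal_iff (by positivity)] at pl3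
  rw [← ofReal_measureReal]
  refine ENNReal.ofReal_le_ofReal ?_
  have e1 : (1 - 1 / (k:ℝ)) * k = (k - 1 : ℕ) := by
    rw [Nat.cast_sub hk1.le]; field_simp; simp
  rw [e1, rpow_natCast, rpow_natCast] at pl3
  obtain ⟨m, rfl⟩ : ∃ m, k = m + 1 := ⟨k - 1, by omega⟩
  simp only [Nat.add_sub_cancel] at pl3
  have h34 : (0:ℝ) < (3 / 4) ^ m := by positivity
  have : (1 / 4 : ℝ) ^ (m + 1) ≤ (1 / 3) ^ (m + 1) * (3 / 4) ^ m := by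
    rw [pow_succ, pow_succ (1/3 : ℝ), mul_right_comm, ← mul_pow]
    norm_num
  exact le_of_mul_le_mul_right (pl3.trans this) h34

theorem borell_exp_lint [IsProbabilityMeasure ν] (ht : 0 ≤ t) (hν : UniformlyLogConcave t ν)
    (e : Euc n) (c : ℝ) {σ : ℝ} (hσ : 0 < σ) (hi : Integrable (fun x => (⟪x, e⟫ - c) ^ 2) ν)
    (h2 : ∫ x, (⟪x, e⟫ - c) ^ 2 ∂ν ≤ σ ^ 2) :
    ∫⁻ x, ENNReal.ofReal (exp (|⟪x, e⟫ - c| / (8 * σ))) ∂ν ≤ ENNReal.ofReal 6 := by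
  set B : ℕ → Set (Euc n) := fun k => {x | 4 * k * σ < |⟪x, e⟫ - c|} with hB
  have hφm : Measurable fun x : Euc n => ⟪x, e⟫ - c := by fun_prop
  have hBm : ∀ k, MeasurableSet (B k) := fun k => measurableSet_lt measurable_const hφm.abs
  have hexp : exp (1/2) ≤ 5 / 3 := by
    have h1 : exp (1/2) * exp (1/2) = exp 1 := by rw [← exp_add]; norm_num
    have h2 := exp_one_lt_d9
    by_contra hcon
    push Not at hcon
    nlinarith
  have pt : ∀ x, ENNReal.ofReal (exp (|⟪x, e⟫ - c| / (8 * σ))) ≤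
      1 + ∑' k : ℕ, (B k).indicator (fun _ => ENNReal.ofReal (exp ((k + 1) / 2))) x := by
    intro x
    set y := |⟪x, e⟫ - c| with hy
    rcases eq_or_lt_of_le (abs_nonneg (⟪x, e⟫ - c)) with h0 | h0
    · rw [hy, ← h0]; simp
    · rw [← hy] at h0
      obtain ⟨k, hk⟩ : ∃ k : ℕ, ⌈y / (4 * σ)⌉₊ = k + 1 := by
        have : 0 < ⌈y / (4 * σ)⌉₊ := Nat.ceil_pos.2 (by positivity)
        exact ⟨⌈y / (4 * σ)⌉₊ - 1, by omega⟩
      have k1 : (k:ℝ) < y / (4 * σ) := by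
        have : k < ⌈y / (4 * σ)⌉₊ := by omega
        exact Nat.lt_ceil.1 this
      have k2 : y / (4 * σ) ≤ k + 1 := by
        have := Nat.le_ceil (y / (4 * σ))
        rw [hk] at this; exact_mod_cast this
      refine le_trans ?_ (le_add_left (ENNReal.le_tsum k))
      rw [indicator_of_mem]
      · refine ENNReal.ofReal_le_ofReal (exp_le_exp.2 ?_)
        have : y / (8 * σ) = y / (4 * σ) / 2 := by field_simp; ring
        rw [this]; linarith
      · show 4 * k * σ < y
        rw [lt_div_iff₀ (by positivity)] at k1
        linarith
  calc _ ≤ ∫⁻ x, (1 + ∑' k : ℕ, (B k).indicator (fun _ => ENNReal.ofReal (exp ((k + 1) / 2))) x) ∂ν :=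
        lintegral_mono pt
    _ = 1 + ∑' k : ℕ, ENNReal.ofReal (exp ((k + 1) / 2)) * ν (B k) := by
        rw [lintegral_add_left measurable_const, lintegral_tsum]
        · simp [lintegral_indicator_const (hBm _)]
        · intro k; exact (measurable_const.indicator (hBm k)).aemeasurable
    _ ≤ 1 + ∑' k : ℕ, ENNReal.ofReal (5 / 3 * (5 / 9) ^ k) := by
        gcongr with k
        refine (mul_le_mul' le_rfl (borell_tail ht hν e c hσ hi h2 k)).trans ?_
        rw [← ENNReal.ofReal_mul (exp_nonneg _)]
        refine ENNReal.ofReal_le_ofReal ?_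
        have : exp (((k:ℝ) + 1) / 2) = exp (1/2) ^ (k + 1) := by
          rw [← exp_nat_mul]; push_cast; ring_nf
        rw [this]
        calc exp (1/2) ^ (k + 1) * (1 / 3) ^ k ≤ (5/3) ^ (k+1) * (1/3) ^ k := by gcongr
          _ = 5 / 3 * (5 / 9) ^ k := by rw [pow_succ, mul_right_comm, ← mul_pow]; norm_num [mul_comm]
    _ = 1 + ENNReal.ofReal (∑' k : ℕ, 5 / 3 * (5 / 9 : ℝ) ^ k) := by
        rw [ENNReal.ofReal_tsum_of_nonneg (fun k => by positivity)]
        exact (summable_geometric_of_lt_one (by norm_num) (by norm_num)).mul_left _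
    _ ≤ _ := by
        rw [tsum_mul_left, tsum_geometric_of_lt_one (by norm_num) (by norm_num), ← ENNReal.ofReal_one,
          ← ENNReal.ofReal_add (by norm_num) (by norm_num)]
        exact ENNReal.ofReal_le_ofReal (by norm_num)

theorem borell_exp [IsProbabilityMeasure ν] (ht : 0 ≤ t) (hν : UniformlyLogConcave t ν)
    (e : Euc n) (c : ℝ) {σ : ℝ} (hσ : 0 < σ) (hi : Integrable (fun x => (⟪x, e⟫ - c) ^ 2) ν)
    (h2 : ∫ x, (⟪x, e⟫ - c) ^ 2 ∂ν ≤ σ ^ 2) :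
    Integrable (fun x => exp (|⟪x, e⟫ - c| / (8 * σ))) ν ∧
    ∫ x, exp (|⟪x, e⟫ - c| / (8 * σ)) ∂ν ≤ 6 := by
  have h := borell_exp_lint ht hν e c hσ hi h2
  have hm : Measurable fun x : Euc n => exp (|⟪x, e⟫ - c| / (8 * σ)) := by fun_prop
  have i : Integrable (fun x => exp (|⟪x, e⟫ - c| / (8 * σ))) ν := by
    refine ⟨hm.aestronglyMeasurable, ?_⟩
    rw [hasFiniteIntegral_iff_ofReal (Filter.Eventually.of_forall fun x => exp_nonneg _)]
    exact h.trans_lt ENNReal.ofReal_lt_top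
  refine ⟨i, ?_⟩
  rw [← ofReal_integral_eq_lintegral_ofReal i (Filter.Eventually.of_forall fun x => exp_nonneg _)] at h
  exact (ENNReal.ofReal_le_ofReal_iff (by norm_num)).1 h

theorem borell_four [IsProbabilityMeasure ν] (ht : 0 ≤ t) (hν : UniformlyLogConcave t ν)
    (e : Euc n) (c : ℝ) {σ : ℝ} (hσ : 0 < σ) (hi : Integrable (fun x => (⟪x, e⟫ - c) ^ 2) ν)
    (h2 : ∫ x, (⟪x, e⟫ - c) ^ 2 ∂ν ≤ σ ^ 2) :
    ∫ x, (⟪x, e⟫ - c) ^ 4 ∂ν ≤ 10 ^ 6 * σ ^ 4 := by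
  obtain ⟨i, h⟩ := borell_exp ht hν e c hσ hi h2
  have pt : ∀ x : Euc n, (⟪x, e⟫ - c) ^ 4 ≤ (24 * 4096 * σ ^ 4) * exp (|⟪x, e⟫ - c| / (8 * σ)) := by
    intro x
    have := pow_div_factorial_le_exp (|⟪x, e⟫ - c| / (8 * σ)) (by positivity) 4
    have e1 : (⟪x, e⟫ - c) ^ 4 = (24 * 4096 * σ ^ 4) * ((|⟪x, e⟫ - c| / (8 * σ)) ^ 4 / (Nat.factorial 4 : ℝ)) := by
      have : (Nat.factorial 4 : ℝ) = 24 := by norm_num [Nat.factorial]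
      rw [this, div_pow, mul_pow]
      have : |⟪x, e⟫ - c| ^ 4 = (⟪x, e⟫ - c) ^ 4 := by
        rw [show 4 = 2 * 2 from rfl, pow_mul, sq_abs, pow_mul]
      rw [this]; field_simp; ring
    rw [e1]
    exact mul_le_mul_of_nonneg_left this (by positivity)
  calc ∫ x, (⟪x, e⟫ - c) ^ 4 ∂ν ≤ ∫ x, (24 * 4096 * σ ^ 4) * exp (|⟪x, e⟫ - c| / (8 * σ)) ∂ν := by
        refine integral_mono_of_nonneg (Filter.Eventually.of_forall fun x => by positivity)
          (i.const_mul _) (Filter.Eventually.of_forall pt)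
    _ = (24 * 4096 * σ ^ 4) * ∫ x, exp (|⟪x, e⟫ - c| / (8 * σ)) ∂ν := integral_const_mul _ _
    _ ≤ (24 * 4096 * σ ^ 4) * 6 := mul_le_mul_of_nonneg_left h (by positivity)
    _ ≤ _ := by nlinarith [pow_pos hσ 4]

end

end KLS

end

section
open MeasureTheory Real Set
open scoped ENNReal RealInnerProductSpace

namespace KLS

noncomputable section

variable {n : ℕ}

/-- standard Gaussian constant -/
def gc (n : ℕ) : ℝ := (∫ x : Euc n, exp (-(1/2) * ‖x‖ ^ 2))⁻¹

/-- standard Gaussian measure -/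
def gam (n : ℕ) : Measure (Euc n) :=
  volume.withDensity fun x => ENNReal.ofReal (gc n * exp (-(1/2) * ‖x‖ ^ 2))

theorem gauss_int {b : ℝ} (hb : 0 < b) : Integrable (fun x : Euc n => exp (-b * ‖x‖ ^ 2)) := by
  by_contra h
  have := GaussianFourier.integral_rexp_neg_mul_sq_norm (V := Euc n) hb
  rw [integral_undef h] at this
  have h2 : 0 < (π / b) ^ (Module.finrank ℝ (Euc n) / 2 : ℝ) := by positivity
  linarith

theorem gint_pos : 0 < ∫ x : Euc n, exp (-(1/2) * ‖x‖ ^ 2) := by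
  rw [GaussianFourier.integral_rexp_neg_mul_sq_norm (by norm_num)]
  positivity

theorem gc_pos : 0 < gc n := inv_pos.mpr gint_pos

instance : IsProbabilityMeasure (gam n) := by
  constructor
  rw [gam, withDensity_apply _ MeasurableSet.univ, Measure.restrict_univ,
    ← ofReal_integral_eq_lintegral_ofReal, integral_const_mul, gc,
    inv_mul_cancel₀ gint_pos.ne', ENNReal.ofReal_one]
  · exact (gauss_int (by norm_num)).const_mul _
  · exact Filter.Eventually.of_forall fun x => mul_nonneg gc_pos.le (exp_pos _).le

theorem gam_ul : UniformlyLogConcave 1 (gam n) := by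
  refine ⟨fun _ => gc n, measurable_const, ⟨fun _ => gc_pos.le, ?_⟩, ?_⟩
  · intro x y a b ha hb hab
    rw [← rpow_add gc_pos, hab, rpow_one]
  · unfold gam
    congr 1
    funext x
    rw [mul_comm]
    congr 3
    ring

theorem gam_integral (F : Euc n → ℝ) :
    ∫ x, F x ∂(gam n) = ∫ x, (gc n * exp (-(1/2) * ‖x‖ ^ 2)) * F x := by
  rw [gam, integral_withDensity_eq_integral_toReal_smul (by fun_prop) (by simp)]
  refine integral_congr_ae (Filter.Eventually.of_forall fun x => ?_)
  simp only [smul_eq_mul]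
  rw [ENNReal.toReal_ofReal (mul_nonneg gc_pos.le (exp_pos _).le)]

theorem gam_integrable {F : Euc n → ℝ} :
    Integrable F (gam n) ↔ Integrable (fun x => (gc n * exp (-(1/2) * ‖x‖ ^ 2)) * F x) := by
  rw [gam, integrable_withDensity_iff_integrable_smul' (by fun_prop) (by simp)]
  refine integrable_congr (Filter.Eventually.of_forall fun x => ?_)
  simp only [smul_eq_mul]
  rw [ENNReal.toReal_ofReal (mul_nonneg gc_pos.le (exp_pos _).le)]

theorem gam_exp (c : ℝ) : Integrable (fun x : Euc n => exp (c * ‖x‖)) (gam n) := by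
  rw [gam_integrable]
  refine ((gauss_int (n := n) (b := 1/4) (by norm_num)).const_mul (gc n * exp (c ^ 2))).mono'
    (by fun_prop) (Filter.Eventually.of_forall fun x => ?_)
  rw [norm_of_nonneg (mul_nonneg (mul_nonneg gc_pos.le (exp_pos _).le) (exp_pos _).le), mul_assoc,
    mul_assoc, ← exp_add, ← exp_add]
  refine mul_le_mul_of_nonneg_left (exp_le_exp.mpr ?_) gc_pos.le
  nlinarith [sq_nonneg (c - ‖x‖ / 2)]

/-- exponential growth -/
theorem gam_int_of_growth {F : Euc n → ℝ} (hF : AEStronglyMeasurable F (gam n)) {K c : ℝ}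
    (h : ∀ x, |F x| ≤ K * exp (c * ‖x‖)) : Integrable F (gam n) :=
  ((gam_exp c).const_mul K).mono' hF (Filter.Eventually.of_forall h)

theorem le_exp_norm (x : Euc n) (i : Fin n) : |x i| ≤ exp ‖x‖ :=
  (PiLp.norm_apply_le x i).trans ((by linarith [add_one_le_exp ‖x‖]))

theorem stein {H : Euc n → ℝ} (hd : Differentiable ℝ H) (i : Fin n) (hc : Continuous (pd i H))
    {K c : ℝ} (h1 : ∀ x, |H x| ≤ K * exp (c * ‖x‖)) (h2 : ∀ x, |pd i H x| ≤ K * exp (c * ‖x‖)) :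
    ∫ x, pd i H x ∂(gam n) = ∫ x, x i * H x ∂(gam n) := by
  have hxi : Continuous fun x : Euc n => x i := by fun_prop
  have K0 : 0 ≤ K := nonneg_of_mul_nonneg_left ((abs_nonneg _).trans (h1 0)) (exp_pos _)
  have i1 : Integrable H (gam n) := gam_int_of_growth hd.continuous.aestronglyMeasurable h1
  have i2 : Integrable (pd i H) (gam n) := gam_int_of_growth hc.aestronglyMeasurable h2
  have i3 : Integrable (fun x => x i * H x) (gam n) := by
    refine gam_int_of_growth (K := K) (c := c + 1) (hxi.mul hd.continuous).aestronglyMeasurable fun x => ?_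
    rw [abs_mul, add_mul, one_mul, exp_add, mul_comm]
    calc |H x| * |x i| ≤ (K * exp (c * ‖x‖)) * exp ‖x‖ :=
          mul_le_mul (h1 x) (le_exp_norm x i) (abs_nonneg _) (mul_nonneg K0 (exp_pos _).le)
      _ = _ := by ring
  set w : Euc n → ℝ := fun x => gc n * exp (-(1/2) * ‖x‖ ^ 2) with hw
  have hwd : ∀ x, HasFDerivAt w ((- w x) • innerSL ℝ x) x := by
    intro x
    have := (((hasStrictFDerivAt_norm_sq x).hasFDerivAt.const_mul (-(1/2))).exp).const_mul (gc n)
    refine this.congr_fderiv ?_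
    rw [two_smul]
    simp only [hw]
    module
  have hwf : ∀ x, fderiv ℝ w x (ee i) = - w x * x i := by
    intro x
    rw [(hwd x).fderiv]
    simp [inner_ee]
  rw [gam_integrable] at i1 i2 i3
  rw [gam_integral, gam_integral]
  have := integral_mul_fderiv_eq_neg_fderiv_mul_of_integrable (μ := volume) (f := w) (g := H)
    (v := ee i) ?_ ?_ ?_ (fun x _ => (hwd x).differentiableAt) (fun x _ => hd x)
  · rw [show (∫ x, w x * pd i H x) = ∫ x, w x * (fderiv ℝ H x) (ee i) from rfl, this,
      ← integral_neg]
    refine integral_congr_ae (Filter.Eventually.of_forall fun x => ?_)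
    simp only [hwf]
    ring
  · refine (i3.neg).congr (Filter.Eventually.of_forall fun x => ?_)
    simp only [hwf, Pi.neg_apply]
    ring
  · exact i2
  · exact i1

theorem cam_mar (F : Euc n → ℝ) (v : Euc n) :
    ∫ z, F (v + z) ∂(gam n) = ∫ z, F z * exp (⟪v, z⟫ - ‖v‖ ^ 2 / 2) ∂(gam n) := by
  rw [gam_integral, gam_integral,
    ← integral_add_left_eq_self (fun x => gc n * exp (-(1/2) * ‖x‖ ^ 2) * (F x * exp (⟪v, x⟫ - ‖v‖ ^ 2 / 2))) v]
  refine integral_congr_ae (Filter.Eventually.of_forall fun x => ?_)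
  simp only
  rw [show gc n * exp (-(1/2) * ‖v + x‖ ^ 2) * (F (v + x) * exp (⟪v, v + x⟫ - ‖v‖ ^ 2 / 2)) =
    gc n * (exp (-(1/2) * ‖v + x‖ ^ 2) * exp (⟪v, v + x⟫ - ‖v‖ ^ 2 / 2)) * F (v + x) by ring, ← exp_add]
  congr 3
  rw [norm_add_sq_real, inner_add_right, real_inner_self_eq_norm_sq]
  ring

end

end KLS

end

section
open MeasureTheory Real Set
open scoped ENNReal RealInnerProductSpace

namespace KLS

noncomputable section

variable {n : ℕ} {t : ℝ} {ν : Measure (Euc n)}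

/-- the class of compactly supported `t`-uniformly log-concave probability measures -/
structure CC (t : ℝ) (ν : Measure (Euc n)) : Prop where
  prob : IsProbabilityMeasure ν
  ul : UniformlyLogConcave t ν
  bs : BS ν

/-- exponent as a linear map in `(T,θ)` -/
def lx (x : Euc n) : ℝ × Euc n →L[ℝ] ℝ :=
  (innerSL ℝ x).comp (ContinuousLinearMap.snd ℝ ℝ (Euc n)) -
    (‖x‖ ^ 2 / 2) • ContinuousLinearMap.fst ℝ ℝ (Euc n)

theorem lx_apply (x : Euc n) (p : ℝ × Euc n) : lx x p = ⟪x, p.2⟫ - ‖x‖ ^ 2 / 2 * p.1 := by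
  simp [lx]

theorem lx_cont : Continuous (lx : Euc n → _) := by
  unfold lx
  refine Continuous.sub ?_ ?_
  · exact (innerSL ℝ).continuous.clm_comp continuous_const
  · exact (by fun_prop : Continuous fun x : Euc n => ‖x‖ ^ 2 / 2).smul continuous_const

theorem lx_cont2 : Continuous (fun q : (ℝ × Euc n) × Euc n => lx q.2 q.1) :=
  (lx_cont.comp continuous_snd).clm_apply continuous_fst

/-- tilted measure -/
def nuT (ν : Measure (Euc n)) (T : ℝ) (θ : Euc n) : Measure (Euc n) :=
  ν.tilted fun x => lx x (T, θ)

/-- tilted mean -/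
def mm (ν : Measure (Euc n)) (F : Euc n → ℝ) (T : ℝ) (θ : Euc n) : ℝ := ∫ x, F x ∂(nuT ν T θ)

/-- unnormalised tilted mean -/
def JJ (ν : Measure (Euc n)) (F : Euc n → ℝ) (p : ℝ × Euc n) : ℝ := ∫ x, F x * exp (lx x p) ∂ν

theorem expl_cont (p : ℝ × Euc n) : Continuous fun x : Euc n => exp (lx x p) :=
  continuous_exp.comp (lx_cont.clm_apply continuous_const)

theorem JJ_one_pos (h : CC t ν) (p : ℝ × Euc n) : 0 < JJ ν (fun _ => 1) p := by
  have := h.prob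
  simp only [JJ, one_mul]
  exact integral_exp_pos (h.bs.integrable (expl_cont p))

theorem mm_eq (F : Euc n → ℝ) (T : ℝ) (θ : Euc n) :
    mm ν F T θ = JJ ν F (T, θ) / JJ ν (fun _ => 1) (T, θ) := by
  simp only [mm, nuT, JJ, one_mul]
  rw [integral_tilted, ← integral_div]
  refine integral_congr_ae (Filter.Eventually.of_forall fun x => ?_)
  simp only [smul_eq_mul]
  ring

theorem nuT_ac (T : ℝ) (θ : Euc n) : nuT ν T θ ≪ ν := tilted_absolutelyContinuous _ _

theorem CC.nuT (h : CC t ν) (T : ℝ) (θ : Euc n) : CC (t + T) (nuT ν T θ) := by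
  have := h.prob
  have hi : Integrable (fun x => exp (lx x (T, θ))) ν := h.bs.integrable (expl_cont _)
  refine ⟨isProbabilityMeasure_tilted hi, ?_, ?_⟩
  · obtain ⟨g, hg, ⟨hg0, hgl⟩, hν⟩ := h.ul
    set Z := ∫ x, exp (lx x (T, θ)) ∂ν with hZ
    have hZ0 : 0 < Z := integral_exp_pos hi
    refine ⟨fun x => g x * exp ⟪x, θ⟫ / Z, ?_, ⟨?_, ?_⟩, ?_⟩
    · have : Measurable fun x : Euc n => exp ⟪x, θ⟫ := by fun_prop
      exact (hg.mul this).div_const _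
    · intro x
      exact div_nonneg (mul_nonneg (hg0 x) (exp_pos _).le) hZ0.le
    · intro x y a b ha hb hab
      rw [div_rpow (mul_nonneg (hg0 x) (exp_pos _).le) hZ0.le,
        div_rpow (mul_nonneg (hg0 y) (exp_pos _).le) hZ0.le,
        mul_rpow (hg0 x) (exp_pos _).le, mul_rpow (hg0 y) (exp_pos _).le, ← exp_mul, ← exp_mul,
        div_mul_div_comm, ← rpow_add hZ0, hab, rpow_one]
      refine div_le_div_of_nonneg_right ?_ hZ0.le
      rw [show g x ^ a * exp (⟪x, θ⟫ * a) * (g y ^ b * exp (⟪y, θ⟫ * b)) =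
        (g x ^ a * g y ^ b) * (exp (⟪x, θ⟫ * a) * exp (⟪y, θ⟫ * b)) by ring, ← exp_add]
      refine mul_le_mul (hgl x y a b ha hb hab) (le_of_eq ?_) (exp_pos _).le (hg0 _)
      rw [inner_add_left, inner_smul_left, inner_smul_left]
      simp
      ring
    · unfold KLS.nuT Measure.tilted
      rw [← hZ]
      nth_rw 1 [hν]
      have m1 : Measurable fun x : Euc n => ENNReal.ofReal (exp (-t * ‖x‖ ^ 2 / 2) * g x) := by
        have : Measurable fun x : Euc n => exp (-t * ‖x‖ ^ 2 / 2) := by fun_prop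
        exact (this.mul hg).ennreal_ofReal
      have m2 : Measurable fun x : Euc n => ENNReal.ofReal (exp (lx x (T, θ)) / Z) :=
        (((expl_cont (T, θ)).measurable).div_const _).ennreal_ofReal
      rw [← withDensity_mul _ m1 m2]
      congr 1
      funext x
      simp only [Pi.mul_apply]
      rw [← ENNReal.ofReal_mul (mul_nonneg (exp_pos _).le (hg0 x)), lx_apply]
      congr 1
      rw [show exp (-t * ‖x‖ ^ 2 / 2) * g x * (exp (⟪x, θ⟫ - ‖x‖ ^ 2 / 2 * T) / Z) =
        (exp (-t * ‖x‖ ^ 2 / 2) * exp (⟪x, θ⟫ - ‖x‖ ^ 2 / 2 * T)) * g x / Z by ring,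
        show exp (-(t + T) * ‖x‖ ^ 2 / 2) * (g x * exp ⟪x, θ⟫ / Z) =
        (exp (-(t + T) * ‖x‖ ^ 2 / 2) * exp ⟪x, θ⟫) * g x / Z by ring, ← exp_add, ← exp_add]
      congr 3
      ring
  · obtain ⟨R, hR⟩ := h.bs
    exact ⟨R, (nuT_ac T θ).ae_le hR⟩

theorem JJ_fd (h : CC t ν) {F : Euc n → ℝ} (hF : Continuous F) (p : ℝ × Euc n) :
    ∃ D : ℝ × Euc n →L[ℝ] ℝ, HasFDerivAt (JJ ν F) D p ∧
      ∀ v, D v = JJ ν (fun x => F x * lx x v) p := by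
  have := h.prob
  have c1 : ∀ p, Continuous fun x : Euc n => F x * exp (lx x p) := fun p => hF.mul (expl_cont p)
  have c2 : ∀ p, Continuous fun x : Euc n => (F x * exp (lx x p)) • lx x := fun p =>
    (c1 p).smul lx_cont
  obtain ⟨R, hR0, hR⟩ := h.bs.pos
  obtain ⟨K1, hK1, hK1'⟩ := h.bs.bdd hF
  obtain ⟨K2, hK2, hK2'⟩ := h.bs.bdd lx_cont
  have := hasFDerivAt_integral_of_dominated_of_fderiv_le (μ := ν) (𝕜 := ℝ)
    (F := fun p x => F x * exp (lx x p)) (F' := fun p x => (F x * exp (lx x p)) • lx x)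
    (x₀ := p) (s := Metric.ball p 1) (bound := fun _ => K1 * exp (K2 * (‖p‖ + 1)) * K2)
    (Metric.ball_mem_nhds _ one_pos)
    (Filter.Eventually.of_forall fun p => (c1 p).aestronglyMeasurable)
    (h.bs.integrable (c1 p)) (c2 p).aestronglyMeasurable ?_ (integrable_const _) ?_
  · refine ⟨_, this, fun v => ?_⟩
    rw [ContinuousLinearMap.integral_apply (h.bs.integrable (c2 p))]
    unfold JJ
    refine integral_congr_ae (Filter.Eventually.of_forall fun x => ?_)
    simp
    ring
  · filter_upwards [hK1', hK2'] with x h1 h2 q hq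
    rw [norm_smul, norm_mul]
    refine mul_le_mul (mul_le_mul h1 ?_ (norm_nonneg _) hK1) h2 (norm_nonneg _) (by positivity)
    rw [norm_of_nonneg (exp_pos _).le]
    refine exp_le_exp.mpr ((le_abs_self _).trans (((lx x).le_opNorm q).trans ?_))
    refine mul_le_mul h2 ?_ (norm_nonneg _) hK2
    rw [Metric.mem_ball, dist_eq_norm] at hq
    linarith [norm_le_norm_add_norm_sub' q p]
  · refine Filter.Eventually.of_forall fun x q _ => ?_
    have := ((lx x).hasFDerivAt (x := q)).exp.const_mul (F x)
    rw [smul_smul] at this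
    exact this

theorem mm_fd (h : CC t ν) {F : Euc n → ℝ} (hF : Continuous F) (p : ℝ × Euc n) :
    ∃ D : ℝ × Euc n →L[ℝ] ℝ, HasFDerivAt (fun p : ℝ × Euc n => mm ν F p.1 p.2) D p ∧
      ∀ v, D v = mm ν (fun x => F x * lx x v) p.1 p.2 - mm ν F p.1 p.2 * mm ν (fun x => lx x v) p.1 p.2 := by
  obtain ⟨D1, h1, h1'⟩ := JJ_fd h hF p
  obtain ⟨D2, h2, h2'⟩ := JJ_fd h (F := fun _ => 1) continuous_const p
  have e : (fun p : ℝ × Euc n => mm ν F p.1 p.2) = fun p => JJ ν F p / JJ ν (fun _ => 1) p := by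
    funext p; exact mm_eq F p.1 p.2
  rw [e]
  have hne := (JJ_one_pos h p).ne'
  have h3 : HasFDerivAt (fun p => JJ ν F p / JJ ν (fun _ => 1) p)
      (JJ ν F p • (-(JJ ν (fun _ => 1) p ^ 2)⁻¹ • D2) + (JJ ν (fun _ => 1) p)⁻¹ • D1) p := by
    simp only [div_eq_mul_inv]
    exact h1.mul ((hasDerivAt_inv hne).comp_hasFDerivAt p h2)
  refine ⟨_, h3, fun v => ?_⟩
  simp only [mm_eq, Prod.mk.eta]
  simp only [smul_apply, add_apply, smul_eq_mul, h1', h2', one_mul]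
  field_simp
  ring

theorem mm_const (h : CC t ν) (c : ℝ) (T : ℝ) (θ : Euc n) : mm ν (fun _ => c) T θ = c := by
  have := (h.nuT T θ).prob
  simp [mm]

theorem mm_int (h : CC t ν) {F : Euc n → ℝ} (hF : Continuous F) (T : ℝ) (θ : Euc n) :
    Integrable F (nuT ν T θ) := by
  have := (h.nuT T θ).prob
  exact (h.nuT T θ).bs.integrable hF

theorem mm_add (h : CC t ν) {F G : Euc n → ℝ} (hF : Continuous F) (hG : Continuous G) (T : ℝ)
    (θ : Euc n) : mm ν (fun x => F x + G x) T θ = mm ν F T θ + mm ν G T θ :=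
  integral_add (mm_int h hF T θ) (mm_int h hG T θ)

theorem mm_sub (h : CC t ν) {F G : Euc n → ℝ} (hF : Continuous F) (hG : Continuous G) (T : ℝ)
    (θ : Euc n) : mm ν (fun x => F x - G x) T θ = mm ν F T θ - mm ν G T θ :=
  integral_sub (mm_int h hF T θ) (mm_int h hG T θ)

theorem mm_smul (c : ℝ) (F : Euc n → ℝ) (T : ℝ) (θ : Euc n) :
    mm ν (fun x => c * F x) T θ = c * mm ν F T θ := integral_const_mul _ _

theorem mm_sum (h : CC t ν) {ι : Type*} (s : Finset ι) {F : ι → Euc n → ℝ}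
    (hF : ∀ i, Continuous (F i)) (T : ℝ) (θ : Euc n) :
    mm ν (fun x => ∑ i ∈ s, F i x) T θ = ∑ i ∈ s, mm ν (F i) T θ :=
  integral_finsetSum _ fun i _ => mm_int h (hF i) T θ

theorem mm_bdd (h : CC t ν) {F : Euc n → ℝ} (hF : Continuous F) :
    ∃ K, 0 ≤ K ∧ ∀ T θ, |mm ν F T θ| ≤ K := by
  obtain ⟨K, hK, hK'⟩ := h.bs.bdd hF
  refine ⟨K, hK, fun T θ => ?_⟩
  have := (h.nuT T θ).prob
  have := norm_integral_le_of_norm_le_const ((nuT_ac (ν := ν) T θ).ae_le hK')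
  simpa [mm] using this

theorem mm_diff (h : CC t ν) {F : Euc n → ℝ} (hF : Continuous F) :
    Differentiable ℝ (fun p : ℝ × Euc n => mm ν F p.1 p.2) := fun p => by
  obtain ⟨D, hD, _⟩ := mm_fd h hF p
  exact hD.differentiableAt

theorem mm_pd (h : CC t ν) {F : Euc n → ℝ} (hF : Continuous F) (i : Fin n) (T : ℝ) (θ : Euc n) :
    pd i (mm ν F T) θ = mm ν (fun x => x i * F x) T θ - mm ν F T θ * mm ν (fun x => x i) T θ := by
  obtain ⟨D, hD, hD'⟩ := mm_fd h hF (T, θ)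
  have h1 : HasFDerivAt (mm ν F T) (D.comp (ContinuousLinearMap.inr ℝ ℝ (Euc n))) θ :=
    hD.comp θ (hasFDerivAt_prodMk_right T θ)
  rw [pd, h1.fderiv]
  simp only [ContinuousLinearMap.comp_apply, ContinuousLinearMap.inr_apply, hD', lx_apply, inner_ee,
    mul_zero, sub_zero]
  simp only [mul_comm]

theorem mm_dT (h : CC t ν) {F : Euc n → ℝ} (hF : Continuous F) (T : ℝ) (θ : Euc n) :
    HasDerivAt (fun s => mm ν F s θ) (-(1/2) * (mm ν (fun x => ‖x‖ ^ 2 * F x) T θ -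
      mm ν F T θ * mm ν (fun x => ‖x‖ ^ 2) T θ)) T := by
  obtain ⟨D, hD, hD'⟩ := mm_fd h hF (T, θ)
  have h1 : HasFDerivAt (fun s => mm ν F s θ) (D.comp (ContinuousLinearMap.inl ℝ ℝ (Euc n))) T :=
    HasFDerivAt.comp (f := fun s : ℝ => (s, θ)) T hD (hasFDerivAt_prodMk_left T θ)
  have h2 := h1.hasDerivAt
  refine h2.congr_deriv ?_
  simp only [ContinuousLinearMap.comp_apply, ContinuousLinearMap.inl_apply, hD', lx_apply,
    inner_zero_right, zero_sub, mul_one]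
  have e1 : mm ν (fun x => F x * -(‖x‖ ^ 2 / 2)) T θ = -(1/2) * mm ν (fun x => ‖x‖ ^ 2 * F x) T θ := by
    rw [← mm_smul]; congr 1; funext x; ring
  have e2 : mm ν (fun x => -(‖x‖ ^ 2 / 2)) T θ = -(1/2) * mm ν (fun x => ‖x‖ ^ 2) T θ := by
    rw [← mm_smul]; congr 1; funext x; ring
  rw [e1, e2]
  ring

theorem mm_SB (h : CC t ν) {F : Euc n → ℝ} (hF : Continuous F) (T : ℝ) : SB (mm ν F T) := by
  intro k
  have hd : ∀ {F : Euc n → ℝ}, Continuous F → Differentiable ℝ (mm ν F T) := fun hF θ =>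
    ((mm_diff h hF) (T, θ)).comp θ (hasFDerivAt_prodMk_right T θ).differentiableAt
  have z : ∀ {F : Euc n → ℝ}, Continuous F → Cb 0 (mm ν F T) := by
    intro F hF
    obtain ⟨K, _, hK⟩ := mm_bdd h hF
    exact ⟨(hd hF).continuous, K, hK T⟩
  induction k generalizing F with
  | zero => exact z hF
  | succ k ih =>
    refine ⟨z hF, hd hF, fun i => ?_⟩
    have e : pd i (mm ν F T) = fun θ => mm ν (fun x => x i * F x) T θ -
      mm ν F T θ * mm ν (fun x => x i) T θ := by
      funext θ; exact mm_pd h hF i T θ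
    rw [e]
    exact (ih (by fun_prop)).sub ((ih hF).mul (ih (by fun_prop)))

/-- time derivative -/
def dT (F : ℝ → Euc n → ℝ) (T : ℝ) (θ : Euc n) : ℝ := deriv (fun s => F s θ) T

structure Nice (F : ℝ → Euc n → ℝ) : Prop where
  diff : Differentiable ℝ (fun p : ℝ × Euc n => F p.1 p.2)
  sb : ∀ T, SB (F T)
  dc : ∀ T, Continuous (dT F T)
  bd : ∃ K, 0 ≤ K ∧ ∀ T θ, |F T θ| ≤ K ∧ |dT F T θ| ≤ K ∧ ∀ i, |pd i (F T) θ| ≤ K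

/-- generator -/
def LL (ν : Measure (Euc n)) (F : ℝ → Euc n → ℝ) (T : ℝ) (θ : Euc n) : ℝ :=
  dT F T θ + 1 / 2 * ∑ i, pd i (pd i (F T)) θ + ∑ i, mm ν (fun x => x i) T θ * pd i (F T) θ

theorem mm_nice (h : CC t ν) {F : Euc n → ℝ} (hF : Continuous F) : Nice (mm ν F) := by
  have c1 : Continuous fun x : Euc n => ‖x‖ ^ 2 := by fun_prop
  have e : ∀ T, dT (mm ν F) T = fun θ => -(1/2) * (mm ν (fun x => ‖x‖ ^ 2 * F x) T θ -
      mm ν F T θ * mm ν (fun x => ‖x‖ ^ 2) T θ) := by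
    intro T; funext θ; exact (mm_dT h hF T θ).deriv
  refine ⟨mm_diff h hF, mm_SB h hF, fun T => ?_, ?_⟩
  · rw [e]
    exact (Cb.const_mul _ ((mm_SB h (c1.mul hF) T 0).sub ((mm_SB h hF T 0).mul (mm_SB h c1 T 0)))).continuous
  · obtain ⟨K1, h1, h1'⟩ := mm_bdd h hF
    obtain ⟨K2, h2, h2'⟩ := mm_bdd h (c1.mul hF)
    obtain ⟨K3, h3, h3'⟩ := mm_bdd h c1
    choose K4 h4 h4' using fun i : Fin n => mm_bdd h (F := fun x => x i * F x) (by fun_prop)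
    choose K5 h5 h5' using fun i : Fin n => mm_bdd h (F := fun x => x i) (by fun_prop)
    refine ⟨K1 + (K2 + K1 * K3) + ∑ i, (K4 i + K1 * K5 i), ?_, fun T θ => ?_⟩
    · have : 0 ≤ ∑ i, (K4 i + K1 * K5 i) := Finset.sum_nonneg fun i _ =>
        add_nonneg (h4 i) (mul_nonneg h1 (h5 i))
      positivity
    have s0 : 0 ≤ ∑ i, (K4 i + K1 * K5 i) := Finset.sum_nonneg fun i _ =>
        add_nonneg (h4 i) (mul_nonneg h1 (h5 i))
    have p0 : 0 ≤ K1 * K3 := mul_nonneg h1 h3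
    refine ⟨by linarith [h1' T θ], ?_, fun i => ?_⟩
    · rw [e]
      simp only
      rw [abs_mul]
      have : |mm ν (fun x => ‖x‖ ^ 2 * F x) T θ - mm ν F T θ * mm ν (fun x => ‖x‖ ^ 2) T θ| ≤ K2 + K1 * K3 := by
        refine (abs_sub _ _).trans (add_le_add (h2' T θ) ?_)
        rw [abs_mul]
        exact mul_le_mul (h1' T θ) (h3' T θ) (abs_nonneg _) h1
      norm_num
      linarith
    · rw [mm_pd h hF]
      have : |mm ν (fun x => x i * F x) T θ - mm ν F T θ * mm ν (fun x => x i) T θ| ≤ K4 i + K1 * K5 i := by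
        refine (abs_sub _ _).trans (add_le_add (h4' i T θ) ?_)
        rw [abs_mul]
        exact mul_le_mul (h1' T θ) (h5' i T θ) (abs_nonneg _) h1
      have := this.trans (Finset.single_le_sum (f := fun i => K4 i + K1 * K5 i)
        (fun i _ => add_nonneg (h4 i) (mul_nonneg h1 (h5 i))) (Finset.mem_univ i))
      linarith

theorem mm_LL (h : CC t ν) {F : Euc n → ℝ} (hF : Continuous F) (T : ℝ) (θ : Euc n) :
    LL ν (mm ν F) T θ = 0 := by
  have hci : ∀ i : Fin n, Continuous fun x : Euc n => x i := fun i => by fun_prop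
  have hd : ∀ {F : Euc n → ℝ}, Continuous F → Differentiable ℝ (mm ν F T) := fun hF =>
    (mm_SB h hF T 1).diff
  have e2 : ∀ i, pd i (pd i (mm ν F T)) θ = mm ν (fun x => x i ^ 2 * F x) T θ
      - mm ν F T θ * mm ν (fun x => x i ^ 2) T θ
      - 2 * (mm ν (fun x => x i) T θ * (mm ν (fun x => x i * F x) T θ - mm ν F T θ * mm ν (fun x => x i) T θ)) := by
    intro i
    have : pd i (mm ν F T) = fun θ => mm ν (fun x => x i * F x) T θ +
      (-1) * (mm ν F T θ * mm ν (fun x => x i) T θ) := by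
      funext θ; rw [mm_pd h hF i T θ]; ring
    have hm : Differentiable ℝ (fun θ => mm ν F T θ * mm ν (fun x => x i) T θ) :=
      (hd hF).mul (hd (hci i))
    rw [this, pd_add (hd (F := fun x => x i * F x) (by fun_prop)) (hm.const_mul (-1)),
      pd_const_mul hm, pd_mul (hd hF) (hd (hci i))]
    simp only
    rw [mm_pd h (by fun_prop), mm_pd h hF, mm_pd h (hci i)]
    simp only [← mul_assoc, ← pow_two]
    ring
  unfold LL
  simp only [e2, mm_pd h hF]
  have s1 : ∀ G : Euc n → ℝ, Continuous G → mm ν (fun x => ‖x‖ ^ 2 * G x) T θ = ∑ i, mm ν (fun x => x i ^ 2 * G x) T θ := by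
    intro G hG
    rw [← mm_sum h _ (fun i => by fun_prop)]
    congr 1; funext x; rw [norm_sq_sum, Finset.sum_mul]
  have s2 : mm ν (fun x => ‖x‖ ^ 2) T θ = ∑ i, mm ν (fun x => x i ^ 2) T θ := by
    simpa using s1 (fun _ => 1) continuous_const
  rw [dT, (mm_dT h hF T θ).deriv, s1 F hF, s2]
  rw [Finset.sum_sub_distrib, Finset.sum_sub_distrib, ← Finset.mul_sum, ← Finset.mul_sum]
  ring

end

end KLS

end

section
open MeasureTheory Real Set
open scoped ENNReal RealInnerProductSpace

namespace KLS

noncomputable section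

variable {n : ℕ} {t : ℝ} {ν : Measure (Euc n)}

/-- continuous of at most exponential growth -/
def Gr (G : Euc n → ℝ) : Prop := Continuous G ∧ ∃ K c, 0 ≤ K ∧ 0 ≤ c ∧ ∀ x, |G x| ≤ K * exp (c * ‖x‖)

theorem Cb.gr {k : ℕ} {f : Euc n → ℝ} (h : Cb k f) : Gr f := by
  obtain ⟨K, h0, hK⟩ := h.bdd
  exact ⟨h.continuous, K, 0, h0, le_rfl, fun x => by simpa using hK x⟩

theorem Gr.coord (i : Fin n) : Gr (fun x : Euc n => x i) :=
  ⟨by fun_prop, 1, 1, zero_le_one, zero_le_one, fun x => by simpa using le_exp_norm x i⟩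

theorem Gr.mul {f g : Euc n → ℝ} (hf : Gr f) (hg : Gr g) : Gr (fun x => f x * g x) := by
  obtain ⟨c1, K, a, hK, ha, h⟩ := hf
  obtain ⟨c2, L, b, hL, hb, h'⟩ := hg
  refine ⟨c1.mul c2, K * L, a + b, mul_nonneg hK hL, add_nonneg ha hb, fun x => ?_⟩
  rw [abs_mul, add_mul, exp_add]
  calc |f x| * |g x| ≤ (K * exp (a * ‖x‖)) * (L * exp (b * ‖x‖)) :=
        mul_le_mul (h x) (h' x) (abs_nonneg _) (mul_nonneg hK (exp_pos _).le)
    _ = _ := by ring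

theorem Gr.add {f g : Euc n → ℝ} (hf : Gr f) (hg : Gr g) : Gr (fun x => f x + g x) := by
  obtain ⟨c1, K, a, hK, ha, h⟩ := hf
  obtain ⟨c2, L, b, hL, hb, h'⟩ := hg
  refine ⟨c1.add c2, K + L, a + b, add_nonneg hK hL, add_nonneg ha hb, fun x => ?_⟩
  refine (abs_add_le _ _).trans ?_
  rw [add_mul]
  refine add_le_add ((h x).trans ?_) ((h' x).trans ?_)
  · exact mul_le_mul_of_nonneg_left (exp_le_exp.mpr (by nlinarith [norm_nonneg x, mul_nonneg hb (norm_nonneg x)])) hK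
  · exact mul_le_mul_of_nonneg_left (exp_le_exp.mpr (by nlinarith [norm_nonneg x, mul_nonneg ha (norm_nonneg x)])) hL

theorem Gr.const (c : ℝ) : Gr (fun _ : Euc n => c) := (Cb.const c 0).gr

theorem Gr.sub {f g : Euc n → ℝ} (hf : Gr f) (hg : Gr g) : Gr (fun x => f x - g x) := by
  have := hf.add ((Gr.const (-1)).mul hg)
  refine (congrArg Gr ?_).mp this
  funext x; ring

theorem Gr.sum {ι : Type*} (s : Finset ι) {f : ι → Euc n → ℝ} (h : ∀ i ∈ s, Gr (f i)) :
    Gr (fun x => ∑ i ∈ s, f i x) := by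
  classical
  induction s using Finset.induction_on with
  | empty => simpa using Gr.const 0
  | insert a s ha ih =>
    simp only [Finset.sum_insert ha]
    exact (h a (Finset.mem_insert_self _ _)).add (ih fun i hi => h i (Finset.mem_insert_of_mem hi))

/-- the position `T x + √T z` -/
def th (T : ℝ) (p : Euc n × Euc n) : Euc n := T • p.1 + √T • p.2

theorem th_cont (T : ℝ) : Continuous (th T : Euc n × Euc n → Euc n) := by unfold th; fun_prop

def EE (ν : Measure (Euc n)) (T : ℝ) (G : Euc n → ℝ) : ℝ := ∫ p, G (th T p) ∂(ν.prod (gam n))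

theorem prod_int (h : CC t ν) {Φ : Euc n × Euc n → ℝ} (hc : Continuous Φ)
    (hb : ∀ R, 0 < R → ∃ K c, ∀ p : Euc n × Euc n, ‖p.1‖ ≤ R → |Φ p| ≤ K * exp (c * ‖p.2‖)) :
    Integrable Φ (ν.prod (gam n)) := by
  have := h.prob
  obtain ⟨R, hR0, hR⟩ := h.bs.pos
  obtain ⟨K, c, hK⟩ := hb R hR0
  refine (((gam_exp c).const_mul K).comp_snd ν).mono' hc.aestronglyMeasurable ?_
  have : ∀ᵐ p ∂(ν.prod (gam n)), ‖p.1‖ ≤ R :=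
    Measure.quasiMeasurePreserving_fst.ae hR
  filter_upwards [this] with p hp using hK p hp

theorem th_norm {T R : ℝ} (hT : 0 ≤ T) {p : Euc n × Euc n} (hp : ‖p.1‖ ≤ R) :
    ‖th T p‖ ≤ T * R + √T * ‖p.2‖ := by
  refine (norm_add_le _ _).trans ?_
  rw [norm_smul, norm_smul, norm_of_nonneg hT, norm_of_nonneg (sqrt_nonneg T)]
  gcongr

theorem Gr.th {G : Euc n → ℝ} (hG : Gr G) {T : ℝ} (hT : 0 ≤ T) (R : ℝ) :
    ∃ K c, 0 ≤ K ∧ 0 ≤ c ∧ ∀ p : Euc n × Euc n, ‖p.1‖ ≤ R → |G (th T p)| ≤ K * exp (c * ‖p.2‖) := by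
  obtain ⟨_, K, c, hK, hc, h⟩ := hG
  refine ⟨K * exp (c * (T * R)), c * √T, by positivity, by positivity, fun p hp => (h _).trans ?_⟩
  rw [mul_assoc, ← exp_add]
  refine mul_le_mul_of_nonneg_left (exp_le_exp.mpr ?_) hK
  have := mul_le_mul_of_nonneg_left (th_norm hT hp) hc
  linarith

theorem Gr.int (h : CC t ν) {G : Euc n → ℝ} (hG : Gr G) {T : ℝ} (hT : 0 ≤ T) :
    Integrable (fun p => G (KLS.th T p)) (ν.prod (gam n)) :=
  prod_int h (hG.1.comp (th_cont T)) fun R _ => by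
    obtain ⟨K, c, _, _, h⟩ := hG.th hT R
    exact ⟨K, c, h⟩

/-- with a factor depending on `x` -/
theorem Gr.int1 (h : CC t ν) {G : Euc n → ℝ} (hG : Gr G) {T : ℝ} (hT : 0 ≤ T) {f : Euc n → ℝ}
    (hf : Continuous f) : Integrable (fun p => f p.1 * G (KLS.th T p)) (ν.prod (gam n)) :=
  prod_int h ((hf.comp continuous_fst).mul (hG.1.comp (th_cont T))) fun R _ => by
    obtain ⟨K, c, hK, _, h⟩ := hG.th hT R
    obtain ⟨L, hL⟩ := (isCompact_closedBall (0 : Euc n) R).exists_bound_of_continuousOn hf.continuousOn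
    refine ⟨L * K, c, fun p hp => ?_⟩
    have := hL p.1 (by simpa using hp)
    rw [abs_mul, mul_assoc]
    exact mul_le_mul this (h p hp) (abs_nonneg _) ((norm_nonneg _).trans this)

/-- with a factor depending on `z` -/
theorem Gr.int2 (h : CC t ν) {G : Euc n → ℝ} (hG : Gr G) {T : ℝ} (hT : 0 ≤ T) {f : Euc n → ℝ}
    (hf : Gr f) : Integrable (fun p => f p.2 * G (KLS.th T p)) (ν.prod (gam n)) :=
  prod_int h ((hf.1.comp continuous_snd).mul (hG.1.comp (th_cont T))) fun R _ => by
    obtain ⟨K, c, hK, _, h⟩ := hG.th hT R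
    obtain ⟨_, L, d, hL, hd, h'⟩ := hf
    refine ⟨L * K, d + c, fun p hp => ?_⟩
    rw [abs_mul, add_mul, exp_add]
    calc |f p.2| * |G (KLS.th T p)| ≤ (L * exp (d * ‖p.2‖)) * (K * exp (c * ‖p.2‖)) :=
          mul_le_mul (h' p.2) (h p hp) (abs_nonneg _) (by positivity)
      _ = _ := by ring

theorem EE_add (h : CC t ν) {T : ℝ} (hT : 0 ≤ T) {f g : Euc n → ℝ} (hf : Gr f) (hg : Gr g) :
    EE ν T (fun x => f x + g x) = EE ν T f + EE ν T g := integral_add (hf.int h hT) (hg.int h hT)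

theorem EE_sub (h : CC t ν) {T : ℝ} (hT : 0 ≤ T) {f g : Euc n → ℝ} (hf : Gr f) (hg : Gr g) :
    EE ν T (fun x => f x - g x) = EE ν T f - EE ν T g := integral_sub (hf.int h hT) (hg.int h hT)

theorem EE_smul {T : ℝ} (c : ℝ) (f : Euc n → ℝ) :
    EE ν T (fun x => c * f x) = c * EE ν T f := integral_const_mul _ _

theorem EE_sum (h : CC t ν) {T : ℝ} (hT : 0 ≤ T) {ι : Type*} (s : Finset ι) {f : ι → Euc n → ℝ}
    (hf : ∀ i, Gr (f i)) : EE ν T (fun x => ∑ i ∈ s, f i x) = ∑ i ∈ s, EE ν T (f i) :=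
  integral_finsetSum _ fun i _ => (hf i).int h hT

theorem EE_mono (h : CC t ν) {T : ℝ} (hT : 0 ≤ T) {f g : Euc n → ℝ} (hf : Gr f) (hg : Gr g)
    (hfg : ∀ x, f x ≤ g x) : EE ν T f ≤ EE ν T g :=
  integral_mono (hf.int h hT) (hg.int h hT) fun p => hfg _

theorem EE_nonneg {T : ℝ} {f : Euc n → ℝ} (hf : ∀ x, 0 ≤ f x) : 0 ≤ EE ν T f :=
  integral_nonneg fun p => hf _

theorem bayes0 (h : CC t ν) {T : ℝ} (hT : 0 ≤ T) {f G : Euc n → ℝ} (hf : Continuous f) (hG : Gr G) :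
    ∫ p, f p.1 * G (th T p) ∂(ν.prod (gam n)) = ∫ z, G (√T • z) * JJ ν f (T, √T • z) ∂(gam n) := by
  have := h.prob
  rw [integral_prod _ (hG.int1 h hT hf)]
  have e1 : ∀ x : Euc n, ∫ z, f x * G (th T (x, z)) ∂(gam n) =
      ∫ z, f x * (G (√T • z) * exp (lx x (T, √T • z))) ∂(gam n) := by
    intro x
    rw [integral_const_mul, integral_const_mul]
    congr 1
    have := cam_mar (fun z => G (√T • z)) (√T • x)
    have e : (fun z => G (√T • (√T • x + z))) = fun z => G (th T (x, z)) := by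
      funext z
      unfold th
      rw [smul_add, smul_smul, mul_self_sqrt hT]
    rw [e] at this
    rw [this]
    refine integral_congr_ae (Filter.Eventually.of_forall fun z => ?_)
    simp only [lx_apply]
    rw [inner_smul_left, inner_smul_right, norm_smul, mul_pow, norm_of_nonneg (sqrt_nonneg T), sq_sqrt hT]
    rw [conj_trivial, mul_div_assoc, mul_comm T]
  simp only [e1]
  rw [integral_integral_swap]
  · refine integral_congr_ae (Filter.Eventually.of_forall fun z => ?_)
    simp only [JJ]
    rw [← integral_const_mul]
    refine integral_congr_ae (Filter.Eventually.of_forall fun x => ?_)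
    simp only
    ring
  · show Integrable (fun p : Euc n × Euc n => f p.1 * (G (√T • p.2) * exp (lx p.1 (T, √T • p.2)))) _
    refine prod_int h ?_ fun R hR => ?_
    · have c1 : Continuous fun p : Euc n × Euc n => lx p.1 (T, √T • p.2) :=
        by simp only [lx_apply]; fun_prop
      have c2 : Continuous fun p : Euc n × Euc n => G (√T • p.2) := hG.1.comp (by fun_prop)
      exact (hf.comp continuous_fst).mul (c2.mul (continuous_exp.comp c1))
    · obtain ⟨_, K, c, hK, hc, hG'⟩ := hG
      obtain ⟨L, hL⟩ := (isCompact_closedBall (0 : Euc n) R).exists_bound_of_continuousOn hf.continuousOn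
      refine ⟨L * K, c * √T + R * √T, fun p hp => ?_⟩
      have h1 := hL p.1 (by simpa using hp)
      have L0 := (norm_nonneg _).trans h1
      have h2 := hG' (√T • p.2)
      rw [norm_smul, norm_of_nonneg (sqrt_nonneg T)] at h2
      have h3 : exp (lx p.1 (T, √T • p.2)) ≤ exp (R * √T * ‖p.2‖) := by
        refine exp_le_exp.mpr ?_
        rw [lx_apply]
        have := real_inner_le_norm p.1 (√T • p.2)
        rw [norm_smul, norm_of_nonneg (sqrt_nonneg T)] at this
        have h4 : ‖p.1‖ * (√T * ‖p.2‖) ≤ R * (√T * ‖p.2‖) := by gcongr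
        have h5 : 0 ≤ ‖p.1‖ ^ 2 / 2 * T := by positivity
        simp only
        linarith
      rw [abs_mul, abs_mul, abs_of_pos (exp_pos _), add_mul, exp_add]
      calc |f p.1| * (|G (√T • p.2)| * exp (lx p.1 (T, √T • p.2)))
          ≤ L * ((K * exp (c * (√T * ‖p.2‖))) * exp (R * √T * ‖p.2‖)) :=
            mul_le_mul h1 (mul_le_mul h2 h3 (exp_pos _).le (by positivity)) (by positivity) L0
        _ = _ := by rw [← mul_assoc c]; ring

theorem bayes (h : CC t ν) {T : ℝ} (hT : 0 ≤ T) {f G : Euc n → ℝ} (hf : Continuous f) (hG : Gr G) :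
    EE ν T (fun θ => mm ν f T θ * G θ) = ∫ p, f p.1 * G (th T p) ∂(ν.prod (gam n)) := by
  have h1 := bayes0 h hT (f := fun _ => 1) continuous_const ((mm_SB h hf T 0).gr.mul hG)
  simp only [one_mul] at h1
  rw [EE, h1, bayes0 h hT hf hG]
  refine integral_congr_ae (Filter.Eventually.of_forall fun z => ?_)
  simp only [mm_eq]
  have := (JJ_one_pos h (T, √T • z)).ne'
  field_simp

theorem EE_mm (h : CC t ν) {T : ℝ} (hT : 0 ≤ T) {f : Euc n → ℝ} (hf : Continuous f) :
    EE ν T (mm ν f T) = ∫ x, f x ∂ν := by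
  have := h.prob
  have h1 := bayes h hT hf (Gr.const 1)
  simp only [mul_one] at h1
  rw [show (fun θ => mm ν f T θ) = mm ν f T from rfl] at h1
  rw [h1, integral_fun_fst]
  simp

theorem stein_E (h : CC t ν) {T : ℝ} (hT : 0 ≤ T) {G : Euc n → ℝ} (hG : Gr G)
    (hd : Differentiable ℝ G) (i : Fin n) (hG' : Gr (pd i G)) :
    ∫ p, p.2 i * G (th T p) ∂(ν.prod (gam n)) = √T * EE ν T (pd i G) := by
  have := h.prob
  have s1 := (hG.int2 h hT (Gr.coord i))
  have s2 := (hG'.int h hT)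
  rw [EE, integral_prod _ s1, integral_prod _ s2, ← integral_const_mul]
  refine integral_congr_ae (Filter.Eventually.of_forall fun x => ?_)
  simp only
  rw [← integral_const_mul]
  have hfd : ∀ z, HasFDerivAt (fun z => G (th T (x, z))) (√T • fderiv ℝ G (th T (x, z))) z := by
    intro z
    have h1 : HasFDerivAt (fun z : Euc n => th T (x, z)) (√T • ContinuousLinearMap.id ℝ (Euc n)) z := by
      unfold th
      exact HasFDerivAt.const_add (T • x) ((hasFDerivAt_id (𝕜 := ℝ) z).const_smul (√T))
    have := (hd (th T (x, z))).hasFDerivAt.comp z h1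
    refine this.congr_fderiv ?_
    rw [ContinuousLinearMap.comp_smul, ContinuousLinearMap.comp_id]
  have hpd : pd i (fun z => G (th T (x, z))) = fun z => √T * pd i G (th T (x, z)) := by
    funext z
    rw [pd, (hfd z).fderiv]
    simp [pd]
  obtain ⟨K1, c1, hK1, hc1, h1⟩ := hG.th hT ‖x‖
  obtain ⟨K2, c2, hK2, hc2, h2⟩ := hG'.th hT ‖x‖
  have cz : Continuous fun z : Euc n => th T (x, z) := (th_cont T).comp (by fun_prop)
  have := stein (H := fun z => G (th T (x, z))) (fun z => (hfd z).differentiableAt) i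
    (by rw [hpd]; exact continuous_const.mul (hG'.1.comp cz)) (K := K1 + √T * K2) (c := c1 + c2) ?_ ?_
  · rw [← this, hpd]
  · intro z
    refine (h1 (x, z) le_rfl).trans ?_
    refine mul_le_mul (by have := mul_nonneg (sqrt_nonneg T) hK2; linarith) (exp_le_exp.mpr ?_) (exp_pos _).le (by positivity)
    exact mul_le_mul_of_nonneg_right (by linarith) (norm_nonneg _)
  · intro z
    rw [hpd]
    simp only
    rw [abs_mul, abs_of_nonneg (sqrt_nonneg T)]
    refine (mul_le_mul_of_nonneg_left (h2 (x, z) le_rfl) (sqrt_nonneg T)).trans ?_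
    rw [← mul_assoc]
    refine mul_le_mul (by linarith) (exp_le_exp.mpr ?_) (exp_pos _).le (by positivity)
    exact mul_le_mul_of_nonneg_right (by linarith) (norm_nonneg _)

/-- integration by parts for the law of `θ` -/
theorem ibp (h : CC t ν) {T : ℝ} (hT : 0 < T) {G : Euc n → ℝ} (hG : Gr G)
    (hd : Differentiable ℝ G) (i : Fin n) (hG' : Gr (pd i G)) :
    EE ν T (pd i G) = EE ν T (fun θ => (θ i / T - mm ν (fun x => x i) T θ) * G θ) := by
  have hci : Continuous fun x : Euc n => x i := by fun_prop
  have s := stein_E h hT.le hG hd i hG'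
  have b := bayes h hT.le hci hG
  have e : (fun θ : Euc n => (θ i / T - mm ν (fun x => x i) T θ) * G θ) =
      fun θ => (1 / T) * (θ i * G θ) - mm ν (fun x => x i) T θ * G θ := by funext θ; ring
  rw [e, EE_sub h hT.le ((Gr.const _).mul ((Gr.coord i).mul hG)) ((mm_SB h hci T 0).gr.mul hG), EE_smul, b]
  have e2 : EE ν T (fun θ => θ i * G θ) = T * (∫ p, p.1 i * G (th T p) ∂(ν.prod (gam n))) +
      √T * ∫ p, p.2 i * G (th T p) ∂(ν.prod (gam n)) := by
    rw [← integral_const_mul, ← integral_const_mul, ← integral_add]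
    · unfold EE
      refine integral_congr_ae (Filter.Eventually.of_forall fun p => ?_)
      simp [th]
      ring
    · exact (hG.int1 h hT.le hci).const_mul T
    · exact (hG.int2 h hT.le (Gr.coord i)).const_mul _
  rw [e2, s, ← mul_assoc, mul_self_sqrt hT.le]
  field_simp
  ring

end

end KLS

end

section
open MeasureTheory Real Set
open scoped ENNReal RealInnerProductSpace

namespace KLS

noncomputable section

variable {n : ℕ} {t : ℝ} {ν : Measure (Euc n)}

theorem Nice.hd {F : ℝ → Euc n → ℝ} (h : Nice F) (T : ℝ) (θ : Euc n) :
    HasDerivAt (fun s => F s θ) (dT F T θ) T := by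
  have h1 : HasFDerivAt (fun s => F s θ) _ T :=
    HasFDerivAt.comp (f := fun s : ℝ => (s, θ)) T (h.diff (T, θ)).hasFDerivAt (hasFDerivAt_prodMk_left T θ)
  exact h1.differentiableAt.hasDerivAt

theorem Nice.d {F : ℝ → Euc n → ℝ} (h : Nice F) (T : ℝ) : Differentiable ℝ (F T) := (h.sb T 1).diff

theorem Nice.cont {F : ℝ → Euc n → ℝ} (h : Nice F) : Continuous (fun p : ℝ × Euc n => F p.1 p.2) :=
  h.diff.continuous

/-- joint derivative -/
theorem Nice.fd {F : ℝ → Euc n → ℝ} (h : Nice F) (T : ℝ) (θ : Euc n) (a : ℝ) (v : Euc n) :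
    fderiv ℝ (fun p : ℝ × Euc n => F p.1 p.2) (T, θ) (a, v) =
      a * dT F T θ + ∑ i, v i * pd i (F T) θ := by
  set D := fderiv ℝ (fun p : ℝ × Euc n => F p.1 p.2) (T, θ)
  have hD : HasFDerivAt (fun p : ℝ × Euc n => F p.1 p.2) D (T, θ) := (h.diff (T, θ)).hasFDerivAt
  have h1 : HasFDerivAt (fun s => F s θ) (D.comp (ContinuousLinearMap.inl ℝ ℝ (Euc n))) T :=
    HasFDerivAt.comp (f := fun s : ℝ => (s, θ)) T hD (hasFDerivAt_prodMk_left T θ)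
  have h2 : HasFDerivAt (F T) (D.comp (ContinuousLinearMap.inr ℝ ℝ (Euc n))) θ :=
    hD.comp θ (hasFDerivAt_prodMk_right T θ)
  have e1 : dT F T θ = D (1, 0) := by
    rw [dT, h1.hasDerivAt.deriv]; simp
  have e2 : D (0, v) = ∑ i, v i * pd i (F T) θ := by
    rw [← fderiv_apply_eq, h2.fderiv]; simp
  rw [e1, ← e2, ← smul_eq_mul, ← map_smul, ← map_add]
  simp

theorem Nice.const (c : ℝ) : Nice (fun _ _ => c : ℝ → Euc n → ℝ) := by
  refine ⟨differentiable_const c, fun T k => Cb.const c k, fun T => ?_, |c|, abs_nonneg c, fun T θ => ⟨le_rfl, ?_, fun i => ?_⟩⟩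
  · have : dT (fun _ _ => c : ℝ → Euc n → ℝ) T = fun _ => 0 := by funext θ; simp [dT]
    rw [this]; exact continuous_const
  · simp [dT]
  · simp [pd]

theorem dT_add {F G : ℝ → Euc n → ℝ} (hF : Nice F) (hG : Nice G) (T : ℝ) :
    dT (fun s x => F s x + G s x) T = fun θ => dT F T θ + dT G T θ := by
  funext θ; exact ((hF.hd T θ).add (hG.hd T θ)).deriv

theorem dT_mul {F G : ℝ → Euc n → ℝ} (hF : Nice F) (hG : Nice G) (T : ℝ) :
    dT (fun s x => F s x * G s x) T = fun θ => dT F T θ * G T θ + F T θ * dT G T θ := by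
  funext θ; exact ((hF.hd T θ).mul (hG.hd T θ)).deriv

theorem Nice.add {F G : ℝ → Euc n → ℝ} (hF : Nice F) (hG : Nice G) :
    Nice (fun s x => F s x + G s x) := by
  obtain ⟨K, hK, h1⟩ := hF.bd
  obtain ⟨L, hL, h2⟩ := hG.bd
  refine ⟨hF.diff.add hG.diff, fun T k => (hF.sb T k).add (hG.sb T k), fun T => ?_, K + L, by positivity, fun T θ => ⟨?_, ?_, fun i => ?_⟩⟩
  · rw [dT_add hF hG]; exact (hF.dc T).add (hG.dc T)
  · exact (abs_add_le _ _).trans (add_le_add (h1 T θ).1 (h2 T θ).1)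
  · rw [dT_add hF hG]; exact (abs_add_le _ _).trans (add_le_add (h1 T θ).2.1 (h2 T θ).2.1)
  · rw [pd_add (hF.d T) (hG.d T)]; exact (abs_add_le _ _).trans (add_le_add ((h1 T θ).2.2 i) ((h2 T θ).2.2 i))

theorem Nice.mul {F G : ℝ → Euc n → ℝ} (hF : Nice F) (hG : Nice G) :
    Nice (fun s x => F s x * G s x) := by
  obtain ⟨K, hK, h1⟩ := hF.bd
  obtain ⟨L, hL, h2⟩ := hG.bd
  have key : ∀ {a b : ℝ}, |a| ≤ K → |b| ≤ L → |a * b| ≤ K * L := fun ha hb => by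
    rw [abs_mul]; exact mul_le_mul ha hb (abs_nonneg _) hK
  refine ⟨hF.diff.mul hG.diff, fun T k => (hF.sb T k).mul (hG.sb T k), fun T => ?_, K * L + K * L, by positivity, fun T θ => ⟨?_, ?_, fun i => ?_⟩⟩
  · rw [dT_mul hF hG]; exact ((hF.dc T).mul (hG.sb T 0).continuous).add ((hF.sb T 0).continuous.mul (hG.dc T))
  · exact (key (h1 T θ).1 (h2 T θ).1).trans (by linarith [mul_nonneg hK hL])
  · rw [dT_mul hF hG]; exact (abs_add_le _ _).trans (add_le_add (key (h1 T θ).2.1 (h2 T θ).1) (key (h1 T θ).1 (h2 T θ).2.1))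
  · rw [pd_mul (hF.d T) (hG.d T)]; exact (abs_add_le _ _).trans (add_le_add (key (h1 T θ).1 ((h2 T θ).2.2 i)) (key ((h1 T θ).2.2 i) (h2 T θ).1))

theorem Nice.const_mul {F : ℝ → Euc n → ℝ} (hF : Nice F) (c : ℝ) : Nice (fun s x => c * F s x) :=
  (Nice.const c).mul hF

theorem Nice.sub {F G : ℝ → Euc n → ℝ} (hF : Nice F) (hG : Nice G) :
    Nice (fun s x => F s x - G s x) := by
  have := hF.add (hG.const_mul (-1))
  refine (congrArg Nice ?_).mp this
  funext s x; ring

theorem Nice.sum {ι : Type*} (s : Finset ι) {F : ι → ℝ → Euc n → ℝ} (h : ∀ i ∈ s, Nice (F i)) :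
    Nice (fun T x => ∑ i ∈ s, F i T x) := by
  classical
  induction s using Finset.induction_on with
  | empty => simpa using Nice.const 0
  | insert a s ha ih =>
    simp only [Finset.sum_insert ha]
    exact (h a (Finset.mem_insert_self _ _)).add (ih fun i hi => h i (Finset.mem_insert_of_mem hi))

theorem pd_comp {φ : ℝ → ℝ} {y : ℝ} {f : Euc n → ℝ} {θ : Euc n} (hφ : HasDerivAt φ y (f θ))
    (hf : DifferentiableAt ℝ f θ) (i : Fin n) : pd i (fun x => φ (f x)) θ = y * pd i f θ := by
  have : HasFDerivAt (fun x => φ (f x)) _ θ := hφ.comp_hasFDerivAt θ hf.hasFDerivAt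
  rw [pd, this.fderiv]; simp [pd]

theorem Nice.comp {F : ℝ → Euc n → ℝ} (hF : Nice F) {φ φ' : ℝ → ℝ} {c : ℝ} (hc : ∀ T θ, c ≤ F T θ)
    (hφ : ∀ y, c ≤ y → HasDerivAt φ (φ' y) y) (hφ' : ContinuousOn φ' (Ici c))
    (hs : ∀ T, SB (fun θ => φ (F T θ))) : Nice (fun s x => φ (F s x)) := by
  obtain ⟨K, hK, h1⟩ := hF.bd
  have i1 : Icc c K ⊆ Ici c := fun x hx => hx.1
  have hφc : ContinuousOn φ (Icc c K) := fun x hx => (hφ x hx.1).continuousAt.continuousWithinAt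
  obtain ⟨A, hA⟩ := isCompact_Icc.exists_bound_of_continuousOn hφc
  obtain ⟨B, hB⟩ := isCompact_Icc.exists_bound_of_continuousOn (hφ'.mono i1)
  have hm : ∀ T θ, F T θ ∈ Icc c K := fun T θ => ⟨hc T θ, (le_abs_self _).trans (h1 T θ).1⟩
  have B0 : 0 ≤ B := (norm_nonneg _).trans (hB _ (hm 0 0))
  have A0 : 0 ≤ A := (norm_nonneg _).trans (hA _ (hm 0 0))
  have ed : ∀ T, dT (fun s x => φ (F s x)) T = fun θ => φ' (F T θ) * dT F T θ := by
    intro T; funext θ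
    exact ((hφ _ (hc T θ)).comp T (hF.hd T θ)).deriv
  have ep : ∀ T i, pd i (fun x => φ (F T x)) = fun θ => φ' (F T θ) * pd i (F T) θ := by
    intro T i; funext θ
    exact pd_comp (hφ _ (hc T θ)) (hF.d T θ) i
  refine ⟨fun p => ?_, hs, fun T => ?_, A + B * K, by positivity, fun T θ => ⟨?_, ?_, fun i => ?_⟩⟩
  · exact ((hφ _ (hc p.1 p.2)).comp_hasFDerivAt p (hF.diff p).hasFDerivAt).differentiableAt
  · rw [ed]
    exact (hφ'.comp_continuous (hF.sb T 0).continuous (hc T)).mul (hF.dc T)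
  · have := hA _ (hm T θ)
    rw [norm_eq_abs] at this
    linarith [mul_nonneg B0 hK]
  · rw [ed]; simp only; rw [abs_mul]
    have := mul_le_mul (hB _ (hm T θ)) (h1 T θ).2.1 (abs_nonneg _) B0
    rw [norm_eq_abs] at this
    linarith
  · rw [ep]; simp only; rw [abs_mul]
    have := mul_le_mul (hB _ (hm T θ)) ((h1 T θ).2.2 i) (abs_nonneg _) B0
    rw [norm_eq_abs] at this
    linarith

theorem LL_add {F G : ℝ → Euc n → ℝ} (hF : Nice F) (hG : Nice G) (T : ℝ) (θ : Euc n) :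
    LL ν (fun s x => F s x + G s x) T θ = LL ν F T θ + LL ν G T θ := by
  have e : ∀ i, pd i (pd i (fun x => F T x + G T x)) θ = pd i (pd i (F T)) θ + pd i (pd i (G T)) θ := by
    intro i
    rw [pd_add (hF.d T) (hG.d T), pd_add ((hF.sb T 2).pd i).diff ((hG.sb T 2).pd i).diff]
  simp only [LL, e]
  rw [dT_add hF hG]
  simp only [pd_add (hF.d T) (hG.d T), mul_add, Finset.sum_add_distrib]
  ring

theorem LL_mul {F G : ℝ → Euc n → ℝ} (hF : Nice F) (hG : Nice G) (T : ℝ) (θ : Euc n) :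
    LL ν (fun s x => F s x * G s x) T θ = F T θ * LL ν G T θ + G T θ * LL ν F T θ +
      ∑ i, pd i (F T) θ * pd i (G T) θ := by
  have e : ∀ i, pd i (pd i (fun x => F T x * G T x)) θ = F T θ * pd i (pd i (G T)) θ +
      G T θ * pd i (pd i (F T)) θ + 2 * (pd i (F T) θ * pd i (G T) θ) := by
    intro i
    have f1 : Differentiable ℝ (pd i (F T)) := ((hF.sb T 2).pd i).diff
    have g1 : Differentiable ℝ (pd i (G T)) := ((hG.sb T 2).pd i).diff
    have m1 : Differentiable ℝ (fun x => F T x * pd i (G T) x) := (hF.d T).mul g1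
    have m2 : Differentiable ℝ (fun x => pd i (F T) x * G T x) := f1.mul (hG.d T)
    rw [pd_mul (hF.d T) (hG.d T), pd_add m1 m2, pd_mul (hF.d T) g1, pd_mul f1 (hG.d T)]
    ring
  simp only [LL, e]
  rw [dT_mul hF hG]
  simp only [pd_mul (hF.d T) (hG.d T), mul_add, Finset.sum_add_distrib, ← Finset.mul_sum]
  have s1 : ∑ i, mm ν (fun x => x i) T θ * (F T θ * pd i (G T) θ) = F T θ * ∑ i, mm ν (fun x => x i) T θ * pd i (G T) θ := by
    rw [Finset.mul_sum]; exact Finset.sum_congr rfl fun i _ => by ring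
  have s2 : ∑ i, mm ν (fun x => x i) T θ * (pd i (F T) θ * G T θ) = G T θ * ∑ i, mm ν (fun x => x i) T θ * pd i (F T) θ := by
    rw [Finset.mul_sum]; exact Finset.sum_congr rfl fun i _ => by ring
  rw [s1, s2]
  ring

theorem LL_const (c : ℝ) (T : ℝ) (θ : Euc n) : LL ν (fun _ _ => c) T θ = 0 := by
  have e : ∀ i, pd i (fun _ : Euc n => c) = fun _ => 0 := by
    intro i; funext x; simp [pd]
  have e' : ∀ i, pd i (fun _ : Euc n => (0:ℝ)) = fun _ => 0 := by
    intro i; funext x; simp [pd]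
  simp [LL, dT, e, e']

theorem LL_const_mul {F : ℝ → Euc n → ℝ} (hF : Nice F) (c : ℝ) (T : ℝ) (θ : Euc n) :
    LL ν (fun s x => c * F s x) T θ = c * LL ν F T θ := by
  rw [LL_mul (Nice.const c) hF, LL_const]
  have e : ∀ i, pd i (fun _ : Euc n => c) θ = 0 := by intro i; simp [pd]
  simp [e]

theorem LL_sub {F G : ℝ → Euc n → ℝ} (hF : Nice F) (hG : Nice G) (T : ℝ) (θ : Euc n) :
    LL ν (fun s x => F s x - G s x) T θ = LL ν F T θ - LL ν G T θ := by
  have := LL_add hF (hG.const_mul (-1)) T θ (ν := ν)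
  rw [LL_const_mul hG] at this
  rw [show (fun s x => F s x - G s x) = fun s x => F s x + -1 * G s x by funext s x; ring, this]
  ring

theorem LL_sum {ι : Type*} (s : Finset ι) {F : ι → ℝ → Euc n → ℝ} (h : ∀ i, Nice (F i)) (T : ℝ) (θ : Euc n) :
    LL ν (fun T x => ∑ i ∈ s, F i T x) T θ = ∑ i ∈ s, LL ν (F i) T θ := by
  classical
  induction s using Finset.induction_on with
  | empty => simpa using LL_const 0 T θ
  | insert a s ha ih =>
    simp only [Finset.sum_insert ha]
    rw [LL_add (h a) (Nice.sum s fun i _ => h i), ih]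

theorem LL_comp {F : ℝ → Euc n → ℝ} (hF : Nice F) {φ φ' φ'' : ℝ → ℝ} {c : ℝ} (hc : ∀ T θ, c ≤ F T θ)
    (hφ : ∀ y, c ≤ y → HasDerivAt φ (φ' y) y) (hφ' : ∀ y, c ≤ y → HasDerivAt φ' (φ'' y) y)
    (T : ℝ) (θ : Euc n) :
    LL ν (fun s x => φ (F s x)) T θ = φ' (F T θ) * LL ν F T θ + 1 / 2 * φ'' (F T θ) * gsq (F T) θ := by
  have ed : dT (fun s x => φ (F s x)) T θ = φ' (F T θ) * dT F T θ :=
    ((hφ _ (hc T θ)).comp T (hF.hd T θ)).deriv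
  have ep : ∀ i, pd i (fun x => φ (F T x)) = fun θ => φ' (F T θ) * pd i (F T) θ := by
    intro i; funext θ
    exact pd_comp (hφ _ (hc T θ)) (hF.d T θ) i
  have ep' : ∀ i, pd i (fun x => φ' (F T x)) θ = φ'' (F T θ) * pd i (F T) θ := by
    intro i
    exact pd_comp (hφ' _ (hc T θ)) (hF.d T θ) i
  have d1 : Differentiable ℝ (fun x => φ' (F T x)) := fun x =>
    ((hφ' _ (hc T x)).comp_hasFDerivAt x (hF.d T x).hasFDerivAt).differentiableAt
  have e2 : ∀ i, pd i (pd i (fun x => φ (F T x))) θ = φ' (F T θ) * pd i (pd i (F T)) θ +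
      φ'' (F T θ) * pd i (F T) θ ^ 2 := by
    intro i
    have f1 : Differentiable ℝ (pd i (F T)) := ((hF.sb T 2).pd i).diff
    rw [ep, pd_mul d1 f1]
    simp only [ep']
    ring
  simp only [LL, ed, e2]
  simp only [ep, Finset.sum_add_distrib, ← Finset.mul_sum, gsq]
  have s1 : ∑ i, mm ν (fun x => x i) T θ * (φ' (F T θ) * pd i (F T) θ) = φ' (F T θ) * ∑ i, mm ν (fun x => x i) T θ * pd i (F T) θ := by
    rw [Finset.mul_sum]; exact Finset.sum_congr rfl fun i _ => by ring
  rw [s1]; ring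

theorem LL_gr (h : CC t ν) {F : ℝ → Euc n → ℝ} (hF : Nice F) (T : ℝ) : Gr (LL ν F T) := by
  have d : Cb 0 (dT F T) := ⟨hF.dc T, by
    obtain ⟨K, _, hK⟩ := hF.bd
    exact ⟨K, fun x => (hK T x).2.1⟩⟩
  have : Cb 0 (LL ν F T) := (d.add ((Cb.sum _ fun i _ => ((hF.sb T 2).pd i).pd i).const_mul (1/2))).add
    (Cb.sum _ fun i _ => (mm_SB h (by fun_prop) T 0).mul ((hF.sb T 1).pd i))
  exact this.gr

/-- the Ito formula -/
theorem ito (h : CC t ν) {F : ℝ → Euc n → ℝ} (hF : Nice F) {T : ℝ} (hT : 0 < T) :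
    HasDerivAt (fun s => EE ν s (F s)) (EE ν T (LL ν F T)) T := by
  have := h.prob
  obtain ⟨R, hR0, hR⟩ := h.bs.pos
  obtain ⟨K, hK0, hK⟩ := hF.bd
  have hci : ∀ i : Fin n, Continuous fun x : Euc n => x i := fun i => by fun_prop
  set Φ' : ℝ → Euc n × Euc n → ℝ := fun s p =>
    1 * dT F s (th s p) + ∑ i, (p.1 + (1 / (2 * √s)) • p.2) i * pd i (F s) (th s p) with hΦ'
  have hder : ∀ s, 0 < s → ∀ p : Euc n × Euc n, HasDerivAt (fun s => F s (th s p)) (Φ' s p) s := by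
    intro s hs p
    have d1 : HasDerivAt (fun s => th s p) (p.1 + (1 / (2 * √s)) • p.2) s := by
      unfold th
      have a1 : HasDerivAt (fun s : ℝ => s • p.1) ((1:ℝ) • p.1) s := (hasDerivAt_id s).smul_const p.1
      rw [one_smul] at a1
      have a2 : HasDerivAt (fun s : ℝ => √s • p.2) ((1 / (2 * √s)) • p.2) s := (hasDerivAt_sqrt hs.ne').smul_const p.2
      exact a1.add a2
    have d2 : HasDerivAt (fun s => (s, th s p)) ((1:ℝ), p.1 + (1 / (2 * √s)) • p.2) s :=
      (hasDerivAt_id s).prodMk d1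
    have d3 := (hF.diff (s, th s p)).hasFDerivAt.comp_hasDerivAt s d2
    rw [hF.fd] at d3
    exact d3
  set bnd : Euc n × Euc n → ℝ := fun p => K + ∑ i : Fin n, (R + (1 / (2 * √(T/2))) * ‖p.2‖) * K with hbnd
  have gd : Gr (dT F T) := by
    have d : Cb 0 (dT F T) := ⟨hF.dc T, K, fun x => (hK T x).2.1⟩
    exact d.gr
  have gp : ∀ i, Gr (pd i (F T)) := fun i => ((hF.sb T 1).pd i).gr
  have gpp : ∀ i, Gr (pd i (pd i (F T))) := fun i => (((hF.sb T 2).pd i).pd i).gr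
  have ga : ∀ i : Fin n, Gr (mm ν (fun x => x i) T) := fun i => (mm_SB h (hci i) T 0).gr
  have key := hasDerivAt_integral_of_dominated_loc_of_deriv_le (μ := ν.prod (gam n)) (𝕜 := ℝ)
    (F := fun s p => F s (th s p)) (F' := Φ') (x₀ := T) (s := Ioi (T/2)) (bound := bnd)
    (Ioi_mem_nhds (by linarith)) ?_ ?_ ?_ ?_ ?_ ?_
  · have k2 := key.2
    refine k2.congr_deriv ?_
    have i1 := gd.int h hT.le
    have i2 : ∀ i, Integrable (fun p : Euc n × Euc n => p.1 i * pd i (F T) (th T p)) (ν.prod (gam n)) :=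
      fun i => (gp i).int1 h hT.le (hci i)
    have i3 : ∀ i, Integrable (fun p : Euc n × Euc n => (1 / (2 * √T)) * (p.2 i * pd i (F T) (th T p))) (ν.prod (gam n)) :=
      fun i => ((gp i).int2 h hT.le (Gr.coord i)).const_mul _
    have e1 : Φ' T = fun p => dT F T (th T p) + ∑ i, (p.1 i * pd i (F T) (th T p) +
        (1 / (2 * √T)) * (p.2 i * pd i (F T) (th T p))) := by
      funext p
      simp only [hΦ', one_mul]
      congr 1
      refine Finset.sum_congr rfl fun i _ => ?_
      simp
      ring
    have i5 : ∀ i, Integrable (fun p : Euc n × Euc n => p.1 i * pd i (F T) (th T p) +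
        (1 / (2 * √T)) * (p.2 i * pd i (F T) (th T p))) (ν.prod (gam n)) := fun i => (i2 i).add (i3 i)
    have i4 : Integrable (fun p : Euc n × Euc n => ∑ i, (p.1 i * pd i (F T) (th T p) +
        (1 / (2 * √T)) * (p.2 i * pd i (F T) (th T p)))) (ν.prod (gam n)) :=
      integrable_finsetSum _ fun i _ => i5 i
    rw [e1, integral_add i1 i4, integral_finsetSum _ fun i _ => i5 i]
    have e2 : ∀ i, ∫ p : Euc n × Euc n, (p.1 i * pd i (F T) (th T p) +
        (1 / (2 * √T)) * (p.2 i * pd i (F T) (th T p))) ∂(ν.prod (gam n)) =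
        EE ν T (fun θ => mm ν (fun x => x i) T θ * pd i (F T) θ) + 1 / 2 * EE ν T (pd i (pd i (F T))) := by
      intro i
      rw [integral_add (i2 i) (i3 i), integral_const_mul, stein_E h hT.le (gp i) ((hF.sb T 2).pd i).diff i (gpp i),
        bayes h hT.le (hci i) (gp i)]
      have := (sqrt_pos.mpr hT).ne'
      field_simp
    simp only [e2]
    unfold LL
    have g1 : Gr (fun θ => ∑ i, pd i (pd i (F T)) θ) := Gr.sum _ fun i _ => gpp i
    have g2 : Gr (fun θ => 1 / 2 * ∑ i, pd i (pd i (F T)) θ) := (Gr.const _).mul g1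
    have g3 : ∀ i, Gr (fun θ => mm ν (fun x => x i) T θ * pd i (F T) θ) := fun i => (ga i).mul (gp i)
    rw [EE_add h hT.le (gd.add g2) (Gr.sum _ fun i _ => g3 i), EE_add h hT.le gd g2, EE_smul,
      EE_sum h hT.le _ gpp, EE_sum h hT.le _ g3, Finset.sum_add_distrib, ← Finset.mul_sum]
    simp only [EE]
    ring
  · exact Filter.Eventually.of_forall fun s =>
      ((hF.sb s 0).continuous.comp (th_cont s)).aestronglyMeasurable
  · exact (hF.sb T 0).gr.int h hT.le
  · have c : Continuous (Φ' T) := by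
      refine (continuous_const.mul ((hF.dc T).comp (th_cont T))).add (continuous_finsetSum _ fun i _ => ?_)
      refine Continuous.mul ?_ (((hF.sb T 1).pd i).continuous.comp (th_cont T))
      fun_prop
    exact c.aestronglyMeasurable
  · have hR' : ∀ᵐ p ∂(ν.prod (gam n)), ‖p.1‖ ≤ R := Measure.quasiMeasurePreserving_fst.ae hR
    filter_upwards [hR'] with p hp s hs
    have hs' : T / 2 < s := hs
    have hsq : 1 / (2 * √s) ≤ 1 / (2 * √(T/2)) := by
      have : 0 < √(T/2) := sqrt_pos.mpr (by linarith)
      gcongr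
    have cn : ∀ (x : Euc n) i, |x i| ≤ ‖x‖ := fun x i => by
      simpa using PiLp.norm_apply_le x i
    simp only [hΦ', hbnd, one_mul, norm_eq_abs]
    refine (abs_add_le _ _).trans (add_le_add (hK _ _).2.1 ((Finset.abs_sum_le_sum_abs _ _).trans
      (Finset.sum_le_sum fun i _ => ?_)))
    rw [abs_mul]
    have h0 : (0:ℝ) ≤ 1 / (2 * √(T/2)) := by positivity
    refine mul_le_mul ?_ ((hK _ _).2.2 i) (abs_nonneg _) (by positivity)
    refine (cn _ i).trans ((norm_add_le _ _).trans (add_le_add hp ?_))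
    rw [norm_smul, norm_of_nonneg (by positivity)]
    exact mul_le_mul_of_nonneg_right hsq (norm_nonneg _)
  · refine prod_int h (by fun_prop) fun R' _ => ?_
    have h0 : (0:ℝ) ≤ 1 / (2 * √(T/2)) := by positivity
    refine ⟨K + ∑ i : Fin n, (R + 1 / (2 * √(T/2))) * K, 1, fun p _ => ?_⟩
    have b0 : 0 ≤ bnd p := add_nonneg hK0 (Finset.sum_nonneg fun i _ => by positivity)
    rw [abs_of_nonneg b0, one_mul, add_mul, Finset.sum_mul]
    have e0 := one_le_exp (norm_nonneg p.2)
    have e1 : ‖p.2‖ ≤ exp ‖p.2‖ := by linarith [add_one_le_exp ‖p.2‖]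
    refine add_le_add (le_mul_of_one_le_right hK0 e0) (Finset.sum_le_sum fun i _ => ?_)
    have q1 := mul_le_mul_of_nonneg_left e0 hR0.le
    have q2 := mul_le_mul_of_nonneg_left e1 h0
    have := mul_le_mul_of_nonneg_right (add_le_add q1 q2) hK0
    linarith
  · exact Filter.Eventually.of_forall fun p s hs => hder s (by have : T / 2 < s := hs; linarith) p

theorem EE_zero (h : CC t ν) (G : Euc n → ℝ) : EE ν 0 G = G 0 := by
  have := h.prob
  simp [EE, th]

/-- continuity at zero -/
theorem EE_cont (h : CC t ν) {F : ℝ → Euc n → ℝ} (hF : Nice F) : Continuous (fun s => EE ν s (F s)) := by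
  have := h.prob
  obtain ⟨K, hK0, hK⟩ := hF.bd
  have c : ∀ s, Continuous fun p => F s (th s p) := fun s => (hF.sb s 0).continuous.comp (th_cont s)
  refine continuous_of_dominated (bound := fun _ => K) (fun s => (c s).aestronglyMeasurable)
    (fun s => Filter.Eventually.of_forall fun p => (hK _ _).1) (integrable_const _)
    (Filter.Eventually.of_forall fun p => ?_)
  have : Continuous fun s => (s, th s p) := by unfold th; fun_prop
  exact hF.cont.comp this

end

end KLS

end

section
open MeasureTheory Real Set
open scoped ENNReal RealInnerProductSpace

namespace KLS

noncomputable section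

variable {n : ℕ} {t : ℝ} {ν : Measure (Euc n)}

/-- Cauchy–Schwarz for integrals -/
theorem int_csq {α : Type*} [MeasurableSpace α] {μ : Measure α} {f g : α → ℝ}
    (hf : Integrable (fun x => f x ^ 2) μ) (hg : Integrable (fun x => g x ^ 2) μ)
    (hfg : Integrable (fun x => f x * g x) μ) :
    (∫ x, f x * g x ∂μ) ^ 2 ≤ (∫ x, f x ^ 2 ∂μ) * ∫ x, g x ^ 2 ∂μ := by
  have key : ∀ s : ℝ, 0 ≤ (∫ x, f x ^ 2 ∂μ) * (s * s) + (2 * ∫ x, f x * g x ∂μ) * s + ∫ x, g x ^ 2 ∂μ := by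
    intro s
    have i1 := hf.const_mul (s * s)
    have i2 := hfg.const_mul (2 * s)
    have i12 : Integrable (fun x => s * s * f x ^ 2 + 2 * s * (f x * g x)) μ := i1.add i2
    have : 0 ≤ ∫ x, (s * s * f x ^ 2 + 2 * s * (f x * g x)) + g x ^ 2 ∂μ :=
      integral_nonneg fun x => by
        have : 0 ≤ (s * f x + g x) ^ 2 := sq_nonneg _
        simp only [Pi.zero_apply]
        linarith
    rw [integral_add i12 hg, integral_add i1 i2, integral_const_mul, integral_const_mul] at this
    linarith
  have := discrim_le_zero key
  rw [discrim] at this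
  linarith

/-- covariance -/
def cv (ω : Measure (Euc n)) (f g : Euc n → ℝ) : ℝ := ∫ x, f x * g x ∂ω - (∫ x, f x ∂ω) * ∫ x, g x ∂ω

theorem cv_self (ω : Measure (Euc n)) (f : Euc n → ℝ) : cv ω f f = vr ω f := by
  simp [cv, vr, ← pow_two]

theorem cv_comm (ω : Measure (Euc n)) (f g : Euc n → ℝ) : cv ω f g = cv ω g f := by
  simp only [cv, mul_comm]

section
variable {ω : Measure (Euc n)} [IsProbabilityMeasure ω] {f g h : Euc n → ℝ}

theorem L2.i (hf : MemLp f 2 ω) : Integrable f ω := hf.integrable (by norm_num)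

theorem L2.m (hf : MemLp f 2 ω) (hg : MemLp g 2 ω) : Integrable (fun x => f x * g x) ω := hf.integrable_mul hg

theorem L2.s (hf : MemLp f 2 ω) : Integrable (fun x => f x ^ 2) ω := hf.integrable_sq

theorem BS.memLp (hb : BS ω) (hf : Continuous f) : MemLp f 2 ω := by
  obtain ⟨K, _, hK⟩ := hb.bdd hf
  exact MemLp.of_bound hf.aestronglyMeasurable K hK

theorem cv_add_left (hf : MemLp f 2 ω) (hg : MemLp g 2 ω) (hh : MemLp h 2 ω) :
    cv ω (fun x => f x + g x) h = cv ω f h + cv ω g h := by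
  simp only [cv, add_mul]
  rw [integral_add (L2.m hf hh) (L2.m hg hh), integral_add (L2.i hf) (L2.i hg)]
  ring

theorem cv_smul_left (c : ℝ) : cv ω (fun x => c * f x) h = c * cv ω f h := by
  simp only [cv, mul_assoc, integral_const_mul]
  ring

theorem cv_sum_left {ι : Type*} (s : Finset ι) {F : ι → Euc n → ℝ} (hF : ∀ i, MemLp (F i) 2 ω)
    (hh : MemLp h 2 ω) : cv ω (fun x => ∑ i ∈ s, F i x) h = ∑ i ∈ s, cv ω (F i) h := by
  simp only [cv, Finset.sum_mul]
  rw [integral_finsetSum _ fun i _ => L2.m (hF i) hh, integral_finsetSum _ fun i _ => L2.i (hF i),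
    Finset.sum_mul, ← Finset.sum_sub_distrib]

theorem cv_eq (hf : MemLp f 2 ω) (hg : MemLp g 2 ω) (a b : ℝ) :
    cv ω f g = ∫ x, (f x - a) * (g x - b) ∂ω - (∫ x, f x ∂ω - a) * (∫ x, g x ∂ω - b) := by
  have e : ∀ x, (f x - a) * (g x - b) = f x * g x - (b * f x + a * g x - a * b) := fun x => by ring
  have i1 := (L2.i hf).const_mul b
  have i2 := (L2.i hg).const_mul a
  have i3 : Integrable (fun x => b * f x + a * g x) ω := i1.add i2
  have i4 : Integrable (fun x => b * f x + a * g x - a * b) ω := i3.sub (integrable_const _)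
  simp only [e]
  rw [integral_sub (L2.m hf hg) i4, integral_sub i3 (integrable_const _), integral_add i1 i2,
    integral_const_mul, integral_const_mul]
  simp [cv]
  ring

theorem vr_eq' (hf : MemLp f 2 ω) : vr ω f = ∫ x, (f x - ∫ y, f y ∂ω) ^ 2 ∂ω := by
  rw [← cv_self, cv_eq hf hf (∫ y, f y ∂ω) (∫ y, f y ∂ω)]
  simp [pow_two]

theorem vr_nonneg (hf : MemLp f 2 ω) : 0 ≤ vr ω f := by
  rw [vr_eq' hf]; exact integral_nonneg fun x => sq_nonneg _

theorem cv_csq (hf : MemLp f 2 ω) (hg : MemLp g 2 ω) : cv ω f g ^ 2 ≤ vr ω f * vr ω g := by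
  have hf' : MemLp (fun x => f x - ∫ y, f y ∂ω) 2 ω := hf.sub (memLp_const _)
  have hg' : MemLp (fun x => g x - ∫ y, g y ∂ω) 2 ω := hg.sub (memLp_const _)
  rw [vr_eq' hf, vr_eq' hg, cv_eq hf hg (∫ y, f y ∂ω) (∫ y, g y ∂ω), sub_self, zero_mul, sub_zero]
  exact int_csq (L2.s hf') (L2.s hg') (L2.m hf' hg')

end

/-- the covariance is at most `M` -/
def CovLe (ω : Measure (Euc n)) (M : ℝ) : Prop := ∀ v : Euc n, vr ω (fun x => ⟪v, x⟫) ≤ M * ‖v‖ ^ 2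

theorem inner_lin (v : Euc n) : (fun x : Euc n => ⟪v, x⟫) = fun x => ∑ i, v i * x i := by
  funext x; exact inner_sum v x

theorem cv_inner {ω : Measure (Euc n)} [IsProbabilityMeasure ω]
    (hx : ∀ i : Fin n, MemLp (fun x : Euc n => x i) 2 ω) {f : Euc n → ℝ} (hf : MemLp f 2 ω) (v : Euc n) :
    cv ω (fun x => ⟪v, x⟫) f = ∑ i, v i * cv ω (fun x => x i) f := by
  rw [inner_lin, cv_sum_left _ (fun i => (hx i).const_mul (v i)) hf]
  simp only [cv_smul_left]

/-- Bessel type inequality -/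
theorem bessel {ω : Measure (Euc n)} [IsProbabilityMeasure ω] {M : ℝ} (hM : CovLe ω M)
    (hx : ∀ i : Fin n, MemLp (fun x : Euc n => x i) 2 ω) {f : Euc n → ℝ} (hf : MemLp f 2 ω) :
    ∑ i, cv ω (fun x => x i) f ^ 2 ≤ M * vr ω f := by
  set v : Euc n := WithLp.toLp 2 (fun i => cv ω (fun x => x i) f) with hv
  have e1 : ∀ i, v i = cv ω (fun x => x i) f := fun i => rfl
  have hS : ‖v‖ ^ 2 = ∑ i, cv ω (fun x => x i) f ^ 2 := norm_sq_sum v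
  have h1 : cv ω (fun x => ⟪v, x⟫) f = ‖v‖ ^ 2 := by
    rw [cv_inner hx hf, hS]
    exact Finset.sum_congr rfl fun i _ => by rw [e1, pow_two]
  have hL : MemLp (fun x : Euc n => ⟪v, x⟫) 2 ω := by
    rw [inner_lin]; exact memLp_finset_sum _ fun i _ => (hx i).const_mul (v i)
  have h2 := cv_csq hL hf
  rw [h1] at h2
  rw [← hS]
  have h3 := mul_le_mul_of_nonneg_right (hM v) (vr_nonneg hf)
  rcases (sq_nonneg ‖v‖).eq_or_lt with h0 | h0
  · rw [← h0]
    by_cases hn : ∃ w : Euc n, w ≠ 0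
    · obtain ⟨w, hw⟩ := hn
      have : 0 ≤ M * ‖w‖ ^ 2 := (vr_nonneg (by
        rw [inner_lin]; exact memLp_finset_sum _ fun i _ => (hx i).const_mul (w i))).trans (hM w)
      have hw' : 0 < ‖w‖ ^ 2 := by positivity
      exact mul_nonneg (nonneg_of_mul_nonneg_left this hw') (vr_nonneg hf)
    · push Not at hn
      have : ∀ x y : Euc n, x = y := fun x y => (hn x).trans (hn y).symm
      have hfc : f = fun _ => f 0 := by funext x; rw [this x 0]
      rw [hfc]; simp [vr]
  · nlinarith

theorem mm_pd_cv (h : CC t ν) {F : Euc n → ℝ} (hF : Continuous F) (i : Fin n) (T : ℝ) (θ : Euc n) :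
    pd i (mm ν F T) θ = cv (nuT ν T θ) (fun x => x i) F := by
  rw [mm_pd h hF, cv, mm, mm, mm]; ring

theorem grad_inner (v : Euc n) (i : Fin n) (x : Euc n) : pd i (fun x : Euc n => ⟪v, x⟫) x = v i := by
  have : HasFDerivAt (fun x : Euc n => ⟪v, x⟫) (innerSL ℝ v) x := (innerSL ℝ v).hasFDerivAt
  rw [pd, this.fderiv, innerSL_apply_apply, inner_ee]

theorem Poin.covLe (h : CC t ν) {C : ℝ} (hP : Poin ν C) : CovLe ν C := by
  intro v
  have := h.prob
  have := hP.smooth h.bs (f := fun x => ⟪v, x⟫) ((innerSL ℝ v).contDiff)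
  refine this.trans (le_of_eq ?_)
  have e : ∀ x, gsq (fun x : Euc n => ⟪v, x⟫) x = ‖v‖ ^ 2 := fun x => by
    simp only [gsq, grad_inner, norm_sq_sum]
  simp [e]

theorem CC.poin (h : CC t ν) (ht : 0 < t) : Poin ν (1 / t) := by
  have := h.prob
  exact ul_Poin ht h.ul

theorem CC.x2 (h : CC t ν) (i : Fin n) : MemLp (fun x : Euc n => x i) 2 ν := by
  have := h.prob
  exact h.bs.memLp (by fun_prop)

theorem CC.l2 (h : CC t ν) {f : Euc n → ℝ} (hf : Continuous f) : MemLp f 2 ν := by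
  have := h.prob
  exact h.bs.memLp hf

/-- the gradient of a tilted mean -/
theorem gsq_mm_le (h : CC t ν) {F : Euc n → ℝ} (hF : Continuous F) {T M : ℝ} {θ : Euc n}
    (hM : CovLe (nuT ν T θ) M) : gsq (mm ν F T) θ ≤ M * vr (nuT ν T θ) F := by
  have h' := h.nuT T θ
  have := h'.prob
  simp only [gsq, mm_pd_cv h hF]
  exact bessel hM h'.x2 (h'.l2 hF)

theorem vr_mm (F : Euc n → ℝ) (T : ℝ) (θ : Euc n) :
    vr (nuT ν T θ) F = mm ν (fun x => F x ^ 2) T θ - mm ν F T θ ^ 2 := rfl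

/-- covariance matrix entries -/
def Am (ν : Measure (Euc n)) (i j : Fin n) (T : ℝ) (θ : Euc n) : ℝ :=
  mm ν (fun x => x i * x j) T θ - mm ν (fun x => x i) T θ * mm ν (fun x => x j) T θ

theorem Am_eq_cv (i j : Fin n) (T : ℝ) (θ : Euc n) :
    Am ν i j T θ = cv (nuT ν T θ) (fun x => x i) (fun x => x j) := rfl

theorem pd_a (h : CC t ν) (i j : Fin n) (T : ℝ) (θ : Euc n) :
    pd i (mm ν (fun x => x j) T) θ = Am ν i j T θ := by
  rw [mm_pd_cv h (by fun_prop)]; rfl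

theorem Am_symm (i j : Fin n) (T : ℝ) (θ : Euc n) : Am ν i j T θ = Am ν j i T θ := by
  rw [Am_eq_cv, Am_eq_cv, cv_comm]

theorem Am_nice (h : CC t ν) (i j : Fin n) : Nice (Am ν i j) :=
  (mm_nice h (by fun_prop)).sub ((mm_nice h (by fun_prop)).mul (mm_nice h (by fun_prop)))

theorem Am_quad (h : CC t ν) (v : Euc n) (T : ℝ) (θ : Euc n) :
    ∑ i, ∑ j, v i * v j * Am ν i j T θ = vr (nuT ν T θ) (fun x => ⟪v, x⟫) := by
  have h' := h.nuT T θ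
  have := h'.prob
  rw [← cv_self, cv_inner h'.x2 (h'.l2 (by fun_prop))]
  refine Finset.sum_congr rfl fun i _ => ?_
  rw [cv_comm, cv_inner h'.x2 (h'.x2 i), Finset.mul_sum]
  refine Finset.sum_congr rfl fun j _ => ?_
  rw [Am_symm, Am_eq_cv]; ring

/-- `∂_i m` as a nice function -/
def dm (ν : Measure (Euc n)) (f : Euc n → ℝ) (i : Fin n) (T : ℝ) (θ : Euc n) : ℝ :=
  mm ν (fun x => x i * f x) T θ - mm ν f T θ * mm ν (fun x => x i) T θ

theorem dm_eq (h : CC t ν) {f : Euc n → ℝ} (hf : Continuous f) (i : Fin n) (T : ℝ) :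
    pd i (mm ν f T) = dm ν f i T := by
  funext θ; exact mm_pd h hf i T θ

theorem dm_nice (h : CC t ν) {f : Euc n → ℝ} (hf : Continuous f) (i : Fin n) : Nice (dm ν f i) :=
  (mm_nice h (by fun_prop)).sub ((mm_nice h hf).mul (mm_nice h (by fun_prop)))

theorem dm_LL (h : CC t ν) {f : Euc n → ℝ} (hf : Continuous f) (i : Fin n) (T : ℝ) (θ : Euc n) :
    LL ν (dm ν f i) T θ = - ∑ j, Am ν i j T θ * dm ν f j T θ := by
  have c1 : Continuous fun x : Euc n => x i * f x := by fun_prop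
  have c2 : Continuous fun x : Euc n => x i := by fun_prop
  have : dm ν f i = fun s x => mm ν (fun x => x i * f x) s x - mm ν f s x * mm ν (fun x => x i) s x := rfl
  rw [this, LL_sub (mm_nice h c1) ((mm_nice h hf).mul (mm_nice h c2)), LL_mul (mm_nice h hf) (mm_nice h c2),
    mm_LL h c1, mm_LL h hf, mm_LL h c2]
  simp only [mul_zero, zero_add, zero_sub]
  congr 1
  refine Finset.sum_congr rfl fun j _ => ?_
  rw [dm_eq h hf, pd_a h, Am_symm, mul_comm]

end

end KLS

end

section
open MeasureTheory Real Set
open scoped ENNReal RealInnerProductSpace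

namespace KLS

noncomputable section

variable {n : ℕ} {t : ℝ} {ν : Measure (Euc n)}

theorem pd_comm {f : Euc n → ℝ} (hf : Cb 2 f) (i j : Fin n) (x : Euc n) :
    pd i (pd j f) x = pd j (pd i f) x := by
  set f' : Euc n → (Euc n →L[ℝ] ℝ) := fun y => ∑ k, pd k f y • innerSL ℝ (ee k)
  have h1 : ∀ y, HasFDerivAt f (f' y) y := by
    intro y
    refine (hf.diff y).hasFDerivAt.congr_fderiv (ContinuousLinearMap.ext fun v => ?_)
    rw [fderiv_apply_eq]
    simp only [f', ContinuousLinearMap.sum_apply, ContinuousLinearMap.smul_apply, innerSL_apply_apply, smul_eq_mul]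
    refine Finset.sum_congr rfl fun k _ => ?_
    rw [real_inner_comm, inner_ee, mul_comm]
  set f'' : Euc n →L[ℝ] (Euc n →L[ℝ] ℝ) := ∑ k, (fderiv ℝ (pd k f) x).smulRight (innerSL ℝ (ee k))
  have h2 : HasFDerivAt f' f'' x :=
    HasFDerivAt.fun_sum fun k _ => ((hf.pd k).diff x).hasFDerivAt.smul_const (innerSL ℝ (ee k))
  have h3 := second_derivative_symmetric h1 h2 (ee i) (ee j)
  have e : ∀ i j : Fin n, f'' (ee i) (ee j) = pd i (pd j f) x := by
    intro i j
    simp only [f'', ContinuousLinearMap.sum_apply, ContinuousLinearMap.smulRight_apply, ContinuousLinearMap.smul_apply,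
      innerSL_apply_apply, smul_eq_mul, inner_ee, ee_apply]
    simp [pd]
  rwa [e, e] at h3

theorem pd_sum {ι : Type*} (s : Finset ι) {f : ι → Euc n → ℝ} (h : ∀ k, Differentiable ℝ (f k)) (i : Fin n) :
    pd i (fun x => ∑ k ∈ s, f k x) = fun x => ∑ k ∈ s, pd i (f k) x := by
  funext x
  rw [pd, fderiv_fun_sum fun k _ => h k x]
  simp [pd]

theorem pd_sub {f g : Euc n → ℝ} (hf : Differentiable ℝ f) (hg : Differentiable ℝ g) (i : Fin n) :
    pd i (fun x => f x - g x) = fun x => pd i f x - pd i g x := by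
  ext x; simp only [pd]
  rw [fderiv_fun_sub (hf x) (hg x)]; simp

/-- minus the score of the law of `θ` -/
def sc (ν : Measure (Euc n)) (T : ℝ) (i : Fin n) (θ : Euc n) : ℝ := θ i / T - mm ν (fun x => x i) T θ

def MM (ν : Measure (Euc n)) (T : ℝ) (u : Euc n → ℝ) (θ : Euc n) : ℝ :=
  ∑ i, (sc ν T i θ * pd i u θ - pd i (pd i u) θ)

theorem coord_hfd (i : Fin n) (x : Euc n) : HasFDerivAt (fun x : Euc n => x i) (innerSL ℝ (ee i)) x := by
  have : (fun x : Euc n => x i) = fun x => innerSL ℝ (ee i) x := by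
    funext x; rw [innerSL_apply_apply, real_inner_comm, inner_ee]
  rw [this]; exact (innerSL ℝ (ee i)).hasFDerivAt

theorem pd_coord (i j : Fin n) : pd i (fun x : Euc n => x j) = fun _ => if i = j then 1 else 0 := by
  funext x
  rw [pd, (coord_hfd j x).fderiv, innerSL_apply_apply, inner_ee, ee_apply]

theorem coord_diff (i : Fin n) : Differentiable ℝ (fun x : Euc n => x i) :=
  fun x => (coord_hfd i x).differentiableAt

theorem coord_div_diff (i : Fin n) (T : ℝ) : Differentiable ℝ (fun x : Euc n => x i / T) := by
  have := (coord_diff (n := n) i).const_mul T⁻¹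
  simpa [div_eq_inv_mul] using this

theorem sc_gr (h : CC t ν) (T : ℝ) (i : Fin n) : Gr (sc ν T i) := by
  have := ((Gr.const (1/T)).mul (Gr.coord i)).sub (mm_SB h (F := fun x => x i) (by fun_prop) T 0).gr
  refine (congrArg Gr ?_).mp this
  funext θ; rw [sc]; ring

theorem sc_diff (h : CC t ν) (T : ℝ) (i : Fin n) : Differentiable ℝ (sc ν T i) :=
  Differentiable.sub (coord_div_diff i T) (mm_SB h (by fun_prop) T 1).diff

theorem pd_sc (h : CC t ν) (T : ℝ) (i j : Fin n) :
    pd i (sc ν T j) = fun θ => (if i = j then 1 else 0) / T - Am ν i j T θ := by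
  have d1 : Differentiable ℝ (fun x : Euc n => x j / T) := coord_div_diff j T
  have : sc ν T j = fun θ => θ j / T - mm ν (fun x => x j) T θ := rfl
  rw [this, pd_sub d1 (mm_SB h (by fun_prop) T 1).diff]
  funext θ
  rw [pd_a h]
  have e : (fun x : Euc n => x j / T) = fun x => T⁻¹ * x j := by funext x; ring
  rw [e, pd_const_mul (coord_diff j), pd_coord]
  simp only
  ring

theorem MM_gr (h : CC t ν) (T : ℝ) {u : Euc n → ℝ} (hu : SB u) : Gr (MM ν T u) :=
  Gr.sum _ fun i _ => ((sc_gr h T i).mul ((hu 1).pd i).gr).sub (((hu 2).pd i).pd i).gr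

theorem MM_term_diff (h : CC t ν) (T : ℝ) {u : Euc n → ℝ} (hu : SB u) (i : Fin n) :
    Differentiable ℝ (fun θ => sc ν T i θ * pd i u θ - pd i (pd i u) θ) :=
  ((sc_diff h T i).mul ((hu 2).pd i).diff).sub (((hu 3).pd i).pd i).diff

theorem MM_diff (h : CC t ν) (T : ℝ) {u : Euc n → ℝ} (hu : SB u) : Differentiable ℝ (MM ν T u) :=
  Differentiable.fun_sum fun i _ => MM_term_diff h T hu i

theorem SB.pd {u : Euc n → ℝ} (hu : SB u) (i : Fin n) : SB (pd i u) := fun k => (hu (k+1)).pd i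

theorem pd_MM (h : CC t ν) (T : ℝ) {u : Euc n → ℝ} (hu : SB u) (i : Fin n) :
    pd i (MM ν T u) = fun θ => MM ν T (pd i u) θ +
      ∑ j, ((if i = j then 1 else 0) / T - Am ν i j T θ) * pd j u θ := by
  have : MM ν T u = fun θ => ∑ j, (sc ν T j θ * pd j u θ - pd j (pd j u) θ) := rfl
  rw [this, pd_sum _ (MM_term_diff h T hu)]
  funext θ
  rw [MM, ← Finset.sum_add_distrib]
  refine Finset.sum_congr rfl fun j _ => ?_
  have d1 : Differentiable ℝ (pd j u) := ((hu 2).pd j).diff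
  have d2 : Differentiable ℝ (fun θ => sc ν T j θ * pd j u θ) := (sc_diff h T j).mul d1
  have d3 : Differentiable ℝ (pd j (pd j u)) := (((hu 3).pd j).pd j).diff
  rw [pd_sub d2 d3, pd_mul (sc_diff h T j) d1, pd_sc h]
  simp only
  have e1 : pd i (pd j u) = pd j (pd i u) := funext fun x => pd_comm (hu 2) i j x
  have e2 : pd i (pd j (pd j u)) θ = pd j (pd j (pd i u)) θ := by
    rw [pd_comm (hu.pd j 2) i j, e1]
  rw [e2, e1]
  ring

theorem pd_MM_gr (h : CC t ν) (T : ℝ) {u : Euc n → ℝ} (hu : SB u) (i : Fin n) : Gr (pd i (MM ν T u)) := by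
  rw [pd_MM h T hu]
  exact (MM_gr h T (hu.pd i)).add (Gr.sum _ fun j _ =>
    ((Gr.const _).sub ((Am_nice h i j).sb T 0).gr).mul ((hu 1).pd j).gr)

theorem selfadj (h : CC t ν) {T : ℝ} (hT : 0 < T) {u w : Euc n → ℝ} (hu : SB u) (hw : Gr w)
    (hd : Differentiable ℝ w) (hw' : ∀ i, Gr (pd i w)) :
    EE ν T (fun θ => w θ * MM ν T u θ) = EE ν T (fun θ => ∑ i, pd i u θ * pd i w θ) := by
  have g1 : ∀ i, Gr (pd i u) := fun i => ((hu 1).pd i).gr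
  have g2 : ∀ i, Gr (pd i (pd i u)) := fun i => (((hu 2).pd i).pd i).gr
  have e : (fun θ => w θ * MM ν T u θ) = fun θ => ∑ i, w θ * (sc ν T i θ * pd i u θ - pd i (pd i u) θ) := by
    funext θ; rw [MM, Finset.mul_sum]
  rw [e, EE_sum h hT.le _ (fun i => hw.mul (((sc_gr h T i).mul (g1 i)).sub (g2 i))),
    EE_sum h hT.le _ (fun i => (g1 i).mul (hw' i))]
  refine Finset.sum_congr rfl fun i _ => ?_
  have d1 : Differentiable ℝ (pd i u) := ((hu 2).pd i).diff
  have e1 : pd i (fun θ => w θ * pd i u θ) = fun θ => w θ * pd i (pd i u) θ + pd i w θ * pd i u θ := pd_mul hd d1 i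
  have := ibp h hT (hw.mul (g1 i)) (hd.mul d1) i (by rw [e1]; exact (hw.mul (g2 i)).add ((hw' i).mul (g1 i)))
  rw [e1, EE_add h hT.le (hw.mul (g2 i)) ((hw' i).mul (g1 i))] at this
  have e3 : (fun θ => w θ * (sc ν T i θ * pd i u θ - pd i (pd i u) θ)) = fun θ =>
      sc ν T i θ * (w θ * pd i u θ) - w θ * pd i (pd i u) θ := by
    funext θ; ring
  change _ = EE ν T (fun θ => sc ν T i θ * (w θ * pd i u θ)) at this
  rw [e3, EE_sub h hT.le ((sc_gr h T i).mul (hw.mul (g1 i))) (hw.mul (g2 i)), ← this]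
  have e4 : (fun θ => pd i w θ * pd i u θ) = fun θ => pd i u θ * pd i w θ := by funext θ; ring
  rw [e4]; ring

/-- quadratic form `⟨A∇m,∇m⟩` -/
def QQ (ν : Measure (Euc n)) (f : Euc n → ℝ) (T : ℝ) (θ : Euc n) : ℝ :=
  ∑ i, ∑ j, dm ν f i T θ * dm ν f j T θ * Am ν i j T θ

/-- squared norm of the Hessian -/
def HH (ν : Measure (Euc n)) (f : Euc n → ℝ) (T : ℝ) (θ : Euc n) : ℝ :=
  ∑ i, ∑ j, pd j (dm ν f i T) θ * pd j (dm ν f i T) θ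

def Ds (ν : Measure (Euc n)) (f : Euc n → ℝ) (T : ℝ) (θ : Euc n) : ℝ :=
  ∑ i, dm ν f i T θ * dm ν f i T θ

section
variable {f : Euc n → ℝ}

theorem Ds_eq (h : CC t ν) (hf : Continuous f) (T : ℝ) (θ : Euc n) : Ds ν f T θ = gsq (mm ν f T) θ := by
  simp only [Ds, gsq, dm_eq h hf, pow_two]

theorem Ds_nice (h : CC t ν) (hf : Continuous f) : Nice (Ds ν f) :=
  Nice.sum _ fun i _ => (dm_nice h hf i).mul (dm_nice h hf i)

theorem QQ_gr (h : CC t ν) (hf : Continuous f) (T : ℝ) : Gr (QQ ν f T) :=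
  Gr.sum _ fun i _ => Gr.sum _ fun j _ => (((dm_nice h hf i).sb T 0).gr.mul ((dm_nice h hf j).sb T 0).gr).mul ((Am_nice h i j).sb T 0).gr

theorem HH_gr (h : CC t ν) (hf : Continuous f) (T : ℝ) : Gr (HH ν f T) :=
  Gr.sum _ fun i _ => Gr.sum _ fun j _ => (((dm_nice h hf i).sb T 1).pd j).gr.mul (((dm_nice h hf i).sb T 1).pd j).gr

theorem QQ_eq (h : CC t ν) (hf : Continuous f) (T : ℝ) (θ : Euc n) : ∃ v : Euc n, ‖v‖ ^ 2 = Ds ν f T θ ∧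
    QQ ν f T θ = vr (nuT ν T θ) (fun x => ⟪v, x⟫) := by
  refine ⟨WithLp.toLp 2 (fun i => dm ν f i T θ), ?_, ?_⟩
  · rw [norm_sq_sum]; simp [Ds, pow_two]
  · rw [← Am_quad h]; rfl

theorem QQ_le (h : CC t ν) (hf : Continuous f) {T M : ℝ} {θ : Euc n} (hM : CovLe (nuT ν T θ) M) :
    QQ ν f T θ ≤ M * Ds ν f T θ := by
  obtain ⟨v, h1, h2⟩ := QQ_eq h hf T θ
  rw [h2, ← h1]; exact hM v

theorem N_deriv (h : CC t ν) (hf : Continuous f) {T : ℝ} (hT : 0 < T) :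
    HasDerivAt (fun s => EE ν s (fun θ => mm ν f s θ * mm ν f s θ)) (EE ν T (Ds ν f T)) T := by
  have := ito h ((mm_nice h hf).mul (mm_nice h hf)) hT
  refine this.congr_deriv ?_
  congr 1
  funext θ
  rw [LL_mul (mm_nice h hf) (mm_nice h hf), mm_LL h hf]
  simp [Ds, dm_eq h hf]

theorem LL_Ds (h : CC t ν) (hf : Continuous f) (T : ℝ) (θ : Euc n) :
    LL ν (Ds ν f) T θ = HH ν f T θ - 2 * QQ ν f T θ := by
  have hn := dm_nice h hf
  have : Ds ν f = fun T θ => ∑ i, dm ν f i T θ * dm ν f i T θ := rfl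
  rw [this, LL_sum _ (fun i => (hn i).mul (hn i)), HH, QQ, Finset.mul_sum, ← Finset.sum_sub_distrib]
  refine Finset.sum_congr rfl fun i _ => ?_
  rw [LL_mul (hn i) (hn i), dm_LL h hf]
  have : ∑ j, dm ν f i T θ * dm ν f j T θ * Am ν i j T θ = dm ν f i T θ * ∑ j, Am ν i j T θ * dm ν f j T θ := by
    rw [Finset.mul_sum]; exact Finset.sum_congr rfl fun j _ => by ring
  rw [this]
  ring

theorem D_deriv (h : CC t ν) (hf : Continuous f) {T : ℝ} (hT : 0 < T) :
    HasDerivAt (fun s => EE ν s (Ds ν f s)) (EE ν T (HH ν f T) - 2 * EE ν T (QQ ν f T)) T := by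
  have := ito h (Ds_nice h hf) hT
  refine this.congr_deriv ?_
  have e : LL ν (Ds ν f) T = fun θ => HH ν f T θ - 2 * QQ ν f T θ := funext (LL_Ds h hf T)
  rw [e, EE_sub h hT.le (HH_gr h hf T) ((Gr.const 2).mul (QQ_gr h hf T)), EE_smul]

theorem bochner (h : CC t ν) (hf : Continuous f) {T : ℝ} (hT : 0 < T) :
    EE ν T (fun θ => MM ν T (mm ν f T) θ ^ 2) =
      EE ν T (HH ν f T) + EE ν T (Ds ν f T) / T - EE ν T (QQ ν f T) := by
  have hm := mm_SB h hf T
  have hn := dm_nice h hf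
  have e0 : (fun θ => MM ν T (mm ν f T) θ ^ 2) = fun θ => MM ν T (mm ν f T) θ * MM ν T (mm ν f T) θ := by
    funext θ; ring
  rw [e0, selfadj h hT hm (MM_gr h T hm) (MM_diff h T hm) (pd_MM_gr h T hm)]
  have e1 : ∀ θ, ∑ i, pd i (mm ν f T) θ * pd i (MM ν T (mm ν f T)) θ =
      (∑ i, dm ν f i T θ * MM ν T (dm ν f i T) θ) + ((1/T) * Ds ν f T θ - QQ ν f T θ) := by
    intro θ
    simp only [pd_MM h T hm, dm_eq h hf, mul_add, Finset.sum_add_distrib]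
    congr 1
    rw [Ds, QQ, Finset.mul_sum, ← Finset.sum_sub_distrib]
    refine Finset.sum_congr rfl fun i _ => ?_
    simp only [sub_mul, Finset.sum_sub_distrib, mul_sub]
    congr 1
    · simp [ite_div, ite_mul]; ring
    · rw [Finset.mul_sum]; exact Finset.sum_congr rfl fun j _ => by ring
  have g1 : ∀ i, Gr (fun θ => dm ν f i T θ * MM ν T (dm ν f i T) θ) := fun i =>
    ((hn i).sb T 0).gr.mul (MM_gr h T ((hn i).sb T))
  have gD : Gr (Ds ν f T) := ((Ds_nice h hf).sb T 0).gr
  simp only [e1]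
  rw [EE_add h hT.le (Gr.sum _ fun i _ => g1 i) (((Gr.const _).mul gD).sub (QQ_gr h hf T)),
    EE_sub h hT.le ((Gr.const _).mul gD) (QQ_gr h hf T), EE_smul, EE_sum h hT.le _ g1]
  have e2 : ∀ i, EE ν T (fun θ => dm ν f i T θ * MM ν T (dm ν f i T) θ) =
      EE ν T (fun θ => ∑ j, pd j (dm ν f i T) θ * pd j (dm ν f i T) θ) := fun i =>
    selfadj h hT ((hn i).sb T) ((hn i).sb T 0).gr ((hn i).d T) (fun j => (((hn i).sb T 1).pd j).gr)
  simp only [e2]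
  have e3 : EE ν T (HH ν f T) = ∑ i, EE ν T (fun θ => ∑ j, pd j (dm ν f i T) θ * pd j (dm ν f i T) θ) :=
    EE_sum h hT.le _ (fun i => Gr.sum _ fun j _ => (((hn i).sb T 1).pd j).gr.mul (((hn i).sb T 1).pd j).gr)
  rw [e3]
  ring

theorem EE_csq (h : CC t ν) {T : ℝ} (hT : 0 ≤ T) {u w : Euc n → ℝ} (hu : Gr u) (hw : Gr w) :
    EE ν T (fun θ => u θ * w θ) ^ 2 ≤ EE ν T (fun θ => u θ ^ 2) * EE ν T (fun θ => w θ ^ 2) := by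
  refine int_csq ?_ ?_ ((hu.mul hw).int h hT)
  · simpa only [pow_two] using (hu.mul hu).int h hT
  · simpa only [pow_two] using (hw.mul hw).int h hT

theorem D_csq (h : CC t ν) (hf : Continuous f) {T : ℝ} (hT : 0 < T) :
    EE ν T (Ds ν f T) ^ 2 ≤ EE ν T (fun θ => mm ν f T θ * mm ν f T θ) *
      (EE ν T (HH ν f T) + EE ν T (Ds ν f T) / T - EE ν T (QQ ν f T)) := by
  have hm := mm_SB h hf T
  have h1 := selfadj h hT hm (hm 0).gr (hm 1).diff (fun i => ((hm 1).pd i).gr)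
  have e : (fun θ => ∑ i, pd i (mm ν f T) θ * pd i (mm ν f T) θ) = Ds ν f T := by
    funext θ; simp only [Ds, dm_eq h hf]
  rw [e] at h1
  rw [← bochner h hf hT]
  have := EE_csq h hT.le (hm 0).gr (MM_gr h T hm)
  rw [h1] at this
  simpa only [pow_two] using this

end

theorem ode {N D D' g : ℝ → ℝ} {C T t : ℝ} (hT : 0 < T) (ht : 0 ≤ t) (hC : 0 ≤ C)
    (hN : ∀ s, 0 < s → 0 ≤ N s) (hD : ∀ s, 0 < s → 0 ≤ D s) (hg : ∀ s, 0 < s → 0 ≤ g s)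
    (dN : ∀ s, 0 < s → HasDerivAt N (D s) s) (dD : ∀ s, 0 < s → HasDerivAt D (D' s) s)
    (h1 : ∀ s, 0 < s → D s ^ 2 ≤ N s * g s) (h2 : ∀ s, 0 < s → g s - D s / s - D s / (t + s) ≤ D' s)
    (h3 : N T ≤ C * D T) {S : ℝ} (hS : T ≤ S) : T * (t + T) * N S ≤ C * (S * (t + S)) * D S := by
  have key0 : ∀ s, T ≤ s → s ≤ S → ∀ ε, 0 < ε →
      s * (t + s) * D s * (N S + ε) ≤ S * (t + S) * D S * (N s + ε) := by
    intro s hs hsS ε hε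
    have hs0 : 0 < s := hT.trans_le hs
    have hder : ∀ x, 0 < x → HasDerivAt (fun x => x * (t + x) * D x / (N x + ε))
        ((((1 * (t + x) + x * 1) * D x + x * (t + x) * D' x) * (N x + ε) - x * (t + x) * D x * D x) / (N x + ε) ^ 2) x := by
      intro x hx
      have := hN x hx
      exact ((((hasDerivAt_id x).mul ((hasDerivAt_id x).const_add t)).mul (dD x hx)).div
        ((dN x hx).add_const ε) (by positivity))
    have mono : MonotoneOn (fun x => x * (t + x) * D x / (N x + ε)) (Ici s) := by
      refine monotoneOn_of_deriv_nonneg (convex_Ici s) ?_ ?_ ?_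
      · intro x hx; exact (hder x (hs0.trans_le hx)).continuousAt.continuousWithinAt
      · intro x hx
        rw [interior_Ici] at hx
        exact (hder x (hs0.trans hx)).differentiableAt.differentiableWithinAt
      · intro x hx
        rw [interior_Ici] at hx
        have hx0 : 0 < x := hs0.trans hx
        rw [(hder x hx0).deriv]
        refine div_nonneg ?_ (sq_nonneg _)
        have a1 := h1 x hx0
        have a2 := h2 x hx0
        have a3 := hN x hx0
        have a4 := hg x hx0
        have tx : 0 < t + x := by linarith
        have a5 : x * (t + x) * (g x - D x / x - D x / (t + x)) ≤ x * (t + x) * D' x :=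
          mul_le_mul_of_nonneg_left a2 (by positivity)
        have a6 : x * (t + x) * (g x - D x / x - D x / (t + x)) = x * (t + x) * g x - (t + x) * D x - x * D x := by
          field_simp
        rw [a6] at a5
        have a7 : x * (t + x) * g x * (N x + ε) ≤ ((1 * (t + x) + x * 1) * D x + x * (t + x) * D' x) * (N x + ε) :=
          mul_le_mul_of_nonneg_right (by linarith) (by linarith)
        have a8 : x * (t + x) * (D x ^ 2) ≤ x * (t + x) * (g x * (N x + ε)) :=
          mul_le_mul_of_nonneg_left (by nlinarith [mul_nonneg a4 hε.le]) (by positivity)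
        nlinarith
    have := mono (self_mem_Ici) (mem_Ici.2 hsS) hsS
    have p1 : 0 < N s + ε := by linarith [hN s hs0]
    have p2 : 0 < N S + ε := by linarith [hN S (hs0.trans_le hsS)]
    simp only at this
    rwa [div_le_div_iff₀ p1 p2] at this
  have key : ∀ s, T ≤ s → s ≤ S → s * (t + s) * D s * N S ≤ S * (t + S) * D S * N s := by
    intro s hs hsS
    have c1 : Filter.Tendsto (fun ε : ℝ => s * (t + s) * D s * (N S + ε)) (nhdsWithin 0 (Ioi 0)) (nhds (s * (t + s) * D s * (N S + 0))) :=
      ((continuous_const.mul (continuous_const.add continuous_id)).tendsto' _ _ rfl).mono_left nhdsWithin_le_nhds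
    have c2 : Filter.Tendsto (fun ε : ℝ => S * (t + S) * D S * (N s + ε)) (nhdsWithin 0 (Ioi 0)) (nhds (S * (t + S) * D S * (N s + 0))) :=
      ((continuous_const.mul (continuous_const.add continuous_id)).tendsto' _ _ rfl).mono_left nhdsWithin_le_nhds
    have := le_of_tendsto_of_tendsto c1 c2 (Filter.eventually_of_mem self_mem_nhdsWithin fun ε hε => key0 s hs hsS ε hε)
    simpa using this
  have hS0 : 0 < S := hT.trans_le hS
  rcases (hN T hT).lt_or_eq with hNT | hNT
  · have k := key T le_rfl hS
    have e1 : T * (t + T) * N S * N T ≤ T * (t + T) * N S * (C * D T) :=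
      mul_le_mul_of_nonneg_left h3 (by have := hN S hS0; positivity)
    have e2 : C * (T * (t + T) * D T * N S) ≤ C * (S * (t + S) * D S * N T) := mul_le_mul_of_nonneg_left k hC
    refine le_of_mul_le_mul_right ?_ hNT
    linarith
  · rcases (hN S hS0).lt_or_eq with hNS | hNS
    · exfalso
      set c := S * (t + S) * D S / (T * (t + T) * N S) with hc
      have hDS := hD S hS0
      have hDc : ∀ s, T ≤ s → s ≤ S → D s ≤ c * N s := by
        intro s hs hsS
        have k := key s hs hsS
        have hs0 : 0 < s := hT.trans_le hs
        have : T * (t + T) * D s * N S ≤ s * (t + s) * D s * N S := by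
          refine mul_le_mul_of_nonneg_right (mul_le_mul_of_nonneg_right ?_ (hD s hs0)) hNS.le
          exact mul_le_mul hs (by linarith) (by linarith) hs0.le
        have p : 0 < T * (t + T) * N S := by positivity
        rw [hc, div_mul_eq_mul_div, le_div_iff₀ p]
        linarith
      have hder : ∀ x, 0 < x → HasDerivAt (fun x => N x * exp (-c * x)) (D x * exp (-c * x) + N x * (exp (-c * x) * (-c * 1))) x := fun x hx =>
        (dN x hx).mul (((hasDerivAt_id x).const_mul (-c)).exp)
      have anti : AntitoneOn (fun x => N x * exp (-c * x)) (Icc T S) := by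
        refine antitoneOn_of_deriv_nonpos (convex_Icc _ _) ?_ ?_ ?_
        · intro x hx; exact (hder x (hT.trans_le hx.1)).continuousAt.continuousWithinAt
        · intro x hx
          rw [interior_Icc] at hx
          exact (hder x (hT.trans hx.1)).differentiableAt.differentiableWithinAt
        · intro x hx
          rw [interior_Icc] at hx
          rw [(hder x (hT.trans hx.1)).deriv]
          have := mul_le_mul_of_nonneg_right (hDc x hx.1.le hx.2.le) (exp_pos (-c * x)).le
          linarith
      have := anti (left_mem_Icc.2 hS) (right_mem_Icc.2 hS) hS
      simp only [← hNT, zero_mul] at this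
      have := mul_pos hNS (exp_pos (-c * S))
      linarith
    · rw [← hNS, mul_zero]
      have := hD S hS0
      positivity

end

end KLS

end

section
open MeasureTheory Real Set
open scoped ENNReal RealInnerProductSpace

namespace KLS

noncomputable section

variable {n : ℕ} {t : ℝ} {ν : Measure (Euc n)}

/-- Poincaré inequality for the law of `θ_T` -/
def PoinE (ν : Measure (Euc n)) (T C : ℝ) : Prop :=
  ∀ F, SB F → EE ν T (fun θ => F θ ^ 2) - EE ν T F ^ 2 ≤ C * EE ν T (gsq F)

section
variable {f : Euc n → ℝ}

theorem nuT_Poin (h : CC t ν) {s : ℝ} (hs : 0 < t + s) (θ : Euc n) : Poin (nuT ν s θ) (1 / (t + s)) :=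
  (h.nuT s θ).poin hs

theorem vr_le_mm (h : CC t ν) (hf : SB f) {s : ℝ} (hs : 0 < t + s) (θ : Euc n) :
    vr (nuT ν s θ) f ≤ 1 / (t + s) * mm ν (gsq f) s θ := nuT_Poin h hs θ f hf

theorem D_le (h : CC t ν) (hf : SB f) {s : ℝ} (hs0 : 0 ≤ s) (hs : 0 < t + s) :
    EE ν s (Ds ν f s) ≤ 1 / (t + s) ^ 2 * ∫ x, gsq f x ∂ν := by
  have c := (hf 0).continuous
  have cg := (hf 1).gsq.continuous
  rw [← EE_mm h hs0 cg, ← EE_smul]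
  refine EE_mono h hs0 ((Ds_nice h c).sb s 0).gr ((Gr.const _).mul (mm_SB h cg s 0).gr) fun θ => ?_
  rw [Ds_eq h c]
  refine (gsq_mm_le h c ((nuT_Poin h hs θ).covLe (h.nuT s θ))).trans ?_
  have := mul_le_mul_of_nonneg_left (vr_le_mm h hf hs θ) (by positivity : 0 ≤ 1 / (t + s))
  refine this.trans (le_of_eq ?_)
  rw [← mul_assoc]; congr 1; field_simp

theorem N_ge (h : CC t ν) (hf : SB f) {s : ℝ} (hs0 : 0 ≤ s) (hs : 0 < t + s) :
    ∫ x, f x ^ 2 ∂ν - 1 / (t + s) * ∫ x, gsq f x ∂ν ≤ EE ν s (fun θ => mm ν f s θ * mm ν f s θ) := by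
  have c := (hf 0).continuous
  have cg := (hf 1).gsq.continuous
  have c2 : Continuous fun x => f x ^ 2 := c.pow 2
  have g1 := (mm_SB h c2 s 0).gr
  have g2 := (mm_SB h cg s 0).gr
  have g3 := (mm_SB h c s 0).gr
  rw [← EE_mm h hs0 cg, ← EE_mm h hs0 c2, ← EE_smul, ← EE_sub h hs0 g1 ((Gr.const _).mul g2)]
  refine EE_mono h hs0 (g1.sub ((Gr.const _).mul g2)) (g3.mul g3) fun θ => ?_
  have := vr_le_mm h hf hs θ
  rw [vr_mm] at this
  nlinarith

theorem partA0 (h : CC t ν) (ht : 0 < t) {T C : ℝ} (hT : 0 < T) (hC : 0 ≤ C) (hP : PoinE ν T C)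
    (hf : SB f) (hm : ∫ x, f x ∂ν = 0) : T * (t + T) * ∫ x, f x ^ 2 ∂ν ≤ C * ∫ x, gsq f x ∂ν := by
  have c := (hf 0).continuous
  have hnn : ∀ s θ, 0 ≤ Ds ν f s θ := fun s θ => Finset.sum_nonneg fun i _ => mul_self_nonneg _
  have key : ∀ S, T ≤ S → T * (t + T) * EE ν S (fun θ => mm ν f S θ * mm ν f S θ) ≤
      C * (S * (t + S)) * EE ν S (Ds ν f S) := by
    intro S hS
    refine ode (N := fun S => EE ν S (fun θ => mm ν f S θ * mm ν f S θ)) (D := fun S => EE ν S (Ds ν f S))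
      (D' := fun S => EE ν S (HH ν f S) - 2 * EE ν S (QQ ν f S))
      (g := fun S => EE ν S (HH ν f S) + EE ν S (Ds ν f S) / S - EE ν S (QQ ν f S))
      hT ht.le hC ?_ ?_ ?_ ?_ ?_ ?_ ?_ ?_ hS
    · exact fun s _ => EE_nonneg fun θ => mul_self_nonneg _
    · exact fun s _ => EE_nonneg (hnn s)
    · intro s hs
      rw [← bochner h c hs]
      exact EE_nonneg fun θ => sq_nonneg _
    · exact fun s hs => N_deriv h c hs
    · exact fun s hs => D_deriv h c hs
    · exact fun s hs => D_csq h c hs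
    · intro s hs
      have hts : 0 < t + s := by linarith
      have : EE ν s (QQ ν f s) ≤ 1 / (t + s) * EE ν s (Ds ν f s) := by
        rw [← EE_smul]
        exact EE_mono h hs.le (QQ_gr h c s) ((Gr.const _).mul ((Ds_nice h c).sb s 0).gr) fun θ =>
          QQ_le h c ((nuT_Poin h hts θ).covLe (h.nuT s θ))
      have e : EE ν s (Ds ν f s) / (t + s) = 1 / (t + s) * EE ν s (Ds ν f s) := by ring
      rw [e]
      linarith
    · have := hP _ (mm_SB h c T)
      rw [EE_mm h hT.le c, hm] at this
      have e : gsq (mm ν f T) = Ds ν f T := by funext θ; rw [Ds_eq h c]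
      rw [e] at this
      simpa [pow_two] using this
  have key2 : ∀ S, T ≤ S → T * (t + T) * (∫ x, f x ^ 2 ∂ν - 1 / (t + S) * ∫ x, gsq f x ∂ν) ≤ C * ∫ x, gsq f x ∂ν := by
    intro S hS
    have hS0 : 0 < S := hT.trans_le hS
    have p : 0 < t + S := by linarith
    have j0 : 0 ≤ ∫ x, gsq f x ∂ν := integral_nonneg fun x => gsq_nonneg f x
    refine (mul_le_mul_of_nonneg_left (N_ge h hf hS0.le p) (by positivity)).trans ((key S hS).trans ?_)
    refine (mul_le_mul_of_nonneg_left (D_le h hf hS0.le p) (by positivity)).trans ?_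
    have : C * (S * (t + S)) * (1 / (t + S) ^ 2 * ∫ x, gsq f x ∂ν) = (S / (t + S)) * (C * ∫ x, gsq f x ∂ν) := by
      field_simp
    rw [this]
    refine mul_le_of_le_one_left (by positivity) ?_
    rw [div_le_one p]; linarith
  have lim : Filter.Tendsto (fun S => T * (t + T) * (∫ x, f x ^ 2 ∂ν - 1 / (t + S) * ∫ x, gsq f x ∂ν)) Filter.atTop
      (nhds (T * (t + T) * (∫ x, f x ^ 2 ∂ν - 0 * ∫ x, gsq f x ∂ν))) := by
    refine Filter.Tendsto.const_mul _ (Filter.Tendsto.const_sub _ (Filter.Tendsto.mul_const _ ?_))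
    simp only [one_div]
    exact tendsto_inv_atTop_zero.comp (Filter.tendsto_atTop_add_const_left _ t Filter.tendsto_id)
  have := le_of_tendsto lim (Filter.eventually_atTop.2 ⟨T, fun S hS => key2 S hS⟩)
  simpa using this

theorem SB.sub_const (hf : SB f) (c : ℝ) : SB (fun x => f x - c) := fun k => (hf k).sub (Cb.const c k)

theorem partA (h : CC t ν) (ht : 0 < t) {T C : ℝ} (hT : 0 < T) (hC : 0 ≤ C) (hP : PoinE ν T C) :
    Poin ν (C / (T * (t + T))) := by
  intro f hf
  have := h.prob
  have i1 := (hf 0).integrable ν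
  have := partA0 h ht hT hC hP (hf.sub_const (∫ x, f x ∂ν)) (by
    rw [integral_sub i1 (integrable_const _)]; simp)
  rw [gsq_sub_const] at this
  have e := vr_eq i1 (((hf 0).pow 2).integrable ν) (∫ x, f x ∂ν)
  simp only [sub_self, ne_eq, OfNat.ofNat_ne_zero, not_false_eq_true, zero_pow, sub_zero] at e
  rw [← e] at this
  rw [div_mul_eq_mul_div, le_div_iff₀ (by positivity)]
  linarith

end

end

end KLS

end

section
open MeasureTheory Real Set
open scoped ENNReal RealInnerProductSpace

namespace KLS

noncomputable section

variable {n : ℕ} {t : ℝ} {ν : Measure (Euc n)}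

theorem pd_affine {f : Euc n → ℝ} (hf : Differentiable ℝ f) (c : Euc n) (s : ℝ) (i : Fin n) :
    pd i (fun z => f (c + s • z)) = fun z => s * pd i f (c + s • z) := by
  funext z
  have h1 : HasFDerivAt (fun z : Euc n => c + s • z) (s • ContinuousLinearMap.id ℝ (Euc n)) z :=
    ((hasFDerivAt_id z).const_smul s).const_add c
  have : HasFDerivAt (fun z => f (c + s • z)) _ z := (hf (c + s • z)).hasFDerivAt.comp z h1
  rw [pd, this.fderiv]
  simp [pd]

theorem Cb.affine : ∀ {k : ℕ} {f : Euc n → ℝ}, Cb k f → ∀ (c : Euc n) (s : ℝ), Cb k (fun z => f (c + s • z)) := by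
  have z : ∀ {f : Euc n → ℝ}, Cb 0 f → ∀ (c : Euc n) (s : ℝ), Cb 0 (fun z => f (c + s • z)) := by
    intro f hf c s
    obtain ⟨h1, K, hK⟩ := hf.zero
    exact ⟨h1.comp (by fun_prop), K, fun x => hK _⟩
  intro k
  induction k with
  | zero => exact fun h => z h
  | succ k ih =>
    intro f hf c s
    refine ⟨z (hf.mono (Nat.zero_le _)) c s, hf.diff.comp (by fun_prop), fun i => ?_⟩
    rw [pd_affine hf.diff]
    exact (ih (hf.pd i) c s).const_mul s

/-- Gaussian average -/
def W (T : ℝ) (F : Euc n → ℝ) (x : Euc n) : ℝ := ∫ z, F (th T (x, z)) ∂(gam n)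

theorem th_sec (T : ℝ) (F : Euc n → ℝ) (x : Euc n) :
    (fun z => F (th T (x, z))) = fun z => F (T • x + √T • z) := rfl

theorem EE_W (h : CC t ν) {T : ℝ} (hT : 0 ≤ T) {G : Euc n → ℝ} (hG : Gr G) : EE ν T G = ∫ x, W T G x ∂ν := by
  have := h.prob
  exact integral_prod _ (hG.int h hT)

theorem W_fd {F : Euc n → ℝ} (hF : Cb 1 F) (T : ℝ) (x : Euc n) :
    DifferentiableAt ℝ (W T F) x ∧ ∀ i, pd i (W T F) x = T * W T (pd i F) x := by
  have hlip : ∀ x, ‖fderiv ℝ F x‖ ≤ ∑ i, |pd i F x| := by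
    intro x
    refine ContinuousLinearMap.opNorm_le_bound _ (Finset.sum_nonneg fun i _ => abs_nonneg _) fun v => ?_
    rw [fderiv_apply_eq, Finset.sum_mul]
    refine (norm_sum_le _ _).trans (Finset.sum_le_sum fun i _ => ?_)
    rw [norm_mul, mul_comm]
    exact mul_le_mul_of_nonneg_left (PiLp.norm_apply_le v i) (abs_nonneg _)
  have hb : ∃ K, ∀ x, ∑ i, |pd i F x| ≤ K := by
    choose K _ hK using fun i => (hF.pd i).bdd
    exact ⟨∑ i, K i, fun x => Finset.sum_le_sum fun i _ => hK i x⟩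
  obtain ⟨K, hK⟩ := hb
  have cf : Continuous (fderiv ℝ F) := by
    have : fderiv ℝ F = fun x => ∑ i, pd i F x • innerSL ℝ (ee i) := by
      funext x
      refine ContinuousLinearMap.ext fun v => ?_
      rw [fderiv_apply_eq]
      simp only [ContinuousLinearMap.sum_apply, ContinuousLinearMap.smul_apply, innerSL_apply_apply, smul_eq_mul]
      refine Finset.sum_congr rfl fun k _ => ?_
      rw [real_inner_comm, inner_ee, mul_comm]
    rw [this]
    exact continuous_finsetSum _ fun i _ => (hF.pd i).continuous.smul continuous_const
  have key := hasFDerivAt_integral_of_dominated_of_fderiv_le (μ := gam n) (𝕜 := ℝ) (x₀ := x) (s := univ)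
    (F := fun x z => F (T • x + √T • z)) (F' := fun x z => T • fderiv ℝ F (T • x + √T • z))
    (bound := fun _ => |T| * K) Filter.univ_mem
    (Filter.Eventually.of_forall fun y => (hF.continuous.comp (by fun_prop)).aestronglyMeasurable)
    ((hF.affine (T • x) (√T)).integrable _)
    (Continuous.aestronglyMeasurable ((cf.comp (by fun_prop)).const_smul T))
    (Filter.Eventually.of_forall fun z y _ => by
      rw [norm_smul, Real.norm_eq_abs]
      exact mul_le_mul_of_nonneg_left ((hlip _).trans (hK _)) (abs_nonneg T))
    (integrable_const _)
    (Filter.Eventually.of_forall fun z y _ => by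
      have h1 : HasFDerivAt (fun y : Euc n => T • y + √T • z) (T • ContinuousLinearMap.id ℝ (Euc n)) y :=
        ((hasFDerivAt_id y).const_smul T).add_const _
      have : HasFDerivAt (fun y => F (T • y + √T • z)) _ y := (hF.diff _).hasFDerivAt.comp y h1
      refine this.congr_fderiv (ContinuousLinearMap.ext fun v => ?_)
      simp)
  have key' : HasFDerivAt (W T F) (∫ z, T • fderiv ℝ F (T • x + √T • z) ∂(gam n)) x := key
  refine ⟨key'.differentiableAt, fun i => ?_⟩
  rw [pd, key'.fderiv, ContinuousLinearMap.integral_apply]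
  · simp only [ContinuousLinearMap.smul_apply, smul_eq_mul]
    rw [integral_const_mul]
    rfl
  · refine (integrable_const (|T| * K)).mono' (Continuous.aestronglyMeasurable ((cf.comp (by fun_prop)).const_smul T))
      (Filter.Eventually.of_forall fun z => ?_)
    rw [norm_smul, Real.norm_eq_abs]
    exact mul_le_mul_of_nonneg_left ((hlip _).trans (hK _)) (abs_nonneg T)

theorem W_diff {F : Euc n → ℝ} (hF : Cb 1 F) (T : ℝ) : Differentiable ℝ (W T F) := fun x => (W_fd hF T x).1

theorem W_pd {F : Euc n → ℝ} (hF : Cb 1 F) (T : ℝ) (i : Fin n) : pd i (W T F) = fun x => T * W T (pd i F) x :=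
  funext fun x => (W_fd hF T x).2 i

theorem W_cb (T : ℝ) : ∀ {k : ℕ} {F : Euc n → ℝ}, Cb (k + 1) F → Cb k (W T F) := by
  have z : ∀ {F : Euc n → ℝ}, Cb 1 F → Cb 0 (W T F) := by
    intro F hF
    obtain ⟨K, hK⟩ := hF.zero.2
    refine ⟨(W_diff hF T).continuous, K, fun x => ?_⟩
    have := norm_integral_le_of_norm_le_const (μ := gam n) (f := fun z => F (th T (x, z))) (C := K)
      (Filter.Eventually.of_forall fun z => hK _)
    simpa [W] using this
  intro k
  induction k with
  | zero => exact fun h => z h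
  | succ k ih =>
    intro F hF
    refine ⟨z (hF.mono (by omega)), W_diff (hF.mono (by omega)) T, fun i => ?_⟩
    rw [W_pd (hF.mono (by omega))]
    exact (ih (hF.pd i)).const_mul T

theorem W_SB {F : Euc n → ℝ} (hF : SB F) (T : ℝ) : SB (W T F) := fun k => W_cb T (hF (k+1))

theorem gam_lp {F : Euc n → ℝ} (hF : Gr F) : MemLp F 2 (gam n) := by
  obtain ⟨hc, K, c, hK, hc0, h⟩ := hF
  refine (memLp_two_iff_integrable_sq hc.aestronglyMeasurable).2 ?_
  refine gam_int_of_growth (K := K ^ 2) (c := 2 * c) (hc.pow 2).aestronglyMeasurable fun x => ?_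
  rw [abs_pow]
  refine (pow_le_pow_left₀ (abs_nonneg _) (h x) 2).trans (le_of_eq ?_)
  rw [mul_pow, ← exp_nat_mul]; congr 2; push_cast; ring

theorem stein_gr {H : Euc n → ℝ} (hd : Differentiable ℝ H) (i : Fin n) (h1 : Gr H) (h2 : Gr (pd i H)) :
    ∫ x, pd i H x ∂(gam n) = ∫ x, x i * H x ∂(gam n) := by
  obtain ⟨c1, K, a, hK, ha, k1⟩ := h1
  obtain ⟨c2, L, b, hL, hb, k2⟩ := h2
  refine stein hd i c2 (K := K + L) (c := a + b) (fun x => (k1 x).trans ?_) (fun x => (k2 x).trans ?_)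
  · exact mul_le_mul (by linarith) (exp_le_exp.2 (mul_le_mul_of_nonneg_right (by linarith) (norm_nonneg _))) (exp_pos _).le (by linarith)
  · exact mul_le_mul (by linarith) (exp_le_exp.2 (mul_le_mul_of_nonneg_right (by linarith) (norm_nonneg _))) (exp_pos _).le (by linarith)

theorem Gr.inner (v : Euc n) : Gr (fun x : Euc n => ⟪v, x⟫) := by
  rw [inner_lin]
  exact Gr.sum _ fun i _ => (Gr.const _).mul (Gr.coord i)

theorem inner_diff (v : Euc n) : Differentiable ℝ (fun x : Euc n => ⟪v, x⟫) :=
  fun x => (innerSL ℝ v).differentiableAt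

theorem gam_mean (i : Fin n) : ∫ x : Euc n, x i ∂(gam n) = 0 := by
  have e : pd i (fun _ : Euc n => (1:ℝ)) = fun _ => 0 := by funext x; simp [pd]
  have := stein_gr (n := n) (H := fun _ => 1) (by fun_prop) i (Gr.const 1) (by rw [e]; exact Gr.const 0)
  rw [e] at this
  simpa using this.symm

theorem gam_inner (v : Euc n) : ∫ x : Euc n, ⟪v, x⟫ ∂(gam n) = 0 := by
  rw [inner_lin, integral_finsetSum _ fun i _ => ((gam_lp (Gr.coord i)).integrable (by norm_num)).const_mul _]
  simp [integral_const_mul, gam_mean]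

theorem gam_inner_sq (v : Euc n) : ∫ x : Euc n, ⟪v, x⟫ ^ 2 ∂(gam n) = ‖v‖ ^ 2 := by
  have e : ∀ i, pd i (fun x : Euc n => ⟪v, x⟫) = fun _ => v i := fun i => funext fun x => grad_inner v i x
  have h1 : ∀ i, ∫ x : Euc n, x i * ⟪v, x⟫ ∂(gam n) = v i := by
    intro i
    rw [← stein_gr (inner_diff v) i (Gr.inner v) (by rw [e]; exact Gr.const _), e]
    simp
  have e2 : ∀ x : Euc n, ⟪v, x⟫ ^ 2 = ∑ i, v i * (x i * ⟪v, x⟫) := by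
    intro x
    nth_rw 1 [pow_two, inner_sum]
    rw [Finset.sum_mul]
    exact Finset.sum_congr rfl fun i _ => by ring
  simp only [e2]
  rw [integral_finsetSum _ fun i _ => (L2.m (gam_lp (Gr.coord i)) (gam_lp (Gr.inner v))).const_mul _, norm_sq_sum]
  refine Finset.sum_congr rfl fun i _ => ?_
  rw [integral_const_mul, h1]; ring

theorem gam_cov : CovLe (gam n) 1 := by
  intro v
  rw [vr, gam_inner_sq, gam_inner]; simp

/-- `a` part -/
def Wv (T : ℝ) (F : Euc n → ℝ) (x : Euc n) : ℝ := W T (fun y => F y ^ 2) x - W T F x ^ 2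

theorem Wv_eq (T : ℝ) (F : Euc n → ℝ) (x : Euc n) : Wv T F x = vr (gam n) (fun z => F (T • x + √T • z)) := rfl

theorem Wv_le {F : Euc n → ℝ} (hF : Cb 2 F) {T : ℝ} (hT : 0 ≤ T) (x : Euc n) : Wv T F x ≤ T * W T (gsq F) x := by
  rw [Wv_eq]
  refine (ul_poin one_pos gam_ul (hF.affine _ _)).trans (le_of_eq ?_)
  rw [div_one, one_mul, W, ← integral_const_mul]
  congr 1
  funext z
  simp only [gsq, pd_affine hF.diff, mul_pow, sq_sqrt hT, Finset.mul_sum, th]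

theorem W_grad {F : Euc n → ℝ} (hF : Cb 2 F) {T : ℝ} (hT : 0 ≤ T) (x : Euc n) : gsq (W T F) x ≤ T * Wv T F x := by
  have hF1 : Cb 1 F := hF.of_succ
  have hs : Cb 2 (fun z => F (T • x + √T • z)) := hF.affine _ _
  have e : ∀ i, pd i (W T F) x = √T * cv (gam n) (fun z => z i) (fun z => F (T • x + √T • z)) := by
    intro i
    rw [W_pd hF1, cv, gam_mean, zero_mul, sub_zero, ← stein_gr hs.diff i hs.gr (hs.pd i).gr, pd_affine hF.diff,
      integral_const_mul, ← mul_assoc, mul_self_sqrt hT]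
    rfl
  have := bessel (gam_cov (n := n)) (fun i => gam_lp (Gr.coord i)) (gam_lp hs.gr)
  rw [one_mul, ← Wv_eq] at this
  rw [gsq]
  simp only [e, mul_pow, sq_sqrt hT, ← Finset.mul_sum]
  exact mul_le_mul_of_nonneg_left this hT

def vE (ν : Measure (Euc n)) (T : ℝ) (F : Euc n → ℝ) : ℝ := EE ν T (fun θ => F θ ^ 2) - EE ν T F ^ 2

theorem vE_split (h : CC t ν) {T : ℝ} (hT : 0 ≤ T) {F : Euc n → ℝ} (hF : Cb 1 F) :
    vE ν T F = ∫ x, Wv T F x ∂ν + vr ν (W T F) := by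
  have := h.prob
  have i1 := (W_cb T (hF.pow 2)).integrable ν
  have i2 := ((W_cb T hF).pow 2).integrable ν
  simp only [vE, Wv, vr]
  rw [EE_W h hT (hF.pow 2).gr, EE_W h hT hF.gr, integral_sub i1 i2]
  ring

theorem vE_a (h : CC t ν) {T : ℝ} (hT : 0 ≤ T) {F : Euc n → ℝ} (hF : SB F) :
    ∫ x, Wv T F x ∂ν ≤ T * EE ν T (gsq F) := by
  have := h.prob
  have i1 := (W_cb T ((hF 1).pow 2)).integrable ν
  have i2 := ((W_cb T (hF 1)).pow 2).integrable ν
  have c3 : Cb 0 (W T (gsq F)) := W_cb T (hF 2).gsq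
  rw [EE_W h hT (hF 1).gsq.gr, ← integral_const_mul]
  exact integral_mono (isub i1 i2) ((c3.integrable ν).const_mul T) fun x => Wv_le (hF 2) hT x

theorem vE_b (h : CC t ν) {T P : ℝ} (hT : 0 ≤ T) (hP0 : 0 ≤ P) (hP : Poin ν P) {F : Euc n → ℝ} (hF : SB F) :
    vr ν (W T F) * (1 + P * T) ≤ P * T * vE ν T F := by
  have := h.prob
  have i1 := (W_cb T ((hF 1).pow 2)).integrable ν
  have i2 := ((W_cb T (hF 1)).pow 2).integrable ν
  have h1 := hP _ (W_SB hF T)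
  have h2 : ∫ x, gsq (W T F) x ∂ν ≤ T * ∫ x, Wv T F x ∂ν := by
    rw [← integral_const_mul]
    exact integral_mono ((W_SB hF T 1).gsq.integrable ν) ((isub i1 i2).const_mul T) fun x => W_grad (hF 2) hT x
  have h3 := mul_le_mul_of_nonneg_left h2 hP0
  rw [vE_split h hT (hF 1)]
  nlinarith

theorem vE_le (h : CC t ν) {T P : ℝ} (hT : 0 ≤ T) (hP0 : 0 ≤ P) (hP : Poin ν P) {F : Euc n → ℝ} (hF : SB F) :
    vE ν T F * (1 + P * T) ≤ (T * (1 + P * T) + P ^ 2 * T ^ 3) * EE ν T (gsq F) +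
      P * T ^ 2 * ∑ i, EE ν T (pd i F) ^ 2 := by
  have := h.prob
  have h1 := hP _ (W_SB hF T)
  have g2 : ∀ i, Gr (fun θ => pd i F θ ^ 2) := fun i => ((hF.pd i 0).pow 2).gr
  have eJ : EE ν T (gsq F) = ∑ i, EE ν T (fun θ => pd i F θ ^ 2) := EE_sum h hT _ g2
  have e1 : ∫ x, gsq (W T F) x ∂ν = T ^ 2 * ∑ i, (vr ν (W T (pd i F)) + EE ν T (pd i F) ^ 2) := by
    have : gsq (W T F) = fun x => ∑ i, T ^ 2 * W T (pd i F) x ^ 2 := by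
      funext x; simp only [gsq, W_pd (hF 1), mul_pow]
    rw [this, integral_finsetSum _ fun i _ => (((W_SB (hF.pd i) T 0).pow 2).integrable ν).const_mul _, Finset.mul_sum]
    refine Finset.sum_congr rfl fun i _ => ?_
    rw [integral_const_mul, vr, EE_W h hT (hF.pd i 0).gr]; ring
  rw [e1] at h1
  have h2 : (∑ i, vr ν (W T (pd i F))) * (1 + P * T) ≤ P * T * (EE ν T (gsq F) - ∑ i, EE ν T (pd i F) ^ 2) := by
    rw [eJ, ← Finset.sum_sub_distrib, Finset.sum_mul, Finset.mul_sum]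
    exact Finset.sum_le_sum fun i _ => vE_b h hT hP0 hP (hF.pd i)
  rw [Finset.sum_add_distrib] at h1
  have h3 := vE_a h hT hF
  rw [vE_split h hT (hF 1)]
  have p : 0 ≤ 1 + P * T := by positivity
  have h4 := mul_le_mul_of_nonneg_right h1 p
  have h5 := mul_le_mul_of_nonneg_right h3 p
  have h6 := mul_le_mul_of_nonneg_left h2 (by positivity : 0 ≤ P * T ^ 2)
  nlinarith

theorem EE_dct (h : CC t ν) {T : ℝ} (hT : 0 ≤ T) {G : ℕ → Euc n → ℝ} {g B : Euc n → ℝ} (hG : ∀ k, Continuous (G k))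
    (hB : Gr B) (hb : ∀ k x, |G k x| ≤ B x) (hl : ∀ x, Filter.Tendsto (fun k => G k x) Filter.atTop (nhds (g x))) :
    Filter.Tendsto (fun k => EE ν T (G k)) Filter.atTop (nhds (EE ν T g)) :=
  tendsto_integral_of_dominated_convergence (fun p => B (th T p))
    (fun k => ((hG k).comp (th_cont T)).aestronglyMeasurable) (hB.int h hT)
    (fun k => Filter.Eventually.of_forall fun p => hb k _) (Filter.Eventually.of_forall fun p => hl _)

end

end KLS

end

section
open MeasureTheory Real Set
open scoped ENNReal RealInnerProductSpace

namespace KLS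

noncomputable section

variable {n : ℕ} {t : ℝ} {ν : Measure (Euc n)}

theorem Gr.abs {f : Euc n → ℝ} (h : Gr f) : Gr (fun x => |f x|) := by
  obtain ⟨c, K, a, hK, ha, h⟩ := h
  exact ⟨c.abs, K, a, hK, ha, fun x => by rw [abs_abs]; exact h x⟩

theorem trig_fd (a b : ℝ) (v : Euc n) (x : Euc n) :
    HasFDerivAt (fun x : Euc n => a * sin ⟪v, x⟫ + b * cos ⟪v, x⟫)
      ((a * cos ⟪v, x⟫ - b * sin ⟪v, x⟫) • innerSL ℝ v) x := by
  have h0 : HasFDerivAt (fun x : Euc n => ⟪v, x⟫) (innerSL ℝ v) x := (innerSL ℝ v).hasFDerivAt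
  have h1 := (h0.sin.const_mul a).add (h0.cos.const_mul b)
  refine (show HasFDerivAt (fun x : Euc n => a * sin ⟪v, x⟫ + b * cos ⟪v, x⟫) _ x from h1).congr_fderiv
    (ContinuousLinearMap.ext fun w => ?_)
  simp
  ring

theorem trig_pd (a b : ℝ) (v : Euc n) (i : Fin n) : pd i (fun x : Euc n => a * sin ⟪v, x⟫ + b * cos ⟪v, x⟫) =
    fun x => (-(b * v i)) * sin ⟪v, x⟫ + (a * v i) * cos ⟪v, x⟫ := by
  funext x
  rw [pd, (trig_fd a b v x).fderiv]
  simp [inner_ee]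
  ring

theorem trig_cb (v : Euc n) : ∀ (k : ℕ) (a b : ℝ), Cb k (fun x : Euc n => a * sin ⟪v, x⟫ + b * cos ⟪v, x⟫) := by
  have z : ∀ a b : ℝ, Cb 0 (fun x : Euc n => a * sin ⟪v, x⟫ + b * cos ⟪v, x⟫) := by
    intro a b
    refine ⟨by fun_prop, |a| + |b|, fun x => (abs_add_le _ _).trans ?_⟩
    rw [abs_mul, abs_mul]
    exact add_le_add (mul_le_of_le_one_right (abs_nonneg _) (abs_sin_le_one _))
      (mul_le_of_le_one_right (abs_nonneg _) (abs_cos_le_one _))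
  intro k
  induction k with
  | zero => exact z
  | succ k ih =>
    intro a b
    refine ⟨z a b, fun x => (trig_fd a b v x).differentiableAt, fun i => ?_⟩
    rw [trig_pd]
    exact ih _ _

theorem sin_lim (y : ℝ) : Filter.Tendsto (fun k : ℕ => ((k:ℝ) + 1) * sin (y / (k + 1))) Filter.atTop (nhds y) := by
  have h : HasDerivAt (fun s => sin (y * s)) (cos (y * 0) * (y * 1)) 0 :=
    ((hasDerivAt_id (0:ℝ)).const_mul y).sin
  rw [hasDerivAt_iff_tendsto_slope_zero] at h
  simp only [mul_zero, cos_zero, mul_one, one_mul, zero_add, sin_zero, sub_zero, smul_eq_mul] at h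
  have l : Filter.Tendsto (fun k : ℕ => (1:ℝ) / (k + 1)) Filter.atTop (nhdsWithin 0 {0}ᶜ) := by
    refine tendsto_nhdsWithin_iff.2 ⟨tendsto_one_div_add_atTop_nhds_zero_nat, Filter.Eventually.of_forall fun k => ?_⟩
    have : (0:ℝ) < 1 / ((k:ℝ) + 1) := by positivity
    exact this.ne'
  have := h.comp l
  refine this.congr fun k => ?_
  simp only [Function.comp]
  rw [one_div, inv_inv]
  rfl

theorem PoinE.lin (h : CC t ν) {T C : ℝ} (hT : 0 ≤ T) (hP : PoinE ν T C) {F : Euc n → ℝ} (hF : SB F) (v : Euc n) :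
    vE ν T (fun θ => F θ + ⟪v, θ⟫) ≤ C * EE ν T (fun θ => ∑ i, (pd i F θ + v i) ^ 2) := by
  set g : ℕ → Euc n → ℝ := fun k θ => ((k:ℝ) + 1) * sin ⟪((k:ℝ) + 1)⁻¹ • v, θ⟫ with hg
  have gform : ∀ k, g k = fun θ => ((k:ℝ) + 1) * sin ⟪((k:ℝ) + 1)⁻¹ • v, θ⟫ + 0 * cos ⟪((k:ℝ) + 1)⁻¹ • v, θ⟫ := by
    intro k; funext θ; simp [hg]
  have gsb : ∀ k, SB (g k) := fun k l => by rw [gform]; exact trig_cb _ l _ _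
  have gpd : ∀ k i, pd i (g k) = fun θ => v i * cos ⟪((k:ℝ) + 1)⁻¹ • v, θ⟫ := by
    intro k i
    rw [gform, trig_pd]
    funext θ
    have : ((k:ℝ) + 1) ≠ 0 := by positivity
    simp
    field_simp
    simp
  have ginner : ∀ (k : ℕ) (θ : Euc n), ⟪((k:ℝ) + 1)⁻¹ • v, θ⟫ = ⟪v, θ⟫ / ((k:ℝ) + 1) := by
    intro k θ
    rw [real_inner_smul_left]; field_simp
  have glim : ∀ θ, Filter.Tendsto (fun k => g k θ) Filter.atTop (nhds ⟪v, θ⟫) := by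
    intro θ
    simp only [hg, ginner]
    exact sin_lim _
  have gb : ∀ k θ, |g k θ| ≤ |⟪v, θ⟫| := by
    intro k θ
    have p : (0:ℝ) < (k:ℝ) + 1 := by positivity
    simp only [hg, ginner]
    rw [abs_mul, abs_of_pos p]
    refine (mul_le_mul_of_nonneg_left (abs_sin_le_abs) p.le).trans (le_of_eq ?_)
    rw [abs_div, abs_of_pos p]; field_simp
  have cfl : ∀ (i : Fin n) θ, Filter.Tendsto (fun k => pd i (g k) θ) Filter.atTop (nhds (v i)) := by
    intro i θ
    simp only [gpd, ginner]
    have : Filter.Tendsto (fun k : ℕ => v i * cos (⟪v, θ⟫ / ((k:ℝ) + 1))) Filter.atTop (nhds (v i * cos (⟪v, θ⟫ * 0))) := by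
      refine Filter.Tendsto.const_mul _ ((continuous_cos.tendsto _).comp ?_)
      have := (tendsto_one_div_add_atTop_nhds_zero_nat (𝕜 := ℝ)).const_mul ⟪v, θ⟫
      refine this.congr fun k => by ring
    simpa using this
  have Fg : ∀ k, SB (fun θ => F θ + g k θ) := fun k l => (hF l).add (gsb k l)
  have cF := (hF 0).continuous
  have bF : Gr (fun θ => |F θ| + |⟪v, θ⟫|) := (hF 0).gr.abs.add (Gr.inner v).abs
  have b1 : ∀ k θ, |F θ + g k θ| ≤ |F θ| + |⟪v, θ⟫| := fun k θ =>
    (abs_add_le _ _).trans (add_le_add le_rfl (gb k θ))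
  have l1 := EE_dct h hT (G := fun k θ => F θ + g k θ) (fun k => (Fg k 0).continuous) bF b1
    (fun θ => (glim θ).const_add (F θ))
  have l2 := EE_dct h hT (G := fun k θ => (F θ + g k θ) ^ 2) (fun k => ((Fg k 0).pow 2).continuous) (bF.mul bF)
    (fun k θ => by
      rw [abs_pow, pow_two]
      exact mul_le_mul (b1 k θ) (b1 k θ) (abs_nonneg _) (by positivity))
    (fun θ => ((glim θ).const_add (F θ)).pow 2)
  have eg : ∀ k θ, gsq (fun θ => F θ + g k θ) θ = ∑ i, (pd i F θ + pd i (g k) θ) ^ 2 := by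
    intro k θ
    simp only [gsq, pd_add (hF 1).diff (gsb k 1).diff]
  have b3 : Gr (fun θ => ∑ i, (|pd i F θ| + |v i|) * (|pd i F θ| + |v i|)) :=
    Gr.sum _ fun i _ => (((hF.pd i 0).gr.abs.add (Gr.const _))).mul (((hF.pd i 0).gr.abs.add (Gr.const _)))
  have l3 := EE_dct h hT (G := fun k θ => gsq (fun θ => F θ + g k θ) θ) (g := fun θ => ∑ i, (pd i F θ + v i) ^ 2)
    (fun k => (Fg k 1).gsq.continuous) b3
    (fun k θ => by
      rw [abs_of_nonneg (gsq_nonneg _ _), eg]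
      refine Finset.sum_le_sum fun i _ => ?_
      have : |pd i F θ + pd i (g k) θ| ≤ |pd i F θ| + |v i| := by
        refine (abs_add_le _ _).trans (add_le_add le_rfl ?_)
        rw [gpd, abs_mul]
        exact mul_le_of_le_one_right (abs_nonneg _) (abs_cos_le_one _)
      rw [← sq_abs, pow_two]
      exact mul_le_mul this this (abs_nonneg _) (by positivity))
    (fun θ => by
      simp only [eg]
      exact tendsto_finsetSum _ fun i _ => ((cfl i θ).const_add _).pow 2)
  exact le_of_tendsto_of_tendsto (l2.sub (l1.pow 2)) (l3.const_mul C) (Filter.Eventually.of_forall fun k => hP _ (Fg k))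

def cE (ν : Measure (Euc n)) (T : ℝ) (F G : Euc n → ℝ) : ℝ := EE ν T (fun θ => F θ * G θ) - EE ν T F * EE ν T G

theorem vE_expand (h : CC t ν) {T : ℝ} (hT : 0 ≤ T) {F G : Euc n → ℝ} (hF : Gr F) (hG : Gr G) (s : ℝ) :
    vE ν T (fun θ => F θ + s * G θ) = vE ν T F + 2 * s * cE ν T F G + s ^ 2 * vE ν T G := by
  have e : (fun θ => (F θ + s * G θ) ^ 2) = fun θ => F θ * F θ + ((2 * s) * (F θ * G θ) + s ^ 2 * (G θ * G θ)) := by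
    funext θ; ring
  have e1 : (fun θ => F θ ^ 2) = fun θ => F θ * F θ := by funext θ; ring
  have e2 : (fun θ => G θ ^ 2) = fun θ => G θ * G θ := by funext θ; ring
  simp only [vE, cE]
  rw [e, e1, e2, EE_add h hT (hF.mul hF) (((Gr.const _).mul (hF.mul hG)).add ((Gr.const _).mul (hG.mul hG))),
    EE_add h hT ((Gr.const _).mul (hF.mul hG)) ((Gr.const _).mul (hG.mul hG)), EE_smul, EE_smul,
    EE_add h hT hF ((Gr.const _).mul hG), EE_smul]
  ring

theorem vE_nonneg (h : CC t ν) {T : ℝ} (hT : 0 ≤ T) {F : Euc n → ℝ} (hF : Gr F) : 0 ≤ vE ν T F := by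
  have := h.prob
  have := EE_csq h hT hF (Gr.const 1)
  have e : EE ν T (fun _ => (1:ℝ) ^ 2) = 1 := by simp [EE]
  rw [e] at this
  simp only [mul_one] at this
  rw [vE]; linarith

theorem cE_csq (h : CC t ν) {T : ℝ} (hT : 0 ≤ T) {F G : Euc n → ℝ} (hF : Gr F) (hG : Gr G) :
    cE ν T F G ^ 2 ≤ vE ν T F * vE ν T G := by
  have := discrim_le_zero (a := vE ν T G) (b := 2 * cE ν T F G) (c := vE ν T F) fun s => by
    have := vE_nonneg h hT (hF.add ((Gr.const s).mul hG))
    rw [vE_expand h hT hF hG] at this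
    nlinarith
  rw [discrim] at this
  nlinarith

theorem vE_inner (h : CC t ν) {T M : ℝ} (hT : 0 ≤ T) (hM : CovLe ν M) (v : Euc n) :
    vE ν T (fun θ => ⟪v, θ⟫) ≤ (T ^ 2 * M + T) * ‖v‖ ^ 2 := by
  have := h.prob
  have i1 : Integrable (fun x : Euc n => ⟪v, x⟫) ν := L2.i (h.l2 (by fun_prop))
  have i2 : Integrable (fun x : Euc n => ⟪v, x⟫ ^ 2) ν := L2.s (h.l2 (by fun_prop))
  have W1 : ∀ x, W T (fun θ => ⟪v, θ⟫) x = T * ⟪v, x⟫ := by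
    intro x
    simp only [W, th, inner_add_right, real_inner_smul_right]
    rw [integral_add (integrable_const _) ((L2.i (gam_lp (Gr.inner v))).const_mul _), integral_const_mul (√T), gam_inner]
    simp
  have W2 : ∀ x, W T (fun θ => ⟪v, θ⟫ ^ 2) x = T ^ 2 * ⟪v, x⟫ ^ 2 + T * ‖v‖ ^ 2 := by
    intro x
    simp only [W, th, inner_add_right, real_inner_smul_right]
    have : ∀ z : Euc n, (T * ⟪v, x⟫ + √T * ⟪v, z⟫) ^ 2 =
        T ^ 2 * ⟪v, x⟫ ^ 2 + ((2 * T * ⟪v, x⟫ * √T) * ⟪v, z⟫ + T * ⟪v, z⟫ ^ 2) := by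
      intro z
      linear_combination ⟪v, z⟫ ^ 2 * sq_sqrt hT
    simp only [this]
    have j1 : Integrable (fun z : Euc n => (2 * T * ⟪v, x⟫ * √T) * ⟪v, z⟫) (gam n) := (L2.i (gam_lp (Gr.inner v))).const_mul _
    have j2 : Integrable (fun z : Euc n => T * ⟪v, z⟫ ^ 2) (gam n) := (L2.s (gam_lp (Gr.inner v))).const_mul _
    rw [integral_add (integrable_const _) (iadd j1 j2), integral_add j1 j2, integral_const_mul (2 * T * ⟪v, x⟫ * √T), integral_const_mul T,
      gam_inner, gam_inner_sq]
    simp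
  have g2 : Gr (fun θ : Euc n => ⟪v, θ⟫ ^ 2) := by simpa only [pow_two] using (Gr.inner v).mul (Gr.inner v)
  rw [vE, EE_W h hT g2, EE_W h hT (Gr.inner v)]
  simp only [W1, W2]
  rw [integral_add (i2.const_mul _) (integrable_const _), integral_const_mul, integral_const_mul]
  have := hM v
  rw [vr] at this
  have h3 := mul_le_mul_of_nonneg_left this (sq_nonneg T)
  rw [integral_const, probReal_univ, one_smul]
  rw [integral_const_mul T]
  nlinarith

theorem partB1 (h : CC t ν) {T C P M : ℝ} (hT : 0 < T) (hC : 0 < C) (hP0 : 0 ≤ P) (hM0 : 0 ≤ M)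
    (hPE : PoinE ν T C) (hP : Poin ν P) (hM : CovLe ν M) {ε : ℝ} (hε : 0 < ε)
    {F : Euc n → ℝ} (hF : SB F) (hFε : (C - ε) * EE ν T (gsq F) < vE ν T F) :
    C ^ 2 * (C - ε) * (1 + P * T) ≤ C ^ 2 * (T * (1 + P * T) + P ^ 2 * T ^ 3) +
      P * T ^ 2 * (C * (T ^ 2 * M + T) + ε * C + 2 * C * √(ε * (T ^ 2 * M + T))) := by
  set V := vE ν T F with hV
  set J := EE ν T (gsq F) with hJ
  set mv : Euc n := WithLp.toLp 2 (fun i => EE ν T (pd i F)) with hmv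
  set q := ‖mv‖ ^ 2 with hq
  have eq1 : q = ∑ i, EE ν T (pd i F) ^ 2 := by rw [hq, norm_sq_sum]
  set A := T ^ 2 * M + T with hA
  have hA0 : 0 < A := by positivity
  have J0 : 0 ≤ J := EE_nonneg fun θ => gsq_nonneg _ _
  have hVJ : V ≤ C * J := hPE F hF
  have Jpos : 0 < J := by
    rcases J0.lt_or_eq with h | h
    · exact h
    · rw [← h] at hVJ hFε; linarith
  have gF := (hF 0).gr
  have gL := Gr.inner mv
  set VL := vE ν T (fun θ => ⟪mv, θ⟫) with hVL
  set cc := cE ν T F (fun θ => ⟪mv, θ⟫) with hcc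
  have VL0 : 0 ≤ VL := vE_nonneg h hT.le gL
  have V0 : 0 ≤ V := vE_nonneg h hT.le gF
  have VLA : VL ≤ A * q := vE_inner h hT.le hM mv
  have csq : cc ^ 2 ≤ V * VL := cE_csq h hT.le gF gL
  have quad : ∀ s : ℝ, 0 ≤ (C * q - VL) * (s * s) + (2 * (C * q - cc)) * s + (C * J - V) := by
    intro s
    have h1 := hPE.lin h hT.le hF (s • mv)
    simp only [real_inner_smul_left] at h1
    rw [vE_expand h hT.le gF gL] at h1
    have e : EE ν T (fun θ => ∑ i, (pd i F θ + (s • mv) i) ^ 2) = J + 2 * s * q + s ^ 2 * q := by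
      have e1 : (fun θ => ∑ i, (pd i F θ + (s • mv) i) ^ 2) =
          fun θ => gsq F θ + ((2 * s) * ∑ i, mv i * pd i F θ + s ^ 2 * q) := by
        funext θ
        rw [hq, norm_sq_sum, gsq, Finset.mul_sum, Finset.mul_sum, ← Finset.sum_add_distrib, ← Finset.sum_add_distrib]
        refine Finset.sum_congr rfl fun i _ => ?_
        simp only [PiLp.smul_apply, smul_eq_mul]
        ring
      have gi : ∀ i, Gr (fun θ => mv i * pd i F θ) := fun i => (Gr.const _).mul (hF.pd i 0).gr
      have gs : Gr (fun θ => ∑ i, mv i * pd i F θ) := Gr.sum _ fun i _ => gi i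
      have := h.prob
      rw [e1, EE_add h hT.le (hF 1).gsq.gr (((Gr.const _).mul gs).add (Gr.const _)),
        EE_add h hT.le ((Gr.const _).mul gs) (Gr.const _), EE_smul, EE_sum h hT.le _ gi]
      have e2 : ∑ i, EE ν T (fun θ => mv i * pd i F θ) = q := by
        rw [eq1]
        refine Finset.sum_congr rfl fun i _ => ?_
        rw [EE_smul, pow_two]
      have e3 : EE ν T (fun _ => s ^ 2 * q) = s ^ 2 * q := by simp [EE]
      rw [e2, e3]; ring
    rw [e] at h1
    nlinarith
  have disc := discrim_le_zero quad
  rw [discrim] at disc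
  have hVε : C * J - V ≤ ε * J := by nlinarith
  have d2 : (C * q - cc) ^ 2 ≤ ε * J * (C * q) := by
    have q0 : 0 ≤ q := sq_nonneg _
    have : (C * J - V) * (C * q - VL) ≤ ε * J * (C * q) := by
      have a1 : (C * J - V) * (C * q - VL) ≤ (C * J - V) * (C * q) :=
        mul_le_mul_of_nonneg_left (by linarith) (by linarith)
      exact a1.trans (mul_le_mul_of_nonneg_right hVε (by positivity))
    nlinarith
  have q0 : 0 ≤ q := sq_nonneg _
  -- bound on q
  have hqb : C ^ 2 * q ≤ C * J * (A + ε + 2 * √(ε * A)) := by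
    have b1 : C * q - cc ≤ √(ε * J * (C * q)) := le_sqrt_of_sq_le d2
    have b2 : cc ≤ √(C * J * (A * q)) := by
      refine le_sqrt_of_sq_le (csq.trans ?_)
      exact mul_le_mul hVJ VLA VL0 (by positivity)
    have e1 : √(ε * J * (C * q)) = √(C * J * q) * √ε := by
      rw [← sqrt_mul (by positivity)]; congr 1; ring
    have e2 : √(C * J * (A * q)) = √(C * J * q) * √A := by
      rw [← sqrt_mul (by positivity)]; congr 1; ring
    rw [e1] at b1
    rw [e2] at b2
    have b3 : C * q ≤ √(C * J * q) * (√ε + √A) := by linarith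
    have b4 : (C * q) ^ 2 ≤ (√(C * J * q) * (√ε + √A)) ^ 2 := pow_le_pow_left₀ (by positivity) b3 2
    rw [mul_pow (√(C * J * q)), sq_sqrt (by positivity), add_sq, sq_sqrt hε.le, sq_sqrt hA0.le, mul_assoc 2, ← sqrt_mul hε.le] at b4
    rcases q0.lt_or_eq with hq1 | hq1
    · refine le_of_mul_le_mul_right ?_ hq1
      nlinarith
    · rw [← hq1]
      have := sqrt_nonneg (ε * A)
      rw [mul_zero]
      positivity
  have main := vE_le h hT.le hP0 hP hF
  rw [← eq1] at main
  refine le_of_mul_le_mul_right (a := J) ?_ Jpos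
  have p : 0 < 1 + P * T := by positivity
  have m1 := mul_le_mul_of_nonneg_left main (sq_nonneg C)
  have m2 := mul_le_mul_of_nonneg_left hqb (by positivity : 0 ≤ P * T ^ 2)
  have m3 : C ^ 2 * ((C - ε) * J * (1 + P * T)) ≤ C ^ 2 * (V * (1 + P * T)) :=
    mul_le_mul_of_nonneg_left (mul_le_mul_of_nonneg_right hFε.le p.le) (sq_nonneg C)
  linarith

theorem opt_const {ι : Type*} {a b : ι → ℝ} (hb : ∀ i, 0 ≤ b i) {c : ℝ} (hc : 0 ≤ c) (h : ∀ i, a i ≤ c * b i) :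
    ∃ c0, 0 ≤ c0 ∧ (∀ i, a i ≤ c0 * b i) ∧ ∀ d, 0 ≤ d → (∀ i, a i ≤ d * b i) → c0 ≤ d := by
  set S := {d : ℝ | 0 ≤ d ∧ ∀ i, a i ≤ d * b i} with hS
  have hne : S.Nonempty := ⟨c, hc, h⟩
  have hbd : BddBelow S := ⟨0, fun d hd => hd.1⟩
  refine ⟨sInf S, le_csInf hne fun d hd => hd.1, fun i => ?_, fun d h1 h2 => csInf_le hbd ⟨h1, h2⟩⟩
  rcases (hb i).lt_or_eq with hi | hi
  · rw [← div_le_iff₀ hi]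
    exact le_csInf hne fun d hd => (div_le_iff₀ hi).2 (hd.2 i)
  · have := h i
    rw [← hi] at this ⊢
    simpa using this

theorem partB2 (h : CC t ν) (ht : 0 < t) {T P M : ℝ} (hT : 0 < T) (hP0 : 0 < P) (hM0 : 0 ≤ M)
    (hP : Poin ν P) (hopt : ∀ d, 0 ≤ d → Poin ν d → P ≤ d) (hM : CovLe ν M) : t * P ^ 2 ≤ M + 2 / T := by
  have hex : PoinE ν T ((1 + P * T) * T) := by
    intro F hF
    have h1 := vE_b h hT.le hP0.le hP hF
    have h2 := vE_a h hT.le hF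
    have h3 := vE_split h hT.le (hF 1)
    change vE ν T F ≤ _
    nlinarith [mul_pos hP0 hT]
  obtain ⟨C, hC0, hC, hCopt⟩ := opt_const (ι := {F : Euc n → ℝ // SB F}) (a := fun F => vE ν T F.1)
    (b := fun F => EE ν T (gsq F.1)) (fun F => EE_nonneg fun θ => gsq_nonneg _ _) (c := (1 + P * T) * T)
    (by positivity) (fun F => hex F.1 F.2)
  have hPE : PoinE ν T C := fun F hF => hC ⟨F, hF⟩
  have hA := partA h ht hT hC0 hPE
  have hPC : P ≤ C / (T * (t + T)) := hopt _ (by positivity) hA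
  rw [le_div_iff₀ (by positivity)] at hPC
  have hCpos : 0 < C := lt_of_lt_of_le (by positivity) hPC
  have key : ∀ ε, 0 < ε → ε < C → C ^ 2 * (C - ε) * (1 + P * T) ≤ C ^ 2 * (T * (1 + P * T) + P ^ 2 * T ^ 3) +
      P * T ^ 2 * (C * (T ^ 2 * M + T) + ε * C + 2 * C * √(ε * (T ^ 2 * M + T))) := by
    intro ε hε hεC
    have : ¬ ∀ F : {F : Euc n → ℝ // SB F}, vE ν T F.1 ≤ (C - ε) * EE ν T (gsq F.1) := fun hh => by
      have := hCopt (C - ε) (by linarith) hh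
      linarith
    push Not at this
    obtain ⟨⟨F, hF⟩, hlt⟩ := this
    exact partB1 h hT hCpos hP0.le hM0 hPE hP hM hε hF hlt
  have lim : C ^ 2 * (C - 0) * (1 + P * T) ≤ C ^ 2 * (T * (1 + P * T) + P ^ 2 * T ^ 3) +
      P * T ^ 2 * (C * (T ^ 2 * M + T) + 0 * C + 2 * C * √(0 * (T ^ 2 * M + T))) := by
    have c1 : Continuous fun ε : ℝ => C ^ 2 * (C - ε) * (1 + P * T) := by fun_prop
    have c2 : Continuous fun ε : ℝ => C ^ 2 * (T * (1 + P * T) + P ^ 2 * T ^ 3) +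
      P * T ^ 2 * (C * (T ^ 2 * M + T) + ε * C + 2 * C * √(ε * (T ^ 2 * M + T))) := by fun_prop
    refine le_of_tendsto_of_tendsto ((c1.tendsto 0).mono_left (nhdsWithin_le_nhds (s := Ioi 0)))
      ((c2.tendsto 0).mono_left nhdsWithin_le_nhds) ?_
    filter_upwards [Ioo_mem_nhdsGT hCpos] with ε hε using key ε hε.1 hε.2
  simp only [sub_zero, zero_mul, add_zero, sqrt_zero, mul_zero] at lim
  have lim2 : C * ((1 + P * T) * C - (T * (1 + P * T) + P ^ 2 * T ^ 3)) ≤ P * T ^ 2 * (T ^ 2 * M + T) := by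
    refine le_of_mul_le_mul_left (a := C) ?_ hCpos
    linarith
  have low : t * T * P + t * T ^ 2 * P ^ 2 - T ≤ (1 + P * T) * C - (T * (1 + P * T) + P ^ 2 * T ^ 3) := by
    have := mul_le_mul_of_nonneg_left hPC (by positivity : 0 ≤ 1 + P * T)
    linarith
  have fin : t * T ^ 2 * P ^ 2 ≤ T ^ 2 * M + 2 * T := by
    by_cases hneg : t * T ^ 2 * P ^ 2 - T ≤ 0
    · have : 0 ≤ T ^ 2 * M := by positivity
      linarith
    · push Not at hneg
      have hx : t * T ^ 2 * P ^ 2 - T ≤ (1 + P * T) * C - (T * (1 + P * T) + P ^ 2 * T ^ 3) := by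
        have : 0 ≤ t * T * P := by positivity
        linarith
      have a1 : (P * T ^ 2) * (t * T ^ 2 * P ^ 2 - T) ≤ C * ((1 + P * T) * C - (T * (1 + P * T) + P ^ 2 * T ^ 3)) := by
        refine mul_le_mul ?_ hx hneg.le hCpos.le
        have : 0 ≤ P * T * t := by positivity
        nlinarith
      have a2 := a1.trans lim2
      have a3 := le_of_mul_le_mul_left a2 (by positivity)
      linarith
  have T2 : 0 < T ^ 2 := by positivity
  refine le_of_mul_le_mul_left (a := T ^ 2) ?_ T2
  have : T ^ 2 * (M + 2 / T) = T ^ 2 * M + 2 * T := by field_simp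
  rw [this]; linarith

theorem Poin.mono {ω : Measure (Euc n)} {C D : ℝ} (hP : Poin ω C) (h : C ≤ D) : Poin ω D := fun f hf =>
  (hP f hf).trans (mul_le_mul_of_nonneg_right h (integral_nonneg fun _ => gsq_nonneg _ _))

theorem partB (h : CC t ν) (ht : 0 < t) {M : ℝ} (hM0 : 0 ≤ M) (hM : CovLe ν M) : Poin ν (√(M / t)) := by
  obtain ⟨P, hP0, hP, hopt⟩ := opt_const (ι := {F : Euc n → ℝ // SB F}) (a := fun F => vr ν F.1)
    (b := fun F => ∫ x, gsq F.1 x ∂ν) (fun F => integral_nonneg fun _ => gsq_nonneg _ _) (c := 1 / t)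
    (by positivity) (fun F => h.poin ht F.1 F.2)
  have hP' : Poin ν P := fun F hF => hP ⟨F, hF⟩
  refine hP'.mono ?_
  rcases hP0.lt_or_eq with hpos | h0
  · refine le_sqrt_of_sq_le ?_
    rw [le_div_iff₀ ht]
    have key : ∀ T, 0 < T → t * P ^ 2 ≤ M + 2 / T := fun T hT =>
      partB2 h ht hT hpos hM0 hP' (fun d hd hh => hopt d hd fun F => hh F.1 F.2) hM
    refine le_of_forall_pos_le_add fun ε hε => ?_
    have := key (2 / ε) (by positivity)
    have e : 2 / (2 / ε) = ε := by field_simp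
    rw [e] at this
    linarith
  · rw [← h0]; exact sqrt_nonneg _

end

end KLS

end

section
open MeasureTheory Real Set
open scoped ENNReal RealInnerProductSpace Matrix

namespace KLS
noncomputable section

variable {n : ℕ}

theorem spec {A : Matrix (Fin n) (Fin n) ℝ} (hA : A.PosSemidef) :
    ∃ (U : Matrix (Fin n) (Fin n) ℝ) (l : Fin n → ℝ), Uᵀ * U = 1 ∧ U * Uᵀ = 1 ∧ (∀ i, 0 ≤ l i) ∧
      ∀ k : ℕ, A ^ k = U * Matrix.diagonal (fun i => l i ^ k) * Uᵀ := by
  have hH := hA.1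
  set U : Matrix (Fin n) (Fin n) ℝ := hH.eigenvectorUnitary.1 with hU
  have u1 : Uᵀ * U = 1 := by
    have := Unitary.coe_star_mul_self hH.eigenvectorUnitary
    rwa [Matrix.star_eq_conjTranspose, Matrix.conjTranspose_eq_transpose_of_trivial] at this
  have u2 : U * Uᵀ = 1 := mul_eq_one_comm.1 u1
  have sp : A = U * Matrix.diagonal hH.eigenvalues * Uᵀ := by
    have := hH.spectral_theorem
    rw [Unitary.conjStarAlgAut_apply, Matrix.star_eq_conjTranspose, Matrix.conjTranspose_eq_transpose_of_trivial] at this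
    exact this
  refine ⟨U, hH.eigenvalues, u1, u2, hA.eigenvalues_nonneg, fun k => ?_⟩
  clear_value U
  generalize hH.eigenvalues = l at sp
  induction k with
  | zero => simp [u2]
  | succ k ih =>
    rw [pow_succ, ih]
    conv_lhs => rw [sp]
    have : Matrix.diagonal (fun i => l i ^ (k + 1)) =
        Matrix.diagonal (fun i => l i ^ k) * Matrix.diagonal l := by
      rw [Matrix.diagonal_mul_diagonal]; simp only [pow_succ]
    rw [this]
    calc _ = U * Matrix.diagonal (fun i => l i ^ k) * (Uᵀ * U) * Matrix.diagonal l * Uᵀ := by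
          simp only [Matrix.mul_assoc]
      _ = _ := by rw [u1]; simp only [Matrix.mul_assoc, Matrix.one_mul]

theorem tr_pow {A U : Matrix (Fin n) (Fin n) ℝ} {l : Fin n → ℝ} (u1 : Uᵀ * U = 1) {k : ℕ}
    (h : A ^ k = U * Matrix.diagonal (fun i => l i ^ k) * Uᵀ) : (A ^ k).trace = ∑ i, l i ^ k := by
  rw [h, Matrix.trace_mul_comm, ← Matrix.mul_assoc, u1, Matrix.one_mul, Matrix.trace_diagonal]

theorem pw_ineq {x y : ℝ} (hx : 0 ≤ x) (hy : 0 ≤ y) (a b : ℕ) :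
    x ^ a * y ^ b + x ^ b * y ^ a ≤ x ^ (a + b) + y ^ (a + b) := by
  have : 0 ≤ (x ^ a - y ^ a) * (x ^ b - y ^ b) := by
    rcases le_total x y with h | h
    · exact mul_nonneg_of_nonpos_of_nonpos (sub_nonpos.2 (pow_le_pow_left₀ hx h a)) (sub_nonpos.2 (pow_le_pow_left₀ hx h b))
    · exact mul_nonneg (sub_nonneg.2 (pow_le_pow_left₀ hy h a)) (sub_nonneg.2 (pow_le_pow_left₀ hy h b))
  rw [pow_add, pow_add]
  linarith

theorem tr_form {A U : Matrix (Fin n) (Fin n) ℝ} {l : Fin n → ℝ}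
    (h : ∀ k, A ^ k = U * Matrix.diagonal (fun i => l i ^ k) * Uᵀ) {H : Matrix (Fin n) (Fin n) ℝ} (hH : Hᵀ = H) (a b : ℕ) :
    (A ^ a * H * A ^ b * H).trace = ∑ i, ∑ j, l i ^ a * l j ^ b * (Uᵀ * H * U) i j ^ 2 := by
  set N := Uᵀ * H * U with hN
  have sN : Nᵀ = N := by
    rw [hN, Matrix.transpose_mul, Matrix.transpose_mul, Matrix.transpose_transpose, hH, Matrix.mul_assoc]
  have : (A ^ a * H * A ^ b * H).trace =
      (Matrix.diagonal (fun i => l i ^ a) * N * (Matrix.diagonal (fun i => l i ^ b) * N)).trace := by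
    rw [h, h, hN]
    simp only [Matrix.mul_assoc]
    rw [Matrix.trace_mul_comm]
    simp only [Matrix.mul_assoc]
  rw [this, Matrix.trace]
  refine Finset.sum_congr rfl fun i _ => ?_
  rw [Matrix.diag_apply, Matrix.mul_apply]
  refine Finset.sum_congr rfl fun j _ => ?_
  rw [Matrix.diagonal_mul, Matrix.diagonal_mul]
  have : N j i = N i j := by rw [← sN, Matrix.transpose_apply, sN]
  rw [this]; ring

theorem tr_ineq {A H : Matrix (Fin n) (Fin n) ℝ} (hA : A.PosSemidef) (hH : Hᵀ = H) (a b : ℕ) :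
    (A ^ a * H * A ^ b * H).trace ≤ (A ^ (a + b) * H * H).trace := by
  obtain ⟨U, l, u1, u2, l0, h⟩ := spec hA
  have e1 : A ^ (a + b) * H * H = A ^ (a + b) * H * A ^ 0 * H := by simp
  rw [e1, tr_form h hH, tr_form h hH]
  set N := Uᵀ * H * U with hN
  have sN : Nᵀ = N := by
    rw [hN, Matrix.transpose_mul, Matrix.transpose_mul, Matrix.transpose_transpose, hH, Matrix.mul_assoc]
  have sym : ∀ i j, N j i = N i j := fun i j => by
    conv_rhs => rw [← sN, Matrix.transpose_apply]
  have sw : ∀ c d : ℕ, ∑ i, ∑ j, l i ^ c * l j ^ d * N i j ^ 2 = ∑ i, ∑ j, l i ^ d * l j ^ c * N i j ^ 2 := by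
    intro c d
    rw [Finset.sum_comm]
    refine Finset.sum_congr rfl fun i _ => Finset.sum_congr rfl fun j _ => ?_
    rw [sym]; ring
  have key : ∑ i, ∑ j, l i ^ a * l j ^ b * N i j ^ 2 + ∑ i, ∑ j, l i ^ b * l j ^ a * N i j ^ 2 ≤
      ∑ i, ∑ j, l i ^ (a + b) * l j ^ 0 * N i j ^ 2 + ∑ i, ∑ j, l i ^ 0 * l j ^ (a + b) * N i j ^ 2 := by
    rw [← Finset.sum_add_distrib, ← Finset.sum_add_distrib]
    refine Finset.sum_le_sum fun i _ => ?_
    rw [← Finset.sum_add_distrib, ← Finset.sum_add_distrib]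
    refine Finset.sum_le_sum fun j _ => ?_
    have := mul_le_mul_of_nonneg_right (pw_ineq (l0 i) (l0 j) a b) (sq_nonneg (N i j))
    simp only [pow_zero, mul_one, one_mul]
    linarith
  rw [sw b a, sw 0 (a + b)] at key
  linarith

theorem tr_pos {A : Matrix (Fin n) (Fin n) ℝ} (hA : A.PosSemidef) (a : ℕ) : 0 ≤ (A ^ a).trace := by
  obtain ⟨U, l, u1, u2, l0, h⟩ := spec hA
  rw [tr_pow u1 (h a)]
  exact Finset.sum_nonneg fun i _ => pow_nonneg (l0 i) a

end
end KLS

end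

section
open MeasureTheory Real Set
open scoped ENNReal RealInnerProductSpace Matrix

namespace KLS
noncomputable section

variable {n : ℕ} {t : ℝ} {ν : Measure (Euc n)}

/-- covariance matrix -/
def AM (ν : Measure (Euc n)) (T : ℝ) (θ : Euc n) : Matrix (Fin n) (Fin n) ℝ := Matrix.of fun i j => Am ν i j T θ

/-- derivative of the covariance matrix -/
def HM (ν : Measure (Euc n)) (k : Fin n) (T : ℝ) (θ : Euc n) : Matrix (Fin n) (Fin n) ℝ :=
  Matrix.of fun i j => pd k (Am ν i j T) θ

def PM (ν : Measure (Euc n)) (q : ℕ) (i j : Fin n) (T : ℝ) (θ : Euc n) : ℝ := (AM ν T θ ^ q) i j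

def DM (ν : Measure (Euc n)) (q : ℕ) (k : Fin n) (T : ℝ) (θ : Euc n) : Matrix (Fin n) (Fin n) ℝ :=
  Matrix.of fun i j => pd k (PM ν q i j T) θ

def LM (ν : Measure (Euc n)) (q : ℕ) (T : ℝ) (θ : Euc n) : Matrix (Fin n) (Fin n) ℝ :=
  Matrix.of fun i j => LL ν (PM ν q i j) T θ

theorem PM_zero (i j : Fin n) : PM ν 0 i j = fun _ _ => (1 : Matrix (Fin n) (Fin n) ℝ) i j := by
  funext T θ; simp [PM]

theorem PM_succ (q : ℕ) (i j : Fin n) : PM ν (q + 1) i j = fun T θ => ∑ l, PM ν q i l T θ * Am ν l j T θ := by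
  funext T θ
  rw [PM, pow_succ, Matrix.mul_apply]; rfl

theorem PM_nice (h : CC t ν) (q : ℕ) : ∀ i j : Fin n, Nice (PM ν q i j) := by
  induction q with
  | zero => intro i j; rw [PM_zero]; exact Nice.const _
  | succ q ih => intro i j; rw [PM_succ]; exact Nice.sum _ fun l _ => (ih i l).mul (Am_nice h l j)

theorem DM_zero (k : Fin n) (T : ℝ) (θ : Euc n) : DM ν 0 k T θ = 0 := by
  ext i j
  simp only [DM, PM_zero, Matrix.of_apply, Matrix.zero_apply, pd]
  rw [fderiv_const_apply]; rfl

theorem DM_succ (h : CC t ν) (q : ℕ) (k : Fin n) (T : ℝ) (θ : Euc n) :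
    DM ν (q + 1) k T θ = DM ν q k T θ * AM ν T θ + AM ν T θ ^ q * HM ν k T θ := by
  ext i j
  have e : PM ν (q + 1) i j T = fun θ => ∑ l, PM ν q i l T θ * Am ν l j T θ := by rw [PM_succ]
  have d1 : ∀ l, Differentiable ℝ (PM ν q i l T) := fun l => (PM_nice h q i l).d T
  have d2 : ∀ l, Differentiable ℝ (Am ν l j T) := fun l => (Am_nice h l j).d T
  have d3 : ∀ l, Differentiable ℝ (fun θ => PM ν q i l T θ * Am ν l j T θ) := fun l => (d1 l).mul (d2 l)
  rw [Matrix.add_apply, Matrix.mul_apply, Matrix.mul_apply, ← Finset.sum_add_distrib, DM, Matrix.of_apply, e,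
    pd_sum _ (fun l => d3 l)]
  refine Finset.sum_congr rfl fun l _ => ?_
  rw [pd_mul (d1 l) (d2 l)]
  simp only [DM, AM, HM, PM, Matrix.of_apply]
  ring

theorem LM_zero (T : ℝ) (θ : Euc n) : LM ν 0 T θ = 0 := by
  ext i j
  simp only [LM, PM_zero, Matrix.of_apply, Matrix.zero_apply]
  exact LL_const _ _ _

theorem Am_LL (h : CC t ν) (i j : Fin n) (T : ℝ) (θ : Euc n) :
    LL ν (Am ν i j) T θ = - (AM ν T θ * AM ν T θ) i j := by
  have := dm_LL h (f := fun x : Euc n => x j) (by fun_prop) i T θ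
  have e : ∀ k, dm ν (fun x : Euc n => x j) k = Am ν k j := by
    intro k; funext T θ; simp only [dm, Am]; ring
  simp only [e] at this
  rw [this, Matrix.mul_apply]; rfl

theorem LM_succ (h : CC t ν) (q : ℕ) (T : ℝ) (θ : Euc n) :
    LM ν (q + 1) T θ = LM ν q T θ * AM ν T θ - AM ν T θ ^ q * (AM ν T θ * AM ν T θ) +
      ∑ k, DM ν q k T θ * HM ν k T θ := by
  ext i j
  rw [LM, Matrix.of_apply, PM_succ, LL_sum _ (fun l => (PM_nice h q i l).mul (Am_nice h l j))]
  rw [Matrix.add_apply, Matrix.sub_apply, Matrix.sum_apply, Matrix.mul_apply, Matrix.mul_apply]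
  simp only [Matrix.mul_apply (M := DM ν q _ T θ)]
  rw [Finset.sum_comm (f := fun k l => DM ν q k T θ i l * HM ν k T θ l j), ← Finset.sum_sub_distrib, ← Finset.sum_add_distrib]
  refine Finset.sum_congr rfl fun l _ => ?_
  rw [LL_mul (PM_nice h q i l) (Am_nice h l j), Am_LL h]
  simp only [DM, AM, HM, PM, LM, Matrix.of_apply]
  ring

theorem DM_eq (h : CC t ν) (q : ℕ) (k : Fin n) (T : ℝ) (θ : Euc n) :
    DM ν q k T θ = ∑ j ∈ Finset.range q, AM ν T θ ^ j * HM ν k T θ * AM ν T θ ^ (q - 1 - j) := by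
  induction q with
  | zero => rw [DM_zero]; simp
  | succ q ih =>
    rw [DM_succ h, ih, Finset.sum_range_succ, Finset.sum_mul]
    congr 1
    · refine Finset.sum_congr rfl fun j hj => ?_
      rw [Matrix.mul_assoc, ← pow_succ]
      have : q - 1 - j + 1 = q + 1 - 1 - j := by have := Finset.mem_range.1 hj; omega
      rw [this]
    · simp

theorem LM_eq (h : CC t ν) (q : ℕ) (T : ℝ) (θ : Euc n) :
    LM ν q T θ = ∑ j ∈ Finset.range q, (- (AM ν T θ ^ j * (AM ν T θ * AM ν T θ)) +
      ∑ k, DM ν j k T θ * HM ν k T θ) * AM ν T θ ^ (q - 1 - j) := by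
  induction q with
  | zero => rw [LM_zero]; simp
  | succ q ih =>
    rw [LM_succ h, ih, Finset.sum_range_succ, Finset.sum_mul, sub_eq_add_neg, add_assoc]
    congr 1
    · refine Finset.sum_congr rfl fun j hj => ?_
      rw [Matrix.mul_assoc, ← pow_succ]
      have : q - 1 - j + 1 = q + 1 - 1 - j := by have := Finset.mem_range.1 hj; omega
      rw [this]
    · simp

theorem AM_psd (h : CC t ν) (T : ℝ) (θ : Euc n) : (AM ν T θ).PosSemidef := by
  refine Matrix.PosSemidef.of_dotProduct_mulVec_nonneg ?_ fun v => ?_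
  · ext i j; simp [AM, Am_symm]
  · have := (h.nuT T θ).prob
    have e := Am_quad h (WithLp.toLp 2 v) T θ
    have e2 : star v ⬝ᵥ AM ν T θ *ᵥ v = ∑ i, ∑ j, v i * v j * Am ν i j T θ := by
      simp only [dotProduct, Matrix.mulVec, AM, Matrix.of_apply, star_trivial, Finset.mul_sum]
      refine Finset.sum_congr rfl fun i _ => Finset.sum_congr rfl fun j _ => ?_
      ring
    rw [e2]
    refine le_of_le_of_eq ?_ e.symm
    exact vr_nonneg ((h.nuT T θ).l2 (by fun_prop))

theorem HM_symm (k : Fin n) (T : ℝ) (θ : Euc n) : (HM ν k T θ)ᵀ = HM ν k T θ := by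
  ext i j
  simp only [HM, Matrix.transpose_apply, Matrix.of_apply]
  have : Am ν j i T = Am ν i j T := by funext θ; exact Am_symm _ _ _ _
  rw [this]

/-- `Tr A^q` -/
def TA (ν : Measure (Euc n)) (q : ℕ) (T : ℝ) (θ : Euc n) : ℝ := (AM ν T θ ^ q).trace

theorem TA_eq (q : ℕ) : TA ν q = fun T θ => ∑ i, PM ν q i i T θ := rfl

theorem TA_nice (h : CC t ν) (q : ℕ) : Nice (TA ν q) := by
  rw [TA_eq]; exact Nice.sum _ fun i _ => PM_nice h q i i

theorem TA_nonneg (h : CC t ν) (q : ℕ) (T : ℝ) (θ : Euc n) : 0 ≤ TA ν q T θ := tr_pos (AM_psd h T θ) q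

theorem TA_pd (h : CC t ν) (q : ℕ) (k : Fin n) (T : ℝ) (θ : Euc n) :
    pd k (TA ν q T) θ = q * (AM ν T θ ^ (q - 1) * HM ν k T θ).trace := by
  have e : TA ν q T = fun θ => ∑ i, PM ν q i i T θ := rfl
  rw [e, pd_sum _ (fun l => (PM_nice h q l l).d T)]
  have : (fun x => ∑ i, pd k (PM ν q i i T) x) θ = (DM ν q k T θ).trace := rfl
  rw [this, DM_eq h, Matrix.trace_sum]
  have : ∀ j ∈ Finset.range q, (AM ν T θ ^ j * HM ν k T θ * AM ν T θ ^ (q - 1 - j)).trace =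
      (AM ν T θ ^ (q - 1) * HM ν k T θ).trace := by
    intro j hj
    rw [Matrix.trace_mul_comm, ← Matrix.mul_assoc, ← pow_add]
    have : q - 1 - j + j = q - 1 := by have := Finset.mem_range.1 hj; omega
    rw [this]
  rw [Finset.sum_congr rfl this]; simp

theorem TA_LL (h : CC t ν) (q : ℕ) (T : ℝ) (θ : Euc n) :
    LL ν (TA ν q) T θ ≤ (q * (q - 1) / 2 : ℝ) * ∑ k, (AM ν T θ ^ (q - 2) * HM ν k T θ * HM ν k T θ).trace := by
  rw [TA_eq, LL_sum _ (fun l => PM_nice h q l l)]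
  have : ∑ i, LL ν (PM ν q i i) T θ = (LM ν q T θ).trace := rfl
  rw [this, LM_eq h, Matrix.trace_sum]
  set A := AM ν T θ with hA
  have psd : A.PosSemidef := AM_psd h T θ
  set Q := ∑ k, (A ^ (q - 2) * HM ν k T θ * HM ν k T θ).trace with hQ
  have step : ∀ j ∈ Finset.range q, ((- (A ^ j * (A * A)) + ∑ k, DM ν j k T θ * HM ν k T θ) * A ^ (q - 1 - j)).trace ≤ j * Q := by
    intro j hj
    have hj' := Finset.mem_range.1 hj
    rw [Matrix.add_mul, Matrix.trace_add, Matrix.neg_mul, Matrix.trace_neg]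
    have n1 : 0 ≤ (A ^ j * (A * A) * A ^ (q - 1 - j)).trace := by
      have : A ^ j * (A * A) * A ^ (q - 1 - j) = A ^ (q + 1) := by
        rw [← pow_two, ← pow_add, ← pow_add]; congr 1; omega
      rw [this]; exact tr_pos psd _
    have n2 : ((∑ k, DM ν j k T θ * HM ν k T θ) * A ^ (q - 1 - j)).trace ≤ j * Q := by
      rw [Finset.sum_mul, Matrix.trace_sum, hQ, Finset.mul_sum]
      refine Finset.sum_le_sum fun k _ => ?_
      rw [DM_eq h, Finset.sum_mul, Finset.sum_mul, Matrix.trace_sum]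
      refine (Finset.sum_le_card_nsmul _ _ ((A ^ (q - 2) * HM ν k T θ * HM ν k T θ).trace) fun i hi => ?_).trans (by simp)
      have hi' := Finset.mem_range.1 hi
      have e1 : (A ^ i * HM ν k T θ * A ^ (j - 1 - i) * HM ν k T θ * A ^ (q - 1 - j)).trace =
          (A ^ (q - 1 - j + i) * HM ν k T θ * A ^ (j - 1 - i) * HM ν k T θ).trace := by
        rw [Matrix.trace_mul_comm, pow_add]
        simp only [Matrix.mul_assoc]
      rw [e1]
      refine (tr_ineq psd (HM_symm k T θ) _ _).trans (le_of_eq ?_)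
      congr 4; omega
    linarith
  refine (Finset.sum_le_sum step).trans (le_of_eq ?_)
  rw [← Finset.sum_mul]
  congr 1
  have := Finset.sum_range_id_mul_two q
  have h2 : (∑ i ∈ Finset.range q, (i:ℝ)) * 2 = q * (q - 1) := by
    rcases q with _ | q
    · simp
    · have : ((∑ i ∈ Finset.range (q+1), i : ℕ) : ℝ) * 2 = ((q + 1 : ℕ) : ℝ) * ((q + 1 - 1 : ℕ) : ℝ) := by exact_mod_cast this
      push_cast at this ⊢
      simp at this ⊢
      linarith
  linarith

end
end KLS

end

section
open MeasureTheory Real Set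
open scoped ENNReal RealInnerProductSpace Matrix

namespace KLS
noncomputable section

variable {n : ℕ} {t : ℝ} {ν : Measure (Euc n)}

/-- centered quadratic form -/
def qf (N : Matrix (Fin n) (Fin n) ℝ) (m : Fin n → ℝ) (x : Euc n) : ℝ :=
  ∑ i, ∑ j, N i j * ((x i - m i) * (x j - m j))

theorem qf_contDiff (N : Matrix (Fin n) (Fin n) ℝ) (m : Fin n → ℝ) :
    ContDiff ℝ ((⊤ : ℕ∞) : WithTop ℕ∞) (qf N m) := by
  have c : ∀ i : Fin n, ContDiff ℝ ((⊤ : ℕ∞) : WithTop ℕ∞) (fun x : Euc n => x i) := fun i =>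
    (EuclideanSpace.proj (𝕜 := ℝ) i).contDiff
  refine ContDiff.sum fun i _ => ContDiff.sum fun j _ => ?_
  exact contDiff_const.mul (((c i).sub contDiff_const).mul ((c j).sub contDiff_const))

/-- mean -/
def me (ω : Measure (Euc n)) (i : Fin n) : ℝ := ∫ x, x i ∂ω

theorem HM_cv (h : CC t ν) (k i j : Fin n) (T : ℝ) (θ : Euc n) :
    HM ν k T θ i j = cv (nuT ν T θ) (fun x => x k)
      (fun x => (x i - me (nuT ν T θ) i) * (x j - me (nuT ν T θ) j)) := by
  have hij : Continuous (fun x : Euc n => x i * x j) := by fun_prop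
  have hi : Continuous (fun x : Euc n => x i) := by fun_prop
  have hj : Continuous (fun x : Euc n => x j) := by fun_prop
  have d1 := (mm_nice h hij).d T
  have d2 := (mm_nice h hi).d T
  have d3 := (mm_nice h hj).d T
  have e : Am ν i j T = fun θ => mm ν (fun x => x i * x j) T θ - mm ν (fun x => x i) T θ * mm ν (fun x => x j) T θ := rfl
  have d4 : Differentiable ℝ (fun θ => mm ν (fun x => x i) T θ * mm ν (fun x => x j) T θ) := d2.mul d3
  rw [HM, Matrix.of_apply, e, pd_sub d1 d4]
  rw [pd_mul d2 d3]
  simp only [mm_pd h hij, mm_pd h hi, mm_pd h hj]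
  set mi := mm ν (fun x => x i) T θ with hmi
  set mj := mm ν (fun x => x j) T θ with hmj
  have e1 : me (nuT ν T θ) i = mi := rfl
  have e2 : me (nuT ν T θ) j = mj := rfl
  rw [e1, e2]
  have c : cv (nuT ν T θ) (fun x => x k) (fun x => (x i - mi) * (x j - mj)) =
    mm ν (fun x => x k * ((x i - mi) * (x j - mj))) T θ - mm ν (fun x => x k) T θ * mm ν (fun x => (x i - mi) * (x j - mj)) T θ := rfl
  have f1 : (fun x : Euc n => x k * ((x i - mi) * (x j - mj))) =
      fun x => (x k * (x i * x j) - mi * (x k * x j)) - (mj * (x k * x i) - (mi * mj) * x k) := by funext x; ring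
  have f2 : (fun x : Euc n => (x i - mi) * (x j - mj)) =
      fun x => (x i * x j - mi * x j) - (mj * x i - mi * mj) := by funext x; ring
  rw [c, f1, f2, mm_sub h (by fun_prop) (by fun_prop), mm_sub h (by fun_prop) (by fun_prop),
    mm_sub h (by fun_prop) (by fun_prop), mm_smul, mm_smul, mm_smul,
    mm_sub h (by fun_prop) (by fun_prop), mm_sub h (by fun_prop) (by fun_prop),
    mm_sub h (by fun_prop) (by fun_prop), mm_smul, mm_smul, mm_const h, ← hmi, ← hmj]
  ring

theorem HM_form (h : CC t ν) (N : Matrix (Fin n) (Fin n) ℝ) (v : Euc n) (T : ℝ) (θ : Euc n) :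
    ∑ k, v k * ∑ i, ∑ j, N i j * HM ν k T θ i j =
      cv (nuT ν T θ) (fun x => ⟪v, x⟫) (qf N (me (nuT ν T θ))) := by
  have hω := h.nuT T θ
  have := hω.prob
  rw [cv_inner hω.x2 (hω.l2 (qf_contDiff N _).continuous)]
  refine Finset.sum_congr rfl fun k _ => ?_
  congr 1
  rw [cv_comm]
  have e : qf N (me (nuT ν T θ)) = fun x => ∑ i, ∑ j, N i j * ((x i - me (nuT ν T θ) i) * (x j - me (nuT ν T θ) j)) := rfl
  rw [e, cv_sum_left _ (fun i => hω.l2 (by fun_prop)) (hω.x2 k)]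
  refine Finset.sum_congr rfl fun i _ => ?_
  rw [cv_sum_left _ (fun i => hω.l2 (by fun_prop)) (hω.x2 k)]
  refine Finset.sum_congr rfl fun j _ => ?_
  rw [cv_smul_left, cv_comm, HM_cv h]

theorem HM_comm (h : CC t ν) (k i j : Fin n) (T : ℝ) (θ : Euc n) : HM ν k T θ i j = HM ν i T θ k j := by
  have e : ∀ i j : Fin n, Am ν i j T = pd i (mm ν (fun x => x j) T) := fun i j => by
    funext θ; exact (pd_a h i j T θ).symm
  simp only [HM, Matrix.of_apply, e]
  exact pd_comm (mm_SB h (by fun_prop) T 2) k i θ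

theorem lin_vr {ω : Measure (Euc n)} [IsProbabilityMeasure ω] (hx : ∀ i : Fin n, MemLp (fun x : Euc n => x i) 2 ω) (a : Fin n → ℝ) :
    ∫ x, (∑ j, a j * (x j - me ω j)) ^ 2 ∂ω = vr ω (fun x => ⟪(WithLp.toLp 2 a : Euc n), x⟫) := by
  have hl : MemLp (fun x : Euc n => ⟪(WithLp.toLp 2 a : Euc n), x⟫) 2 ω := by
    rw [inner_lin]
    exact memLp_finsetSum _ fun i _ => (hx i).const_mul _
  rw [vr_eq' hl]
  congr 1; funext x
  congr 1
  simp only [inner_sum]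
  rw [integral_finsetSum _ fun i _ => (L2.i (hx i)).const_mul _, ← Finset.sum_sub_distrib]
  refine Finset.sum_congr rfl fun j _ => ?_
  rw [integral_const_mul, mul_sub]; rfl

theorem qf_pd (N : Matrix (Fin n) (Fin n) ℝ) (hN : Nᵀ = N) (m : Fin n → ℝ) (k : Fin n) (x : Euc n) :
    pd k (qf N m) x = 2 * ∑ j, N k j * (x j - m j) := by
  have d : ∀ i : Fin n, Differentiable ℝ (fun x : Euc n => x i - m i) := fun i => (coord_diff i).sub (differentiable_const _)
  have d1 : ∀ i j : Fin n, Differentiable ℝ (fun x : Euc n => (x i - m i) * (x j - m j)) := fun i j => (d i).mul (d j)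
  have d2 : ∀ i j : Fin n, Differentiable ℝ (fun x : Euc n => N i j * ((x i - m i) * (x j - m j))) := fun i j => (d1 i j).const_mul _
  have d3 : ∀ i : Fin n, Differentiable ℝ (fun x : Euc n => ∑ j, N i j * ((x i - m i) * (x j - m j))) := fun i =>
    Differentiable.fun_sum fun j _ => d2 i j
  have e : qf N m = fun x => ∑ i, ∑ j, N i j * ((x i - m i) * (x j - m j)) := rfl
  have p : ∀ i, pd k (fun x : Euc n => x i - m i) = fun _ => if k = i then 1 else 0 := by
    intro i
    rw [pd_sub (coord_diff i) (differentiable_const _), pd_coord]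
    funext x
    simp [pd]
  rw [e, pd_sum _ d3]
  have q : ∀ i, pd k (fun x : Euc n => ∑ j, N i j * ((x i - m i) * (x j - m j))) x =
      ∑ j, N i j * ((x i - m i) * (if k = j then 1 else 0) + (if k = i then 1 else 0) * (x j - m j)) := by
    intro i
    rw [pd_sum _ (d2 i)]
    refine Finset.sum_congr rfl fun j _ => ?_
    rw [pd_const_mul (d1 i j), pd_mul (d i) (d j), p, p]
  simp only [q, mul_add, Finset.sum_add_distrib]
  have s1 : ∑ i, ∑ j, N i j * ((x i - m i) * (if k = j then 1 else 0)) = ∑ j, N k j * (x j - m j) := by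
    refine Finset.sum_congr rfl fun i _ => ?_
    have : N i k = N k i := by conv_lhs => rw [← hN, Matrix.transpose_apply]
    simp [this]
  have s2 : ∑ i, ∑ j, N i j * ((if k = i then 1 else 0) * (x j - m j)) = ∑ j, N k j * (x j - m j) := by
    rw [Finset.sum_comm]
    refine Finset.sum_congr rfl fun i _ => ?_
    simp
  rw [s1, s2]; ring

theorem qf_vr {ω : Measure (Euc n)} (h : CC t ω) {P M : ℝ} (hP0 : 0 ≤ P) (hP : Poin ω P) (hM : CovLe ω M)
    {N : Matrix (Fin n) (Fin n) ℝ} (hN : Nᵀ = N) :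
    vr ω (qf N (me ω)) ≤ 4 * P * M * ∑ i, ∑ j, N i j ^ 2 := by
  have := h.prob
  refine (hP.smooth h.bs (qf_contDiff N _)).trans ?_
  have : ∫ x, gsq (qf N (me ω)) x ∂ω ≤ 4 * M * ∑ i, ∑ j, N i j ^ 2 := by
    have e : ∀ x, gsq (qf N (me ω)) x = ∑ k, 4 * (∑ j, N k j * (x j - me ω j)) ^ 2 := by
      intro x
      refine Finset.sum_congr rfl fun k _ => ?_
      rw [qf_pd N hN]; ring
    simp only [e]
    rw [integral_finsetSum _ fun k _ => (L2.s (h.l2 (by fun_prop))).const_mul _, Finset.mul_sum]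
    refine Finset.sum_le_sum fun k _ => ?_
    rw [integral_const_mul, lin_vr h.x2]
    have := hM (WithLp.toLp 2 (N k))
    rw [norm_sq_sum] at this
    nlinarith
  calc _ ≤ P * (4 * M * ∑ i, ∑ j, N i j ^ 2) := mul_le_mul_of_nonneg_left this hP0
    _ = _ := by ring

/-- the key third moment estimate -/
theorem kappa (h : CC t ν) {T : ℝ} {θ : Euc n} {P M : ℝ} (hP0 : 0 ≤ P) (hM0 : 0 ≤ M) (hP : Poin (nuT ν T θ) P)
    (hM : CovLe (nuT ν T θ) M) (v : Euc n) :
    ∑ i, ∑ j, (∑ k, v k * HM ν k T θ i j) ^ 2 ≤ 4 * P * M * vr (nuT ν T θ) (fun x => ⟪v, x⟫) := by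
  have hω := h.nuT T θ
  have := hω.prob
  set N : Matrix (Fin n) (Fin n) ℝ := Matrix.of fun i j => ∑ k, v k * HM ν k T θ i j with hN
  have sN : Nᵀ = N := by
    ext i j
    simp only [hN, Matrix.transpose_apply, Matrix.of_apply]
    refine Finset.sum_congr rfl fun k _ => ?_
    rw [← HM_symm k T θ, Matrix.transpose_apply, HM_symm]
  have e : ∑ i, ∑ j, N i j ^ 2 = cv (nuT ν T θ) (fun x => ⟪v, x⟫) (qf N (me (nuT ν T θ))) := by
    rw [← HM_form h]
    simp only [Finset.mul_sum]
    symm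
    rw [Finset.sum_comm]
    refine Finset.sum_congr rfl fun i _ => ?_
    rw [Finset.sum_comm]
    refine Finset.sum_congr rfl fun j _ => ?_
    rw [pow_two]
    conv_rhs => rw [hN, Matrix.of_apply]
    rw [Finset.sum_mul]
    refine Finset.sum_congr rfl fun k _ => ?_
    simp only [hN, Matrix.of_apply]; ring
  have c := cv_csq (hω.l2 (f := fun x => ⟪v, x⟫) (by fun_prop)) (hω.l2 (qf_contDiff N (me (nuT ν T θ))).continuous)
  rw [← e] at c
  have b := qf_vr hω hP0 hP hM sN
  have s0 : 0 ≤ vr (nuT ν T θ) (fun x => ⟪v, x⟫) := vr_nonneg (hω.l2 (by fun_prop))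
  have S0 : 0 ≤ ∑ i, ∑ j, N i j ^ 2 := Finset.sum_nonneg fun i _ => Finset.sum_nonneg fun j _ => sq_nonneg _
  have c2 := c.trans (mul_le_mul_of_nonneg_left b s0)
  change ∑ i, ∑ j, N i j ^ 2 ≤ _
  rcases S0.lt_or_eq with hS | hS
  · refine le_of_mul_le_mul_right ?_ hS
    linarith
  · rw [← hS]
    positivity

end
end KLS

end

section
open MeasureTheory Real Set
open scoped ENNReal RealInnerProductSpace Matrix

namespace KLS
noncomputable section

variable {n : ℕ} {t : ℝ} {ν : Measure (Euc n)}

theorem spec_quad {U B : Matrix (Fin n) (Fin n) ℝ} {l : Fin n → ℝ} (h : B = U * Matrix.diagonal l * Uᵀ) (v : Fin n → ℝ) :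
    ∑ i, ∑ j, v i * v j * B i j = ∑ k, l k * (∑ i, U i k * v i) ^ 2 := by
  have e : ∀ i j, B i j = ∑ k, U i k * l k * U j k := by
    intro i j
    rw [h, Matrix.mul_apply]
    refine Finset.sum_congr rfl fun k _ => ?_
    rw [Matrix.mul_diagonal, Matrix.transpose_apply]
  have r : ∀ k, l k * (∑ i, U i k * v i) ^ 2 = ∑ i, ∑ j, v i * v j * (U i k * l k * U j k) := by
    intro k
    rw [pow_two, Finset.sum_mul_sum, Finset.mul_sum]
    refine Finset.sum_congr rfl fun i _ => ?_
    rw [Finset.mul_sum]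
    refine Finset.sum_congr rfl fun j _ => ?_
    ring
  simp only [e, r, Finset.mul_sum]
  symm
  rw [Finset.sum_comm]
  refine Finset.sum_congr rfl fun i _ => ?_
  rw [Finset.sum_comm]

theorem spec_orth {U : Matrix (Fin n) (Fin n) ℝ} (u1 : Uᵀ * U = 1) (k m : Fin n) :
    ∑ i, U i k * U i m = if k = m then 1 else 0 := by
  have := congrFun (congrFun u1 k) m
  rw [Matrix.mul_apply, Matrix.one_apply] at this
  simpa only [Matrix.transpose_apply] using this

/-- spectral data of the covariance -/
theorem AM_spec (h : CC t ν) (T : ℝ) (θ : Euc n) :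
    ∃ (U : Matrix (Fin n) (Fin n) ℝ) (l : Fin n → ℝ), Uᵀ * U = 1 ∧ U * Uᵀ = 1 ∧ (∀ i, 0 ≤ l i) ∧
      (∀ k : ℕ, AM ν T θ ^ k = U * Matrix.diagonal (fun i => l i ^ k) * Uᵀ) ∧
      (∀ k : ℕ, TA ν k T θ = ∑ i, l i ^ k) ∧
      (∀ k, vr (nuT ν T θ) (fun x => ⟪(WithLp.toLp 2 (fun i => U i k) : Euc n), x⟫) = l k) ∧
      (∀ v : Euc n, vr (nuT ν T θ) (fun x => ⟪v, x⟫) = ∑ k, l k * (∑ i, U i k * v i) ^ 2) ∧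
      (∀ v : Euc n, ‖v‖ ^ 2 = ∑ k, (∑ i, U i k * v i) ^ 2) := by
  obtain ⟨U, l, u1, u2, l0, hk⟩ := spec (AM_psd h T θ)
  have hv : ∀ v : Euc n, vr (nuT ν T θ) (fun x => ⟪v, x⟫) = ∑ k, l k * (∑ i, U i k * v i) ^ 2 := by
    intro v
    have h1 := hk 1
    simp only [pow_one] at h1
    rw [← Am_quad h, ← spec_quad h1]
    rfl
  refine ⟨U, l, u1, u2, l0, hk, fun k => tr_pow u1 (hk k), fun k => ?_, hv, fun v => ?_⟩
  · rw [hv]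
    simp only [spec_orth u1]
    simp
  · have h0 := hk 0
    simp only [pow_zero] at h0
    have := spec_quad h0 v
    rw [norm_sq_sum]
    simp only [one_mul] at this
    rw [← this]
    refine Finset.sum_congr rfl fun i _ => ?_
    simp [Matrix.one_apply, pow_two]

theorem covLe_TA (h : CC t ν) {T : ℝ} {θ : Euc n} {q : ℕ} (hq : q ≠ 0) {R : ℝ} (hR : 0 ≤ R) (hS : TA ν q T θ ≤ R ^ q) :
    CovLe (nuT ν T θ) R := by
  obtain ⟨U, l, u1, u2, l0, hk, tr, hl, hv, hn⟩ := AM_spec h T θ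
  intro v
  rw [hv, hn, Finset.mul_sum]
  refine Finset.sum_le_sum fun k _ => mul_le_mul_of_nonneg_right ?_ (sq_nonneg _)
  rw [tr] at hS
  have : l k ^ q ≤ R ^ q := (Finset.single_le_sum (f := fun i => l i ^ q) (fun i _ => pow_nonneg (l0 i) q) (Finset.mem_univ k)).trans hS
  exact le_of_pow_le_pow_left₀ hq hR this

theorem TA_le (h : CC t ν) {T : ℝ} {θ : Euc n} (q : ℕ) {B : ℝ} (hB : CovLe (nuT ν T θ) B) :
    TA ν q T θ ≤ n * B ^ q := by
  obtain ⟨U, l, u1, u2, l0, hk, tr, hl, hv, hn⟩ := AM_spec h T θ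
  rw [tr]
  refine (Finset.sum_le_card_nsmul _ _ (B ^ q) fun k _ => ?_).trans (by simp)
  refine pow_le_pow_left₀ (l0 k) ?_ q
  rw [← hl k]
  refine (hB _).trans (le_of_eq ?_)
  rw [norm_sq_sum]
  have := spec_orth u1 k k
  simp only [if_true] at this
  simp only [pow_two, this, mul_one]

theorem third_sum (h : CC t ν) {T : ℝ} {θ : Euc n} {P M : ℝ} (hP0 : 0 ≤ P) (hM0 : 0 ≤ M) (hP : Poin (nuT ν T θ) P)
    (hM : CovLe (nuT ν T θ) M) (q : ℕ) :
    ∑ k, (AM ν T θ ^ q * HM ν k T θ * HM ν k T θ).trace ≤ 4 * P * M * TA ν (q + 1) T θ := by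
  obtain ⟨U, l, u1, u2, l0, hk, tr, hl, hv, hn⟩ := AM_spec h T θ
  have e : ∀ k, (AM ν T θ ^ q * HM ν k T θ * HM ν k T θ).trace =
      ∑ m, l m ^ q * ∑ i, (∑ j, U j m * HM ν j T θ i k) ^ 2 := by
    intro k
    rw [hk]
    have : (U * Matrix.diagonal (fun i => l i ^ q) * Uᵀ * HM ν k T θ * HM ν k T θ).trace =
        (Matrix.diagonal (fun i => l i ^ q) * ((HM ν k T θ * U)ᵀ * (HM ν k T θ * U))).trace := by
      rw [Matrix.transpose_mul, HM_symm]
      simp only [Matrix.mul_assoc]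
      rw [Matrix.trace_mul_comm]
      simp only [Matrix.mul_assoc]
    rw [this, Matrix.trace]
    refine Finset.sum_congr rfl fun m _ => ?_
    rw [Matrix.diag_apply, Matrix.diagonal_mul, Matrix.mul_apply]
    congr 1
    refine Finset.sum_congr rfl fun i _ => ?_
    rw [Matrix.transpose_apply, pow_two]
    have : (HM ν k T θ * U) i m = ∑ j, U j m * HM ν j T θ i k := by
      rw [Matrix.mul_apply]
      refine Finset.sum_congr rfl fun j _ => ?_
      have s : HM ν k T θ i j = HM ν j T θ i k := by
        have s1 : HM ν k T θ i j = HM ν k T θ j i := by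
          conv_lhs => rw [← HM_symm, Matrix.transpose_apply]
        have s2 : HM ν j T θ i k = HM ν j T θ k i := by
          conv_lhs => rw [← HM_symm, Matrix.transpose_apply]
        rw [s1, s2, HM_comm h]
      rw [s, mul_comm]
    rw [this]
  simp only [e]
  rw [Finset.sum_comm, tr, Finset.mul_sum]
  refine Finset.sum_le_sum fun m _ => ?_
  rw [← Finset.mul_sum, Finset.sum_comm]
  have := kappa h hP0 hM0 hP hM (WithLp.toLp 2 (fun i => U i m))
  rw [hl m] at this
  calc _ ≤ l m ^ q * (4 * P * M * l m) := mul_le_mul_of_nonneg_left this (pow_nonneg (l0 m) q)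
    _ = _ := by rw [pow_succ]; ring

theorem TA_pred (h : CC t ν) {T : ℝ} {θ : Euc n} {p : ℕ} (hn2 : n ≤ 2 ^ p) {R : ℝ} (hR : 0 < R)
    (hS : TA ν (p + 1) T θ ≤ R ^ (p + 1)) : TA ν p T θ ≤ 3 * R ^ p := by
  obtain ⟨U, l, u1, u2, l0, hk, tr, hl, hv, hn⟩ := AM_spec h T θ
  rw [tr] at hS ⊢
  have pt : ∀ i, l i ^ p ≤ 2 / R * l i ^ (p + 1) + (R / 2) ^ p := by
    intro i
    rcases le_total (l i) (R / 2) with h1 | h1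
    · have := pow_le_pow_left₀ (l0 i) h1 p
      have h2 : 0 ≤ 2 / R * l i ^ (p + 1) := mul_nonneg (by positivity) (pow_nonneg (l0 i) _)
      linarith
    · have h2 : l i ^ p * 1 ≤ l i ^ p * (2 / R * l i) := by
        refine mul_le_mul_of_nonneg_left ?_ (pow_nonneg (l0 i) p)
        rw [div_mul_eq_mul_div, le_div_iff₀ hR]; linarith
      have h3 : 0 ≤ (R / 2) ^ p := by positivity
      rw [pow_succ]; nlinarith
  calc ∑ i, l i ^ p ≤ ∑ i, (2 / R * l i ^ (p + 1) + (R / 2) ^ p) := Finset.sum_le_sum fun i _ => pt i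
    _ = 2 / R * ∑ i, l i ^ (p + 1) + n * (R / 2) ^ p := by rw [Finset.sum_add_distrib, Finset.mul_sum]; simp
    _ ≤ 2 / R * R ^ (p + 1) + 2 ^ p * (R / 2) ^ p := by
        have : (n:ℝ) ≤ 2 ^ p := by exact_mod_cast hn2
        gcongr
    _ = 3 * R ^ p := by
        rw [← mul_pow, pow_succ]
        field_simp
        ring

theorem borell_four' (h : CC t ν) (ht : 0 ≤ t) (e : Euc n) :
    ∫ x, (⟪e, x⟫ - ∫ y, ⟪e, y⟫ ∂ν) ^ 4 ∂ν ≤ 10 ^ 6 * (vr ν (fun x => ⟪e, x⟫)) ^ 2 := by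
  have := h.prob
  have hl : MemLp (fun x : Euc n => ⟪e, x⟫) 2 ν := h.l2 (by fun_prop)
  set v := vr ν (fun x => ⟪e, x⟫) with hv
  have v0 : 0 ≤ v := vr_nonneg hl
  have key : ∀ ε : ℝ, 0 < ε → ∫ x, (⟪e, x⟫ - ∫ y, ⟪e, y⟫ ∂ν) ^ 4 ∂ν ≤ 10 ^ 6 * (v + ε) ^ 2 := by
    intro ε hε
    have s : 0 < √(v + ε) := sqrt_pos.2 (by linarith)
    have := borell_four ht h.ul e (∫ y, ⟪e, y⟫ ∂ν) s (L2.s (h.l2 (by fun_prop))) (by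
      rw [sq_sqrt (by linarith)]
      have := vr_eq' hl
      simp only [real_inner_comm e] at this ⊢
      linarith)
    have e4 : √(v + ε) ^ 4 = (v + ε) ^ 2 := by
      rw [show (4:ℕ) = 2 * 2 from rfl, pow_mul, sq_sqrt (by linarith)]
    rw [e4] at this
    simp only [real_inner_comm e] at this ⊢
    exact this
  have l : Filter.Tendsto (fun ε : ℝ => 10 ^ 6 * (v + ε) ^ 2) (nhdsWithin 0 (Ioi 0)) (nhds (10 ^ 6 * (v + 0) ^ 2)) := by
    apply tendsto_nhdsWithin_of_tendsto_nhds
    exact (by fun_prop : Continuous fun ε : ℝ => 10 ^ 6 * (v + ε) ^ 2).tendsto 0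
  rw [add_zero] at l
  exact ge_of_tendsto l (eventually_nhdsWithin_of_forall fun ε hε => key ε hε)

theorem TA_grad (h : CC t ν) {T : ℝ} (hT : 0 ≤ t + T) {θ : Euc n} {M : ℝ} (hM : CovLe (nuT ν T θ) M) (p : ℕ) :
    gsq (TA ν (p + 2) T) θ ≤ ((p + 2 : ℕ) : ℝ) ^ 2 * (M * (10 ^ 6 * TA ν (p + 2) T θ ^ 2)) := by
  obtain ⟨U, l, u1, u2, l0, hk, tr, hl, hv, hn⟩ := AM_spec h T θ
  have hω := h.nuT T θ
  have := hω.prob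
  set ω := nuT ν T θ with hω'
  set N := AM ν T θ ^ (p + 1) with hN
  set Y := qf N (me ω) with hY
  have Ym : MemLp Y 2 ω := hω.l2 (qf_contDiff N _).continuous
  -- Y in spectral form
  have Yeq : ∀ x, Y x = ∑ k, l k ^ (p + 1) * (⟪(WithLp.toLp 2 (fun i => U i k) : Euc n), x⟫ -
      ∫ y, ⟪(WithLp.toLp 2 (fun i => U i k) : Euc n), y⟫ ∂ω) ^ 2 := by
    intro x
    have := spec_quad (hk (p + 1)) (fun i => x i - me ω i)
    have e1 : Y x = ∑ i, ∑ j, (x i - me ω i) * (x j - me ω j) * (AM ν T θ ^ (p+1)) i j := by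
      rw [hY, qf]
      refine Finset.sum_congr rfl fun i _ => Finset.sum_congr rfl fun j _ => ?_
      rw [hN]; ring
    rw [e1, this]
    refine Finset.sum_congr rfl fun k _ => ?_
    congr 2
    simp only [inner_sum]
    rw [integral_finsetSum _ fun i _ => (L2.i (hω.x2 i)).const_mul _, ← Finset.sum_sub_distrib]
    refine Finset.sum_congr rfl fun j _ => ?_
    rw [integral_const_mul, mul_sub]; rfl
  have Y2 : ∫ x, Y x ^ 2 ∂ω ≤ 10 ^ 6 * TA ν (p + 2) T θ ^ 2 := by
    set z : Fin n → Euc n → ℝ := fun k x => ⟪(WithLp.toLp 2 (fun i => U i k) : Euc n), x⟫ -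
      ∫ y, ⟪(WithLp.toLp 2 (fun i => U i k) : Euc n), y⟫ ∂ω with hz
    have pt : ∀ x, Y x ^ 2 ≤ (∑ k, l k ^ (p + 2)) * ∑ k, l k ^ p * z k x ^ 4 := by
      intro x
      rw [Yeq]
      have := Finset.sum_sq_le_sum_mul_sum_of_sq_eq_mul Finset.univ (r := fun k => l k ^ (p + 1) * z k x ^ 2)
        (f := fun k => l k ^ (p + 2)) (g := fun k => l k ^ p * z k x ^ 4) (fun k _ => pow_nonneg (l0 k) _)
        (fun k _ => mul_nonneg (pow_nonneg (l0 k) _) (by positivity)) (fun k _ => by ring)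
      exact this
    have zc : ∀ k, Continuous (z k) := fun k => by simp only [hz]; fun_prop
    have zi : ∀ k, Integrable (fun x => l k ^ p * z k x ^ 4) ω := fun k =>
      (L2.i (hω.l2 (f := fun x => z k x ^ 4) ((zc k).pow 4))).const_mul _
    refine (integral_mono (L2.s Ym) ((integrable_finsetSum _ fun k _ => zi k).const_mul _) pt).trans ?_
    rw [integral_const_mul, integral_finsetSum _ fun k _ => zi k, tr, pow_two]
    have s0 : 0 ≤ ∑ k, l k ^ (p + 2) := Finset.sum_nonneg fun k _ => pow_nonneg (l0 k) _
    have : ∑ k, ∫ x, l k ^ p * z k x ^ 4 ∂ω ≤ 10 ^ 6 * ∑ k, l k ^ (p + 2) := by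
      rw [Finset.mul_sum]
      refine Finset.sum_le_sum fun k _ => ?_
      rw [integral_const_mul]
      have b := borell_four' hω hT (WithLp.toLp 2 (fun i => U i k))
      rw [hl k] at b
      calc _ ≤ l k ^ p * (10 ^ 6 * l k ^ 2) := mul_le_mul_of_nonneg_left b (pow_nonneg (l0 k) p)
        _ = _ := by rw [pow_add]; ring
    nlinarith
  have YV : vr ω Y ≤ 10 ^ 6 * TA ν (p + 2) T θ ^ 2 := by
    rw [vr]; nlinarith [sq_nonneg (∫ x, Y x ∂ω)]
  have trf : ∀ k, (N * HM ν k T θ).trace = cv ω (fun x => x k) Y := by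
    intro k
    have := HM_form h N (ee k) T θ
    have e2 : (fun x : Euc n => ⟪ee k, x⟫) = fun x => x k := by funext x; rw [real_inner_comm, inner_ee]
    rw [e2] at this
    rw [← this]
    simp only [ee_apply]
    rw [Finset.sum_eq_single k]
    · simp only [if_true, one_mul, Matrix.trace, Matrix.diag_apply, Matrix.mul_apply]
      refine Finset.sum_congr rfl fun i _ => Finset.sum_congr rfl fun j _ => ?_
      congr 1
      conv_lhs => rw [← HM_symm, Matrix.transpose_apply]
    · intro b _ hb; simp [hb]
    · simp
  have bs := bessel hM hω.x2 Ym
  have M0 : M * vr ω Y ≤ M * (10 ^ 6 * TA ν (p + 2) T θ ^ 2) := by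
    rcases n.eq_zero_or_pos with h0 | h0
    · subst h0
      have z1 : TA ν (p + 2) T θ = 0 := by rw [tr]; simp
      have z2 : vr ω Y = 0 := le_antisymm (by rw [z1] at YV; simpa using YV) (vr_nonneg Ym)
      rw [z1, z2]; simp
    · have m0 : 0 ≤ M := by
        have h1 := hM (ee ⟨0, h0⟩)
        rw [norm_ee] at h1
        have := vr_nonneg (ω := ω) (hω.l2 (f := fun x => ⟪ee ⟨0, h0⟩, x⟫) (by fun_prop))
        linarith
      exact mul_le_mul_of_nonneg_left YV m0
  calc gsq (TA ν (p + 2) T) θ = ((p + 2 : ℕ) : ℝ) ^ 2 * ∑ i, cv ω (fun x => x i) Y ^ 2 := by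
        rw [gsq, Finset.mul_sum]
        refine Finset.sum_congr rfl fun i _ => ?_
        rw [TA_pd h, ← trf]
        have : p + 2 - 1 = p + 1 := rfl
        rw [this]; ring
    _ ≤ _ := mul_le_mul_of_nonneg_left (bs.trans M0) (sq_nonneg _)

end
end KLS

end

section
open MeasureTheory Real Set
open scoped ENNReal RealInnerProductSpace Matrix

namespace KLS
noncomputable section

variable {n : ℕ} {t : ℝ} {ν : Measure (Euc n)}

theorem Cb.exp : ∀ {k : ℕ} {f : Euc n → ℝ}, Cb k f → Cb k (fun x => Real.exp (f x)) := by
  intro k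
  induction k with
  | zero =>
    intro f h
    obtain ⟨K, _, hK⟩ := h.bdd
    exact ⟨Real.continuous_exp.comp h.continuous, Real.exp K, fun x => by
      rw [abs_of_pos (exp_pos _)]; exact exp_le_exp.2 ((le_abs_self _).trans (hK x))⟩
  | succ k ih =>
    intro f h
    obtain ⟨K, _, hK⟩ := h.bdd
    have d : Differentiable ℝ (fun x => Real.exp (f x)) := h.diff.exp
    refine ⟨⟨d.continuous, Real.exp K, fun x => by
      rw [abs_of_pos (exp_pos _)]; exact exp_le_exp.2 ((le_abs_self _).trans (hK x))⟩, d, fun i => ?_⟩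
    have : KLS.pd i (fun x => Real.exp (f x)) = fun x => Real.exp (f x) * KLS.pd i f x := by
      funext x; exact pd_comp (Real.hasDerivAt_exp (f x)) (h.diff x) i
    rw [this]
    exact (ih h.of_succ).mul (h.pd i)

/-- `s^(1/q)` -/
def rr (q : ℕ) (s : ℝ) : ℝ := exp (log s / q)

theorem rr_pos (q : ℕ) (s : ℝ) : 0 < rr q s := exp_pos _

theorem rr_pow {q : ℕ} (hq : q ≠ 0) {s : ℝ} (hs : 0 < s) : rr q s ^ q = s := by
  rw [rr, ← exp_nat_mul]
  have : (q:ℝ) ≠ 0 := by exact_mod_cast hq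
  rw [mul_div_cancel₀ _ this, exp_log hs]

theorem one_le_rr {q : ℕ} {s : ℝ} (hs : 1 ≤ s) : 1 ≤ rr q s := by
  rw [rr]; exact one_le_exp (div_nonneg (log_nonneg hs) (by positivity))

theorem rr_deriv (q : ℕ) {s : ℝ} (hs : 0 < s) : HasDerivAt (rr q) (rr q s * (s⁻¹ / q)) s :=
  ((hasDerivAt_log hs.ne').div_const (q:ℝ)).exp

def ph (q : ℕ) (M : ℝ) (s : ℝ) : ℝ := (1 + rr q s / M)⁻¹

def ph1 (q : ℕ) (M : ℝ) (s : ℝ) : ℝ := - (rr q s * (s⁻¹ / q) / M) / (1 + rr q s / M) ^ 2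

def ph2 (q : ℕ) (M : ℝ) (s : ℝ) : ℝ :=
  ((1 - 1 / q) * rr q s * (s⁻¹ ^ 2 / q) / M) / (1 + rr q s / M) ^ 2 +
    2 * (rr q s * (s⁻¹ / q) / M) ^ 2 / (1 + rr q s / M) ^ 3

theorem ph_deriv (q : ℕ) {M : ℝ} (hM : 0 < M) {s : ℝ} (hs : 0 < s) : HasDerivAt (ph q M) (ph1 q M s) s := by
  have h := ((rr_deriv q hs).div_const M).const_add 1
  have p : 1 + rr q s / M ≠ 0 := by have := rr_pos q s; positivity
  have := h.inv p
  exact this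

theorem ph1_deriv (q : ℕ) {M : ℝ} (hM : 0 < M) {s : ℝ} (hs : 0 < s) : HasDerivAt (ph1 q M) (ph2 q M s) s := by
  have h := ((rr_deriv q hs).div_const M).const_add 1
  have p : 1 + rr q s / M ≠ 0 := by have := rr_pos q s; positivity
  have h2 := ((((rr_deriv q hs).mul ((hasDerivAt_inv hs.ne').div_const (q:ℝ))).div_const M).neg).div (h.pow 2) (pow_ne_zero 2 p)
  refine h2.congr_deriv ?_
  rw [ph2]
  simp only [Pi.mul_apply, Pi.pow_apply, Pi.neg_apply]
  set r := rr q s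
  have e : (s^2)⁻¹ = s⁻¹ ^ 2 := by rw [inv_pow]
  have e0 : ((q:ℝ)) ⁻¹ = (q:ℝ)⁻¹ := rfl
  set u := 1 + r / M with hu
  simp only [Nat.add_one_sub_one, pow_one, Nat.cast_ofNat]
  rcases eq_or_ne (q:ℝ) 0 with hq | hq
  · simp [hq]
  · field_simp
    ring

theorem ph2_nonneg {q : ℕ} {M : ℝ} (hM : 0 < M) {s : ℝ} (hs : 0 < s) : 0 ≤ ph2 q M s := by
  have := rr_pos q s
  have h1 : 0 ≤ 1 - 1 / (q:ℝ) := by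
    rcases q.eq_zero_or_pos with hq | hq
    · subst hq; simp
    · have : (1:ℝ) ≤ q := by exact_mod_cast hq
      rw [sub_nonneg, div_le_one (by linarith)]; exact this
  rw [ph2]
  have : 0 ≤ (1 - 1 / (q:ℝ)) * rr q s * (s⁻¹ ^ 2 / q) / M := by
    apply div_nonneg _ hM.le
    exact mul_nonneg (mul_nonneg h1 (rr_pos q s).le) (by positivity)
  positivity

/-- `S = 1 + Tr A^q` -/
def SS (ν : Measure (Euc n)) (q : ℕ) (T : ℝ) (θ : Euc n) : ℝ := 1 + TA ν q T θ

theorem SS_nice (h : CC t ν) (q : ℕ) : Nice (SS ν q) := (Nice.const 1).add (TA_nice h q)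

theorem one_le_SS (h : CC t ν) (q : ℕ) (T : ℝ) (θ : Euc n) : 1 ≤ SS ν q T θ := by
  have := TA_nonneg h q T θ
  rw [SS]; linarith

def GG (ν : Measure (Euc n)) (q : ℕ) (M : ℝ) (T : ℝ) (θ : Euc n) : ℝ := ph q M (SS ν q T θ)

theorem GG_nice (h : CC t ν) (q : ℕ) {M : ℝ} (hM : 0 < M) : Nice (GG ν q M) := by
  refine (SS_nice h q).comp (φ := ph q M) (φ' := ph1 q M) (c := 1) (one_le_SS h q) (fun y hy => ph_deriv q hM (by linarith)) ?_ ?_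
  · intro y hy
    have hy' : (0:ℝ) < y := lt_of_lt_of_le one_pos hy
    exact (ph1_deriv q hM hy').continuousAt.continuousWithinAt
  · intro T k
    have h1 : Cb k (SS ν q T) := (SS_nice h q).sb T k
    have h2 : Cb k (fun θ => (1 + M⁻¹ * Real.exp ((q:ℝ)⁻¹ * log (SS ν q T θ)))⁻¹) := by
      refine (((Cb.const 1 k).add (Cb.const_mul _ (Cb.exp (Cb.const_mul _ (h1.log one_pos (one_le_SS h q T)))))).inv one_pos ?_)
      intro x
      have : 0 ≤ M⁻¹ * Real.exp ((q:ℝ)⁻¹ * log (SS ν q T x)) := by positivity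
      linarith
    have e : (fun θ => ph q M (SS ν q T θ)) = (fun θ => (1 + M⁻¹ * Real.exp ((q:ℝ)⁻¹ * log (SS ν q T θ)))⁻¹) := by
      funext θ
      simp only [ph, rr, div_eq_inv_mul]
    rw [e]; exact h2

section
variable {M : ℝ} {q : ℕ}

theorem GG_pos (hM : 0 < M) (T : ℝ) (θ : Euc n) : 0 < GG ν q M T θ := by
  have := rr_pos q (SS ν q T θ)
  rw [GG, ph]; positivity

theorem GG_le_one (hM : 0 < M) (T : ℝ) (θ : Euc n) : GG ν q M T θ ≤ 1 := by
  have := rr_pos q (SS ν q T θ)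
  rw [GG, ph]
  apply inv_le_one_of_one_le₀
  have : 0 ≤ rr q (SS ν q T θ) / M := by positivity
  linarith

theorem GG_mul_le (hM : 0 < M) (T : ℝ) (θ : Euc n) : GG ν q M T θ * rr q (SS ν q T θ) ≤ M := by
  have := rr_pos q (SS ν q T θ)
  rw [GG, ph, inv_mul_le_iff₀ (by positivity), add_mul, div_mul_cancel₀ _ hM.ne']
  linarith

theorem GG_mul_sqrt (hM : 0 < M) (T : ℝ) (θ : Euc n) : GG ν q M T θ * √(rr q (SS ν q T θ)) ≤ √M := by
  have r := rr_pos q (SS ν q T θ)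
  have h1 := GG_mul_le (ν := ν) (q := q) hM T θ
  have h2 := GG_le_one (ν := ν) (q := q) hM T θ
  have h3 := GG_pos (ν := ν) (q := q) hM T θ
  apply le_sqrt_of_sq_le
  rw [mul_pow, sq_sqrt r.le]
  nlinarith [mul_pos h3 r]

theorem covLe_rr (h : CC t ν) (hq : q ≠ 0) (T : ℝ) (θ : Euc n) : CovLe (nuT ν T θ) (rr q (SS ν q T θ)) := by
  have := one_le_SS h q T θ
  refine covLe_TA h hq (rr_pos _ _).le ?_
  rw [rr_pow hq (by linarith), SS]; linarith

theorem GG_LL (h : CC t ν) {p : ℕ} (hn2 : n ≤ 2 ^ (p + 1)) (hM : 0 < M) {T : ℝ} {θ : Euc n} {Ψ : ℝ} (hΨ : 0 ≤ Ψ)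
    (hP : Poin (nuT ν T θ) (Ψ * rr (p + 2) (SS ν (p + 2) T θ))) :
    - (6 * (p + 2) * Ψ * M) ≤ LL ν (GG ν (p + 2) M) T θ := by
  have S1 := one_le_SS h (p + 2) T θ
  have S0 : 0 < SS ν (p + 2) T θ := by linarith
  have e := LL_comp (ν := ν) (SS_nice h (p + 2)) (φ := ph (p + 2) M) (φ' := ph1 (p + 2) M) (φ'' := ph2 (p + 2) M) (c := 1)
    (one_le_SS h (p + 2)) (fun y hy => ph_deriv (p + 2) hM (by linarith)) (fun y hy => ph1_deriv (p + 2) hM (by linarith)) T θ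
  change LL ν (GG ν (p + 2) M) T θ = _ at e
  have e2 : LL ν (SS ν (p + 2)) T θ = LL ν (TA ν (p + 2)) T θ := by
    have := LL_add (ν := ν) (Nice.const 1) (TA_nice h (p + 2)) T θ
    rw [LL_const, zero_add] at this
    exact this
  have hl := TA_LL h (p + 2) T θ
  have hR0 := rr_pos (p + 2) (SS ν (p + 2) T θ)
  have hRp := rr_pow (q := p + 2) (by omega) S0
  have hcov := covLe_rr h (q := p + 2) (by omega) T θ
  set S := SS ν (p + 2) T θ with hS
  set R := rr (p + 2) S with hR
  have ht := third_sum h (by positivity) hR0.le hP hcov p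
  have hpred := TA_pred h (p := p + 1) (T := T) (θ := θ) hn2 hR0 (by rw [hRp, hS, SS]; linarith)
  have g0 := gsq_nonneg (SS ν (p + 2) T) θ
  have p2 := ph2_nonneg (q := p + 2) hM S0
  have LS : LL ν (SS ν (p + 2)) T θ ≤ 6 * (p + 2) * (p + 2) * Ψ * (R * S) := by
    rw [e2]
    refine hl.trans ?_
    have : p + 2 - 2 = p := rfl
    rw [this]
    push_cast
    calc _ ≤ ((p + 2) * (p + 2 - 1) / 2 : ℝ) * (4 * (Ψ * R) * R * (3 * R ^ (p + 1))) := by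
          refine mul_le_mul_of_nonneg_left (ht.trans ?_) ?_
          · exact mul_le_mul_of_nonneg_left hpred (by positivity)
          · have : (0:ℝ) ≤ (p:ℝ) + 2 - 1 := by have : (0:ℝ) ≤ (p:ℝ) := by positivity
                                               linarith
            positivity
      _ = (6 * (p + 2) * Ψ * (R * R ^ (p + 2))) * (p + 1) := by ring
      _ ≤ (6 * (p + 2) * Ψ * (R * R ^ (p + 2))) * (p + 2) := by
          refine mul_le_mul_of_nonneg_left (by linarith) (by positivity)
      _ = _ := by rw [hRp]; ring
  have ph1n : ph1 (p + 2) M S ≤ 0 := by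
    rw [ph1]; apply div_nonpos_of_nonpos_of_nonneg _ (by positivity)
    rw [neg_nonpos]; positivity
  have main : ph1 (p + 2) M S * (6 * (p + 2) * (p + 2) * Ψ * (R * S)) = - (6 * (p + 2) * Ψ * (R ^ 2 / (M * (1 + R / M) ^ 2))) := by
    rw [ph1, ← hR]
    have : (1 + R / M) ≠ 0 := by positivity
    push_cast
    generalize (1 + R / M) = u at *
    field_simp
  have b : R ^ 2 / (M * (1 + R / M) ^ 2) ≤ M := by
    rw [div_le_iff₀ (by positivity)]
    have : M * (M * (1 + R / M) ^ 2) = (M + R) ^ 2 := by field_simp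
    rw [this]; nlinarith
  rw [e]
  have c1 := mul_le_mul_of_nonpos_left LS ph1n
  rw [main] at c1
  have c2 : 0 ≤ 1 / 2 * ph2 (p + 2) M S * gsq (SS ν (p + 2) T) θ := by positivity
  have c3 : 6 * (p + 2) * Ψ * (R ^ 2 / (M * (1 + R / M) ^ 2)) ≤ 6 * (p + 2) * Ψ * M := mul_le_mul_of_nonneg_left b (by positivity)
  linarith

theorem GG_grad (h : CC t ν) {p : ℕ} (hM : 0 < M) {T : ℝ} (hT : 0 ≤ t + T) (θ : Euc n) :
    gsq (GG ν (p + 2) M T) θ ≤ 10 ^ 6 * M ^ 2 / rr (p + 2) (SS ν (p + 2) T θ) := by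
  have S1 := one_le_SS h (p + 2) T θ
  have S0 : 0 < SS ν (p + 2) T θ := by linarith
  have hR0 := rr_pos (p + 2) (SS ν (p + 2) T θ)
  have hcov := covLe_rr h (q := p + 2) (by omega) T θ
  have tg := TA_grad h hT hcov p
  have e : gsq (GG ν (p + 2) M T) θ = ph1 (p + 2) M (SS ν (p + 2) T θ) ^ 2 * gsq (TA ν (p + 2) T) θ := by
    rw [gsq, gsq, Finset.mul_sum]
    refine Finset.sum_congr rfl fun i _ => ?_
    have := pd_comp (ph_deriv (p + 2) hM S0) ((SS_nice h (p + 2)).d T θ) i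
    have e1 : pd i (GG ν (p + 2) M T) θ = ph1 (p + 2) M (SS ν (p + 2) T θ) * pd i (SS ν (p + 2) T) θ := this
    have e2 : pd i (SS ν (p + 2) T) = fun θ => pd i (fun _ => (1:ℝ)) θ + pd i (TA ν (p + 2) T) θ :=
      pd_add (differentiable_const _) ((TA_nice h (p + 2)).d T) i
    have e3 : pd i (fun _ : Euc n => (1:ℝ)) θ = 0 := by simp [pd]
    rw [e1, e2]; simp only [e3, zero_add]; ring
  have TS : TA ν (p + 2) T θ ^ 2 ≤ SS ν (p + 2) T θ ^ 2 :=
    pow_le_pow_left₀ (TA_nonneg h _ T θ) (by rw [SS]; linarith) 2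
  rw [e]
  set S := SS ν (p + 2) T θ with hS
  set R := rr (p + 2) S with hR
  calc ph1 (p + 2) M S ^ 2 * gsq (TA ν (p + 2) T) θ
      ≤ ph1 (p + 2) M S ^ 2 * (((p + 2 : ℕ) : ℝ) ^ 2 * (R * (10 ^ 6 * S ^ 2))) := by
        refine mul_le_mul_of_nonneg_left (tg.trans ?_) (sq_nonneg _)
        gcongr
    _ = 10 ^ 6 * R ^ 3 / (M ^ 2 * (1 + R / M) ^ 4) := by
        rw [ph1, ← hR]
        have : (1 + R / M) ≠ 0 := by positivity
        push_cast
        generalize (1 + R / M) = u at *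
        field_simp
    _ ≤ _ := by
        rw [div_le_div_iff₀ (by positivity) hR0]
        have : 10 ^ 6 * M ^ 2 * (M ^ 2 * (1 + R / M) ^ 4) = 10 ^ 6 * (M + R) ^ 4 := by field_simp
        rw [this]
        have : R ^ 4 ≤ (M + R) ^ 4 := pow_le_pow_left₀ hR0.le (by linarith) 4
        nlinarith

end
end
end KLS

end

section
open MeasureTheory Real Set
open scoped ENNReal RealInnerProductSpace Matrix

namespace KLS
noncomputable section

variable {n : ℕ} {t : ℝ} {ν : Measure (Euc n)} {f : Euc n → ℝ}

theorem wgrad {ω : Measure (Euc n)} {s R : ℝ} (h : CC s ω) (hs : 0 < s) (hf : SB f) (hR0 : 0 < R)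
    (hR : CovLe ω R) (w : Euc n) :
    ∫ x, (⟪x, w⟫ - ∫ y, ⟪y, w⟫ ∂ω) * (f x - ∫ y, f y ∂ω) ^ 2 ∂ω ≤
      8 * √R * ‖w‖ * (2 / s * ∫ x, gsq f x ∂ω + 2 * vr ω f) := by
  have := h.prob
  rcases eq_or_ne w 0 with rfl | hw
  · simp
  have hwp : 0 < ‖w‖ := norm_pos_iff.2 hw
  set a := ∫ y, ⟪y, w⟫ ∂ω with ha
  set m := ∫ y, f y ∂ω with hm
  have hσ : 0 < √R * ‖w‖ := by positivity
  have cw : Continuous fun x : Euc n => ⟪x, w⟫ := by fun_prop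
  have e2 : ∫ x, (⟪x, w⟫ - a) ^ 2 ∂ω ≤ (√R * ‖w‖) ^ 2 := by
    rw [← vr_eq' (h.l2 cw), mul_pow, Real.sq_sqrt hR0.le]
    have := hR w
    simpa only [real_inner_comm] using this
  have ci : Continuous fun x : Euc n => (⟪x, w⟫ - a) ^ 2 := by fun_prop
  obtain ⟨b1, b2⟩ := borell_exp hs.le h.ul w a hσ (h.bs.integrable ci) e2
  have c1 : Continuous fun x : Euc n => (⟪x, w⟫ - a) / (8 * (√R * ‖w‖)) := by fun_prop
  have c2 : Continuous fun x : Euc n => exp ((⟪x, w⟫ - a) / (8 * (√R * ‖w‖))) := by fun_prop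
  have c3 : ∫ x, exp ((⟪x, w⟫ - a) / (8 * (√R * ‖w‖))) ∂ω ≤ 6 := by
    refine (integral_mono (h.bs.integrable c2) b1 fun x => ?_).trans b2
    exact exp_le_exp.2 (div_le_div_of_nonneg_right (le_abs_self _) (by positivity))
  have g := ul_gibbs hs h.ul ((hf.sub_const m) 2) (h.bs.integrable c1) (h.bs.integrable c2) c3
  rw [gsq_sub_const, ← vr_eq' (h.l2 (hf 0).continuous)] at g
  have l6 : log 6 ≤ 2 := by
    have : (6:ℝ) ≤ exp 2 := by
      have := Real.add_one_le_exp (1:ℝ)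
      have h1 := Real.exp_one_gt_d9
      rw [show (2:ℝ) = 1 + 1 by norm_num, exp_add]
      nlinarith
    calc log 6 ≤ log (exp 2) := log_le_log (by norm_num) this
      _ = 2 := log_exp 2
  have v0 := vr_nonneg (h.l2 (hf 0).continuous)
  have e3 : ∫ x, (⟪x, w⟫ - a) * (f x - m) ^ 2 ∂ω = (8 * (√R * ‖w‖)) *
      ∫ x, (⟪x, w⟫ - a) / (8 * (√R * ‖w‖)) * (f x - m) ^ 2 ∂ω := by
    rw [← integral_const_mul]
    congr 1; funext x; field_simp
  rw [e3, show 8 * √R * ‖w‖ = 8 * (√R * ‖w‖) by ring]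
  refine mul_le_mul_of_nonneg_left (g.trans ?_) (by positivity)
  have := mul_le_mul_of_nonneg_right l6 v0
  linarith

def VV (ν : Measure (Euc n)) (f : Euc n → ℝ) (T : ℝ) (θ : Euc n) : ℝ :=
  mm ν (fun x => f x ^ 2) T θ - mm ν f T θ * mm ν f T θ

theorem VV_eq (T : ℝ) (θ : Euc n) : VV ν f T θ = vr (nuT ν T θ) f := by
  rw [vr_mm, VV, pow_two (mm ν f T θ)]

theorem VV_nice (h : CC t ν) (hf : Continuous f) : Nice (VV ν f) :=
  (mm_nice h (hf.pow 2)).sub ((mm_nice h hf).mul (mm_nice h hf))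

theorem VV_nonneg (h : CC t ν) (hf : Continuous f) (T : ℝ) (θ : Euc n) : 0 ≤ VV ν f T θ := by
  have h' := h.nuT T θ
  have := h'.prob
  rw [VV_eq]; exact vr_nonneg (h'.l2 hf)

theorem VV_LL (h : CC t ν) (hf : Continuous f) (T : ℝ) (θ : Euc n) :
    LL ν (VV ν f) T θ = - gsq (mm ν f T) θ := by
  have e : VV ν f = fun T θ => mm ν (fun x => f x ^ 2) T θ - mm ν f T θ * mm ν f T θ := rfl
  have c2 : Continuous fun x => f x ^ 2 := hf.pow 2
  rw [e, LL_sub (mm_nice h c2) ((mm_nice h hf).mul (mm_nice h hf)),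
    LL_mul (mm_nice h hf) (mm_nice h hf), mm_LL h c2, mm_LL h hf]
  simp [gsq, pow_two]

theorem VV_pd (h : CC t ν) (hf : Continuous f) (T : ℝ) (θ : Euc n) (w : Euc n) :
    ∑ i, w i * pd i (VV ν f T) θ = ∫ x, (⟪x, w⟫ - ∫ y, ⟪y, w⟫ ∂(nuT ν T θ)) *
      (f x - ∫ y, f y ∂(nuT ν T θ)) ^ 2 ∂(nuT ν T θ) := by
  have h' := h.nuT T θ
  have := h'.prob
  set ω := nuT ν T θ with hω
  set m := ∫ y, f y ∂ω with hm
  have hm' : mm ν f T θ = m := rfl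
  have c2 : Continuous fun x => f x ^ 2 := hf.pow 2
  have cw : Continuous fun x : Euc n => ⟪w, x⟫ := by fun_prop
  have d2 : Differentiable ℝ (mm ν (fun x => f x ^ 2) T) := (mm_nice h c2).d T
  have d1 : Differentiable ℝ (mm ν f T) := (mm_nice h hf).d T
  have d3 : Differentiable ℝ (fun θ => mm ν f T θ * mm ν f T θ) := d1.mul d1
  have p : ∀ i, pd i (VV ν f T) θ = cv ω (fun x => x i) (fun x => f x ^ 2) -
      2 * m * cv ω (fun x => x i) f := by
    intro i
    have e : VV ν f T = fun θ => mm ν (fun x => f x ^ 2) T θ - mm ν f T θ * mm ν f T θ := rfl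
    rw [e, pd_sub d2 d3, pd_mul d1 d1]
    simp only
    rw [mm_pd_cv h c2, mm_pd_cv h hf, hm']
    ring
  have e1 : ∑ i, w i * pd i (VV ν f T) θ = cv ω (fun x => ⟪w, x⟫) (fun x => f x ^ 2) -
      2 * m * cv ω (fun x => ⟪w, x⟫) f := by
    rw [cv_inner h'.x2 (h'.l2 c2), cv_inner h'.x2 (h'.l2 hf), Finset.mul_sum, ← Finset.sum_sub_distrib]
    refine Finset.sum_congr rfl fun i _ => ?_
    rw [p]; ring
  rw [e1, cv_eq (h'.l2 cw) (h'.l2 c2) (∫ x, ⟪w, x⟫ ∂ω) 0, cv_eq (h'.l2 cw) (h'.l2 hf) (∫ x, ⟪w, x⟫ ∂ω) 0]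
  simp only [sub_self, zero_mul, sub_zero]
  have ic : ∀ x : Euc n, ⟪w, x⟫ = ⟪x, w⟫ := fun x => real_inner_comm _ _
  simp only [ic]
  set a := ∫ x, ⟪x, w⟫ ∂ω with ha
  have cx : Continuous fun x : Euc n => ⟪x, w⟫ := by fun_prop
  have i1 : Integrable (fun x => (⟪x, w⟫ - a) * f x ^ 2) ω := h'.bs.integrable (by fun_prop)
  have i2 : Integrable (fun x => 2 * m * ((⟪x, w⟫ - a) * f x)) ω := h'.bs.integrable (by fun_prop)
  have i3 : Integrable (fun x => m ^ 2 * (⟪x, w⟫ - a)) ω := h'.bs.integrable (by fun_prop)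
  have z : ∫ x, (⟪x, w⟫ - a) ∂ω = 0 := by
    rw [integral_sub (h'.bs.integrable cx) (integrable_const _)]; simp [ha]
  have e2 : ∀ x, (⟪x, w⟫ - a) * (f x - m) ^ 2 = (⟪x, w⟫ - a) * f x ^ 2 - 2 * m * ((⟪x, w⟫ - a) * f x) +
      m ^ 2 * (⟪x, w⟫ - a) := fun x => by ring
  rw [integral_congr_ae (Filter.Eventually.of_forall e2)]
  rw [integral_add (isub i1 i2) i3, integral_sub i1 i2, integral_const_mul, integral_const_mul, z]
  ring

/-- The cross term bound. -/
theorem cross (h : CC t ν) {p : ℕ} {M T : ℝ} (hM : 0 < M) (hT : 0 < t + T) (hf : SB f) (θ : Euc n) :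
    - (8000 * M * (2 / (t + T) * mm ν (gsq f) T θ + 2 * VV ν f T θ)) ≤
      ∑ i, pd i (GG ν (p + 2) M T) θ * pd i (VV ν f T) θ := by
  have h' := h.nuT T θ
  set R := rr (p + 2) (SS ν (p + 2) T θ) with hR
  have R0 : 0 < R := rr_pos _ _
  set G := GG ν (p + 2) M T with hG
  have g1 := wgrad h' hT hf R0 (covLe_rr h (by omega) T θ) (- gradient G θ)
  rw [← VV_pd h (hf 0).continuous, norm_neg, ← VV_eq] at g1
  have e : ∑ i, (- gradient G θ) i * pd i (VV ν f T) θ = - ∑ i, pd i G θ * pd i (VV ν f T) θ := by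
    rw [← Finset.sum_neg_distrib]
    refine Finset.sum_congr rfl fun i _ => ?_
    rw [← gradient_apply G]; simp
  rw [e] at g1
  have g2 : √R * ‖gradient G θ‖ ≤ 1000 * M := by
    have := GG_grad h (p := p) hM hT.le θ
    rw [gsq_eq, ← hR, ← hG, le_div_iff₀ R0] at this
    refine abs_le_of_sq_le_sq' ?_ (by positivity) |>.2
    rw [mul_pow, Real.sq_sqrt R0.le]
    nlinarith
  have nn : 0 ≤ 2 / (t + T) * ∫ x, gsq f x ∂(nuT ν T θ) + 2 * VV ν f T θ := by
    have := VV_nonneg h (hf 0).continuous T θ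
    have : 0 ≤ ∫ x, gsq f x ∂(nuT ν T θ) := integral_nonneg fun x => gsq_nonneg f x
    positivity
  have g3 := mul_le_mul_of_nonneg_right g2 nn
  have e4 : mm ν (gsq f) T θ = ∫ x, gsq f x ∂(nuT ν T θ) := rfl
  rw [e4]
  linarith

end

end KLS

end

section
open MeasureTheory Real Set
open scoped ENNReal RealInnerProductSpace Matrix

namespace KLS
noncomputable section

variable {n : ℕ} {t : ℝ} {ν : Measure (Euc n)} {f : Euc n → ℝ}

def HH0 (n : ℕ) (τ Ψ : ℝ) : Prop := ∀ t, τ ≤ t → ∀ ν : Measure (Euc n), CC t ν → ∀ B, 1 ≤ B →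
  CovLe ν B → Poin ν (Ψ * B)

theorem HH0_start {τ Ψ : ℝ} (hτ : 0 < τ) (hΨ : 1 / τ ≤ Ψ) : HH0 n τ Ψ := by
  intro t ht ν h B hB _
  refine (h.poin (hτ.trans_le ht)).mono ?_
  have h1 : 1 / t ≤ 1 / τ := one_div_le_one_div_of_le hτ ht
  have h0 : 0 < 1 / τ := by positivity
  nlinarith

theorem nuT_zero [IsProbabilityMeasure ν] : nuT ν 0 0 = ν := by
  have : (fun x : Euc n => lx x (0, 0)) = fun _ => (0:ℝ) := by
    funext x; rw [lx_apply]; simp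
  rw [nuT, this, tilted_const]

theorem GG_zero (h : CC t ν) {p : ℕ} (hn2 : n ≤ 2 ^ (p + 1)) {B : ℝ} (hB : 1 ≤ B) (hc : CovLe ν B) :
    1 / 2 ≤ GG ν (p + 2) (2 * B) 0 0 := by
  have := h.prob
  have B0 : 0 < B := by linarith
  have h1 : TA ν (p + 2) 0 0 ≤ n * B ^ (p + 2) := TA_le h _ (by rwa [nuT_zero])
  have h2 : SS ν (p + 2) 0 0 ≤ (2 * B) ^ (p + 2) := by
    have e1 : (n : ℝ) ≤ 2 ^ (p + 1) := by exact_mod_cast hn2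
    have e2 : (1:ℝ) ≤ 2 ^ (p + 1) := one_le_pow₀ (by norm_num)
    have e3 : (1:ℝ) ≤ B ^ (p + 2) := one_le_pow₀ hB
    have e4 : (2:ℝ) ^ (p + 2) = 2 ^ (p + 1) + 2 ^ (p + 1) := by ring
    rw [SS, mul_pow, e4]
    have e5 := mul_le_mul_of_nonneg_right e1 (by linarith : 0 ≤ B ^ (p + 2))
    nlinarith
  have h3 : rr (p + 2) (SS ν (p + 2) 0 0) ≤ 2 * B := by
    refine le_of_pow_le_pow_left₀ (n := p + 2) (by omega) (by positivity) ?_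
    rwa [rr_pow (by omega) (by linarith [one_le_SS h (p + 2) 0 0])]
  rw [GG, ph, one_div]
  refine inv_anti₀ (by have := rr_pos (p + 2) (SS ν (p + 2) 0 0); positivity) ?_
  have : rr (p + 2) (SS ν (p + 2) 0 0) / (2 * B) ≤ 1 := by rwa [div_le_one (by positivity)]
  linarith

theorem GV_LL (h : CC t ν) {p : ℕ} (hn2 : n ≤ 2 ^ (p + 1)) {τ Ψ : ℝ} (hτ : 0 < τ) (hΨ : 0 ≤ Ψ)
    (ht : τ ≤ t) (H : HH0 n τ Ψ) {M : ℝ} (hM : 0 < M) (hf : SB f) {T : ℝ} (hT : 0 ≤ T) (θ : Euc n) :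
    - (M * (16001 + 6 * (p + 2) * Ψ) * VV ν f T θ + 16000 * M / (t + T) * mm ν (gsq f) T θ) ≤
      LL ν (fun s x => GG ν (p + 2) M s x * VV ν f s x) T θ := by
  have hf0 := (hf 0).continuous
  have hP : Poin (nuT ν T θ) (Ψ * rr (p + 2) (SS ν (p + 2) T θ)) :=
    H (t + T) (by linarith) _ (h.nuT T θ) _ (one_le_rr (one_le_SS h _ T θ)) (covLe_rr h (by omega) T θ)
  have hc := cross h (p := p) hM (by linarith : 0 < t + T) hf θ
  have hg := GG_LL h hn2 hM hΨ hP
  have v0 := VV_nonneg h hf0 T θ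
  have g0 := GG_pos (ν := ν) (q := p + 2) hM T θ
  have g1 := gsq_mm_le h hf0 (covLe_rr h (q := p + 2) (by omega) T θ)
  rw [← VV_eq] at g1
  have g2 := GG_mul_le (ν := ν) (q := p + 2) hM T θ
  have g3 := mul_le_mul_of_nonneg_left g1 g0.le
  have g4 := mul_le_mul_of_nonneg_right g2 v0
  have g5 := mul_le_mul_of_nonneg_left hg v0
  rw [LL_mul (GG_nice h _ hM) (VV_nice h hf0), VV_LL h hf0]
  have e : 16000 * M / (t + T) * mm ν (gsq f) T θ = 8000 * M * (2 / (t + T) * mm ν (gsq f) T θ) := by ring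
  rw [e]
  nlinarith

theorem EE_VV (h : CC t ν) (hf : Continuous f) {T : ℝ} (hT : 0 ≤ T) : EE ν T (VV ν f T) ≤ vr ν f := by
  have := h.prob
  have e : EE ν 0 (VV ν f 0) = vr ν f := by rw [EE_zero h, VV_eq, nuT_zero]
  rw [← e]
  have an : AntitoneOn (fun s => EE ν s (VV ν f s)) (Ici 0) := by
    refine antitoneOn_of_deriv_nonpos (convex_Ici 0) (EE_cont h (VV_nice h hf)).continuousOn ?_ ?_
    · intro x hx
      rw [interior_Ici] at hx
      exact (ito h (VV_nice h hf) hx).differentiableAt.differentiableWithinAt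
    · intro x hx
      rw [interior_Ici] at hx
      rw [(ito h (VV_nice h hf) hx).deriv]
      have : LL ν (VV ν f) x = fun θ => (-1) * gsq (mm ν f x) θ := by
        funext θ; rw [VV_LL h hf]; ring
      rw [this, EE_smul]
      have := EE_nonneg (ν := ν) (T := x) (fun θ => gsq_nonneg (mm ν f x) θ)
      linarith
  exact an (by simp) hT hT

theorem step_ineq (h : CC t ν) {p : ℕ} (hn2 : n ≤ 2 ^ (p + 1)) {τ Ψ : ℝ} (hτ : 0 < τ) (hΨ : 0 ≤ Ψ)
    (ht : τ ≤ t) (H : HH0 n τ Ψ) {B : ℝ} (hB : 1 ≤ B) (hc : CovLe ν B) (hf : SB f) {T1 : ℝ} (hT1 : 0 < T1) :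
    1 / 2 * vr ν f ≤ √(2 * B / T1) * ∫ x, gsq f x ∂ν + 2 * B * (16001 + 6 * (p + 2) * Ψ) * vr ν f * T1 +
      16000 * (2 * B) * (∫ x, gsq f x ∂ν) * (log (t + T1) - log t) := by
  have := h.prob
  have hf0 := (hf 0).continuous
  have B0 : 0 < B := by linarith
  have t0 : 0 < t := hτ.trans_le ht
  set M := 2 * B with hM
  have M0 : 0 < M := by positivity
  set j := ∫ x, gsq f x ∂ν with hj
  have j0 : 0 ≤ j := integral_nonneg fun x => gsq_nonneg f x
  set X := 16001 + 6 * ((p:ℝ) + 2) * Ψ with hX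
  have X0 : 0 < X := by positivity
  have N := (GG_nice h (p + 2) M0).mul (VV_nice h hf0)
  have cg : Continuous (gsq f) := (hf 1).gsq.continuous
  have v0 : 0 ≤ vr ν f := vr_nonneg (h.l2 hf0)
  have mono : MonotoneOn (fun s => EE ν s (fun x => GG ν (p + 2) M s x * VV ν f s x) + M * X * vr ν f * s +
      16000 * M * j * log (t + s)) (Icc 0 T1) := by
    have cl : ContinuousOn (fun s => log (t + s)) (Icc 0 T1) :=
      ContinuousOn.log (by fun_prop) fun s hs => by have := hs.1; positivity
    have hd : ∀ s, 0 < s → HasDerivAt (fun s => EE ν s (fun x => GG ν (p + 2) M s x * VV ν f s x) + M * X * vr ν f * s +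
        16000 * M * j * log (t + s)) (EE ν s (LL ν (fun s x => GG ν (p + 2) M s x * VV ν f s x) s) + M * X * vr ν f * 1 +
        16000 * M * j * (1 / (t + s))) s := by
      intro s hs
      refine ((ito h N hs).add ((hasDerivAt_id s).const_mul _)).add (HasDerivAt.const_mul _ ?_)
      exact ((hasDerivAt_id s).const_add t).log (by simp; positivity)
    refine monotoneOn_of_deriv_nonneg (convex_Icc 0 T1) ?_ ?_ ?_
    · exact (((EE_cont h N).continuousOn).add (by fun_prop)).add (continuousOn_const.mul cl)
    · intro s hs
      rw [interior_Icc] at hs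
      exact (hd s hs.1).differentiableAt.differentiableWithinAt
    · intro s hs
      rw [interior_Icc] at hs
      rw [(hd s hs.1).deriv]
      have g1 : Gr (fun θ => - (M * X) * VV ν f s θ) := (Gr.const _).mul ((VV_nice h hf0).sb s 0).gr
      have g2 : Gr (fun θ => - (16000 * M / (t + s)) * mm ν (gsq f) s θ) := (Gr.const _).mul ((mm_nice h cg).sb s 0).gr
      have := EE_mono h hs.1.le (g1.add g2) (LL_gr h N s) fun θ => by
        have := GV_LL h hn2 hτ hΨ ht H M0 hf hs.1.le θ
        rw [← hX] at this
        linarith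
      rw [EE_add h hs.1.le g1 g2, EE_smul, EE_smul, EE_mm h hs.1.le cg, ← hj] at this
      have v1 := mul_le_mul_of_nonneg_left (EE_VV h hf0 hs.1.le) (by positivity : 0 ≤ M * X)
      have e : 16000 * M * j * (1 / (t + s)) = 16000 * M / (t + s) * j := by ring
      rw [e]
      linarith
  have m := mono (left_mem_Icc.2 hT1.le) (right_mem_Icc.2 hT1.le) hT1.le
  simp only [mul_zero, add_zero] at m
  rw [EE_zero h, VV_eq, nuT_zero] at m
  have m1 := mul_le_mul_of_nonneg_right (GG_zero h hn2 hB hc) v0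
  have m2 : EE ν T1 (fun x => GG ν (p + 2) M T1 x * VV ν f T1 x) ≤ √(M / T1) * j := by
    rw [hj, ← EE_mm h hT1.le cg, ← EE_smul]
    refine EE_mono h hT1.le (N.sb T1 0).gr ((Gr.const _).mul ((mm_nice h cg).sb T1 0).gr) fun θ => ?_
    have hp := partB (h.nuT T1 θ) (by positivity) (rr_pos (p + 2) (SS ν (p + 2) T1 θ)).le
      (covLe_rr h (by omega) T1 θ) f hf
    rw [← VV_eq] at hp
    have jn : 0 ≤ mm ν (gsq f) T1 θ := integral_nonneg fun x => gsq_nonneg f x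
    have g0 := GG_pos (ν := ν) (q := p + 2) M0 T1 θ
    have gs := GG_mul_sqrt (ν := ν) (q := p + 2) M0 T1 θ
    calc GG ν (p + 2) M T1 θ * VV ν f T1 θ ≤ GG ν (p + 2) M T1 θ * (√(rr (p + 2) (SS ν (p + 2) T1 θ) / (t + T1)) *
          mm ν (gsq f) T1 θ) := mul_le_mul_of_nonneg_left hp g0.le
      _ = (GG ν (p + 2) M T1 θ * √(rr (p + 2) (SS ν (p + 2) T1 θ))) / √(t + T1) * mm ν (gsq f) T1 θ := by
          rw [Real.sqrt_div (rr_pos _ _).le]; ring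
      _ ≤ √M / √T1 * mm ν (gsq f) T1 θ := by
          refine mul_le_mul_of_nonneg_right ?_ jn
          exact div_le_div₀ (by positivity) gs (by positivity) (Real.sqrt_le_sqrt (by linarith))
      _ = √(M / T1) * mm ν (gsq f) T1 θ := by rw [Real.sqrt_div M0.le]
  linarith

theorem step {p : ℕ} (hn2 : n ≤ 2 ^ (p + 1)) {τ Ψ : ℝ} (hτ : 0 < τ) (hΨ : 0 ≤ Ψ)
    (H : HH0 n τ Ψ) : HH0 n τ (Ψ / 2 + 128000 * (p + 2 + log (1 + 1 / τ))) := by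
  intro t ht ν h B hB hc f hf
  have := h.prob
  have B0 : 0 < B := by linarith
  have t0 : 0 < t := hτ.trans_le ht
  set j := ∫ x, gsq f x ∂ν with hj
  have j0 : 0 ≤ j := integral_nonneg fun x => gsq_nonneg f x
  set Q := (p:ℝ) + 2 with hQ
  have Q1 : 1 ≤ Q := by have : (0:ℝ) ≤ p := by positivity
                        linarith
  set X := 16001 + 6 * Q * Ψ with hX
  have hX1 : 1 ≤ X := by have : 0 ≤ 6 * Q * Ψ := by positivity
                         linarith
  set L := log (1 + 1 / τ) with hL
  set T1 := 1 / (8 * B * X) with hT1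
  have T0 : 0 < T1 := by positivity
  have T1le : T1 ≤ 1 := by
    rw [hT1, div_le_one (by positivity)]; nlinarith
  have s := step_ineq h hn2 hτ hΨ ht H hB hc hf T0
  rw [← hj, ← hQ, ← hX] at s
  have e1 : 2 * B * X * vr ν f * T1 = vr ν f / 4 := by
    rw [hT1]; field_simp; ring
  have e2 : √(2 * B / T1) = 4 * B * √X := by
    rw [hT1, show 2 * B / (1 / (8 * B * X)) = (4 * B) ^ 2 * X by field_simp; norm_num,
      Real.sqrt_mul (by positivity), Real.sqrt_sq (by positivity)]
  have e3 : log (t + T1) - log t ≤ L := by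
    rw [← log_div (by positivity) (by positivity), hL]
    refine log_le_log (by positivity) ?_
    rw [add_div, div_self t0.ne']
    have : T1 / t ≤ 1 / τ := div_le_div₀ zero_le_one T1le hτ ht
    linarith
  have e4 : 16 * √X ≤ Ψ / 2 + 2200 * Q := by
    have a1 : X = (√X) ^ 2 := (Real.sq_sqrt (by linarith)).symm
    have a2 : 0 ≤ √X := Real.sqrt_nonneg _
    have a3 : 0 ≤ (√X - 96 * Q) ^ 2 := sq_nonneg _
    have a4 : 12 * Q * (16 * √X) ≤ 12 * Q * (Ψ / 2 + 2200 * Q) := by nlinarith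
    exact le_of_mul_le_mul_left a4 (by positivity)
  rw [e1, e2] at s
  have e5 := mul_le_mul_of_nonneg_left e3 (by positivity : 0 ≤ 16000 * (2 * B) * j)
  have e6 := mul_le_mul_of_nonneg_left e4 (by positivity : 0 ≤ B * j)
  have e7 : 0 ≤ B * j * Q := by positivity
  have e8 : vr ν f ≤ B * j * (16 * √X) + 128000 * B * j * L := by linarith
  calc vr ν f ≤ B * j * (Ψ / 2 + 2200 * Q) + 128000 * B * j * L := by linarith
    _ ≤ _ := by linarith

theorem main_bound {p : ℕ} (hn2 : n ≤ 2 ^ (p + 1)) {τ : ℝ} (hτ : 0 < τ) (h : CC τ ν) {B : ℝ} (hB : 1 ≤ B)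
    (hc : CovLe ν B) : Poin ν (256000 * (p + 2 + log (1 + 1 / τ)) * B) := by
  set D := 256000 * ((p:ℝ) + 2 + log (1 + 1 / τ)) with hD
  have D0 : 0 ≤ D := by
    have : 0 ≤ log (1 + 1 / τ) := log_nonneg (by have : 0 < 1 / τ := by positivity
                                                 linarith)
    positivity
  have hk : ∀ k : ℕ, HH0 n τ (D + (1 / τ) * (1 / 2) ^ k) := by
    intro k
    induction k with
    | zero => exact HH0_start hτ (by simp; exact D0)
    | succ k ih =>
      have := step hn2 hτ (by positivity) ih
      have e : (D + 1 / τ * (1 / 2) ^ k) / 2 + 128000 * (p + 2 + log (1 + 1 / τ)) =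
        D + 1 / τ * (1 / 2) ^ (k + 1) := by rw [hD]; ring
      rwa [e] at this
  intro f hf
  have lim : Filter.Tendsto (fun k : ℕ => (D + (1 / τ) * (1 / 2) ^ k) * B * ∫ x, gsq f x ∂ν) Filter.atTop
      (nhds ((D + (1 / τ) * 0) * B * ∫ x, gsq f x ∂ν)) := by
    refine Filter.Tendsto.mul_const _ (Filter.Tendsto.mul_const _ (Filter.Tendsto.const_add _
      (Filter.Tendsto.const_mul _ (tendsto_pow_atTop_nhds_zero_of_lt_one (by norm_num) (by norm_num)))))
  have := ge_of_tendsto' lim fun k => hk k τ le_rfl ν h B hB hc f hf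
  simpa using this

end

end KLS

end

section
open MeasureTheory Real Set
open scoped ENNReal RealInnerProductSpace Matrix

namespace KLS
noncomputable section

variable {n : ℕ} {μ : Measure (Euc n)} {ρ : Euc n → ℝ}

theorem lc_ul (hm : Measurable ρ) (hρ : IsLogConcaveFun ρ)
    (hμ : μ = volume.withDensity fun x => ENNReal.ofReal (ρ x)) : UniformlyLogConcave 0 μ :=
  ⟨ρ, hm, hρ, by rw [hμ]; simp⟩

theorem iso_ij (h : IsIsotropic μ) (i j : Fin n) : ∫ x, x i * x j ∂μ = if i = j then 1 else 0 := h.2 i j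

theorem iso_mem [IsProbabilityMeasure μ] (h : IsIsotropic μ) (i : Fin n) : MemLp (fun x : Euc n => x i) 2 μ := by
  have c : Continuous fun x : Euc n => x i := by fun_prop
  rw [memLp_two_iff_integrable_sq c.aestronglyMeasurable]
  by_contra hn
  have := integral_undef hn
  have h2 := iso_ij h i i
  simp only [if_true, ← pow_two] at h2
  linarith

theorem iso_inner [IsProbabilityMeasure μ] (h : IsIsotropic μ) (e : Euc n) :
    Integrable (fun x : Euc n => ⟪x, e⟫ ^ 2) μ ∧ ∫ x, ⟪x, e⟫ ^ 2 ∂μ = ‖e‖ ^ 2 := by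
  have q : ∀ x : Euc n, ⟪x, e⟫ ^ 2 = ∑ i, ∑ j, e i * e j * (x i * x j) := by
    intro x
    rw [inner_sum, pow_two, Finset.sum_mul_sum]
    refine Finset.sum_congr rfl fun i _ => Finset.sum_congr rfl fun j _ => by ring
  have ii : ∀ i j : Fin n, Integrable (fun x : Euc n => e i * e j * (x i * x j)) μ := fun i j =>
    (L2.m (iso_mem h i) (iso_mem h j)).const_mul _
  simp only [q]
  refine ⟨integrable_finsetSum _ fun i _ => integrable_finsetSum _ fun j _ => ii i j, ?_⟩
  rw [integral_finsetSum _ fun i _ => integrable_finsetSum _ fun j _ => ii i j, norm_sq_sum]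
  refine Finset.sum_congr rfl fun i _ => ?_
  rw [integral_finsetSum _ fun j _ => ii i j]
  simp only [integral_const_mul, iso_ij h]
  simp [pow_two]

theorem iso_norm [IsProbabilityMeasure μ] (h : IsIsotropic μ) :
    Integrable (fun x : Euc n => ‖x‖ ^ 2) μ ∧ ∫ x, ‖x‖ ^ 2 ∂μ = n := by
  have ii : ∀ i : Fin n, Integrable (fun x : Euc n => x i ^ 2) μ := fun i => L2.s (iso_mem h i)
  simp only [norm_sq_sum]
  refine ⟨integrable_finsetSum _ fun i _ => ii i, ?_⟩
  rw [integral_finsetSum _ fun i _ => ii i]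
  have : ∀ i : Fin n, ∫ x : Euc n, x i ^ 2 ∂μ = 1 := fun i => by
    have := iso_ij h i i
    simpa [pow_two] using this
  simp [this]

theorem iso_ball [IsProbabilityMeasure μ] (h : IsIsotropic μ) (hn : 1 ≤ n) :
    ENNReal.ofReal (3 / 4) ≤ μ {x | ‖x‖ ≤ 2 * √n} := by
  set A : Set (Euc n) := {x | ‖x‖ ≤ 2 * √n} with hA
  have hAm : MeasurableSet A := measurableSet_le (by fun_prop) measurable_const
  have n0 : (0:ℝ) < n := by exact_mod_cast hn
  have m := mul_meas_ge_le_integral_of_nonneg (Filter.Eventually.of_forall fun x => sq_nonneg ‖x‖) (iso_norm h).1 (4 * n)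
  rw [(iso_norm h).2] at m
  have m1 : μ.real Aᶜ ≤ μ.real {x : Euc n | 4 * (n:ℝ) ≤ ‖x‖ ^ 2} := by
    refine measureReal_mono fun x hx => ?_
    simp only [hA, mem_compl_iff, mem_ofPred_eq, not_le] at hx ⊢
    have : (2 * √(n:ℝ)) ^ 2 ≤ ‖x‖ ^ 2 := pow_le_pow_left₀ (by positivity) hx.le 2
    rw [mul_pow, Real.sq_sqrt n0.le] at this
    linarith
  have m2 : μ.real {x : Euc n | 4 * (n:ℝ) ≤ ‖x‖ ^ 2} ≤ 1 / 4 := by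
    have : 4 * (n:ℝ) * μ.real {x : Euc n | 4 * (n:ℝ) ≤ ‖x‖ ^ 2} ≤ n := m
    rw [le_div_iff₀ (by norm_num)]
    nlinarith
  have m3 := probReal_compl_eq_one_sub (μ := μ) hAm
  rw [← ofReal_measureReal]
  exact ENNReal.ofReal_le_ofReal (by linarith)

theorem iso_tail [IsProbabilityMeasure μ] (h : IsIsotropic μ) (hu : UniformlyLogConcave 0 μ) {e : Euc n}
    (he : ‖e‖ ≤ 1) (x : ℝ) : μ {v | 4 * x ≤ ⟪v, e⟫} ≤ ENNReal.ofReal (exp (1 - x)) := by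
  rcases le_or_gt x 1 with hx | hx
  · refine prob_le_one.trans ?_
    rw [← ENNReal.ofReal_one]
    exact ENNReal.ofReal_le_ofReal (Real.one_le_exp (by linarith))
  obtain ⟨k, hk1, hk2⟩ : ∃ k : ℕ, (k:ℝ) < x ∧ x - 1 ≤ k := by
    have h1 := Nat.le_ceil x
    have h2 := Nat.ceil_lt_add_one (by linarith : 0 ≤ x)
    have h3 : 1 ≤ ⌈x⌉₊ := Nat.one_le_ceil_iff.2 (by linarith)
    refine ⟨⌈x⌉₊ - 1, ?_, ?_⟩ <;> push_cast [h3] <;> linarith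
  have := borell_tail (t := 0) le_rfl hu e 0 one_pos (by simpa using (iso_inner h e).1) (by
    simp only [sub_zero, (iso_inner h e).2]
    exact pow_le_pow_left₀ (norm_nonneg _) he 2) k
  refine (measure_mono fun v hv => ?_).trans (this.trans (ENNReal.ofReal_le_ofReal ?_))
  · simp only [mem_ofPred_eq] at hv ⊢
    rw [sub_zero]
    have := le_abs_self ⟪v, e⟫
    linarith
  · have e3 : (1:ℝ) / 3 ≤ exp (-1) := by
      rw [exp_neg, one_div]
      exact inv_anti₀ (exp_pos _) (by have := Real.exp_one_lt_d9; linarith)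
    calc ((1:ℝ) / 3) ^ k ≤ exp (-1) ^ k := pow_le_pow_left₀ (by norm_num) e3 k
      _ = exp (-k) := by rw [← exp_nat_mul]; ring_nf
      _ ≤ _ := exp_le_exp.2 (by linarith)

theorem lint_half (H : Euc n → ℝ≥0∞) (hH : Measurable H) (y : Euc n) :
    ∫⁻ x, H ((1/2:ℝ) • x + (1/2:ℝ) • y) = 2 ^ n * ∫⁻ x, H x := by
  have e1 : ∫⁻ x, H ((1/2:ℝ) • x + (1/2:ℝ) • y) = ∫⁻ x, (fun z => H (z + (1/2:ℝ) • y)) x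
      ∂(Measure.map (fun x : Euc n => (1/2:ℝ) • x) volume) := by
    rw [lintegral_map (by fun_prop) (by fun_prop)]
  have e2 : Measure.map (fun x : Euc n => (1/2:ℝ) • x) volume = (2:ℝ≥0∞) ^ n • (volume : Measure (Euc n)) := by
    have := Measure.map_addHaar_smul (volume : Measure (Euc n)) (r := (1/2:ℝ)) (by norm_num)
    rw [show (fun x : Euc n => (1/2:ℝ) • x) = ((1/2:ℝ) • ·) from rfl, this]
    congr 1
    rw [finrank_euclideanSpace_fin]
    rw [← inv_pow, abs_of_pos (by positivity), ENNReal.ofReal_pow (by norm_num)]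
    norm_num
  rw [e1, e2, lintegral_smul_measure, lintegral_add_right_eq_self (fun z => H z)]
  rfl

/-- Pointwise exponential decay of an isotropic log-concave density. -/
theorem decay [IsProbabilityMeasure μ] (hn : 1 ≤ n) (hm : Measurable ρ) (hρ : IsLogConcaveFun ρ)
    (hμ : μ = volume.withDensity fun x => ENNReal.ofReal (ρ x)) (h : IsIsotropic μ) :
    ∃ x0 : Euc n, ‖x0‖ ≤ 2 * √n ∧ 0 < ρ x0 ∧ ∀ y, ρ y ≤ exp (8 * n - ‖y - x0‖ / 4) * ρ x0 := by
  have hu := lc_ul hm hρ hμ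
  have n1 : (1:ℝ) ≤ n := by exact_mod_cast hn
  set G : Set (Euc n) := {x | ‖x‖ ≤ 2 * √n} with hG
  have hGm : MeasurableSet G := measurableSet_le (by fun_prop) measurable_const
  have hGmass := iso_ball h hn
  set J : ℝ≥0∞ := ∫⁻ x in G, ENNReal.ofReal √(ρ x) with hJ
  have tail : ∀ y, ENNReal.ofReal √(ρ y) * J ≤ 2 ^ n * ENNReal.ofReal (exp (1 - (‖y‖ / 8 - √n / 4))) := by
    intro y
    set e : Euc n := ‖y‖⁻¹ • y with he
    have he1 : ‖e‖ ≤ 1 := by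
      rw [he, norm_smul, norm_inv, norm_norm]; exact inv_mul_le_one
    have hye : ⟪y, e⟫ = ‖y‖ := by
      rw [he, inner_smul_right, real_inner_self_eq_norm_sq]
      rcases eq_or_ne ‖y‖ 0 with h0 | h0
      · rw [h0]; simp
      · field_simp
    set S : Set (Euc n) := {v | 4 * (‖y‖ / 8 - √n / 4) ≤ ⟪v, e⟫} with hS
    have hSm : MeasurableSet S := measurableSet_le measurable_const (by fun_prop)
    have t1 := iso_tail h hu he1 (‖y‖ / 8 - √n / 4)
    have t2 : μ S = ∫⁻ x, S.indicator (fun x => ENNReal.ofReal (ρ x)) x := by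
      rw [lintegral_indicator hSm, hμ, withDensity_apply _ hSm]
    have t3 := lint_half (S.indicator (fun x => ENNReal.ofReal (ρ x))) (hm.ennreal_ofReal.indicator hSm) y
    rw [← t2] at t3
    refine le_trans ?_ (t3.le.trans (mul_le_mul_right t1 _))
    rw [hJ, ← lintegral_const_mul _ (by fun_prop), ← lintegral_indicator hGm]
    refine lintegral_mono fun x => ?_
    by_cases hx : x ∈ G
    · have hxS : (1/2:ℝ) • x + (1/2:ℝ) • y ∈ S := by
        simp only [hS, mem_ofPred_eq]
        rw [inner_add_left, inner_smul_left, inner_smul_left, hye]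
        simp only [RCLike.conj_to_real]
        have : |⟪x, e⟫| ≤ ‖x‖ * ‖e‖ := abs_real_inner_le_norm x e
        have h1 := (abs_le.1 this).1
        have h2 : ‖x‖ ≤ 2 * √n := hx
        have h3 : ‖x‖ * ‖e‖ ≤ ‖x‖ := mul_le_of_le_one_right (norm_nonneg _) he1
        linarith
      rw [indicator_of_mem hx, indicator_of_mem hxS, ← ENNReal.ofReal_mul (Real.sqrt_nonneg _)]
      refine ENNReal.ofReal_le_ofReal ?_
      have := hρ.2 x y (1/2) (1/2) (by norm_num) (by norm_num) (by norm_num)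
      rw [← Real.sqrt_eq_rpow, ← Real.sqrt_eq_rpow] at this
      linarith
    · rw [indicator_of_notMem hx]; exact zero_le
  have mG : μ G = ∫⁻ x in G, ENNReal.ofReal (ρ x) := by rw [hμ, withDensity_apply _ hGm]
  have hGpos : 0 < μ G := lt_of_lt_of_le (by simp) hGmass
  have J0 : J ≠ 0 := by
    intro h0
    rw [hJ, lintegral_eq_zero_iff (by fun_prop)] at h0
    have : μ G = 0 := by
      rw [mG, lintegral_eq_zero_iff (by fun_prop)]
      filter_upwards [h0] with x hx
      have hx' : √(ρ x) ≤ 0 := ENNReal.ofReal_eq_zero.1 hx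
      have : ρ x ≤ 0 := Real.sqrt_eq_zero'.1 (le_antisymm hx' (Real.sqrt_nonneg _))
      exact ENNReal.ofReal_eq_zero.2 this
    exact hGpos.ne' this
  have bdd : BddAbove (ρ '' G) := by
    set Q := (2 : ℝ≥0∞) ^ n * ENNReal.ofReal (exp (1 + √n / 4)) / J with hQ
    have hQt : Q ≠ ⊤ := ENNReal.div_ne_top (ENNReal.mul_ne_top (by simp) ENNReal.ofReal_ne_top) J0
    refine ⟨Q.toReal ^ 2, ?_⟩
    rintro _ ⟨y, _, rfl⟩
    have h1 : ENNReal.ofReal √(ρ y) ≤ Q := by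
      rw [hQ, ENNReal.le_div_iff_mul_le (Or.inl J0) (Or.inr (ENNReal.mul_ne_top (by simp) ENNReal.ofReal_ne_top))]
      refine (tail y).trans (mul_le_mul_right (ENNReal.ofReal_le_ofReal (exp_le_exp.2 ?_)) _)
      have := norm_nonneg y
      linarith
    have h2 := (ENNReal.ofReal_le_iff_le_toReal hQt).1 h1
    have := pow_le_pow_left₀ (Real.sqrt_nonneg _) h2 2
    rwa [Real.sq_sqrt (hρ.1 y)] at this
  obtain ⟨z, hzG, hz⟩ : ∃ z ∈ G, 0 < ρ z := by
    by_contra! hc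
    have : μ G = 0 := by
      rw [mG, ← lintegral_indicator hGm]
      have : G.indicator (fun x => ENNReal.ofReal (ρ x)) = fun _ => 0 := by
        funext x
        by_cases hx : x ∈ G
        · rw [indicator_of_mem hx]; exact ENNReal.ofReal_eq_zero.2 (hc x hx)
        · rw [indicator_of_notMem hx]
      rw [this, lintegral_zero]
    exact hGpos.ne' this
  set S := sSup (ρ '' G) with hS
  have hzS : ρ z ≤ S := le_csSup bdd ⟨z, hzG, rfl⟩
  obtain ⟨_, ⟨x0, hx0, rfl⟩, hx0S⟩ := exists_lt_of_lt_csSup (s := ρ '' G) (Set.Nonempty.image ρ ⟨z, hzG⟩) (show S / 2 < S by linarith)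
  have hxp : 0 < ρ x0 := by linarith
  refine ⟨x0, hx0, hxp, fun y => ?_⟩
  have k1 : μ G ≤ ENNReal.ofReal √(2 * ρ x0) * J := by
    rw [mG, hJ, ← lintegral_const_mul _ (by fun_prop)]
    refine setLIntegral_mono (by fun_prop) fun x hx => ?_
    rw [← ENNReal.ofReal_mul (Real.sqrt_nonneg _)]
    refine ENNReal.ofReal_le_ofReal ?_
    have : ρ x ≤ S := le_csSup bdd ⟨x, hx, rfl⟩
    calc ρ x = √(ρ x) * √(ρ x) := (Real.mul_self_sqrt (hρ.1 x)).symm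
      _ ≤ _ := mul_le_mul_of_nonneg_right (Real.sqrt_le_sqrt (by linarith)) (Real.sqrt_nonneg _)
  have k2 : ENNReal.ofReal (√(ρ y) * (3 / 4)) ≤ ENNReal.ofReal (√(2 * ρ x0) * (2 ^ n * exp (1 - (‖y‖ / 8 - √n / 4)))) := by
    rw [ENNReal.ofReal_mul (Real.sqrt_nonneg _), ENNReal.ofReal_mul (Real.sqrt_nonneg _),
      ENNReal.ofReal_mul (by positivity), ENNReal.ofReal_pow (by norm_num)]
    calc ENNReal.ofReal √(ρ y) * ENNReal.ofReal (3 / 4) ≤ ENNReal.ofReal √(ρ y) * (ENNReal.ofReal √(2 * ρ x0) * J) :=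
          mul_le_mul_right (hGmass.trans k1) _
      _ = ENNReal.ofReal √(2 * ρ x0) * (ENNReal.ofReal √(ρ y) * J) := by ring
      _ ≤ _ := mul_le_mul_right (by simpa using tail y) _
  rw [ENNReal.ofReal_le_ofReal_iff (by positivity)] at k2
  have k3 := pow_le_pow_left₀ (by positivity) k2 2
  have ρy := hρ.1 y
  rw [mul_pow, mul_pow, mul_pow, Real.sq_sqrt ρy, Real.sq_sqrt (by positivity), ← pow_mul, mul_comm n 2, pow_mul,
    ← exp_nat_mul] at k3
  have s1 : √(n:ℝ) ≤ n := by rw [Real.sqrt_le_left (by linarith)]; nlinarith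
  have s2 : (4:ℝ) ≤ exp 2 := by
    have := Real.add_one_le_exp (1:ℝ)
    rw [show (2:ℝ) = 1 + 1 by norm_num, exp_add]
    nlinarith
  have s3 : ((2:ℝ) ^ 2) ^ n ≤ exp (2 * n) := by
    rw [mul_comm, exp_nat_mul]
    exact pow_le_pow_left₀ (by norm_num) (by linarith) n
  have s4 : ‖y - x0‖ ≤ ‖y‖ + 2 * n := by
    have h1 := norm_sub_le y x0
    have h2 : ‖x0‖ ≤ 2 * √n := hx0
    linarith
  have s5 : ρ y ≤ 4 * (exp (2 * n) * exp ((2:ℕ) * (1 - (‖y‖ / 8 - √n / 4)))) * ρ x0 := by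
    have a := mul_le_mul_of_nonneg_right s3 (by positivity : 0 ≤ ρ x0 * exp ((2:ℕ) * (1 - (‖y‖ / 8 - √n / 4))))
    have b : 0 ≤ exp (2 * n) * exp ((2:ℕ) * (1 - (‖y‖ / 8 - √n / 4))) * ρ x0 := by positivity
    nlinarith
  refine s5.trans (mul_le_mul_of_nonneg_right ?_ hxp.le)
  calc 4 * (exp (2 * n) * exp ((2:ℕ) * (1 - (‖y‖ / 8 - √n / 4)))) ≤
        exp 2 * (exp (2 * n) * exp ((2:ℕ) * (1 - (‖y‖ / 8 - √n / 4)))) := mul_le_mul_of_nonneg_right s2 (by positivity)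
    _ = exp (2 + (2 * n + (2:ℕ) * (1 - (‖y‖ / 8 - √n / 4)))) := by rw [exp_add, exp_add]
    _ ≤ _ := exp_le_exp.2 (by push_cast; linarith)

end

end KLS

end

section
open MeasureTheory Real Set
open scoped ENNReal RealInnerProductSpace Matrix

namespace KLS
noncomputable section

variable {n : ℕ} {μ : Measure (Euc n)} {ρ : Euc n → ℝ} {x0 : Euc n}

theorem scal (hρ : IsLogConcaveFun ρ) (hx0 : 0 < ρ x0)
    (hd : ∀ y, ρ y ≤ exp (8 * n - ‖y - x0‖ / 4) * ρ x0) {v : Euc n} (hv : 64 * n ≤ ‖v‖) {δ : ℝ} (hδ : 0 < δ) :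
    (1 + δ) ^ n * ρ (x0 + (1 + δ) • v) ≤ ρ (x0 + v) * exp (- (δ * (‖v‖ / 16))) := by
  have d1 : 0 < 1 + δ := by linarith
  set y := x0 + (1 + δ) • v with hy
  rcases (hρ.1 y).eq_or_lt with h0 | h0
  · rw [← h0, mul_zero]; exact mul_nonneg (hρ.1 _) (exp_pos _).le
  have hyn : ‖y - x0‖ = (1 + δ) * ‖v‖ := by
    rw [hy, add_sub_cancel_left, norm_smul, Real.norm_of_nonneg d1.le]
  have h1 : ρ y ≤ exp (- ((1 + δ) * ‖v‖ / 8)) * ρ x0 := by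
    refine (hd y).trans (mul_le_mul_of_nonneg_right (exp_le_exp.2 ?_) hx0.le)
    rw [hyn]
    have : 64 * (n:ℝ) ≤ (1 + δ) * ‖v‖ := by nlinarith [norm_nonneg v]
    linarith
  have h2 := hρ.2 x0 y (δ / (1 + δ)) (1 / (1 + δ)) (by positivity) (by positivity) (by field_simp; ring)
  have e1 : (δ / (1 + δ)) • x0 + (1 / (1 + δ)) • y = x0 + v := by
    rw [hy, smul_add, smul_smul, ← add_assoc, ← add_smul]
    have a1 : δ / (1 + δ) + 1 / (1 + δ) = 1 := by field_simp; ring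
    have a2 : 1 / (1 + δ) * (1 + δ) = 1 := by field_simp
    rw [a1, a2, one_smul, one_smul]
  rw [e1] at h2
  have h3 : ρ y ≤ exp (- (δ * ‖v‖ / 8)) * ρ (x0 + v) := by
    calc ρ y = ρ y ^ (δ / (1 + δ)) * ρ y ^ (1 / (1 + δ)) := by
          rw [← Real.rpow_add h0]
          have a1 : δ / (1 + δ) + 1 / (1 + δ) = 1 := by field_simp; ring
          rw [a1, Real.rpow_one]
      _ ≤ (exp (- ((1 + δ) * ‖v‖ / 8)) * ρ x0) ^ (δ / (1 + δ)) * ρ y ^ (1 / (1 + δ)) :=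
          mul_le_mul_of_nonneg_right (Real.rpow_le_rpow h0.le h1 (by positivity)) (Real.rpow_nonneg h0.le _)
      _ = exp (- (δ * ‖v‖ / 8)) * (ρ x0 ^ (δ / (1 + δ)) * ρ y ^ (1 / (1 + δ))) := by
          rw [Real.mul_rpow (exp_pos _).le hx0.le, ← Real.exp_mul, mul_assoc]
          congr 2
          field_simp
      _ ≤ _ := mul_le_mul_of_nonneg_left h2 (exp_pos _).le
  have h4 : (1 + δ) ^ n ≤ exp (δ * ‖v‖ / 64) := by
    calc (1 + δ) ^ n ≤ exp δ ^ n := pow_le_pow_left₀ d1.le (by have := Real.add_one_le_exp δ; linarith) n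
      _ = exp (n * δ) := by rw [← exp_nat_mul]
      _ ≤ _ := exp_le_exp.2 (by nlinarith)
  calc (1 + δ) ^ n * ρ y ≤ exp (δ * ‖v‖ / 64) * (exp (- (δ * ‖v‖ / 8)) * ρ (x0 + v)) :=
        mul_le_mul h4 h3 h0.le (exp_pos _).le
    _ = ρ (x0 + v) * exp (δ * ‖v‖ / 64 + - (δ * ‖v‖ / 8)) := by rw [exp_add]; ring
    _ ≤ _ := by
      refine mul_le_mul_of_nonneg_left (exp_le_exp.2 ?_) (hρ.1 _)
      have : 0 ≤ δ * ‖v‖ := by positivity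
      linarith

theorem lint_scale (H : Euc n → ℝ≥0∞) (hH : Measurable H) (x0 : Euc n) {c : ℝ} (hc : 0 < c) :
    ∫⁻ x, H x = ENNReal.ofReal (c ^ n) * ∫⁻ v, H (x0 + c • v) := by
  have e1 : ∫⁻ v, H (x0 + c • v) = ∫⁻ x, (fun z => H (x0 + z)) x ∂(Measure.map (fun x : Euc n => c • x) volume) := by
    rw [lintegral_map (by fun_prop) (by fun_prop)]
  have e2 : Measure.map (fun x : Euc n => c • x) volume = ENNReal.ofReal ((c ^ n)⁻¹) • (volume : Measure (Euc n)) := by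
    have := Measure.map_addHaar_smul (volume : Measure (Euc n)) (r := c) hc.ne'
    rw [show (fun x : Euc n => c • x) = (c • ·) from rfl, this]
    rw [finrank_euclideanSpace_fin, abs_of_pos (by positivity)]
  rw [e1, e2, lintegral_smul_measure, lintegral_add_left_eq_self (fun z => H z), smul_eq_mul, ← mul_assoc,
    ← ENNReal.ofReal_mul (by positivity), mul_inv_cancel₀ (by positivity)]
  simp

theorem scal_int [IsProbabilityMeasure μ] (hm : Measurable ρ) (hρ : IsLogConcaveFun ρ) 
    (hμ : μ = volume.withDensity fun x => ENNReal.ofReal (ρ x)) (hx0 : 0 < ρ x0)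
    (hd : ∀ y, ρ y ≤ exp (8 * n - ‖y - x0‖ / 4) * ρ x0) {F : Euc n → ℝ} (hF : Measurable F) {K : ℝ}
    (hF0 : ∀ x, 0 ≤ F x) (hFK : ∀ x, F x ≤ K)
    (hFz : ∀ x, ‖x - x0‖ < 64 * n → F x = 0) {δ : ℝ} (hδ : 0 < δ) :
    ∫ x, F (x0 + (1 + δ)⁻¹ • (x - x0)) ∂μ ≤ ∫ x, F x * exp (- (δ * (‖x - x0‖ / 16))) ∂μ := by
  have d1 : 0 < 1 + δ := by linarith
  have m1 : Measurable fun x => F (x0 + (1 + δ)⁻¹ • (x - x0)) := hF.comp (by fun_prop)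
  have m2 : Measurable fun x => F x * exp (- (δ * (‖x - x0‖ / 16))) := hF.mul (by fun_prop)
  have n2 : ∀ x, 0 ≤ F x * exp (- (δ * (‖x - x0‖ / 16))) := fun x => mul_nonneg (hF0 x) (exp_pos _).le
  rw [integral_eq_lintegral_of_nonneg_ae (Filter.Eventually.of_forall fun x => hF0 _) m1.aestronglyMeasurable,
    integral_eq_lintegral_of_nonneg_ae (Filter.Eventually.of_forall n2) m2.aestronglyMeasurable]
  have i2 : Integrable (fun x => F x * exp (- (δ * (‖x - x0‖ / 16)))) μ := by
    refine integrable_bm m2 (K := K) fun x => ?_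
    rw [abs_of_nonneg (n2 x)]
    exact (mul_le_of_le_one_right (hF0 x) (exp_le_one_iff.2 (by have := norm_nonneg (x - x0); nlinarith))).trans (hFK x)
  refine ENNReal.toReal_mono ?_ ?_
  · have := i2.lintegral_lt_top
    exact this.ne
  · rw [hμ, lintegral_withDensity_eq_lintegral_mul _ (by fun_prop) (by fun_prop),
      lintegral_withDensity_eq_lintegral_mul _ (by fun_prop) (by fun_prop)]
    rw [lint_scale _ (by fun_prop) x0 d1]
    conv_rhs => rw [lint_scale _ (by fun_prop) x0 one_pos]
    simp only [one_pow, ENNReal.ofReal_one, one_mul, one_smul, Pi.mul_apply]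
    rw [← lintegral_const_mul _ (by fun_prop)]
    refine lintegral_mono fun v => ?_
    simp only [add_sub_cancel_left, smul_smul]
    rw [inv_mul_cancel₀ d1.ne', one_smul, ← ENNReal.ofReal_mul (hρ.1 _), ← ENNReal.ofReal_mul (hρ.1 _),
      ← ENNReal.ofReal_mul (by positivity)]
    refine ENNReal.ofReal_le_ofReal ?_
    rcases lt_or_ge ‖v‖ (64 * n) with hv | hv
    · rw [hFz (x0 + v) (by simpa using hv)]; simp
    · have := mul_le_mul_of_nonneg_left (scal hρ hx0 hd hv hδ) (hF0 (x0 + v))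
      linarith

theorem ray_deriv {F D : Euc n → ℝ} 
    (hD : ∀ x, HasDerivAt (fun s : ℝ => F (x0 + s • (x - x0))) (D x) 1) (x : Euc n) {δ : ℝ} (hδ : 0 < 1 + δ) :
    HasDerivAt (fun δ => F (x0 + (1 + δ)⁻¹ • (x - x0))) (- D (x0 + (1 + δ)⁻¹ • (x - x0)) / (1 + δ)) δ := by
  set y := x0 + (1 + δ)⁻¹ • (x - x0) with hy
  have e : (fun δ' : ℝ => F (x0 + (1 + δ')⁻¹ • (x - x0))) =
      (fun s : ℝ => F (x0 + s • (y - x0))) ∘ fun δ' => (1 + δ) * (1 + δ')⁻¹ := by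
    funext δ'
    simp only [Function.comp, hy, add_sub_cancel_left, smul_smul]
    congr 3
    field_simp
  rw [e]
  have h1 : HasDerivAt (fun δ' : ℝ => (1 + δ) * (1 + δ')⁻¹) ((1 + δ) * (- 1 / (1 + δ) ^ 2)) δ :=
    (((hasDerivAt_id δ).const_add 1).inv hδ.ne').const_mul (1 + δ)
  have h2 := HasDerivAt.comp δ (h₂ := fun s : ℝ => F (x0 + s • (y - x0))) (h₂' := D y) (by
    rw [mul_inv_cancel₀ hδ.ne']; exact hD y) h1
  have hne : 1 + δ ≠ 0 := hδ.ne'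
  have e3 : - D y / (1 + δ) = D y * ((1 + δ) * (- 1 / (1 + δ) ^ 2)) := by
    rw [pow_two, ← div_div, mul_div_assoc', mul_div_cancel₀ _ hne]; ring
  rw [e3]; exact h2

theorem lyap [IsProbabilityMeasure μ] (hm : Measurable ρ) (hρ : IsLogConcaveFun ρ) 
    (hμ : μ = volume.withDensity fun x => ENNReal.ofReal (ρ x)) (hx0 : 0 < ρ x0)
    (hd : ∀ y, ρ y ≤ exp (8 * n - ‖y - x0‖ / 4) * ρ x0) {F D : Euc n → ℝ} (hF : Measurable F) {K : ℝ}
    (hF0 : ∀ x, 0 ≤ F x) (hFK : ∀ x, F x ≤ K) (hFK' : ∀ x, F x * ‖x - x0‖ ≤ K)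
    (hFz : ∀ x, ‖x - x0‖ < 64 * n → F x = 0)
    (hD : ∀ x, HasDerivAt (fun s : ℝ => F (x0 + s • (x - x0))) (D x) 1) (hDK : ∀ x, |D x| ≤ K) :
    1 / 16 * ∫ x, F x * ‖x - x0‖ ∂μ ≤ ∫ x, D x ∂μ := by
  set δ : ℕ → ℝ := fun m => 1 / ((m:ℝ) + 1) with hδ
  have δ0 : ∀ m, 0 < δ m := fun m => by positivity
  have δl : Filter.Tendsto δ Filter.atTop (nhds 0) := tendsto_one_div_add_atTop_nhds_zero_nat
  have δl' : Filter.Tendsto δ Filter.atTop (nhdsWithin 0 {0}ᶜ) :=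
    tendsto_nhdsWithin_iff.2 ⟨δl, Filter.Eventually.of_forall fun m => (δ0 m).ne'⟩
  have mF : ∀ d : ℝ, Measurable fun x => F (x0 + (1 + d)⁻¹ • (x - x0)) := fun d => hF.comp (by fun_prop)
  have bF : ∀ x, |F x| ≤ K := fun x => by rw [abs_of_nonneg (hF0 x)]; exact hFK x
  have K0 : 0 ≤ K := (hF0 x0).trans (hFK x0)
  have A : Filter.Tendsto (fun m => ∫ x, (F x - F (x0 + (1 + δ m)⁻¹ • (x - x0))) / δ m ∂μ) Filter.atTop
      (nhds (∫ x, D x ∂μ)) := by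
    refine tendsto_integral_of_dominated_convergence (fun _ => K) (fun m => ?_) (integrable_const _) (fun m => ?_) ?_
    · exact ((hF.sub (mF _)).div_const _).aestronglyMeasurable
    · refine Filter.Eventually.of_forall fun x => ?_
      have mv := Convex.norm_image_sub_le_of_norm_hasDerivWithin_le (f := fun d : ℝ => F (x0 + (1 + d)⁻¹ • (x - x0)))
        (f' := fun d => - D (x0 + (1 + d)⁻¹ • (x - x0)) / (1 + d)) (s := Icc 0 (δ m)) (C := K)
        (fun d hd => (ray_deriv hD x (by have := hd.1; linarith)).hasDerivWithinAt) (fun d hd => by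
          have h0 := hd.1
          rw [norm_div, norm_neg, Real.norm_eq_abs, Real.norm_of_nonneg (by linarith : (0:ℝ) ≤ 1 + d)]
          refine div_le_of_le_mul₀ (by linarith) K0 ((hDK _).trans ?_)
          nlinarith) (convex_Icc _ _) (left_mem_Icc.2 (δ0 m).le) (right_mem_Icc.2 (δ0 m).le)
      simp only [add_zero, inv_one, one_smul, add_sub_cancel, sub_zero] at mv
      rw [norm_div, norm_sub_rev, div_le_iff₀ (by rw [Real.norm_of_nonneg (δ0 m).le]; exact δ0 m)]
      exact mv
    · refine Filter.Eventually.of_forall fun x => ?_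
      have h1 := ray_deriv hD x (δ := 0) (by norm_num)
      have h2 := (hasDerivAt_iff_tendsto_slope.1 h1).comp δl'
      simp only [add_zero, inv_one, one_smul, add_sub_cancel, div_one] at h2
      have h3 := h2.neg
      rw [neg_neg] at h3
      refine h3.congr fun m => ?_
      simp only [Function.comp, slope_def_field, add_zero, inv_one, one_smul, add_sub_cancel, sub_zero]
      rw [← neg_div, neg_sub]
  have B : Filter.Tendsto (fun m => ∫ x, F x * ((1 - exp (- (δ m * (‖x - x0‖ / 16)))) / δ m) ∂μ) Filter.atTop
      (nhds (∫ x, F x * (‖x - x0‖ / 16) ∂μ)) := by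
    refine tendsto_integral_of_dominated_convergence (fun _ => K) (fun m => ?_) (integrable_const _) (fun m => ?_) ?_
    · exact (hF.mul (by fun_prop)).aestronglyMeasurable
    · refine Filter.Eventually.of_forall fun x => ?_
      have h0 : 0 ≤ δ m * (‖x - x0‖ / 16) := mul_nonneg (δ0 m).le (by positivity)
      have h1 := Real.add_one_le_exp (- (δ m * (‖x - x0‖ / 16)))
      have h2 : (1 - exp (- (δ m * (‖x - x0‖ / 16)))) / δ m ≤ ‖x - x0‖ / 16 := by
        rw [div_le_iff₀ (δ0 m)]; linarith
      have h3 : 0 ≤ (1 - exp (- (δ m * (‖x - x0‖ / 16)))) / δ m :=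
        div_nonneg (by have := exp_le_one_iff.2 (neg_nonpos.2 h0); linarith) (δ0 m).le
      rw [Real.norm_of_nonneg (mul_nonneg (hF0 x) h3)]
      have h4 := mul_le_mul_of_nonneg_left h2 (hF0 x)
      have h5 := hFK' x
      have h6 := mul_nonneg (hF0 x) (norm_nonneg (x - x0))
      linarith
    · refine Filter.Eventually.of_forall fun x => Filter.Tendsto.const_mul _ ?_
      have h1 : HasDerivAt (fun d : ℝ => exp (- (d * (‖x - x0‖ / 16)))) (exp (- (0 * (‖x - x0‖ / 16))) * (- (1 * (‖x - x0‖ / 16)))) 0 :=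
        (((hasDerivAt_id (0:ℝ)).mul_const _).neg).exp
      have h2 := ((hasDerivAt_iff_tendsto_slope.1 h1).comp δl').neg
      simp only [zero_mul, neg_zero, exp_zero, one_mul, neg_neg] at h2
      refine h2.congr fun m => ?_
      simp only [Function.comp, slope_def_field, zero_mul, neg_zero, exp_zero, sub_zero]
      rw [← neg_div, neg_sub]
  have e : 1 / 16 * ∫ x, F x * ‖x - x0‖ ∂μ = ∫ x, F x * (‖x - x0‖ / 16) ∂μ := by
    rw [← integral_const_mul]; congr 1; funext x; ring
  rw [e]
  refine le_of_tendsto_of_tendsto' B A fun m => ?_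
  have s := scal_int hm hρ hμ hx0 hd hF hF0 hFK hFz (δ0 m)
  have i1 : Integrable F μ := integrable_bm hF bF
  have i2 : Integrable (fun x => F (x0 + (1 + δ m)⁻¹ • (x - x0))) μ := integrable_bm (mF _) fun x => bF _
  have i3 : Integrable (fun x => F x * exp (- (δ m * (‖x - x0‖ / 16)))) μ := by
    refine integrable_bm (hF.mul (by fun_prop)) (K := K) fun x => ?_
    rw [abs_mul, abs_of_pos (exp_pos _)]
    refine (mul_le_of_le_one_right (abs_nonneg _) (exp_le_one_iff.2 ?_)).trans (bF x)
    have := mul_nonneg (δ0 m).le (norm_nonneg (x - x0))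
    linarith
  have e2 : ∀ x, F x * ((1 - exp (- (δ m * (‖x - x0‖ / 16)))) / δ m) = (F x - F x * exp (- (δ m * (‖x - x0‖ / 16)))) / δ m :=
    fun x => by ring
  simp only [e2]
  rw [integral_div, integral_div, integral_sub i1 i2, integral_sub i1 i3]
  exact div_le_div_of_nonneg_right (by linarith) (δ0 m).le

end

end KLS

end

section
open MeasureTheory Real Set
open scoped ENNReal RealInnerProductSpace Matrix

namespace KLS
noncomputable section

variable {n : ℕ} {μ : Measure (Euc n)} {ρ : Euc n → ℝ} {x0 : Euc n}

theorem tail [IsProbabilityMeasure μ] (hn : 1 ≤ n) (hm : Measurable ρ) (hρ : IsLogConcaveFun ρ) 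
    (hμ : μ = volume.withDensity fun x => ENNReal.ofReal (ρ x)) (hx0 : 0 < ρ x0)
    (hd : ∀ y, ρ y ≤ exp (8 * n - ‖y - x0‖ / 4) * ρ x0) {h : Euc n → ℝ} (hh : SB h)
    (hz : ∀ x, ‖x - x0‖ < 64 * n → h x = 0) :
    ∫ x, h x ^ 2 ∂μ ≤ 1024 * ∫ x, gsq h x ∂μ := by
  have n1 : (1:ℝ) ≤ n := by exact_mod_cast hn
  obtain ⟨K, K0, hK⟩ := (hh 0).bdd
  obtain ⟨G, G0, hG⟩ := ((hh 1).gsq).bdd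
  have hgr : ∀ x, ‖gradient h x‖ ≤ G + 1 := fun x => by
    have := hG x
    rw [gsq_eq, abs_of_nonneg (sq_nonneg _)] at this
    nlinarith [norm_nonneg (gradient h x)]
  set D : Euc n → ℝ := fun x => 2 * h x * ⟪gradient h x, x - x0⟫ / ‖x - x0‖ - h x ^ 2 / ‖x - x0‖ with hDdef
  have b1 : ∀ x, |⟪gradient h x, x - x0⟫ / ‖x - x0‖| ≤ ‖gradient h x‖ := fun x => by
    rw [abs_div, abs_of_nonneg (norm_nonneg (x - x0))]
    exact div_le_of_le_mul₀ (norm_nonneg _) (norm_nonneg _) (abs_real_inner_le_norm _ _)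
  have b2 : ∀ x, 0 ≤ h x ^ 2 / ‖x - x0‖ := fun x => by positivity
  have b3 : ∀ x, h x ^ 2 / ‖x - x0‖ ≤ h x ^ 2 := fun x => by
    rcases lt_or_ge ‖x - x0‖ (64 * n) with hx | hx
    · rw [hz x hx]; simp
    · exact div_le_self (sq_nonneg _) (by linarith)
  have b4 : ∀ x, h x ^ 2 ≤ K ^ 2 := fun x => by
    rw [← sq_abs]; exact pow_le_pow_left₀ (abs_nonneg _) (hK x) 2
  have eD : ∀ x, D x = 2 * h x * (⟪gradient h x, x - x0⟫ / ‖x - x0‖) - h x ^ 2 / ‖x - x0‖ := fun x => by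
    simp only [hDdef]; ring
  have b5 : ∀ x, |2 * h x * (⟪gradient h x, x - x0⟫ / ‖x - x0‖)| ≤ 2 * |h x| * ‖gradient h x‖ := fun x => by
    rw [abs_mul, abs_mul, abs_two]
    exact mul_le_mul_of_nonneg_left (b1 x) (by positivity)
  have b6 : ∀ x, 2 * |h x| * ‖gradient h x‖ ≤ 2 * K * (G + 1) := fun x =>
    mul_le_mul (by linarith [hK x]) (hgr x) (norm_nonneg _) (by positivity)
  set L := K ^ 2 + 2 * K * (G + 1) with hL
  have p6 : 0 ≤ 2 * K * (G + 1) := by positivity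
  have key := lyap hm hρ hμ hx0 hd (F := fun x => h x ^ 2 / ‖x - x0‖) (D := D) (K := L)
    (((hh 0).measurable.pow_const 2).div (by fun_prop)) b2 (fun x => by linarith [b3 x, b4 x]) (fun x => by
      rcases eq_or_ne ‖x - x0‖ 0 with h0 | h0
      · simp only [h0, mul_zero]; nlinarith [sq_nonneg K]
      · rw [div_mul_cancel₀ _ h0]; linarith [b4 x]) (fun x hx => by simp [hz x hx]) (fun x => by
      rcases eq_or_ne (x - x0) 0 with h0 | h0
      · have : D x = 0 := by simp [hDdef, h0]
        rw [this]
        simp only [h0, smul_zero]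
        exact hasDerivAt_const _ _
      · have hne : ‖x - x0‖ ≠ 0 := norm_ne_zero_iff.2 h0
        have c1 : HasDerivAt (fun s : ℝ => x0 + s • (x - x0)) ((1:ℝ) • (x - x0)) 1 :=
          ((hasDerivAt_id (1:ℝ)).smul_const (x - x0)).const_add x0
        have c2 : HasFDerivAt h (fderiv ℝ h x) (x0 + (1:ℝ) • (x - x0)) := by
          rw [one_smul, add_sub_cancel]; exact ((hh 1).diff x).hasFDerivAt
        have c3 := c2.comp_hasDerivAt (1:ℝ) c1
        rw [one_smul, fderiv_eq_inner] at c3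
        have c4 : HasDerivAt (fun s : ℝ => s * ‖x - x0‖) (1 * ‖x - x0‖) 1 := (hasDerivAt_id (1:ℝ)).mul_const _
        have c5 := (c3.pow 2).div c4 (by simpa using hne)
        have c6 : HasDerivAt (fun s : ℝ => h (x0 + s • (x - x0)) ^ 2 / (s * ‖x - x0‖)) (D x) 1 := by
          refine HasDerivAt.congr_deriv c5 ?_
          simp only [Function.comp, one_smul, add_sub_cancel, one_mul, hDdef, Pi.pow_apply]
          field_simp
          norm_num
          ring
        refine c6.congr_of_eventuallyEq ?_
        filter_upwards [lt_mem_nhds (zero_lt_one (α := ℝ))] with s hs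
        rw [add_sub_cancel_left, norm_smul, Real.norm_of_nonneg hs.le]) (fun x => by
      rw [eD]
      refine (abs_sub _ _).trans ?_
      rw [abs_of_nonneg (b2 x)]
      linarith [b5 x, b6 x, b3 x, b4 x])
  have e1 : ∀ x, h x ^ 2 / ‖x - x0‖ * ‖x - x0‖ = h x ^ 2 := fun x => by
    rcases eq_or_ne ‖x - x0‖ 0 with h0 | h0
    · rw [hz x (by rw [h0]; linarith)]; simp
    · rw [div_mul_cancel₀ _ h0]
  simp only [e1] at key
  have i1 : Integrable (fun x => h x ^ 2) μ := ((hh 0).pow 2).integrable μ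
  have i2 : Integrable (gsq h) μ := ((hh 1).gsq).integrable μ
  have le : ∫ x, D x ∂μ ≤ ∫ x, (1 / 32 * h x ^ 2 + 32 * gsq h x) ∂μ := by
    by_cases hi : Integrable D μ
    · refine integral_mono hi (iadd (i1.const_mul _) (i2.const_mul _)) fun x => ?_
      simp only [eD, gsq_eq]
      have := (le_abs_self _).trans (b5 x)
      have q := sq_nonneg (|h x| - 32 * ‖gradient h x‖)
      have q2 := sq_abs (h x)
      nlinarith [b2 x]
    · rw [integral_undef hi]
      refine integral_nonneg fun x => ?_
      have := gsq_nonneg h x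
      positivity
  rw [integral_add (i1.const_mul _) (i2.const_mul _), integral_const_mul, integral_const_mul] at le
  linarith

end

end KLS

end

section
open MeasureTheory Real Set
open scoped ENNReal RealInnerProductSpace Matrix

namespace KLS
noncomputable section

variable {n : ℕ} {μ : Measure (Euc n)} {ρ : Euc n → ℝ} {x0 : Euc n}

theorem lc_ind (hρ : IsLogConcaveFun ρ) {B : Set (Euc n)} (hB : Convex ℝ B) {Z : ℝ} (hZ : 0 < Z) :
    IsLogConcaveFun (fun x => B.indicator ρ x * Z⁻¹) := by
  have nn : ∀ x, 0 ≤ B.indicator ρ x * Z⁻¹ := fun x =>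
    mul_nonneg (indicator_nonneg (fun x _ => hρ.1 x) x) (inv_nonneg.2 hZ.le)
  refine ⟨nn, fun x y a b ha hb hab => ?_⟩
  beta_reduce
  rcases ha.eq_or_lt with h0 | h0
  · have : b = 1 := by linarith
    subst h0; subst this; simp
  rcases hb.eq_or_lt with h1 | h1
  · have : a = 1 := by linarith
    subst h1; subst this; simp
  by_cases hx : x ∈ B
  · by_cases hy : y ∈ B
    · rw [indicator_of_mem hx, indicator_of_mem hy, indicator_of_mem (hB hx hy ha hb hab),
        Real.mul_rpow (hρ.1 x) (inv_nonneg.2 hZ.le), Real.mul_rpow (hρ.1 y) (inv_nonneg.2 hZ.le)]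
      have e : Z⁻¹ ^ a * Z⁻¹ ^ b = Z⁻¹ := by
        rw [← Real.rpow_add (inv_pos.2 hZ), hab, Real.rpow_one]
      calc _ = ρ x ^ a * ρ y ^ b * (Z⁻¹ ^ a * Z⁻¹ ^ b) := by ring
        _ ≤ _ := by rw [e]; exact mul_le_mul_of_nonneg_right (hρ.2 x y a b ha hb hab) (inv_nonneg.2 hZ.le)
    · rw [indicator_of_notMem hy, zero_mul, Real.zero_rpow h1.ne', mul_zero]; exact nn _
  · rw [indicator_of_notMem hx, zero_mul, Real.zero_rpow h0.ne', zero_mul]; exact nn _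

theorem trunc [IsProbabilityMeasure μ] (hn : 2 ≤ n) (hm : Measurable ρ) (hρ : IsLogConcaveFun ρ) 
    (hμ : μ = volume.withDensity fun x => ENNReal.ofReal (ρ x)) (h : IsIsotropic μ) :
    ∃ ν : Measure (Euc n), CC (1 / (200 * (n:ℝ)) ^ 2) ν ∧ CovLe ν 3 ∧
      (∀ F : Euc n → ℝ, (∀ x, 0 ≤ F x) → Integrable F μ → ∫ x, F x ∂ν ≤ 3 * ∫ x, F x ∂μ) ∧
      (∀ F : Euc n → ℝ, (∀ x, 0 ≤ F x) → Integrable F μ →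
        ∫ x in {x | ‖x‖ ≤ 200 * n}, F x ∂μ ≤ 2 * ∫ x, F x ∂ν) := by
  have n2 : (2:ℝ) ≤ n := by exact_mod_cast hn
  set R : ℝ := 200 * n with hR
  have R0 : 0 < R := by positivity
  set B : Set (Euc n) := {x | ‖x‖ ≤ R} with hB
  have mB : MeasurableSet B := measurableSet_le (by fun_prop) measurable_const
  have cB : Convex ℝ B := by
    have : B = Metric.closedBall 0 R := by ext x; simp [hB]
    rw [this]; exact convex_closedBall _ _
  set t : ℝ := 1 / R ^ 2 with ht
  have t0 : 0 < t := by positivity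
  set e : Euc n → ℝ := fun x => exp (-t * ‖x‖ ^ 2 / 2) with he
  have me : Measurable e := by fun_prop
  have e1 : ∀ x, e x ≤ 1 := fun x => exp_le_one_iff.2 (by nlinarith [mul_nonneg t0.le (sq_nonneg ‖x‖)])
  have e0 : ∀ x, 0 < e x := fun x => exp_pos _
  have eB : ∀ x ∈ B, 1 / 2 ≤ e x := fun x hx => by
    have h1 : t * ‖x‖ ^ 2 ≤ 1 := by
      rw [ht, one_div, inv_mul_le_iff₀ (by positivity), mul_one]
      exact pow_le_pow_left₀ (norm_nonneg _) hx 2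
    have := Real.add_one_le_exp (-t * ‖x‖ ^ 2 / 2)
    simp only [he]; linarith
  set Z := ∫ x, B.indicator e x ∂μ with hZ
  have iE : Integrable (B.indicator e) μ := by
    refine integrable_bm (me.indicator mB) (K := 1) fun x => ?_
    rw [abs_of_nonneg (indicator_nonneg (fun x _ => (e0 x).le) x)]
    by_cases hx : x ∈ B
    · rw [indicator_of_mem hx]; exact e1 x
    · rw [indicator_of_notMem hx]; exact zero_le_one
  have Z1 : Z ≤ 1 := by
    calc Z ≤ ∫ _, (1:ℝ) ∂μ := integral_mono iE (integrable_const _) fun x => by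
          by_cases hx : x ∈ B
          · simp only [indicator_of_mem hx]; exact e1 x
          · simp only [indicator_of_notMem hx]; exact zero_le_one
      _ = 1 := by simp
  have Z0 : 3 / 8 ≤ Z := by
    have hb := iso_ball h (by omega)
    set A : Set (Euc n) := {x | ‖x‖ ≤ 2 * √n} with hA
    have mA : MeasurableSet A := measurableSet_le (by fun_prop) measurable_const
    have AB : A ⊆ B := fun x hx => by
      have : √(n:ℝ) ≤ n := by
        rw [Real.sqrt_le_left (by linarith)]; nlinarith
      have h1 : ‖x‖ ≤ 2 * √n := hx
      show ‖x‖ ≤ R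
      linarith
    calc (3:ℝ) / 8 = 1 / 2 * (3 / 4) := by norm_num
      _ ≤ 1 / 2 * μ.real A := by
        refine mul_le_mul_of_nonneg_left ?_ (by norm_num)
        exact (ENNReal.ofReal_le_iff_le_toReal (measure_ne_top _ _)).1 hb
      _ = ∫ x, A.indicator (fun _ => (1:ℝ) / 2) x ∂μ := by
        rw [integral_indicator_const _ mA, smul_eq_mul, mul_comm]
      _ ≤ Z := by
        refine integral_mono ((integrable_const _).indicator mA) iE fun x => ?_
        by_cases hx : x ∈ A
        · simp only [indicator_of_mem hx, indicator_of_mem (AB hx)]; exact eB x (AB hx)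
        · simp only [indicator_of_notMem hx]; exact indicator_nonneg (fun x _ => (e0 x).le) x
  have Zp : 0 < Z := by linarith
  set w : Euc n → ℝ := fun x => B.indicator e x * Z⁻¹ with hw
  have mw : Measurable w := (me.indicator mB).mul_const _
  have w0 : ∀ x, 0 ≤ w x := fun x => mul_nonneg (indicator_nonneg (fun x _ => (e0 x).le) x) (inv_nonneg.2 Zp.le)
  have iZ : Z⁻¹ ≤ 8 / 3 := by
    rw [inv_le_comm₀ Zp (by norm_num)]; linarith
  have w1 : ∀ x, w x ≤ 3 := fun x => by
    have i0 : 0 ≤ Z⁻¹ := inv_nonneg.2 Zp.le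
    have : B.indicator e x ≤ 1 := by
      by_cases hx : x ∈ B
      · simp only [indicator_of_mem hx]; exact e1 x
      · simp only [indicator_of_notMem hx]; exact zero_le_one
    have := mul_le_mul_of_nonneg_right this i0
    simp only [hw]; linarith
  have w2 : ∀ x ∈ B, 1 / 2 ≤ w x := fun x hx => by
    have : 1 ≤ Z⁻¹ := (one_le_inv₀ Zp).2 Z1
    have h2 := eB x hx
    simp only [hw, indicator_of_mem hx]
    nlinarith
  set ν := μ.withDensity fun x => ENNReal.ofReal (w x) with hν
  have mo : Measurable fun x => ENNReal.ofReal (w x) := by fun_prop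
  have int : ∀ F : Euc n → ℝ, ∫ x, F x ∂ν = ∫ x, w x * F x ∂μ := fun F => by
    rw [hν, integral_withDensity_eq_integral_toReal_smul mo (Filter.Eventually.of_forall fun x => ENNReal.ofReal_lt_top)]
    refine integral_congr_ae (Filter.Eventually.of_forall fun x => ?_)
    simp only [ENNReal.toReal_ofReal (w0 x), smul_eq_mul]
  have iw : ∀ F : Euc n → ℝ, Integrable F μ → Integrable (fun x => w x * F x) μ := fun F hF =>
    hF.bdd_mul (c := 3) mw.aestronglyMeasurable (Filter.Eventually.of_forall fun x => by
      rw [Real.norm_of_nonneg (w0 x)]; exact w1 x)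
  have iν : Integrable w μ := iE.mul_const _
  have pν : IsProbabilityMeasure ν := by
    constructor
    rw [hν, withDensity_apply _ MeasurableSet.univ, setLIntegral_univ,
      ← ofReal_integral_eq_lintegral_ofReal iν (Filter.Eventually.of_forall w0)]
    simp only [hw]
    rw [integral_mul_const, ← hZ, mul_inv_cancel₀ Zp.ne', ENNReal.ofReal_one]
  have up : ∀ F : Euc n → ℝ, (∀ x, 0 ≤ F x) → Integrable F μ → ∫ x, F x ∂ν ≤ 3 * ∫ x, F x ∂μ := fun F F0 hF => by
    rw [int, ← integral_const_mul]
    exact integral_mono (iw F hF) (hF.const_mul _) fun x => mul_le_mul_of_nonneg_right (w1 x) (F0 x)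
  refine ⟨ν, ⟨pν, ⟨fun x => B.indicator ρ x * Z⁻¹, (hm.indicator mB).mul_const _, lc_ind hρ cB Zp, ?_⟩, R, ?_⟩, ?_, up, ?_⟩
  · rw [hν, hμ, ← withDensity_mul _ (by fun_prop) mo]
    congr 1
    funext x
    rw [Pi.mul_apply, ← ENNReal.ofReal_mul (hρ.1 x)]
    congr 1
    simp only [hw]
    by_cases hx : x ∈ B
    · simp only [indicator_of_mem hx, he]; ring
    · simp only [indicator_of_notMem hx]; ring
  · rw [hν, ae_withDensity_iff mo]
    refine Filter.Eventually.of_forall fun x hx => ?_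
    by_contra hh
    have : x ∉ B := hh
    apply hx
    simp [hw, indicator_of_notMem this]
  · intro v
    have h1 : vr ν (fun x => ⟪v, x⟫) ≤ ∫ x, ⟪v, x⟫ ^ 2 ∂ν := by
      unfold vr; linarith [sq_nonneg (∫ x, ⟪v, x⟫ ∂ν)]
    have h2 := iso_inner h v
    simp only [real_inner_comm] at h2
    have h3 := up (fun x => ⟪v, x⟫ ^ 2) (fun x => sq_nonneg _) h2.1
    rw [h2.2] at h3
    exact h1.trans h3
  · intro F F0 hF
    rw [int, ← integral_indicator mB, ← integral_const_mul]
    refine integral_mono (hF.indicator mB) ((iw F hF).const_mul _) fun x => ?_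
    by_cases hx : x ∈ B
    · simp only [indicator_of_mem hx]
      have := mul_le_mul_of_nonneg_right (w2 x hx) (F0 x)
      linarith
    · simp only [indicator_of_notMem hx]
      have := mul_nonneg (w0 x) (F0 x)
      linarith

end

end KLS

end

section
open MeasureTheory Real Set
open scoped ENNReal RealInnerProductSpace Matrix

namespace KLS
noncomputable section

variable {n : ℕ} {μ : Measure (Euc n)} {ρ : Euc n → ℝ} {x0 : Euc n}

theorem norm_gradient (f : Euc n → ℝ) (x : Euc n) : ‖gradient f x‖ = ‖fderiv ℝ f x‖ := by
  unfold gradient; rw [LinearIsometryEquiv.norm_map]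

theorem gsq_fderiv (f : Euc n → ℝ) (x : Euc n) : gsq f x = ‖fderiv ℝ f x‖ ^ 2 := by
  rw [gsq_eq, norm_gradient]

theorem st_deriv : ∃ D : ℝ, 0 ≤ D ∧ ∀ s, |deriv Real.smoothTransition s| ≤ D := by
  have c : Continuous (deriv Real.smoothTransition) :=
    (Real.smoothTransition.contDiff (n := 1)).continuous_deriv le_rfl
  have z : ∀ s, s ∉ Icc (0:ℝ) 1 → deriv Real.smoothTransition s = 0 := by
    intro s hs
    have hs' : s < 0 ∨ 1 < s := by
      by_contra hh
      push Not at hh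
      exact hs hh
    rcases hs' with h | h
    · have : Real.smoothTransition =ᶠ[nhds s] fun _ => 0 := by
        filter_upwards [gt_mem_nhds h] with y hy using Real.smoothTransition.zero_of_nonpos hy.le
      rw [this.deriv_eq, deriv_const]
    · have : Real.smoothTransition =ᶠ[nhds s] fun _ => 1 := by
        filter_upwards [lt_mem_nhds h] with y hy using Real.smoothTransition.one_of_one_le hy.le
      rw [this.deriv_eq, deriv_const]
  obtain ⟨D, hD⟩ := (isCompact_Icc (a := (0:ℝ)) (b := 1)).exists_bound_of_continuousOn c.continuousOn
  refine ⟨max D 0, le_max_right _ _, fun s => ?_⟩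
  by_cases hs : s ∈ Icc (0:ℝ) 1
  · exact (hD s hs).trans (le_max_left _ _)
  · rw [z s hs, abs_zero]; exact le_max_right _ _

theorem cut : ∃ M : ℝ, 0 ≤ M ∧ ∀ (n : ℕ) (x0 : Euc n) (k : ℝ), 1 ≤ k → ∃ χ : Euc n → ℝ,
    ContDiff ℝ ((⊤ : ℕ∞) : WithTop ℕ∞) χ ∧ HasCompactSupport χ ∧ (∀ x, 0 ≤ χ x ∧ χ x ≤ 1) ∧
    (∀ x, ‖x - x0‖ ≤ k → χ x = 1) ∧ (∀ x, ‖x - x0‖ < k → gsq χ x = 0) ∧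
    (∀ x, 2 * k < ‖x - x0‖ → χ x = 0 ∧ gsq χ x = 0) ∧ ∀ x, gsq χ x ≤ M := by
  obtain ⟨D, D0, hD⟩ := st_deriv
  refine ⟨(4 * D) ^ 2, sq_nonneg _, fun n x0 k hk => ?_⟩
  have k0 : 0 < k := by linarith
  set a : Euc n → ℝ := fun x => 2 - ‖x - x0‖ ^ 2 / k ^ 2 with ha
  set χ : Euc n → ℝ := fun x => Real.smoothTransition (a x) with hχ
  have ca : ContDiff ℝ ((⊤ : ℕ∞) : WithTop ℕ∞) a := by
    refine contDiff_const.sub (ContDiff.div_const ?_ _)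
    exact (contDiff_id.sub contDiff_const).norm_sq ℝ
  have cχ : ContDiff ℝ ((⊤ : ℕ∞) : WithTop ℕ∞) χ := Real.smoothTransition.contDiff.comp ca
  have h1 : ∀ x, ‖x - x0‖ ≤ k → χ x = 1 := fun x hx => by
    refine Real.smoothTransition.one_of_one_le ?_
    have : ‖x - x0‖ ^ 2 / k ^ 2 ≤ 1 := by
      rw [div_le_one (by positivity)]; exact pow_le_pow_left₀ (norm_nonneg _) hx 2
    simp only [ha]; linarith
  have h2 : ∀ x, 2 * k < ‖x - x0‖ → χ x = 0 := fun x hx => by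
    refine Real.smoothTransition.zero_of_nonpos ?_
    have : 4 ≤ ‖x - x0‖ ^ 2 / k ^ 2 := by
      rw [le_div_iff₀ (by positivity)]
      have := pow_le_pow_left₀ (by positivity) hx.le 2
      nlinarith
    simp only [ha]; linarith
  have z : ∀ c x, χ =ᶠ[nhds x] (fun _ => c) → gsq χ x = 0 := fun c x hx => by
    rw [gsq_fderiv, hx.fderiv_eq]; simp
  have h3 : ∀ x, ‖x - x0‖ < k → gsq χ x = 0 := fun x hx => by
    refine z 1 x ?_
    have o : IsOpen {y : Euc n | ‖y - x0‖ < k} := isOpen_lt (by fun_prop) continuous_const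
    filter_upwards [o.mem_nhds hx] with y hy using h1 y (le_of_lt hy)
  have h4 : ∀ x, 2 * k < ‖x - x0‖ → gsq χ x = 0 := fun x hx => by
    refine z 0 x ?_
    have o : IsOpen {y : Euc n | 2 * k < ‖y - x0‖} := isOpen_lt continuous_const (by fun_prop)
    filter_upwards [o.mem_nhds hx] with y hy using h2 y hy
  refine ⟨χ, cχ, ?_, fun x => ⟨Real.smoothTransition.nonneg _, Real.smoothTransition.le_one _⟩, h1, h3,
    fun x hx => ⟨h2 x hx, h4 x hx⟩, fun x => ?_⟩
  · refine HasCompactSupport.intro (isCompact_closedBall x0 (2 * k)) fun x hx => h2 x ?_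
    rw [Metric.mem_closedBall, dist_eq_norm] at hx
    exact not_le.1 hx
  · rcases lt_or_ge (2 * k) ‖x - x0‖ with hx | hx
    · rw [h4 x hx]; positivity
    · rw [gsq_fderiv]
      refine pow_le_pow_left₀ (norm_nonneg _) ?_ 2
      have d1 : HasFDerivAt (fun y : Euc n => ‖y - x0‖ ^ 2) (2 • innerSL ℝ (x - x0)) x := by
        have := (hasStrictFDerivAt_norm_sq (x - x0)).hasFDerivAt.comp x ((hasFDerivAt_id x).sub_const x0)
        rw [ContinuousLinearMap.comp_id] at this
        exact this
      have d2 : HasFDerivAt a (-((k ^ 2)⁻¹ • (2 • innerSL ℝ (x - x0)))) x := by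
        have := (d1.mul_const ((k ^ 2)⁻¹)).const_sub 2
        simpa only [ha, div_eq_mul_inv] using this
      have d3 : HasDerivAt Real.smoothTransition (deriv Real.smoothTransition (a x)) (a x) :=
        ((Real.smoothTransition.contDiff (n := 1)).differentiable one_ne_zero _).hasDerivAt
      have d4 := d3.comp_hasFDerivAt x d2
      have d5 : fderiv ℝ χ x = _ := d4.fderiv
      rw [d5, norm_smul, norm_neg, norm_smul, two_smul ℕ (innerSL ℝ (x - x0)), Real.norm_eq_abs]
      have q : ‖innerSL ℝ (x - x0) + innerSL ℝ (x - x0)‖ ≤ 4 * k := by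
        refine (norm_add_le _ _).trans ?_
        rw [innerSL_apply_norm]; linarith
      have q2 : ‖(k ^ 2)⁻¹‖ * ‖innerSL ℝ (x - x0) + innerSL ℝ (x - x0)‖ ≤ 4 := by
        rw [Real.norm_of_nonneg (by positivity), inv_mul_le_iff₀ (by positivity)]
        nlinarith
      calc _ ≤ D * 4 := mul_le_mul (hD _) q2 (by positivity) D0
        _ = _ := by ring

end

end KLS

end

section
open MeasureTheory Real Set
open scoped ENNReal RealInnerProductSpace Matrix

namespace KLS
noncomputable section

variable {n : ℕ} {μ : Measure (Euc n)} {ρ : Euc n → ℝ} {x0 : Euc n}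

theorem log_est (hn : 2 ≤ n) : 1 / 2 ≤ log n ∧
    256000 * ((Nat.log 2 n : ℕ) + 2 + log (1 + 1 / (1 / (200 * (n:ℝ)) ^ 2))) * 3 ≤ 20000000 * log n := by
  have n2 : (2:ℝ) ≤ n := by exact_mod_cast hn
  have l2 : log 2 ≤ log n := log_le_log (by norm_num) n2
  have l3 := Real.log_two_gt_d9
  have a : (Nat.log 2 n : ℝ) ≤ 2 * log n := by
    have h1 : (2:ℝ) ^ Nat.log 2 n ≤ n := by exact_mod_cast Nat.pow_log_le_self 2 (by omega)
    have h2 := log_le_log (by positivity) h1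
    rw [log_pow] at h2
    have h3 : (0:ℝ) ≤ Nat.log 2 n := Nat.cast_nonneg _
    nlinarith
  have b : log (1 + 1 / (1 / (200 * (n:ℝ)) ^ 2)) ≤ 18 * log n := by
    have h1 : (65536:ℝ) ≤ (n:ℝ) ^ 16 := by
      calc (65536:ℝ) = 2 ^ 16 := by norm_num
        _ ≤ _ := pow_le_pow_left₀ (by norm_num) n2 16
    have h2 : 1 + 1 / (1 / (200 * (n:ℝ)) ^ 2) ≤ (n:ℝ) ^ 18 := by
      rw [one_div_one_div]
      have : (n:ℝ) ^ 18 = n ^ 16 * n ^ 2 := by ring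
      rw [this]
      have := mul_le_mul_of_nonneg_right h1 (sq_nonneg (n:ℝ))
      nlinarith
    have h3 := log_le_log (by positivity) h2
    rw [log_pow] at h3
    exact_mod_cast h3
  constructor
  · linarith
  · linarith

theorem SB.one_sub {f : Euc n → ℝ} (h : SB f) : SB (fun x => 1 - f x) := fun k => (Cb.const 1 k).sub (h k)

theorem gsq_one_sub_mul {χ g : Euc n → ℝ} (hχ : SB χ) (hg : SB g) (h1 : ∀ x, 0 ≤ χ x ∧ χ x ≤ 1) (x : Euc n) :
    gsq (fun x => (1 - χ x) * g x) x ≤ 2 * gsq g x + 2 * (gsq χ x * g x ^ 2) := by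
  have d1 := (hχ 1).diff x
  have d2 := (hg 1).diff x
  have e : fderiv ℝ (fun x => (1 - χ x) * g x) x = (1 - χ x) • fderiv ℝ g x - g x • fderiv ℝ χ x := by
    have := (d1.hasFDerivAt.const_sub 1).mul d2.hasFDerivAt
    have t2 : fderiv ℝ (fun x => (1 - χ x) * g x) x = _ := this.fderiv
    rw [t2, smul_neg]; exact (sub_eq_add_neg _ _).symm
  have b : ‖fderiv ℝ (fun x => (1 - χ x) * g x) x‖ ≤ ‖fderiv ℝ g x‖ + |g x| * ‖fderiv ℝ χ x‖ := by
    rw [e]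
    refine (norm_sub_le _ _).trans ?_
    rw [norm_smul, norm_smul, Real.norm_eq_abs, Real.norm_eq_abs]
    have : |1 - χ x| ≤ 1 := by rw [abs_le]; constructor <;> linarith [(h1 x).1, (h1 x).2]
    have := mul_le_mul_of_nonneg_right this (norm_nonneg (fderiv ℝ g x))
    linarith
  simp only [gsq_fderiv]
  have b2 := pow_le_pow_left₀ (norm_nonneg _) b 2
  have := sq_nonneg (‖fderiv ℝ g x‖ - |g x| * ‖fderiv ℝ χ x‖)
  have s := sq_abs (g x)
  calc _ ≤ _ := b2
    _ ≤ 2 * ‖fderiv ℝ g x‖ ^ 2 + 2 * (‖fderiv ℝ χ x‖ ^ 2 * |g x| ^ 2) := by nlinarith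
    _ = _ := by rw [s]

theorem smooth_bound : ∃ C : ℝ, 0 < C ∧ ∀ n : ℕ, 2 ≤ n → ∀ μ : Measure (Euc n),
      IsProbabilityMeasure μ → IsLogConcaveMeasure μ → IsIsotropic μ → Poin μ (C * Real.log n) := by
  obtain ⟨M, M0, hM⟩ := cut
  refine ⟨4096 + (1 + 2048 * M) * (6 * 20000000), by positivity, fun n hn μ pμ hlc hi f hf => ?_⟩
  obtain ⟨ρ, hm, hρ, hμ⟩ := hlc
  have n2 : (2:ℝ) ≤ n := by exact_mod_cast hn
  obtain ⟨x0, hx0, hρ0, hd⟩ := decay (by omega) hm hρ hμ hi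
  obtain ⟨ν, hcc, hcov, hup, hlo⟩ := trunc hn hm hρ hμ hi
  have pν := hcc.prob
  obtain ⟨lg, hP⟩ := log_est hn
  have mb := main_bound (p := Nat.log 2 n) (Nat.lt_pow_succ_log_self (by norm_num) n).le (by positivity) hcc (by norm_num) hcov
  obtain ⟨χ, c1, c2, c3, c4, c5, c6, c7⟩ := hM n x0 (64 * n) (by linarith)
  set c := ∫ x, f x ∂ν with hc
  set g : Euc n → ℝ := fun x => f x - c with hg
  have sg : SB g := SB.sub_const hf c
  have sχ : SB χ := SB.of_compact c1 c2
  have sh : SB (fun x => (1 - χ x) * g x) := fun k => (sχ.one_sub k).mul (sg k)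
  have gg : gsq g = gsq f := gsq_sub_const c
  set B : Set (Euc n) := {x | ‖x‖ ≤ 200 * n} with hB
  have mB : MeasurableSet B := measurableSet_le (by fun_prop) measurable_const
  have i1 : Integrable (fun x => g x ^ 2) μ := ((sg 0).pow 2).integrable μ
  have i2 : Integrable (gsq f) μ := ((hf 1).gsq).integrable μ
  set G2 := ∫ x, gsq f x ∂μ with hG2
  have G0 : 0 ≤ G2 := integral_nonneg fun x => gsq_nonneg f x
  set I := ∫ x in B, g x ^ 2 ∂μ with hI
  have I0 : 0 ≤ I := integral_nonneg fun x => sq_nonneg _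
  have bI : I ≤ 6 * (20000000 * log n) * G2 := by
    have a1 := hlo (fun x => g x ^ 2) (fun x => sq_nonneg _) i1
    have a2 := mb f hf
    rw [vr_eq ((hf 0).integrable ν) (((hf 0).pow 2).integrable ν) c, ← hc, sub_self] at a2
    have a3 := hup (gsq f) (gsq_nonneg f) i2
    have a4 : 0 ≤ ∫ x, gsq f x ∂ν := integral_nonneg fun x => gsq_nonneg f x
    have a5 := mul_le_mul_of_nonneg_right hP a4
    have a6 := mul_le_mul_of_nonneg_left a3 (by linarith : 0 ≤ 20000000 * log n)
    have a7 : (∫ x, (f x - c) ^ 2 ∂ν) = ∫ x, g x ^ 2 ∂ν := rfl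
    rw [a7] at a2
    linarith
  have out : ∀ x, x ∉ B → 2 * (64 * (n:ℝ)) < ‖x - x0‖ := fun x hx => by
    have h1 : 200 * (n:ℝ) < ‖x‖ := not_le.1 hx
    have h2 : √(n:ℝ) ≤ n := by rw [Real.sqrt_le_left (by linarith)]; nlinarith
    have h3 := norm_sub_norm_le x x0
    linarith
  have t := tail (by omega) hm hρ hμ hρ0 hd sh (fun x hx => by
    simp only [c4 x hx.le, sub_self, zero_mul])
  have b1 : ∫ x, gsq (fun x => (1 - χ x) * g x) x ∂μ ≤ 2 * G2 + 2 * (M * I) := by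
    calc _ ≤ ∫ x, (2 * gsq f x + 2 * (M * B.indicator (fun x => g x ^ 2) x)) ∂μ := by
          refine integral_mono (((sh 1).gsq).integrable μ)
            (iadd (i2.const_mul _) (((i1.indicator mB).const_mul _).const_mul _)) fun x => ?_
          have h1 := gsq_one_sub_mul sχ sg c3 x
          rw [gg] at h1
          by_cases hx : x ∈ B
          · simp only [indicator_of_mem hx]
            have := mul_le_mul_of_nonneg_right (c7 x) (sq_nonneg (g x))
            linarith
          · simp only [indicator_of_notMem hx]
            rw [(c6 x (out x hx)).2] at h1
            linarith
      _ = _ := by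
        rw [integral_add (i2.const_mul _) (((i1.indicator mB).const_mul _).const_mul _), integral_const_mul,
          integral_const_mul, integral_const_mul, integral_indicator mB]
  have b2 : ∫ x, g x ^ 2 ∂μ ≤ I + ∫ x, ((1 - χ x) * g x) ^ 2 ∂μ := by
    rw [hI, ← integral_indicator mB, ← integral_add (i1.indicator mB) (((sh 0).pow 2).integrable μ)]
    refine integral_mono i1 (iadd (i1.indicator mB) (((sh 0).pow 2).integrable μ)) fun x => ?_
    by_cases hx : x ∈ B
    · simp only [indicator_of_mem hx]
      linarith [sq_nonneg ((1 - χ x) * g x)]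
    · simp only [indicator_of_notMem hx]
      rw [(c6 x (out x hx)).1]
      simp
  have b3 : vr μ f ≤ ∫ x, g x ^ 2 ∂μ := by
    rw [vr_eq ((hf 0).integrable μ) (((hf 0).pow 2).integrable μ) c]
    linarith [sq_nonneg (∫ x, f x ∂μ - c)]
  have b4 : vr μ f ≤ 2048 * G2 + (1 + 2048 * M) * I := by linarith
  have b5 := mul_le_mul_of_nonneg_left bI (by positivity : 0 ≤ 1 + 2048 * M)
  have b6 := mul_le_mul_of_nonneg_right lg G0
  refine b4.trans ?_
  have : (4096 + (1 + 2048 * M) * (6 * 20000000)) * log n * G2 =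
    4096 * (log n * G2) + (1 + 2048 * M) * (6 * (20000000 * log n) * G2) := by ring
  rw [this]
  linarith

end

end KLS

end

section
open MeasureTheory Real Set
open scoped ENNReal RealInnerProductSpace Matrix

namespace KLS
noncomputable section

open scoped Convolution in
theorem Poin.lip {n : ℕ} {μ : Measure (Euc n)} [IsProbabilityMeasure μ] (hac : μ ≪ volume) {C : ℝ} (hP : Poin μ C)
    {φ : Euc n → ℝ} {L : NNReal} (hL : LipschitzWith L φ) (hc : HasCompactSupport φ) :
    vr μ φ ≤ C * ∫ x, gsq φ x ∂μ := by
  obtain ⟨K, hK⟩ := hL.continuous.bounded_above_of_compact_support hc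
  set ψ : ℕ → ContDiffBump (0 : Euc n) := fun m =>
    ⟨1 / ((m:ℝ) + 1), 2 * (1 / ((m:ℝ) + 1)), by positivity, by
      have : 0 < 1 / ((m:ℝ) + 1) := by positivity
      linarith⟩ with hψ
  have lim : Filter.Tendsto (fun m => (ψ m).rOut) Filter.atTop (nhds 0) := by
    have := (tendsto_one_div_add_atTop_nhds_zero_nat (𝕜 := ℝ)).const_mul 2
    simpa only [mul_zero] using this
  have rat : ∀ᶠ m in Filter.atTop, (ψ m).rOut ≤ 2 * (ψ m).rIn := Filter.Eventually.of_forall fun m => le_rfl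
  set u : ℕ → Euc n → ℝ := fun m => (ψ m).normed volume ⋆[ContinuousLinearMap.lsmul ℝ ℝ, volume] φ with hu
  have ue : ∀ m x, u m x = ∫ t, (ψ m).normed volume t * φ (x - t) := fun m x => rfl
  have mfd : Measurable (fderiv ℝ φ) := measurable_fderiv ℝ φ
  have bfd : ∀ x, ‖fderiv ℝ φ x‖ ≤ L := fun x => norm_fderiv_le_of_lipschitz ℝ hL
  have ade : ∀ᵐ x : Euc n, DifferentiableAt ℝ φ x := hL.ae_differentiableAt
  have p0 : ∀ m t, 0 ≤ (ψ m).normed volume t := fun m t => (ψ m).nonneg_normed t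
  have pi : ∀ m, Integrable ((ψ m).normed volume) volume := fun m => (ψ m).integrable_normed
  have hfd : ∀ m x, HasFDerivAt (u m) (∫ t, (ψ m).normed volume t • fderiv ℝ φ (x - t)) x := by
    intro m x
    refine (hasFDerivAt_integral_of_dominated_loc_of_lip' (μ := volume) (F := fun x t => (ψ m).normed volume t * φ (x - t))
      (F' := fun t => (ψ m).normed volume t • fderiv ℝ φ (x - t)) (s := univ)
      (bound := fun t => (ψ m).normed volume t * L) Filter.univ_mem (fun y _ => ?_) ?_ ?_ ?_ ?_ ?_).2
    · exact ((ψ m).continuous_normed.mul (hL.continuous.comp (by fun_prop))).aestronglyMeasurable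
    · exact (pi m).mul_bdd (c := K) (hL.continuous.comp (by fun_prop)).aestronglyMeasurable
        (Filter.Eventually.of_forall fun t => hK _)
    · exact ((ψ m).continuous_normed.measurable.smul (mfd.comp (by fun_prop))).aestronglyMeasurable
    · refine Filter.Eventually.of_forall fun t y _ => ?_
      rw [← mul_sub, norm_mul, Real.norm_of_nonneg (p0 m t), mul_assoc]
      refine mul_le_mul_of_nonneg_left ?_ (p0 m t)
      have := hL.norm_sub_le (y - t) (x - t)
      simpa using this
    · exact (pi m).mul_const _
    · have q := (quasiMeasurePreserving_sub_left_of_right_invariant (volume : Measure (Euc n)) x).ae ade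
      filter_upwards [q] with t ht
      have h1 : HasFDerivAt (fun y => φ (y - t)) (fderiv ℝ φ (x - t)) x := by
        have h2 : HasFDerivAt φ (fderiv ℝ φ (x - t)) (x - t) := ht.hasFDerivAt
        have := h2.comp x ((hasFDerivAt_id x).sub_const t)
        rw [ContinuousLinearMap.comp_id] at this
        exact this
      exact h1.const_mul _
  have su : ∀ m, SB (u m) := fun m => by
    refine SB.of_compact ?_ ?_
    · exact (ψ m).hasCompactSupport_normed.contDiff_convolution_left _ (ψ m).contDiff_normed hL.continuous.locallyIntegrable
    · exact (ψ m).hasCompactSupport_normed.convolution _ hc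
  have bu : ∀ m x, |u m x| ≤ K := fun m x => by
    rw [ue]
    have : ‖∫ t, (ψ m).normed volume t * φ (x - t)‖ ≤ ∫ t, (ψ m).normed volume t * K :=
      norm_integral_le_of_norm_le ((pi m).mul_const K) (Filter.Eventually.of_forall fun t => by
        rw [norm_mul, Real.norm_of_nonneg (p0 m t)]
        exact mul_le_mul_of_nonneg_left (hK _) (p0 m t))
    rw [integral_mul_const, (ψ m).integral_normed, one_mul] at this
    exact this
  have bg : ∀ m x, ‖fderiv ℝ (u m) x‖ ≤ L := fun m x => by
    rw [(hfd m x).fderiv]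
    have : ‖∫ t, (ψ m).normed volume t • fderiv ℝ φ (x - t)‖ ≤ ∫ t, (ψ m).normed volume t * L :=
      norm_integral_le_of_norm_le ((pi m).mul_const _) (Filter.Eventually.of_forall fun t => by
        rw [norm_smul, Real.norm_of_nonneg (p0 m t)]
        exact mul_le_mul_of_nonneg_left (bfd _) (p0 m t))
    rw [integral_mul_const, (ψ m).integral_normed, one_mul] at this
    exact this
  have a1 : ∀ᵐ x ∂μ, Filter.Tendsto (fun m => u m x) Filter.atTop (nhds (φ x)) :=
    hac.ae_le (ContDiffBump.ae_convolution_tendsto_right_of_locallyIntegrable (μ := volume) lim rat hL.continuous.locallyIntegrable)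
  have a2 : ∀ᵐ x ∂μ, Filter.Tendsto (fun m => fderiv ℝ (u m) x) Filter.atTop (nhds (fderiv ℝ φ x)) := by
    have li : LocallyIntegrable (fderiv ℝ φ) (volume : Measure (Euc n)) := by
      refine (locallyIntegrable_const (L:ℝ)).mono mfd.aestronglyMeasurable (Filter.Eventually.of_forall fun x => ?_)
      exact (bfd x).trans (le_abs_self _)
    have := hac.ae_le (ContDiffBump.ae_convolution_tendsto_right_of_locallyIntegrable (μ := volume) lim rat li)
    filter_upwards [this] with x hx
    refine hx.congr fun m => ?_
    rw [(hfd m x).fderiv]; rfl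
  have t1 : Filter.Tendsto (fun m => ∫ x, u m x ∂μ) Filter.atTop (nhds (∫ x, φ x ∂μ)) := by
    refine tendsto_integral_of_dominated_convergence (fun _ => K) (fun m => (su m 0).measurable.aestronglyMeasurable)
      (integrable_const _) (fun m => Filter.Eventually.of_forall fun x => bu m x) a1
  have t2 : Filter.Tendsto (fun m => ∫ x, u m x ^ 2 ∂μ) Filter.atTop (nhds (∫ x, φ x ^ 2 ∂μ)) := by
    refine tendsto_integral_of_dominated_convergence (fun _ => K ^ 2) (fun m => ((su m 0).pow 2).measurable.aestronglyMeasurable)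
      (integrable_const _) (fun m => Filter.Eventually.of_forall fun x => ?_) ?_
    · rw [norm_pow]; exact pow_le_pow_left₀ (norm_nonneg _) (bu m x) 2
    · filter_upwards [a1] with x hx using hx.pow 2
  have t3 : Filter.Tendsto (fun m => ∫ x, gsq (u m) x ∂μ) Filter.atTop (nhds (∫ x, gsq φ x ∂μ)) := by
    refine tendsto_integral_of_dominated_convergence (fun _ => (L:ℝ) ^ 2) (fun m => ((su m 1).gsq).measurable.aestronglyMeasurable)
      (integrable_const _) (fun m => Filter.Eventually.of_forall fun x => ?_) ?_
    · rw [gsq_fderiv, norm_pow, norm_norm]; exact pow_le_pow_left₀ (norm_nonneg _) (bg m x) 2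
    · filter_upwards [a2] with x hx
      simp only [gsq_fderiv]
      exact hx.norm.pow 2
  exact le_of_tendsto_of_tendsto' (t2.sub (t1.pow 2)) (t3.const_mul C) fun m => hP (u m) (su m)

theorem lip_cut {n : ℕ} {f χ : Euc n → ℝ} (hf : LocallyLipschitz f) (hχ : ContDiff ℝ ((⊤ : ℕ∞) : WithTop ℕ∞) χ) {k : ℝ}
    (hz : ∀ x, 2 * k < ‖x - 0‖ → χ x = 0) : ∃ L : NNReal, LipschitzWith L (fun x => f x * χ x) := by
  set g : Euc n → ℝ := fun x => f x * χ x with hg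
  have cp := isCompact_closedBall (0 : Euc n) (2 * k + 1)
  have lχ : LocallyLipschitz χ := (hχ.of_le (by simp)).locallyLipschitz
  obtain ⟨L1, h1⟩ := hf.locallyLipschitzOn.exists_lipschitzOnWith_of_compact cp
  obtain ⟨L2, h2⟩ := lχ.locallyLipschitzOn.exists_lipschitzOnWith_of_compact cp
  obtain ⟨K1, k1⟩ := cp.exists_bound_of_continuousOn hf.continuous.continuousOn
  obtain ⟨K2, k2⟩ := cp.exists_bound_of_continuousOn lχ.continuous.continuousOn
  set A := |K1| * L2 + |K2| * L1 + |K1| * |K2| with hA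
  have A0 : 0 ≤ A := by positivity
  have z : ∀ x, 2 * k < ‖x‖ → g x = 0 := fun x hx => by simp only [hg, hz x (by simpa using hx), mul_zero]
  have c1 : ∀ x y, ‖x‖ ≤ 2 * k + 1 → ‖y‖ ≤ 2 * k + 1 → |g x - g y| ≤ A * ‖x - y‖ := fun x y hx hy => by
    have mx : x ∈ Metric.closedBall (0 : Euc n) (2 * k + 1) := by simpa using hx
    have my : y ∈ Metric.closedBall (0 : Euc n) (2 * k + 1) := by simpa using hy
    have e : g x - g y = f x * (χ x - χ y) + χ y * (f x - f y) := by simp only [hg]; ring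
    have q1 := h1.norm_sub_le mx my
    have q2 := h2.norm_sub_le mx my
    have q3 := (k1 x mx).trans (le_abs_self K1)
    have q4 := (k2 y my).trans (le_abs_self K2)
    rw [e]
    refine (abs_add_le _ _).trans ?_
    rw [abs_mul, abs_mul]
    have r1 := mul_le_mul q3 q2 (norm_nonneg _) (abs_nonneg _)
    have r2 := mul_le_mul q4 q1 (norm_nonneg _) (abs_nonneg _)
    simp only [Real.norm_eq_abs] at r1 r2
    have r3 : 0 ≤ |K1| * |K2| * ‖x - y‖ := by positivity
    rw [hA]
    nlinarith
  have c2 : ∀ x y, ‖x‖ ≤ 2 * k + 1 → 2 * k + 1 < ‖y‖ → |g x - g y| ≤ A * ‖x - y‖ := fun x y hx hy => by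
    rw [z y (by linarith), sub_zero]
    rcases lt_or_ge (2 * k) ‖x‖ with h | h
    · rw [z x h, abs_zero]; positivity
    · have mx : x ∈ Metric.closedBall (0 : Euc n) (2 * k + 1) := by simpa using hx
      have q3 := (k1 x mx).trans (le_abs_self K1)
      have q4 := (k2 x mx).trans (le_abs_self K2)
      have d : 1 ≤ ‖x - y‖ := by
        have := norm_sub_norm_le y x
        rw [norm_sub_rev] at this
        linarith
      have r := mul_le_mul q3 q4 (norm_nonneg _) (abs_nonneg _)
      rw [← norm_mul] at r
      have r2 : |K1| * |K2| ≤ A := by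
        have : 0 ≤ |K1| * (L2:ℝ) + |K2| * L1 := by positivity
        linarith
      have r3 : A * 1 ≤ A * ‖x - y‖ := mul_le_mul_of_nonneg_left d A0
      have r4 : |g x| ≤ |K1| * |K2| := r
      linarith
  refine ⟨A.toNNReal, LipschitzWith.of_dist_le_mul fun x y => ?_⟩
  rw [Real.coe_toNNReal _ A0, Real.dist_eq, dist_eq_norm]
  rcases le_or_gt ‖x‖ (2 * k + 1) with hx | hx
  · rcases le_or_gt ‖y‖ (2 * k + 1) with hy | hy
    · exact c1 x y hx hy
    · exact c2 x y hx hy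
  · rcases le_or_gt ‖y‖ (2 * k + 1) with hy | hy
    · rw [abs_sub_comm, norm_sub_rev]; exact c2 y x hy hx
    · rw [z x (by linarith), z y (by linarith), sub_self, abs_zero]; positivity

theorem Poin.locLip {n : ℕ} {μ : Measure (Euc n)} [IsProbabilityMeasure μ] (hac : μ ≪ volume) {C : ℝ} (hC : 0 ≤ C)
    (hP : Poin μ C) : C ∈ poincareSet μ := by
  refine ⟨hC, fun f hf hg => ?_⟩
  have R0 : 0 ≤ C * ∫ x, ‖gradient f x‖ ^ 2 ∂μ := mul_nonneg hC (integral_nonneg fun x => sq_nonneg _)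
  by_cases h2 : Integrable (fun x => f x ^ 2) μ
  swap
  · rw [integral_undef h2]; linarith [sq_nonneg (∫ x, f x ∂μ)]
  simp only [← gsq_eq] at hg ⊢
  have cf := hf.continuous
  have h1 : Integrable f μ := 
    ((memLp_two_iff_integrable_sq cf.aestronglyMeasurable).2 h2).integrable (by norm_num)
  obtain ⟨M, M0, hM⟩ := cut
  have hM' : ∀ m : ℕ, _ := fun m => hM n 0 ((m:ℝ) + 1) (by have : (0:ℝ) ≤ m := Nat.cast_nonneg m
                                                           linarith)
  choose χ c1 c2 c3 c4 c5 c6 c7 using hM'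
  choose L hL using fun m => lip_cut hf (c1 m) (fun x hx => (c6 m x hx).1)
  have ev : ∀ x : Euc n, ∀ᶠ m : ℕ in Filter.atTop, ‖x - 0‖ < (m:ℝ) + 1 := fun x => by
    filter_upwards [Filter.eventually_ge_atTop ⌈‖x - 0‖⌉₊] with m hm
    have := Nat.ceil_le.1 hm
    linarith
  have loc : ∀ m : ℕ, ∀ x : Euc n, ‖x - 0‖ < (m:ℝ) + 1 → (fun x => f x * χ m x) =ᶠ[nhds x] f := fun m x hx => by
    have o : IsOpen {y : Euc n | ‖y - 0‖ < (m:ℝ) + 1} := isOpen_lt (by fun_prop) continuous_const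
    filter_upwards [o.mem_nhds hx] with y hy
    rw [c4 m y (le_of_lt hy), mul_one]
  have df : ∀ᵐ x ∂μ, DifferentiableAt ℝ f x := by
    have : ∀ᵐ x : Euc n, ∀ m, DifferentiableAt ℝ (fun x => f x * χ m x) x :=
      ae_all_iff.2 fun m => (hL m).ae_differentiableAt
    filter_upwards [hac.ae_le this] with x hx
    obtain ⟨m, hm⟩ := (ev x).exists
    exact (hx m).congr_of_eventuallyEq (loc m x hm).symm
  have cc : ∀ m, HasCompactSupport (fun x => f x * χ m x) := fun m => (c2 m).mul_left
  have cχ : ∀ m, Continuous (χ m) := fun m => (c1 m).continuous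
  have bf : ∀ m x, |f x * χ m x| ≤ |f x| := fun m x => by
    rw [abs_mul, abs_of_nonneg (c3 m x).1]
    exact mul_le_of_le_one_right (abs_nonneg _) (c3 m x).2
  have t0 : ∀ x, Filter.Tendsto (fun m => f x * χ m x) Filter.atTop (nhds (f x)) := fun x => by
    refine tendsto_const_nhds.congr' ?_
    filter_upwards [ev x] with m hm
    exact ((loc m x hm).eq_of_nhds).symm
  have t1 : Filter.Tendsto (fun m => ∫ x, f x * χ m x ∂μ) Filter.atTop (nhds (∫ x, f x ∂μ)) := by
    refine tendsto_integral_of_dominated_convergence (fun x => |f x|) (fun m => (cf.mul (cχ m)).aestronglyMeasurable)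
      h1.abs (fun m => Filter.Eventually.of_forall fun x => bf m x) (Filter.Eventually.of_forall t0)
  have t2 : Filter.Tendsto (fun m => ∫ x, (f x * χ m x) ^ 2 ∂μ) Filter.atTop (nhds (∫ x, f x ^ 2 ∂μ)) := by
    refine tendsto_integral_of_dominated_convergence (fun x => f x ^ 2) (fun m => ((cf.mul (cχ m)).pow 2).aestronglyMeasurable)
      h2 (fun m => Filter.Eventually.of_forall fun x => ?_) (Filter.Eventually.of_forall fun x => (t0 x).pow 2)
    rw [norm_pow, ← sq_abs (f x)]
    exact pow_le_pow_left₀ (norm_nonneg _) (bf m x) 2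
  have mg : ∀ h : Euc n → ℝ, Measurable (gsq h) := fun h => by
    have : gsq h = fun x => ‖fderiv ℝ h x‖ ^ 2 := funext fun x => gsq_fderiv h x
    rw [this]
    exact ((measurable_fderiv ℝ h).norm).pow_const 2
  have t3 : Filter.Tendsto (fun m => ∫ x, gsq (fun x => f x * χ m x) x ∂μ) Filter.atTop (nhds (∫ x, gsq f x ∂μ)) := by
    refine tendsto_integral_of_dominated_convergence (fun x => 2 * gsq f x + 2 * (M * f x ^ 2))
      (fun m => (mg _).aestronglyMeasurable) (iadd (hg.const_mul _) ((h2.const_mul _).const_mul _)) (fun m => ?_)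
      (Filter.Eventually.of_forall fun x => ?_)
    · filter_upwards [df] with x hx
      rw [Real.norm_of_nonneg (gsq_nonneg _ x)]
      have dχ : DifferentiableAt ℝ (χ m) x := ((c1 m).differentiable (by simp)) x
      have d : fderiv ℝ (fun x => f x * χ m x) x = f x • fderiv ℝ (χ m) x + χ m x • fderiv ℝ f x :=
        (hx.hasFDerivAt.mul dχ.hasFDerivAt).fderiv
      have b : ‖fderiv ℝ (fun x => f x * χ m x) x‖ ≤ |f x| * ‖fderiv ℝ (χ m) x‖ + ‖fderiv ℝ f x‖ := by
        rw [d]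
        refine (norm_add_le _ _).trans ?_
        rw [norm_smul, norm_smul, Real.norm_eq_abs, Real.norm_eq_abs, abs_of_nonneg (c3 m x).1]
        have := mul_le_mul_of_nonneg_right (c3 m x).2 (norm_nonneg (fderiv ℝ f x))
        linarith
      have b2 := pow_le_pow_left₀ (norm_nonneg _) b 2
      have b3 := mul_le_mul_of_nonneg_right (c7 m x) (sq_nonneg (f x))
      rw [gsq_fderiv] at b3
      have s := sq_abs (f x)
      have q := sq_nonneg (|f x| * ‖fderiv ℝ (χ m) x‖ - ‖fderiv ℝ f x‖)
      simp only [gsq_fderiv]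
      calc _ ≤ _ := b2
        _ ≤ 2 * ‖fderiv ℝ f x‖ ^ 2 + 2 * (‖fderiv ℝ (χ m) x‖ ^ 2 * |f x| ^ 2) := by nlinarith
        _ ≤ _ := by rw [s]; linarith
    · refine tendsto_const_nhds.congr' ?_
      filter_upwards [ev x] with m hm
      rw [gsq_fderiv, gsq_fderiv, (loc m x hm).fderiv_eq]
  exact le_of_tendsto_of_tendsto' (t2.sub (t1.pow 2)) (t3.const_mul C) fun m => Poin.lip hac hP (hL m) (cc m)

end

end KLS

end

/-- KLS bound: the Poincaré constant of an isotropic log-concave probability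
measure on ℝⁿ is at most C·log n. -/
theorem kls_log_bound :
    ∃ C : ℝ, 0 < C ∧ ∀ n : ℕ, 2 ≤ n → ∀ μ : Measure (Euc n),
      IsProbabilityMeasure μ → IsLogConcaveMeasure μ → IsIsotropic μ →
      poincareConst μ ≤ C * Real.log n := by
  obtain ⟨C, C0, h⟩ := KLS.smooth_bound
  refine ⟨C, C0, fun n hn μ pμ hlc hi => ?_⟩
  have hP := h n hn μ pμ hlc hi
  have hac : μ ≪ volume := by
    obtain ⟨ρ, _, _, hμ⟩ := hlc
    rw [hμ]; exact withDensity_absolutelyContinuous _ _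
  exact csInf_le ⟨0, fun _ hx => hx.1⟩
    (KLS.Poin.locLip hac (mul_nonneg C0.le (Real.log_natCast_nonneg n)) hP)
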